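/- Let λ > 0 and let w : ℝ³ → ℝ³ be a smooth Beltrami field, curl w = λ w, satisfying the decay bound |w(x)| ≤ C₀/|x| for all x ≠ 0 and some constant C₀. Fix α ∈ (0,1). Then there exist constants c₂ > c₁ > 0, depending on w but not on N, such that: for every ε > 0 there is N₀ with the property that for every odd integer N ≥ N₀ there exists a Beltrami field W on 𝕋³ with curl W = N W such that ‖W(λ·/N) − w‖_{C^{4,α}(𝔹₁)} < ε, where W(λ·/N) denotes the field x ↦ W(λx/N) on the unit ball 𝔹₁ ⊂ ℝ³ (W being viewed as a 2π-periodic field on ℝ³), and moreover c₁/N ≤ ‖W‖_{L²(𝕋³)} ≤ c₂/√N. -/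

import Mathlib

open MeasureTheory Real Set

noncomputable section

abbrev E3 := Fin 3 → ℝ

def T3 : Set E3 := Set.Icc 0 (fun _ => 2 * Real.pi)

def SpacePeriodic {ι : Type*} (f : E3 → ι) : Prop :=
  ∀ (x : E3) (j : Fin 3), f (x + (2 * Real.pi) • (Pi.single j 1 : E3)) = f x

def pd (j : Fin 3) (f : E3 → ℝ) : E3 → ℝ := fun x => fderiv ℝ f x (Pi.single j 1 : E3)

def pdM (β : Fin 3 → ℕ) (f : E3 → ℝ) : E3 → ℝ :=
  (pd 0)^[β 0] ((pd 1)^[β 1] ((pd 2)^[β 2] f))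

def midx (m : ℕ) : Finset (Fin 3 → ℕ) := Finset.Nat.antidiagonalTuple 3 m

def gradSq {ι : Type*} [Fintype ι] (m : ℕ) (f : E3 → ι → ℝ) (x : E3) : ℝ :=
  ∑ i : ι, ∑ β ∈ midx m, (pdM β (fun y => f y i) x) ^ 2

def HnormSq {ι : Type*} [Fintype ι] (r : ℕ) (f : E3 → ι → ℝ) : ℝ :=
  ∑ m ∈ Finset.range (r + 1), ∫ x in T3, gradSq m f x

def Hnorm {ι : Type*} [Fintype ι] (r : ℕ) (f : E3 → ι → ℝ) : ℝ :=
  Real.sqrt (HnormSq r f)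

def L2norm {ι : Type*} [Fintype ι] (f : E3 → ι → ℝ) : ℝ := Hnorm 0 f

def LinfGrad {ι : Type*} [Fintype ι] (m : ℕ) (f : E3 → ι → ℝ) : ℝ :=
  ⨆ x : E3, Real.sqrt (gradSq m f x)

def Linf {ι : Type*} [Fintype ι] (f : E3 → ι → ℝ) : ℝ := LinfGrad 0 f

def ZeroMean {ι : Type*} [Fintype ι] (f : E3 → ι → ℝ) : Prop :=
  ∀ i, (∫ x in T3, f x i) = 0

def vdiv (u : E3 → E3) : E3 → ℝ := fun x => ∑ j, pd j (fun y => u y j) x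

def vcurl (u : E3 → E3) : E3 → E3 := fun x =>
  ![pd 1 (fun y => u y 2) x - pd 2 (fun y => u y 1) x,
    pd 2 (fun y => u y 0) x - pd 0 (fun y => u y 2) x,
    pd 0 (fun y => u y 1) x - pd 1 (fun y => u y 0) x]

def lap (f : E3 → ℝ) : E3 → ℝ := fun x => ∑ j, pd j (pd j f) x

def IsNS (ν : ℝ) (I : Set ℝ) (u : E3 → ℝ → E3) (P : E3 → ℝ → ℝ) : Prop :=
  (∀ t ∈ I, ∀ (x : E3) (i : Fin 3),
      derivWithin (fun τ => u x τ i) I t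
        + (∑ j, u x t j * pd j (fun y => u y t i) x)
        - ν * lap (fun y => u y t i) x
        = - pd i (fun y => P y t) x) ∧
  (∀ t ∈ I, ∀ x : E3, vdiv (fun y => u y t) x = 0)

def SmoothOnTime (u : E3 → ℝ → E3) (I : Set ℝ) : Prop :=
  ContDiffOn ℝ (⊤ : ℕ∞) (fun p : E3 × ℝ => u p.1 p.2) (Set.univ ×ˢ I)

def wNormInf (m : ℕ) (w : E3 → ℝ → E3) (t : ℝ) : ℝ := LinfGrad m (fun x => w x t)

def Q (w : E3 → ℝ → E3) : ℕ → ℝ → ℝ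
  | 0, _ => 1
  | (j + 1), t => 1 + ∑ m ∈ (Finset.range (j + 1)).attach,
      Q w m.1 t * ∫ τ in (0:ℝ)..t, (wNormInf (j + 1 - m.1) w τ) ^ 2
  decreasing_by exact Finset.mem_range.mp m.2

def Qinf (w : E3 → ℝ → E3) (r : ℕ) : ℝ := ⨆ t : Set.Ici (0:ℝ), Q w r t

/-- The `α`-Hölder seminorm of a scalar function on a set `s ⊆ ℝ³`
(note that in Lean `0/0 = 0`, so the diagonal contributes nothing). -/
def holderSemiOn (α : ℝ) (s : Set E3) (f : E3 → ℝ) : ℝ :=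
  ⨆ p : s × s, |f p.1 - f p.2| / ‖(p.1 : E3) - (p.2 : E3)‖ ^ α

/-- The Hölder norm `‖f‖_{C^{k,α}(s)}`: sum of the sup norms of all partial derivatives of
order at most `k`, plus the `α`-Hölder seminorms of the order-`k` derivatives. -/
def CkaNormOn {ι : Type*} [Fintype ι] (k : ℕ) (α : ℝ) (s : Set E3) (f : E3 → ι → ℝ) : ℝ :=
  (∑ m ∈ Finset.range (k + 1), ∑ i : ι, ∑ β ∈ midx m,
      ⨆ x : s, |pdM β (fun y => f y i) (x : E3)|)
  + ∑ i : ι, ∑ β ∈ midx k, holderSemiOn α s (pdM β (fun y => f y i))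

/-- The Euclidean norm of a point of `ℝ³`. -/
def enorm3 (x : E3) : ℝ := Real.sqrt (∑ i, (x i) ^ 2)

/-- The open unit ball `𝔹₁ ⊂ ℝ³` (for the Euclidean norm). -/
def B1 : Set E3 := {x | enorm3 x < 1}

namespace HighFreq

abbrev Hz := Quaternion ℤ

def Hz.mk (a b c d : ℤ) : Hz := ⟨a, b, c, d⟩

@[simp] theorem Hz.mk_re (a b c d : ℤ) : (Hz.mk a b c d).re = a := rfl
@[simp] theorem Hz.mk_imI (a b c d : ℤ) : (Hz.mk a b c d).imI = b := rfl
@[simp] theorem Hz.mk_imJ (a b c d : ℤ) : (Hz.mk a b c d).imJ = c := rfl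
@[simp] theorem Hz.mk_imK (a b c d : ℤ) : (Hz.mk a b c d).imK = d := rfl

theorem Hz.dvd_iff (n : ℤ) (x : Hz) :
    (n : Hz) ∣ x ↔ n ∣ x.re ∧ n ∣ x.imI ∧ n ∣ x.imJ ∧ n ∣ x.imK := by
  constructor
  · rintro ⟨y, rfl⟩
    simp
  · rintro ⟨⟨a, ha⟩, ⟨b, hb⟩, ⟨c, hc⟩, ⟨d, hd⟩⟩
    exact ⟨Hz.mk a b c d, by ext <;> simp [ha, hb, hc, hd]⟩

theorem Hz.dvd_mul_left' {n : ℤ} {x : Hz} (h : (n : Hz) ∣ x) (y : Hz) : (n : Hz) ∣ y * x := by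
  obtain ⟨z, rfl⟩ := h
  exact ⟨y * z, by rw [← mul_assoc, ← mul_assoc, (Int.cast_commute n y).eq]⟩

theorem Hz.dvd_mul_right' {n : ℤ} {x : Hz} (h : (n : Hz) ∣ x) (y : Hz) : (n : Hz) ∣ x * y :=
  h.mul_right y

theorem Hz.mul_cancel {n : ℤ} (hn : n ≠ 0) {x y : Hz} (h : (n : Hz) * x = (n : Hz) * y) :
    x = y := by
  have h1 := congrArg (·.re) h
  have h2 := congrArg (·.imI) h
  have h3 := congrArg (·.imJ) h
  have h4 := congrArg (·.imK) h
  simp at h1 h2 h3 h4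
  ext <;> simp_all

theorem Hz.normSq_eq (x : Hz) :
    Quaternion.normSq x = x.re ^ 2 + x.imI ^ 2 + x.imJ ^ 2 + x.imK ^ 2 :=
  Quaternion.normSq_def' x

theorem Hz.star_mul_self' (x : Hz) : star x * x = ((Quaternion.normSq x : ℤ) : Hz) := by
  rw [Quaternion.star_mul_self]; rfl

theorem Hz.self_mul_star' (x : Hz) : x * star x = ((Quaternion.normSq x : ℤ) : Hz) := by
  rw [Quaternion.self_mul_star]; rfl

theorem Hz.normSq_intCast (n : ℤ) : Quaternion.normSq (n : Hz) = n ^ 2 := by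
  rw [Hz.normSq_eq]; simp

theorem Hz.dvd_star {n : ℤ} {x : Hz} (h : (n : Hz) ∣ x) : (n : Hz) ∣ star x := by
  rw [Hz.dvd_iff] at *
  simpa using h

theorem Hz.normSq_dvd {n : ℤ} {x : Hz} (h : (n : Hz) ∣ x) : n ^ 2 ∣ Quaternion.normSq x := by
  obtain ⟨y, rfl⟩ := h
  rw [map_mul, Hz.normSq_intCast]
  exact Dvd.intro _ rfl

/-- If `n` is coprime to the norm of `u` and divides `u * x` then it divides `x`. -/
theorem Hz.dvd_of_dvd_mul_left {n : ℤ} {u x : Hz} (hu : IsCoprime n (Quaternion.normSq u))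
    (h : (n : Hz) ∣ u * x) : (n : Hz) ∣ x := by
  have h2 := Hz.dvd_mul_left' h (star u)
  rw [← mul_assoc, Hz.star_mul_self', Hz.dvd_iff] at h2
  rw [Hz.dvd_iff]
  simp at h2
  exact ⟨hu.dvd_of_dvd_mul_left h2.1, hu.dvd_of_dvd_mul_left h2.2.1,
    hu.dvd_of_dvd_mul_left h2.2.2.1, hu.dvd_of_dvd_mul_left h2.2.2.2⟩

theorem Hz.dvd_of_dvd_mul_right {n : ℤ} {u x : Hz} (hu : IsCoprime n (Quaternion.normSq u))
    (h : (n : Hz) ∣ x * u) : (n : Hz) ∣ x := by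
  have h2 := Hz.dvd_star h
  rw [star_mul] at h2
  have h3 := Hz.dvd_of_dvd_mul_left (by rwa [Quaternion.normSq_star]) h2
  simpa using Hz.dvd_star h3

abbrev Gen := Fin 3 × Bool

def Gen.inv (s : Gen) : Gen := (s.1, !s.2)

def Gen.q : Gen → Hz
  | (0, true) => Hz.mk 2 1 0 0
  | (0, false) => Hz.mk 2 (-1) 0 0
  | (1, true) => Hz.mk 2 0 1 0
  | (1, false) => Hz.mk 2 0 (-1) 0
  | (2, true) => Hz.mk 2 0 0 1
  | (2, false) => Hz.mk 2 0 0 (-1)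

theorem Gen.star_q (s : Gen) : star s.q = s.inv.q := by
  obtain ⟨i, b⟩ := s
  fin_cases i <;> cases b <;> ext <;> simp [Gen.q, Gen.inv]

theorem Gen.normSq_q (s : Gen) : Quaternion.normSq s.q = 5 := by
  obtain ⟨i, b⟩ := s
  rw [Hz.normSq_eq]
  fin_cases i <;> cases b <;> simp [Gen.q]

theorem Gen.inv_inv (s : Gen) : s.inv.inv = s := by simp [Gen.inv]

theorem Gen.inv_ne (s : Gen) : s.inv ≠ s := by
  obtain ⟨i, b⟩ := s
  simp [Gen.inv]

theorem Gen.star_mul_q (s : Gen) : s.inv.q * s.q = ((5 : ℤ) : Hz) := by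
  rw [← Gen.star_q, Hz.star_mul_self', Gen.normSq_q]

theorem Gen.q_mul_star (s : Gen) : s.q * s.inv.q = ((5 : ℤ) : Hz) := by
  rw [← Gen.star_q, Hz.self_mul_star', Gen.normSq_q]

theorem Gen.normSq_sub {s t : Gen} (h : s ≠ t) :
    IsCoprime (5 : ℤ) (Quaternion.normSq (s.q - t.q)) := by
  obtain ⟨i, b⟩ := s
  obtain ⟨j, c⟩ := t
  rw [Hz.normSq_eq, Int.isCoprime_iff_gcd_eq_one]
  revert h
  fin_cases i <;> fin_cases j <;> cases b <;> cases c <;> simp [Gen.q] <;> norm_num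

/-- The six left lines modulo `5`: at most one generator kills a given class. -/
theorem Gen.unique_of_dvd {s t : Gen} {x : Hz} (hs : ((5 : ℤ) : Hz) ∣ s.q * x)
    (ht : ((5 : ℤ) : Hz) ∣ t.q * x) (hx : ¬ ((5 : ℤ) : Hz) ∣ x) : s = t := by
  by_contra h
  apply hx
  apply Hz.dvd_of_dvd_mul_left (Gen.normSq_sub h)
  rw [sub_mul]
  exact dvd_sub hs ht

theorem Gen.exists_dvd_aux : ∀ a b c d : Fin 5,
    (a.1 * a.1 + b.1 * b.1 + c.1 * c.1 + d.1 * d.1) % 5 = 0 →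
    ((b.1 % 5 = (2 * a.1) % 5 ∧ d.1 % 5 = (2 * c.1) % 5) ∨
      (b.1 % 5 = (3 * a.1) % 5 ∧ d.1 % 5 = (3 * c.1) % 5)) ∨
    ((c.1 % 5 = (2 * a.1) % 5 ∧ d.1 % 5 = (3 * b.1) % 5) ∨
      (c.1 % 5 = (3 * a.1) % 5 ∧ d.1 % 5 = (2 * b.1) % 5)) ∨
    ((d.1 % 5 = (2 * a.1) % 5 ∧ c.1 % 5 = (2 * b.1) % 5) ∨
      (d.1 % 5 = (3 * a.1) % 5 ∧ c.1 % 5 = (3 * b.1) % 5)) := by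
  decide +kernel

theorem Gen.exists_dvd {x : Hz} (hx : (5 : ℤ) ∣ Quaternion.normSq x) :
    ∃ s : Gen, ((5 : ℤ) : Hz) ∣ s.q * x := by
  rw [Hz.normSq_eq] at hx
  obtain ⟨a, ea⟩ : ∃ a, a = x.re := ⟨_, rfl⟩
  obtain ⟨b, eb⟩ : ∃ a, a = x.imI := ⟨_, rfl⟩
  obtain ⟨c, ec⟩ : ∃ a, a = x.imJ := ⟨_, rfl⟩
  obtain ⟨d, ed⟩ : ∃ a, a = x.imK := ⟨_, rfl⟩
  rw [← ea, ← eb, ← ec, ← ed] at hx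
  have key : ∀ z : ℤ, ∃ n : ℕ, n < 5 ∧ (n : ℤ) ≡ z [ZMOD 5] := fun z => by
    refine ⟨(z % 5).toNat, by omega, ?_⟩
    rw [Int.toNat_of_nonneg (by omega)]
    exact Int.mod_modEq z 5
  obtain ⟨a', ha, ha'⟩ := key a
  obtain ⟨b', hb, hb'⟩ := key b
  obtain ⟨c', hc, hc'⟩ := key c
  obtain ⟨d', hd, hd'⟩ := key d
  have h0 : (a' * a' + b' * b' + c' * c' + d' * d') % 5 = 0 := by
    have : ((a' * a' + b' * b' + c' * c' + d' * d' : ℕ) : ℤ) ≡ a ^ 2 + b ^ 2 + c ^ 2 + d ^ 2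
        [ZMOD 5] := by
      push_cast
      simp only [pow_two]
      exact (((ha'.mul ha').add (hb'.mul hb')).add (hc'.mul hc')).add (hd'.mul hd')
    have h1 := this.trans ((Int.modEq_zero_iff_dvd).2 hx)
    have h2 := Int.modEq_zero_iff_dvd.1 h1
    omega
  simp only [Int.ModEq] at ha' hb' hc' hd'
  have haux := Gen.exists_dvd_aux ⟨a', ha⟩ ⟨b', hb⟩ ⟨c', hc⟩ ⟨d', hd⟩ h0
  simp only at haux
  rcases haux with
    (h | h) | (h | h) | (h | h)
  · refine ⟨(0, true), (Hz.dvd_iff _ _).2 ?_⟩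
    simp [Gen.q, ← ea, ← eb, ← ec, ← ed]; omega
  · refine ⟨(0, false), (Hz.dvd_iff _ _).2 ?_⟩
    simp [Gen.q, ← ea, ← eb, ← ec, ← ed]; omega
  · refine ⟨(1, true), (Hz.dvd_iff _ _).2 ?_⟩
    simp [Gen.q, ← ea, ← eb, ← ec, ← ed]; omega
  · refine ⟨(1, false), (Hz.dvd_iff _ _).2 ?_⟩
    simp [Gen.q, ← ea, ← eb, ← ec, ← ed]; omega
  · refine ⟨(2, true), (Hz.dvd_iff _ _).2 ?_⟩
    simp [Gen.q, ← ea, ← eb, ← ec, ← ed]; omega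
  · refine ⟨(2, false), (Hz.dvd_iff _ _).2 ?_⟩
    simp [Gen.q, ← ea, ← eb, ← ec, ← ed]; omega

/-- The imaginary unit `i`. -/
def qI : Hz := Hz.mk 0 1 0 0

/-- The generator `2 + i`. -/
abbrev tau : Hz := Gen.q (0, true)

abbrev tauBar : Hz := Gen.q (0, false)

/-- The lattice point attached to a quaternion. -/
def kk (α : Hz) : Hz := α * qI * star α

def IsX (N : ℕ) (k : Hz) : Prop := ∃ α : Hz, Quaternion.normSq α = N ∧ kk α = k

theorem star_qI : star qI = -qI := by ext <;> simp [qI]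

theorem star_kk (α : Hz) : star (kk α) = - kk α := by
  simp [kk, star_qI, mul_assoc]

theorem IsX.star {N : ℕ} {k : Hz} (h : IsX N k) : star k = -k := by
  obtain ⟨α, -, rfl⟩ := h
  exact star_kk α

theorem normSq_kk (α : Hz) : Quaternion.normSq (kk α) = (Quaternion.normSq α) ^ 2 := by
  have : Quaternion.normSq qI = 1 := by rw [Hz.normSq_eq]; simp [qI]
  rw [kk, map_mul, map_mul, this, Quaternion.normSq_star]; ring

theorem IsX.normSq {N : ℕ} {k : Hz} (h : IsX N k) : Quaternion.normSq k = (N : ℤ) ^ 2 := by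
  obtain ⟨α, h, rfl⟩ := h
  rw [normSq_kk, h]

theorem IsX.re {N : ℕ} {k : Hz} (h : IsX N k) : k.re = 0 := by
  have := congrArg (·.re) h.star
  simp at this
  omega

theorem tau_eq : tau = ((2 : ℤ) : Hz) + qI := by
  ext <;> simp [-Int.cast_ofNat, tau, Gen.q, qI]
theorem tauBar_eq : tauBar = ((2 : ℤ) : Hz) - qI := by
  ext <;> simp [-Int.cast_ofNat, tauBar, Gen.q, qI]

theorem tauBar_mul_tau : tauBar * tau = ((5 : ℤ) : Hz) := Gen.star_mul_q (0, true)

theorem two_add_kk {N : ℕ} {α : Hz} (h : Quaternion.normSq α = N) :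
    ((2 * N : ℤ) : Hz) + kk α = α * tau * star α := by
  rw [tau_eq, mul_add, add_mul, kk]
  congr 1
  rw [mul_assoc, (Int.cast_commute 2 (star α)).eq, ← mul_assoc, Hz.self_mul_star', h,
    ← Int.cast_mul, mul_comm]

theorem two_sub_kk {N : ℕ} {α : Hz} (h : Quaternion.normSq α = N) :
    ((2 * N : ℤ) : Hz) - kk α = α * tauBar * star α := by
  rw [tauBar_eq, mul_sub, sub_mul, kk]
  congr 1
  rw [mul_assoc, (Int.cast_commute 2 (star α)).eq, ← mul_assoc, Hz.self_mul_star', h,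
    ← Int.cast_mul, mul_comm]

def fwd (N : ℕ) (k : Hz) (s : Gen) : Prop := ((5 : ℤ) : Hz) ∣ s.q * (((2 * N : ℤ) : Hz) - k)
def bwd (N : ℕ) (k : Hz) (s : Gen) : Prop :=
  ((5 : ℤ) : Hz) ∣ s.inv.q * (((2 * N : ℤ) : Hz) + k)

theorem cop_of {N : ℕ} (h5 : ¬ 5 ∣ N) : IsCoprime (5 : ℤ) (N : ℤ) := by
  have := (Nat.Prime.coprime_iff_not_dvd (by norm_num : Nat.Prime 5)).2 h5
  exact_mod_cast Nat.isCoprime_iff_coprime.2 this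

theorem IsX.not_dvd_sub {N : ℕ} (h5 : ¬ 5 ∣ N) {k : Hz} (h : IsX N k) :
    ¬ ((5 : ℤ) : Hz) ∣ ((2 * N : ℤ) : Hz) - k := by
  intro hd
  have := ((Hz.dvd_iff _ _).1 hd).1
  simp [h.re, -Int.cast_mul] at this
  omega

theorem IsX.not_dvd_add {N : ℕ} (h5 : ¬ 5 ∣ N) {k : Hz} (h : IsX N k) :
    ¬ ((5 : ℤ) : Hz) ∣ ((2 * N : ℤ) : Hz) + k := by
  intro hd
  have := ((Hz.dvd_iff _ _).1 hd).1
  simp [h.re, -Int.cast_mul] at this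
  omega

theorem fwd_iff {N : ℕ} (h5 : ¬ 5 ∣ N) {α : Hz} (h : Quaternion.normSq α = N) (s : Gen) :
    fwd N (kk α) s ↔ ((5 : ℤ) : Hz) ∣ s.q * α * tauBar := by
  rw [fwd, two_sub_kk h, ← mul_assoc, ← mul_assoc]
  refine ⟨fun hd => Hz.dvd_of_dvd_mul_right ?_ hd, fun hd => Hz.dvd_mul_right' hd _⟩
  rw [Quaternion.normSq_star, h]
  exact cop_of h5

theorem bwd_iff {N : ℕ} (h5 : ¬ 5 ∣ N) {α : Hz} (h : Quaternion.normSq α = N) (s : Gen) :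
    bwd N (kk α) s ↔ ((5 : ℤ) : Hz) ∣ s.inv.q * α * tau := by
  rw [bwd, two_add_kk h, ← mul_assoc, ← mul_assoc]
  refine ⟨fun hd => Hz.dvd_of_dvd_mul_right ?_ hd, fun hd => Hz.dvd_mul_right' hd _⟩
  rw [Quaternion.normSq_star, h]
  exact cop_of h5

theorem exists_fwd {N : ℕ} {k : Hz} (h : IsX N k) : ∃ s, fwd N k s := by
  obtain ⟨α, h, rfl⟩ := h
  apply Gen.exists_dvd
  rw [two_sub_kk h, map_mul, map_mul, Gen.normSq_q, mul_right_comm]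
  exact dvd_mul_left _ _

theorem exists_bwd {N : ℕ} {k : Hz} (h : IsX N k) : ∃ s, bwd N k s := by
  obtain ⟨α, h, rfl⟩ := h
  obtain ⟨s, hs⟩ := Gen.exists_dvd (x := ((2 * N : ℤ) : Hz) + kk α) (by
    rw [two_add_kk h, map_mul, map_mul, Gen.normSq_q, mul_right_comm]
    exact dvd_mul_left _ _)
  exact ⟨s.inv, by rwa [bwd, Gen.inv_inv]⟩

theorem fwd_unique {N : ℕ} (h5 : ¬ 5 ∣ N) {k : Hz} (h : IsX N k) {s t : Gen}
    (hs : fwd N k s) (ht : fwd N k t) : s = t :=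
  Gen.unique_of_dvd hs ht (h.not_dvd_sub h5)

theorem bwd_unique {N : ℕ} (h5 : ¬ 5 ∣ N) {k : Hz} (h : IsX N k) {s t : Gen}
    (hs : bwd N k s) (ht : bwd N k t) : s = t := by
  have := Gen.unique_of_dvd hs ht (h.not_dvd_add h5)
  rw [← s.inv_inv, this, Gen.inv_inv]

open Classical in
/-- The departure letter of a lattice point. -/
def nxt (N : ℕ) (k : Hz) : Gen := if h : ∃ s, fwd N k s then h.choose else (0, true)

open Classical in
/-- The arrival letter of a lattice point. -/
def arr (N : ℕ) (k : Hz) : Gen := if h : ∃ s, bwd N k s then h.choose else (0, true)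

theorem nxt_spec {N : ℕ} {k : Hz} (h : IsX N k) : fwd N k (nxt N k) := by
  rw [nxt, dif_pos (exists_fwd h)]
  exact (exists_fwd h).choose_spec

theorem arr_spec {N : ℕ} {k : Hz} (h : IsX N k) : bwd N k (arr N k) := by
  rw [arr, dif_pos (exists_bwd h)]
  exact (exists_bwd h).choose_spec

theorem nxt_ne {N : ℕ} (h5 : ¬ 5 ∣ N) {k : Hz} (h : IsX N k) : nxt N k ≠ (arr N k).inv := by
  intro he
  have h1 := nxt_spec h
  have h2 := arr_spec h
  rw [bwd, ← he] at h2
  have h3 := dvd_add h1 h2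
  rw [← mul_add, sub_add_add_cancel, ← Int.cast_add] at h3
  have h4 : IsCoprime (5 : ℤ) (Quaternion.normSq ((2 * N + 2 * N : ℤ) : Hz)) := by
    rw [Hz.normSq_intCast]
    apply IsCoprime.pow_right
    have : (2 * N + 2 * N : ℤ) = 4 * N := by ring
    rw [this]
    exact IsCoprime.mul_right (by norm_num) (cop_of h5)
  have h6 := Hz.normSq_dvd (Hz.dvd_of_dvd_mul_right h4 h3)
  rw [Gen.normSq_q] at h6
  norm_num at h6

/-- Conjugation by a generator (without normalisation). -/
def act (s : Gen) (k : Hz) : Hz := s.q * k * s.inv.q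

def div5 (x : Hz) : Hz := Hz.mk (x.re / 5) (x.imI / 5) (x.imJ / 5) (x.imK / 5)

theorem div5_mul (x : Hz) : div5 (((5 : ℤ) : Hz) * x) = x := by
  ext <;> simp [-Int.cast_ofNat, div5]

/-- One step of the flow. -/
def flow (N : ℕ) (k : Hz) : Hz := div5 (act (nxt N k) k)

theorem act_inj {s : Gen} {k l : Hz} (h : act s k = act s l) : k = l := by
  have h2 := congrArg (fun x => s.inv.q * x * s.q) h
  simp only [act] at h2
  have e : ∀ x : Hz, s.inv.q * (s.q * x * s.inv.q) * s.q = ((5 : ℤ) : Hz) * (((5 : ℤ) : Hz) * x) := by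
    intro x
    calc s.inv.q * (s.q * x * s.inv.q) * s.q = (s.inv.q * s.q) * x * (s.inv.q * s.q) := by
          simp only [mul_assoc]
      _ = _ := by
          rw [Gen.star_mul_q, mul_assoc, ← (Int.cast_commute 5 x).eq]
  rw [e, e] at h2
  exact Hz.mul_cancel (by norm_num) (Hz.mul_cancel (by norm_num) h2)

theorem flow_aux {N : ℕ} (h5 : ¬ 5 ∣ N) {α : Hz} (h : Quaternion.normSq α = N) :
    ∃ α' : Hz, Quaternion.normSq α' = N ∧
      (nxt N (kk α)).q * α * tauBar = ((5 : ℤ) : Hz) * α' ∧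
      act (nxt N (kk α)) (kk α) = ((5 : ℤ) : Hz) * kk α' := by
  obtain ⟨α', hα⟩ := (fwd_iff h5 h _).1 (nxt_spec ⟨α, h, rfl⟩)
  refine ⟨α', ?_, hα, ?_⟩
  · have := congrArg Quaternion.normSq hα
    rw [map_mul, map_mul, map_mul, Gen.normSq_q, Gen.normSq_q, Hz.normSq_intCast, h] at this
    omega
  · set s := nxt N (kk α)
    have h1 : s.q * α * tauBar * qI * star (s.q * α * tauBar) = ((5 : ℤ) : Hz) * (((5 : ℤ) : Hz) * kk α') := by
      rw [hα, star_mul, kk]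
      have : star ((5 : ℤ) : Hz) = ((5 : ℤ) : Hz) := by simp
      rw [this]
      simp only [mul_assoc]
      rw [← (Int.cast_commute 5 (star α')).eq, (Int.cast_commute 5 qI).symm.left_comm, (Int.cast_commute 5 α').symm.left_comm]
    apply Hz.mul_cancel (n := 5) (by norm_num)
    rw [← h1, star_mul, star_mul, Gen.star_q, Gen.star_q]
    have h2 : tauBar * qI * tau = ((5 : ℤ) : Hz) * qI := by
      ext <;> simp [-Int.cast_ofNat, Gen.q, qI]
    have h3 : (Gen.inv (0, false)).q = tau := rfl
    rw [h3]
    calc ((5 : ℤ) : Hz) * act s (kk α) = s.q * α * (((5 : ℤ) : Hz) * qI) * (star α * s.inv.q) := by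
          simp only [act, kk, mul_assoc]
          rw [(Int.cast_commute 5 (s.q)).left_comm, (Int.cast_commute 5 α).left_comm]
      _ = _ := by rw [← h2]; simp only [mul_assoc]

theorem flow_kk {N : ℕ} {α α' : Hz} (h : act (nxt N (kk α)) (kk α) = ((5 : ℤ) : Hz) * kk α') :
    flow N (kk α) = kk α' := by
  rw [flow, h, div5_mul]

theorem IsX.flow {N : ℕ} (h5 : ¬ 5 ∣ N) {k : Hz} (h : IsX N k) : IsX N (flow N k) := by
  obtain ⟨α, h, rfl⟩ := h
  obtain ⟨α', h1, h2, h3⟩ := flow_aux h5 h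
  exact ⟨α', h1, (flow_kk h3).symm⟩

theorem act_nxt {N : ℕ} (h5 : ¬ 5 ∣ N) {k : Hz} (h : IsX N k) :
    act (nxt N k) k = ((5 : ℤ) : Hz) * flow N k := by
  obtain ⟨α, h, rfl⟩ := h
  obtain ⟨α', h1, h2, h3⟩ := flow_aux h5 h
  rw [flow_kk h3, h3]

theorem arr_flow {N : ℕ} (h5 : ¬ 5 ∣ N) {k : Hz} (h : IsX N k) : arr N (flow N k) = nxt N k := by
  apply bwd_unique h5 (h.flow h5) (arr_spec (h.flow h5))
  obtain ⟨α, h, rfl⟩ := h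
  obtain ⟨α', h1, h2, h3⟩ := flow_aux h5 h
  rw [flow_kk h3, bwd_iff h5 h1]
  refine ⟨α, ?_⟩
  apply Hz.mul_cancel (n := 5) (by norm_num)
  calc ((5 : ℤ) : Hz) * ((nxt N (kk α)).inv.q * α' * tau)
      = (nxt N (kk α)).inv.q * (((5 : ℤ) : Hz) * α') * tau := by
        simp only [mul_assoc]
        rw [(Int.cast_commute 5 ((nxt N (kk α)).inv.q)).left_comm]
    _ = ((nxt N (kk α)).inv.q * (nxt N (kk α)).q) * α * (tauBar * tau) := by
        rw [← h2]; simp only [mul_assoc]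
    _ = _ := by
        rw [Gen.star_mul_q, tauBar_mul_tau, mul_assoc, (Int.cast_commute 5 α).eq]

theorem flow_inj {N : ℕ} (h5 : ¬ 5 ∣ N) {k l : Hz} (hk : IsX N k) (hl : IsX N l)
    (h : flow N k = flow N l) : k = l := by
  have h1 : nxt N k = nxt N l := by rw [← arr_flow h5 hk, h, arr_flow h5 hl]
  have h2 := act_nxt h5 hk
  rw [h, ← act_nxt h5 hl, h1] at h2
  exact act_inj h2

/-- The first `L` departure letters along the orbit of `k`. -/
def wd (N : ℕ) : ℕ → Hz → List Gen
  | 0, _ => []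
  | L + 1, k => nxt N k :: wd N L (flow N k)

/-- The product of the generators of a word (the last letter on the left). -/
def wq : List Gen → Hz
  | [] => 1
  | s :: w => wq w * s.q

theorem normSq_wq (w : List Gen) : Quaternion.normSq (wq w) = 5 ^ w.length := by
  induction w with
  | nil => simp [wq]
  | cons s w ih => rw [wq, map_mul, ih, Gen.normSq_q, List.length_cons, pow_succ]

theorem length_wd (N L : ℕ) (k : Hz) : (wd N L k).length = L := by
  induction L generalizing k with
  | zero => rfl
  | succ L ih => simp [wd, ih]

theorem wd_spec {N : ℕ} (h5 : ¬ 5 ∣ N) (L : ℕ) {α : Hz} (h : Quaternion.normSq α = N) :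
    ((5 ^ L : ℤ) : Hz) ∣ wq (wd N L (kk α)) * α * tauBar ^ L := by
  induction L generalizing α with
  | zero => simp
  | succ L ih =>
    obtain ⟨α', h1, h2, h3⟩ := flow_aux h5 h
    obtain ⟨δ, hδ⟩ := ih h1
    refine ⟨δ, ?_⟩
    rw [wd, flow_kk h3, wq]
    calc wq (wd N L (kk α')) * (nxt N (kk α)).q * α * tauBar ^ (L + 1)
        = wq (wd N L (kk α')) * ((nxt N (kk α)).q * α * tauBar) * tauBar ^ L := by
          rw [pow_succ']; simp only [mul_assoc]
      _ = ((5 : ℤ) : Hz) * (wq (wd N L (kk α')) * α' * tauBar ^ L) := by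
          rw [h2]; simp only [mul_assoc]
          rw [(Int.cast_commute 5 (wq (wd N L (kk α')))).left_comm]
      _ = _ := by rw [hδ, ← mul_assoc, ← Int.cast_mul, pow_succ']

/-- Two points with the same word have nearly the same quaternion. -/
theorem wd_eq_dvd {N : ℕ} (h5 : ¬ 5 ∣ N) (L : ℕ) {α β : Hz} (hα : Quaternion.normSq α = N)
    (hβ : Quaternion.normSq β = N) (h : wd N L (kk α) = wd N L (kk β)) :
    ((5 ^ L : ℤ) : Hz) ∣ tau ^ L * (star α * β) * tauBar ^ L := by
  obtain ⟨a, ha⟩ := wd_spec h5 L hα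
  obtain ⟨b, hb⟩ := wd_spec h5 L hβ
  refine ⟨star a * b, ?_⟩
  have h1 := congrArg star ha
  have h0 : star tauBar = tau := Gen.star_q (0, false)
  have hs : star ((5 ^ L : ℤ) : Hz) = ((5 ^ L : ℤ) : Hz) := by simp
  rw [star_mul, star_mul, star_mul, hs, star_pow, h0] at h1
  set w := wd N L (kk α)
  rw [← h] at hb
  have hw : star (wq w) * wq w = ((5 ^ L : ℤ) : Hz) := by
    rw [Hz.star_mul_self', normSq_wq, length_wd]
  apply Hz.mul_cancel (n := 5 ^ L) (by positivity)
  have c := Int.cast_commute (5 ^ L : ℤ) (α := Hz)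
  calc ((5 ^ L : ℤ) : Hz) * (tau ^ L * (star α * β) * tauBar ^ L)
      = tau ^ L * (star α * ((5 ^ L : ℤ) : Hz)) * (β * tauBar ^ L) := by
        simp only [mul_assoc]
        rw [(c (tau ^ L)).left_comm, (c (star α)).left_comm]
    _ = (tau ^ L * (star α * star (wq w))) * (wq w * β * tauBar ^ L) := by
        rw [← hw]; simp only [mul_assoc]
    _ = _ := by
        rw [h1, hb]
        simp only [mul_assoc]
        rw [(c (star a)).left_comm, (c (star a)).left_comm]

open Classical in
/-- Quaternions of norm `N`. -/
def QN (N : ℕ) : Finset Hz :=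
  ((Fintype.piFinset (fun _ : Fin 4 => Finset.Icc (-N : ℤ) N)).image
    (fun v => Hz.mk (v 0) (v 1) (v 2) (v 3))).filter (fun x => Quaternion.normSq x = (N : ℤ))

theorem mem_QN {N : ℕ} {x : Hz} : x ∈ QN N ↔ Quaternion.normSq x = (N : ℤ) := by
  classical
  rw [QN, Finset.mem_filter, and_iff_right_iff_imp]
  intro h
  rw [Finset.mem_image]
  refine ⟨![x.re, x.imI, x.imJ, x.imK], ?_, by ext <;> simp⟩
  rw [Hz.normSq_eq] at h
  have key : ∀ a : ℤ, a ^ 2 ≤ N → -(N : ℤ) ≤ a ∧ a ≤ N := fun a ha =>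
    ⟨by nlinarith [Int.le_self_sq (-a)], by nlinarith [Int.le_self_sq a]⟩
  rw [Fintype.mem_piFinset]
  intro i
  have := sq_nonneg x.re
  have := sq_nonneg x.imI
  have := sq_nonneg x.imJ
  have := sq_nonneg x.imK
  rw [Finset.mem_Icc]
  fin_cases i <;> simp <;> apply key <;> linarith

open Classical in
/-- The lattice points attached to `N`. -/
def XN (N : ℕ) : Finset Hz := (QN N).image kk

theorem mem_XN {N : ℕ} {k : Hz} : k ∈ XN N ↔ IsX N k := by
  simp [XN, IsX, mem_QN]

theorem sum_flow {N : ℕ} (h5 : ¬ 5 ∣ N) (F : Hz → ℝ) :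
    ∑ k ∈ XN N, F (flow N k) = ∑ k ∈ XN N, F k := by
  classical
  have hinj : Set.InjOn (flow N) (XN N) := fun k hk l hl h =>
    flow_inj h5 (mem_XN.1 hk) (mem_XN.1 hl) h
  have him : (XN N).image (flow N) = XN N := by
    apply Finset.eq_of_subset_of_card_le
    · intro k hk
      obtain ⟨l, hl, rfl⟩ := Finset.mem_image.1 hk
      exact mem_XN.2 ((mem_XN.1 hl).flow h5)
    · rw [Finset.card_image_of_injOn hinj]
  conv_rhs => rw [← him]
  rw [Finset.sum_image hinj]

open Classical in
/-- Lattice points reached by non-backtracking words, with the last letter. -/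
def lift (N : ℕ) : ℕ → Finset (Hz × Gen)
  | 0 => (XN N).image (fun k => (k, arr N k))
  | a + 1 => (((lift N a) ×ˢ Finset.univ).filter (fun p => p.2 ≠ p.1.2.inv)).image
      (fun p => (act p.2 p.1.1, p.2))

theorem mem_lift_zero {N : ℕ} {p : Hz × Gen} : p ∈ lift N 0 ↔ IsX N p.1 ∧ p.2 = arr N p.1 := by
  simp only [lift, Finset.mem_image, mem_XN]
  constructor
  · rintro ⟨k, hk, rfl⟩
    exact ⟨hk, rfl⟩
  · rintro ⟨h1, h2⟩
    exact ⟨p.1, h1, by rw [← h2]⟩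

theorem mem_lift_succ {N a : ℕ} {p : Hz × Gen} : p ∈ lift N (a + 1) ↔
    ∃ y s, (y, s) ∈ lift N a ∧ p.2 ≠ s.inv ∧ p.1 = act p.2 y := by
  simp only [lift, Finset.mem_image, Finset.mem_filter, Finset.mem_product]
  constructor
  · rintro ⟨⟨⟨y, s⟩, t⟩, ⟨⟨h1, -⟩, h2⟩, rfl⟩
    exact ⟨y, s, h1, h2, rfl⟩
  · rintro ⟨y, s, h1, h2, h3⟩
    exact ⟨⟨⟨y, s⟩, p.2⟩, ⟨⟨h1, Finset.mem_univ _⟩, h2⟩, by rw [← h3]⟩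

theorem star_act {s : Gen} {y : Hz} (h : star y = -y) : star (act s y) = - act s y := by
  have e : star s.inv.q = s.q := by rw [Gen.star_q, Gen.inv_inv]
  rw [act, star_mul, star_mul, h, e, Gen.star_q]
  simp [mul_assoc]

theorem normSq_act (s : Gen) (y : Hz) :
    Quaternion.normSq (act s y) = 25 * Quaternion.normSq y := by
  rw [act, map_mul, map_mul, Gen.normSq_q, Gen.normSq_q]; ring

theorem lift_star {N a : ℕ} {p : Hz × Gen} (h : p ∈ lift N a) : star p.1 = -p.1 := by
  induction a generalizing p with
  | zero => exact (mem_lift_zero.1 h).1.star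
  | succ a ih =>
    obtain ⟨y, s, h1, -, h3⟩ := mem_lift_succ.1 h
    rw [h3]
    exact star_act (ih h1)

theorem lift_normSq {N a : ℕ} {p : Hz × Gen} (h : p ∈ lift N a) :
    Quaternion.normSq p.1 = ((5 ^ a * N : ℕ) : ℤ) ^ 2 := by
  induction a generalizing p with
  | zero => simpa using (mem_lift_zero.1 h).1.normSq
  | succ a ih =>
    obtain ⟨y, s, h1, -, h3⟩ := mem_lift_succ.1 h
    have := ih h1
    simp only at this
    rw [h3, normSq_act, this]
    push_cast
    ring

theorem act_smul (s : Gen) (y : Hz) (n : ℤ) : act s ((n : Hz) * y) = (n : Hz) * act s y := by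
  simp only [act, mul_assoc]
  rw [(Int.cast_commute n s.q).left_comm]

theorem inv_q_act (s : Gen) (y : Hz) : ((5 : ℤ) : Hz) ∣ s.inv.q * act s y := by
  rw [act, ← mul_assoc, ← mul_assoc, Gen.star_mul_q, mul_assoc]
  exact Dvd.intro _ rfl

/-- If conjugation creates a factor `5`, the letter goes back. -/
theorem eq_inv_of_dvd_act {s t : Gen} {u v : Hz}
    (hs : ((5 : ℤ) : Hz) ∣ s.inv.q * u) (hv : star u = v)
    (ht : ((5 : ℤ) : Hz) ∣ act t u) (hv' : ¬ ((5 : ℤ) : Hz) ∣ t.q * v) : t = s.inv := by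
  have hx : ¬ ((5 : ℤ) : Hz) ∣ u * t.inv.q := by
    intro h
    apply hv'
    have := Hz.dvd_star h
    rwa [star_mul, Gen.star_q, Gen.inv_inv, hv] at this
  refine Gen.unique_of_dvd (x := u * t.inv.q) ?_ ?_ hx
  · rw [← mul_assoc]; exact ht
  · rw [← mul_assoc]; exact Hz.dvd_mul_right' hs _

theorem lift_dvd {N : ℕ} (h5 : ¬ 5 ∣ N) {a : ℕ} {z : Hz} {t : Gen}
    (h : (((5 : ℤ) : Hz) * z, t) ∈ lift N (a + 1)) : (z, t) ∈ lift N a := by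
  induction a generalizing z t with
  | zero =>
    obtain ⟨k, s, h1, h2, h3⟩ := mem_lift_succ.1 h
    simp only at h2 h3
    obtain ⟨hk, h1⟩ := mem_lift_zero.1 h1
    simp only at hk h1
    subst h1
    have harr := arr_spec hk
    have hst := hk.star
    have hf : fwd N k t := by
      by_contra hf
      apply h2
      refine eq_inv_of_dvd_act (u := ((2 * N : ℤ) : Hz) + k) harr ?_ ?_ hf
      · rw [star_add, hst, sub_eq_add_neg]
        congr 1
      · rw [act, mul_add, add_mul]
        refine dvd_add ?_ ?_
        · rw [(Int.cast_commute (2 * N : ℤ) t.q).symm.eq, mul_assoc, Gen.q_mul_star]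
          exact Hz.dvd_mul_left' dvd_rfl _
        · exact ⟨z, h3.symm⟩
    have hn : nxt N k = t := fwd_unique h5 hk (nxt_spec hk) hf
    have hz : z = flow N k := by
      apply Hz.mul_cancel (n := 5) (by norm_num)
      rw [h3, ← hn, act_nxt h5 hk]
    rw [mem_lift_zero, hz]
    exact ⟨hk.flow h5, by rw [arr_flow h5 hk, hn]⟩
  | succ a ih =>
    obtain ⟨y, s, h1, h2, h3⟩ := mem_lift_succ.1 h
    simp only at h2 h3
    by_cases hy : ((5 : ℤ) : Hz) ∣ y
    · obtain ⟨y', rfl⟩ := hy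
      rw [act_smul] at h3
      rw [mem_lift_succ]
      exact ⟨y', s, ih h1, h2, Hz.mul_cancel (by norm_num) h3⟩
    · exfalso
      obtain ⟨y0, s0, h4, h5', h6⟩ := mem_lift_succ.1 h1
      simp only at h5' h6
      have hsy : ((5 : ℤ) : Hz) ∣ s.inv.q * y := by rw [h6]; exact inv_q_act s y0
      apply h2
      by_cases hty : ((5 : ℤ) : Hz) ∣ t.q * y
      · exact Gen.unique_of_dvd hty hsy hy
      · refine eq_inv_of_dvd_act hsy (lift_star h1) ⟨z, h3.symm⟩ ?_
        rwa [mul_neg, dvd_neg]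

theorem lift_unique {N : ℕ} (h5 : ¬ 5 ∣ N) {a : ℕ} {y : Hz} {s t : Gen}
    (hs : (y, s) ∈ lift N a) (ht : (y, t) ∈ lift N a) : s = t := by
  induction a generalizing y s t with
  | zero => exact (mem_lift_zero.1 hs).2.trans (mem_lift_zero.1 ht).2.symm
  | succ a ih =>
    by_cases hy : ((5 : ℤ) : Hz) ∣ y
    · obtain ⟨y', rfl⟩ := hy
      exact ih (lift_dvd h5 hs) (lift_dvd h5 ht)
    · obtain ⟨y0, s0, -, -, h6⟩ := mem_lift_succ.1 hs
      obtain ⟨y1, s1, -, -, h7⟩ := mem_lift_succ.1 ht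
      simp only at h6 h7
      have := Gen.unique_of_dvd (s := s.inv) (t := t.inv) (x := y) (by rw [h6]; exact inv_q_act s y0)
        (by rw [h7]; exact inv_q_act t y1) hy
      rw [← s.inv_inv, this, Gen.inv_inv]

theorem sum_lift_zero (N : ℕ) (F : Hz × Gen → ℝ) :
    ∑ p ∈ lift N 0, F p = ∑ k ∈ XN N, F (k, arr N k) := by
  classical
  rw [lift, Finset.sum_image]
  intro k _ l _ h
  exact (Prod.ext_iff.1 h).1

theorem sum_lift_succ {N : ℕ} (h5 : ¬ 5 ∣ N) (a : ℕ) (F : Hz × Gen → ℝ) :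
    ∑ p ∈ lift N (a + 1), F p =
      ∑ p ∈ lift N a, ∑ t ∈ Finset.univ.filter (fun t => t ≠ p.2.inv), F (act t p.1, t) := by
  classical
  rw [lift, Finset.sum_image, Finset.sum_filter, Finset.sum_product]
  · simp only [Finset.sum_filter]
  · rintro ⟨⟨y, s⟩, t⟩ h ⟨⟨y', s'⟩, t'⟩ h' he
    simp only [Prod.mk.injEq] at he
    obtain ⟨he, rfl⟩ := he
    have := act_inj he
    subst this
    simp only [Finset.coe_filter, Finset.mem_product, Set.mem_ofPred_eq] at h h'
    rw [lift_unique h5 h.1.1 h'.1.1]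

theorem sum_image_lift {N : ℕ} (h5 : ¬ 5 ∣ N) (a : ℕ) [DecidableEq Hz] (F : Hz → ℝ) :
    ∑ y ∈ (lift N a).image Prod.fst, F y = ∑ p ∈ lift N a, F p.1 := by
  rw [Finset.sum_image]
  rintro ⟨y, s⟩ h ⟨y', s'⟩ h' he
  simp only at he
  subst he
  rw [lift_unique h5 h h']

section rows
variable {p : ℕ} [Fact p.Prime]

/-- First coordinate of the row vector `(s, t)` times the splitting matrix of `q` modulo `p`. -/
def row1 (x y s t : ZMod p) (q : Hz) : ZMod p :=
  s * (q.re + x * q.imJ + y * q.imK) + t * (-q.imI + y * q.imJ - x * q.imK)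

def row2 (x y s t : ZMod p) (q : Hz) : ZMod p :=
  s * (q.imI + y * q.imJ - x * q.imK) + t * (q.re - x * q.imJ - y * q.imK)

theorem row1_mul {x y : ZMod p} (h : x ^ 2 + y ^ 2 = -1) (s t : ZMod p) (q r : Hz) :
    row1 x y s t (q * r) = row1 x y (row1 x y s t q) (row2 x y s t q) r := by
  simp only [row1, row2, Quaternion.re_mul, Quaternion.imI_mul, Quaternion.imJ_mul,
    Quaternion.imK_mul]
  push_cast
  linear_combination (- (s * (q.imJ * r.imJ + q.imK * r.imK : ZMod p)) + t * (q.imK * r.imJ - q.imJ * r.imK)) * h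

theorem row2_mul {x y : ZMod p} (h : x ^ 2 + y ^ 2 = -1) (s t : ZMod p) (q r : Hz) :
    row2 x y s t (q * r) = row2 x y (row1 x y s t q) (row2 x y s t q) r := by
  simp only [row1, row2, Quaternion.re_mul, Quaternion.imI_mul, Quaternion.imJ_mul,
    Quaternion.imK_mul]
  push_cast
  linear_combination (- (t * (q.imJ * r.imJ + q.imK * r.imK : ZMod p)) - s * (q.imK * r.imJ - q.imJ * r.imK)) * h

theorem row1_int (x y s t : ZMod p) (n : ℤ) : row1 x y s t (n : Hz) = n * s := by
  simp [row1, mul_comm]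

theorem row2_int (x y s t : ZMod p) (n : ℤ) : row2 x y s t (n : Hz) = n * t := by
  simp [row2, mul_comm]

theorem row1_smul (x y s t : ZMod p) (n : ℤ) (q : Hz) :
    n * row1 x y s t q = row1 x y s t ((n : Hz) * q) := by
  simp [row1]; ring

theorem row2_smul (x y s t : ZMod p) (n : ℤ) (q : Hz) :
    n * row2 x y s t q = row2 x y s t ((n : Hz) * q) := by
  simp [row2]; ring

theorem norm_of_row {x y : ZMod p} (h : x ^ 2 + y ^ 2 = -1) {s t : ZMod p} (hst : s ≠ 0 ∨ t ≠ 0)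
    {q : Hz} (h1 : row1 x y s t q = 0) (h2 : row2 x y s t q = 0) :
    (p : ℤ) ∣ Quaternion.normSq q := by
  rw [← ZMod.intCast_zmod_eq_zero_iff_dvd]
  have e1 := row1_mul h s t q (star q)
  have e2 := row2_mul h s t q (star q)
  rw [h1, h2, Hz.self_mul_star', row1_int] at e1
  rw [h1, h2, Hz.self_mul_star', row2_int] at e2
  simp [row1, row2] at e1 e2
  rcases hst with hs | ht
  · exact e1.resolve_right hs
  · exact e2.resolve_right ht

theorem dvd_of_rows (hp : p ≠ 2) {x y : ZMod p} (h : x ^ 2 + y ^ 2 = -1) {s t s' t' : ZMod p}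
    (hst : s * t' - s' * t ≠ 0) {q : Hz} (h1 : row1 x y s t q = 0) (h2 : row2 x y s t q = 0)
    (h3 : row1 x y s' t' q = 0) (h4 : row2 x y s' t' q = 0) : ((p : ℤ) : Hz) ∣ q := by
  have two : (2 : ZMod p) ≠ 0 := by
    intro h2
    have : ((2 : ℕ) : ZMod p) = 0 := by exact_mod_cast h2
    rw [ZMod.natCast_eq_zero_iff] at this
    exact hp ((Nat.prime_dvd_prime_iff_eq (Fact.out) Nat.prime_two).1 this)
  unfold row1 at h1 h3
  unfold row2 at h2 h4
  have a1 : (q.re + x * q.imJ + y * q.imK : ZMod p) = 0 := by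
    have : (s * t' - s' * t) * (q.re + x * q.imJ + y * q.imK : ZMod p) = 0 := by
      linear_combination t' * h1 - t * h3
    exact (mul_eq_zero.1 this).resolve_left hst
  have a2 : (-q.imI + y * q.imJ - x * q.imK : ZMod p) = 0 := by
    have : (s * t' - s' * t) * (-q.imI + y * q.imJ - x * q.imK : ZMod p) = 0 := by
      linear_combination s * h3 - s' * h1
    exact (mul_eq_zero.1 this).resolve_left hst
  have a3 : (q.imI + y * q.imJ - x * q.imK : ZMod p) = 0 := by
    have : (s * t' - s' * t) * (q.imI + y * q.imJ - x * q.imK : ZMod p) = 0 := by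
      linear_combination t' * h2 - t * h4
    exact (mul_eq_zero.1 this).resolve_left hst
  have a4 : (q.re - x * q.imJ - y * q.imK : ZMod p) = 0 := by
    have : (s * t' - s' * t) * (q.re - x * q.imJ - y * q.imK : ZMod p) = 0 := by
      linear_combination s * h4 - s' * h2
    exact (mul_eq_zero.1 this).resolve_left hst
  rw [Hz.dvd_iff]
  simp only [← ZMod.intCast_zmod_eq_zero_iff_dvd]
  refine ⟨?_, ?_, ?_, ?_⟩ <;> apply (mul_eq_zero.1 _).resolve_left two
  · linear_combination a1 + a4
  · linear_combination a3 - a2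
  · linear_combination (-x) * (a1 - a4) + (-y) * (a2 + a3) + 2 * q.imJ * h
  · linear_combination (-y) * (a1 - a4) + x * (a2 + a3) + 2 * q.imK * h

/-- A point of the projective line over `ZMod p`. -/
def ptS : Option (ZMod p) → ZMod p
  | none => 0
  | some _ => 1
def ptT : Option (ZMod p) → ZMod p
  | none => 1
  | some t => t

theorem pt_ne (v : Option (ZMod p)) : ptS v ≠ 0 ∨ ptT v ≠ 0 := by
  cases v <;> simp [ptS, ptT]

theorem pt_det {v w : Option (ZMod p)} (h : v ≠ w) : ptS v * ptT w - ptS w * ptT v ≠ 0 := by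
  cases v <;> cases w <;> simp_all [ptS, ptT, sub_eq_zero]
  exact fun h' => h h'.symm

theorem dvd_add_of_normSq_two {q : Hz} (h : (2 : ℤ) ∣ Quaternion.normSq q) :
    ∃ r : Hz, Quaternion.normSq r = 2 ∧ ((2 : ℤ) : Hz) ∣ q * r := by
  rw [Hz.normSq_eq] at h
  obtain ⟨a, ea⟩ : ∃ a, a = q.re := ⟨_, rfl⟩
  obtain ⟨b, eb⟩ : ∃ a, a = q.imI := ⟨_, rfl⟩
  obtain ⟨c, ec⟩ : ∃ a, a = q.imJ := ⟨_, rfl⟩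
  obtain ⟨d, ed⟩ : ∃ a, a = q.imK := ⟨_, rfl⟩
  rw [← ea, ← eb, ← ec, ← ed] at h
  have h' : (2 : ℤ) ∣ a + b + c + d := by
    rw [← even_iff_two_dvd] at *
    simpa [parity_simps] using h
  rcases Int.even_or_odd (a + b) with hab | hab
  · refine ⟨Hz.mk 1 1 0 0, by rw [Hz.normSq_eq]; simp, ?_⟩
    rw [Hz.dvd_iff]
    simp [← ea, ← eb, ← ec, ← ed]
    obtain ⟨e, he⟩ := hab
    omega
  · rcases Int.even_or_odd (a + c) with hac | hac
    · refine ⟨Hz.mk 1 0 1 0, by rw [Hz.normSq_eq]; simp, ?_⟩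
      rw [Hz.dvd_iff]
      simp [← ea, ← eb, ← ec, ← ed]
      obtain ⟨e, he⟩ := hac
      omega
    · refine ⟨Hz.mk 1 0 0 1, by rw [Hz.normSq_eq]; simp, ?_⟩
      rw [Hz.dvd_iff]
      simp [← ea, ← eb, ← ec, ← ed]
      obtain ⟨e, he⟩ := hac
      obtain ⟨f, hf⟩ := hab
      omega

theorem three_aux : ∀ a b c d : ZMod 3, a ^ 2 + b ^ 2 + c ^ 2 + d ^ 2 = 0 →
    ∃ e f : ZMod 3, ((e = 1 ∨ e = -1) ∧ (f = 1 ∨ f = -1)) ∧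
      (a - b * e - c * f = 0 ∧ a * e + b - d * f = 0 ∧ a * f + c + d * e = 0 ∧
        d + b * f - c * e = 0) := by
  decide +kernel

theorem dvd_add_of_normSq_three {q : Hz} (h : (3 : ℤ) ∣ Quaternion.normSq q) :
    ∃ r : Hz, Quaternion.normSq r = 3 ∧ ((3 : ℤ) : Hz) ∣ q * r := by
  rw [Hz.normSq_eq] at h
  have key := three_aux (q.re : ZMod 3) (q.imI : ZMod 3) (q.imJ : ZMod 3) (q.imK : ZMod 3) (by
    have := (ZMod.intCast_zmod_eq_zero_iff_dvd _ 3).2 h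
    push_cast at this
    exact this)
  obtain ⟨e, f, ⟨he, hf⟩, h1, h2, h3, h4⟩ := key
  obtain ⟨e', he', hee⟩ : ∃ e' : ℤ, (e' : ZMod 3) = e ∧ e' ^ 2 = 1 := by
    rcases he with rfl | rfl
    · exact ⟨1, by simp, by norm_num⟩
    · exact ⟨-1, by simp, by norm_num⟩
  obtain ⟨f', hf', hff⟩ : ∃ e' : ℤ, (e' : ZMod 3) = f ∧ e' ^ 2 = 1 := by
    rcases hf with rfl | rfl
    · exact ⟨1, by simp, by norm_num⟩
    · exact ⟨-1, by simp, by norm_num⟩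
  refine ⟨Hz.mk 1 e' f' 0, by rw [Hz.normSq_eq]; simp [hee, hff], ?_⟩
  rw [Hz.dvd_iff]
  have c : ∀ z : ℤ, (3 : ℤ) ∣ z ↔ (z : ZMod 3) = 0 := fun z =>
    (ZMod.intCast_zmod_eq_zero_iff_dvd z 3).symm
  simp only [c]
  refine ⟨?_, ?_, ?_, ?_⟩ <;> simp [he', hf']
  · linear_combination h1
  · linear_combination h2
  · linear_combination h3
  · linear_combination h4

theorem exists_norm_p (hp : p ≠ 2) {x y : ZMod p} (h : x ^ 2 + y ^ 2 = -1) (v : Option (ZMod p)) :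
    ∃ R : Hz, Quaternion.normSq R = p ∧ row1 x y (ptS v) (ptT v) R = 0 ∧
      row2 x y (ptS v) (ptT v) R = 0 := by
  have pp : p.Prime := Fact.out
  set r := Nat.sqrt p with hr
  have hr1 : r * r < p := by
    refine lt_of_le_of_ne (Nat.sqrt_le p) ?_
    intro he
    exact pp.prime.irreducible.not_isSquare ⟨r, he.symm⟩
  have hr2 : p < (r + 1) * (r + 1) := Nat.lt_succ_sqrt p
  -- pigeonhole
  let f : (Fin 4 → Fin (r + 1)) → ZMod p × ZMod p := fun w =>
    (row1 x y (ptS v) (ptT v) (Hz.mk (w 0).1 (w 1).1 (w 2).1 (w 3).1),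
     row2 x y (ptS v) (ptT v) (Hz.mk (w 0).1 (w 1).1 (w 2).1 (w 3).1))
  obtain ⟨w, w', hne, hww⟩ := Fintype.exists_ne_map_eq_of_card_lt f (by
    simp only [Fintype.card_prod, ZMod.card, Fintype.card_pi, Fintype.card_fin, Finset.prod_const,
      Finset.card_univ]
    nlinarith)
  obtain ⟨d, hd⟩ : ∃ d : Fin 4 → ℤ, ∀ i, d i = (w i).1 - (w' i).1 := ⟨_, fun i => rfl⟩
  have hdn : ∀ i, d i ^ 2 ≤ (r : ℤ) ^ 2 := by
    intro i
    have h1 := (w i).2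
    have h2 := (w' i).2
    rw [sq_le_sq, abs_of_nonneg (by positivity : (0:ℤ) ≤ r), abs_le, hd]
    omega
  have hd0 : ∃ i, d i ≠ 0 := by
    by_contra hcon
    push Not at hcon
    apply hne
    funext i
    have := hcon i
    rw [hd] at this
    exact Fin.ext (by omega)
  set q := Hz.mk (d 0) (d 1) (d 2) (d 3) with hq
  simp only [f, Prod.mk.injEq] at hww
  have r1 : row1 x y (ptS v) (ptT v) q = 0 := by
    have := hww.1
    simp [row1, hq, hd] at this ⊢
    linear_combination this
  have r2 : row2 x y (ptS v) (ptT v) q = 0 := by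
    have := hww.2
    simp [row2, hq, hd] at this ⊢
    linear_combination this
  have hN := norm_of_row h (pt_ne v) r1 r2
  have hNq : Quaternion.normSq q = d 0 ^ 2 + d 1 ^ 2 + d 2 ^ 2 + d 3 ^ 2 := by
    rw [Hz.normSq_eq]; simp [hq]
  obtain ⟨m, hm⟩ := hN
  have pos : 0 < Quaternion.normSq q := by
    rw [hNq]
    obtain ⟨i, hi⟩ := hd0
    have := sq_nonneg (d 0)
    have := sq_nonneg (d 1)
    have := sq_nonneg (d 2)
    have := sq_nonneg (d 3)
    have hi2 := pow_pos (abs_pos.2 hi) 2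
    rw [sq_abs] at hi2
    fin_cases i <;> simp at hi2 <;> linarith
  have ub : Quaternion.normSq q ≤ 4 * (r : ℤ) ^ 2 := by
    rw [hNq]; linarith [hdn 0, hdn 1, hdn 2, hdn 3]
  have pp0 : (0 : ℤ) < p := by exact_mod_cast pp.pos
  have hr1' : (r : ℤ) * r < p := by exact_mod_cast hr1
  have m0 : 0 < m := by
    rw [hm] at pos
    exact (mul_pos_iff_of_pos_left pp0).1 pos
  have m4 : m < 4 := by
    rw [hm] at ub
    by_contra hcon
    nlinarith
  have fin : ∀ n : ℤ, ¬ (p : ℤ) ∣ n → ∀ t : Hz, Quaternion.normSq t = n →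
      Quaternion.normSq q = p * n → (n : Hz) ∣ q * t → n ≠ 0 → ∃ R : Hz, Quaternion.normSq R = p ∧
      row1 x y (ptS v) (ptT v) R = 0 ∧ row2 x y (ptS v) (ptT v) R = 0 := by
    intro n hpn t ht hqn hdvd hn0
    obtain ⟨R, hR⟩ := hdvd
    have hn : (n : ZMod p) ≠ 0 := by
      rwa [Ne, ZMod.intCast_zmod_eq_zero_iff_dvd]
    refine ⟨R, ?_, ?_, ?_⟩
    · have := congrArg Quaternion.normSq hR
      rw [map_mul, map_mul, Hz.normSq_intCast, ht, hqn] at this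
      have hn2 : n ^ 2 ≠ 0 := pow_ne_zero 2 hn0
      apply mul_left_cancel₀ hn2
      rw [← this]; ring
    · have e := row1_mul h (ptS v) (ptT v) q t
      rw [r1, r2, hR, ← row1_smul] at e
      have e' : (n : ZMod p) * row1 x y (ptS v) (ptT v) R = 0 := by
        rw [e]
        simp [row1]
      exact (mul_eq_zero.1 e').resolve_left hn
    · have e := row2_mul h (ptS v) (ptT v) q t
      rw [r1, r2, hR, ← row2_smul] at e
      have e' : (n : ZMod p) * row2 x y (ptS v) (ptT v) R = 0 := by
        rw [e]
        simp [row2]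
      exact (mul_eq_zero.1 e').resolve_left hn
  have p3 : 3 ≤ p := by
    have := pp.two_le
    omega
  have small : ∀ n : ℕ, 0 < n → n < p → ¬ (p : ℤ) ∣ (n : ℤ) := by
    intro n h0 hn hd
    have := Nat.le_of_dvd h0 (Int.natCast_dvd_natCast.1 hd)
    omega
  have : m = 1 ∨ m = 2 ∨ m = 3 := by omega
  rcases this with rfl | rfl | rfl
  · exact ⟨q, by rw [hm]; ring, r1, r2⟩
  · obtain ⟨t, ht, htd⟩ := dvd_add_of_normSq_two (q := q) ⟨p, by rw [hm]; ring⟩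
    exact fin 2 (small 2 (by norm_num) (by omega)) t ht hm htd (by norm_num)
  · obtain ⟨t, ht, htd⟩ := dvd_add_of_normSq_three (q := q) ⟨p, by rw [hm]; ring⟩
    refine fin 3 (small 3 (by norm_num) ?_) t ht hm htd (by norm_num)
    rcases Nat.lt_or_ge 3 p with h3 | h3
    · exact h3
    · exfalso
      have h3' : p = 3 := le_antisymm h3 p3
      rw [hm, h3'] at ub
      rw [h3'] at hr1'
      push_cast at ub hr1'
      nlinarith

end rows

theorem kk_mul (R α : Hz) : kk (R * α) = R * kk α * star R := by
  simp [kk, mul_assoc]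

theorem kk_imI (b : Hz) : (kk b).imI = b.re ^ 2 + b.imI ^ 2 - b.imJ ^ 2 - b.imK ^ 2 := by
  simp only [kk, qI, Quaternion.re_mul, Quaternion.imI_mul, Quaternion.imJ_mul, Quaternion.imK_mul,
    Quaternion.re_star, Quaternion.imI_star, Quaternion.imJ_star, Quaternion.imK_star, Hz.mk_re,
    Hz.mk_imI, Hz.mk_imJ, Hz.mk_imK]
  ring

theorem kk_imJ (b : Hz) : (kk b).imJ = 2 * (b.imI * b.imJ + b.re * b.imK) := by
  simp only [kk, qI, Quaternion.re_mul, Quaternion.imI_mul, Quaternion.imJ_mul, Quaternion.imK_mul,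
    Quaternion.re_star, Quaternion.imI_star, Quaternion.imJ_star, Quaternion.imK_star, Hz.mk_re,
    Hz.mk_imI, Hz.mk_imJ, Hz.mk_imK]
  ring

theorem kk_imK (b : Hz) : (kk b).imK = 2 * (b.imI * b.imK - b.re * b.imJ) := by
  simp only [kk, qI, Quaternion.re_mul, Quaternion.imI_mul, Quaternion.imJ_mul, Quaternion.imK_mul,
    Quaternion.re_star, Quaternion.imI_star, Quaternion.imJ_star, Quaternion.imK_star, Hz.mk_re,
    Hz.mk_imI, Hz.mk_imJ, Hz.mk_imK]
  ring

section desc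
variable {p : ℕ} [Fact p.Prime]

theorem two_ne_zmod (hp : p ≠ 2) : (2 : ZMod p) ≠ 0 := by
  intro h2
  have : ((2 : ℕ) : ZMod p) = 0 := by exact_mod_cast h2
  rw [ZMod.natCast_eq_zero_iff] at this
  exact hp ((Nat.prime_dvd_prime_iff_eq (Fact.out) Nat.prime_two).1 this)

theorem zmod_of_dvd_kk (hp : p ≠ 2) {M : ℕ} {b : Hz} (hb : Quaternion.normSq b = (p * M : ℕ))
    (hd : ((p : ℤ) : Hz) ∣ kk b) :
    ((b.re : ZMod p) ^ 2 + (b.imI : ZMod p) ^ 2 = 0 ∧ (b.imJ : ZMod p) ^ 2 + (b.imK : ZMod p) ^ 2 = 0) ∧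
    (b.imI * b.imJ + b.re * b.imK : ZMod p) = 0 ∧ (b.imI * b.imK - b.re * b.imJ : ZMod p) = 0 := by
  have two := two_ne_zmod hp
  rw [Hz.normSq_eq] at hb
  rw [Hz.dvd_iff, kk_imI, kk_imJ, kk_imK] at hd
  obtain ⟨-, h1, h2, h3⟩ := hd
  have hb' := congrArg (Int.cast : ℤ → ZMod p) hb
  rw [← ZMod.intCast_zmod_eq_zero_iff_dvd] at h1 h2 h3
  push_cast at h1 h2 h3 hb'
  rw [CharP.cast_eq_zero, zero_mul] at hb'
  refine ⟨⟨?_, ?_⟩, (mul_eq_zero.1 h2).resolve_left two, (mul_eq_zero.1 h3).resolve_left two⟩ <;>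
    apply (mul_eq_zero.1 _).resolve_left two
  · linear_combination hb' + h1
  · linear_combination hb' - h1

theorem desc_three (hp : p % 4 = 3) {M : ℕ} {y : Hz} (hy : IsX (p * M) y)
    (hd : ((p : ℤ) : Hz) ∣ y) : ∃ M' k, M = p * M' ∧ IsX M' k ∧ y = ((p ^ 2 : ℤ) : Hz) * k := by
  have pp : p.Prime := Fact.out
  obtain ⟨b, hb, rfl⟩ := hy
  obtain ⟨⟨h1, h2⟩, -⟩ := zmod_of_dvd_kk (by rintro rfl; omega) hb hd
  have key : ∀ u v : ℤ, (u : ZMod p) ^ 2 + (v : ZMod p) ^ 2 = 0 → (p : ℤ) ∣ u := by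
    intro u v h
    rw [← ZMod.intCast_zmod_eq_zero_iff_dvd]
    by_contra hu
    have hv : (v : ZMod p) ≠ 0 := by
      intro hv
      rw [hv] at h
      exact hu (by simpa using h)
    exact ZMod.mod_four_ne_three_of_sq_eq_neg_sq' hv (x := (u : ZMod p)) (by linear_combination h) hp
  have : ((p : ℤ) : Hz) ∣ b := by
    rw [Hz.dvd_iff]
    exact ⟨key _ _ h1, key _ b.re (by linear_combination h1), key _ _ h2,
      key _ b.imJ (by linear_combination h2)⟩
  obtain ⟨c, rfl⟩ := this
  rw [map_mul, Hz.normSq_intCast] at hb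
  have p0 : (p : ℤ) ≠ 0 := by exact_mod_cast pp.ne_zero
  have hM : (M : ℤ) = p * Quaternion.normSq c := by
    apply mul_left_cancel₀ p0
    push_cast at hb
    rw [← hb]; ring
  have c0 : 0 ≤ Quaternion.normSq c := by rw [Hz.normSq_eq]; positivity
  lift Quaternion.normSq c to ℕ using c0 with n hn
  refine ⟨n, kk c, by exact_mod_cast hM, ⟨c, hn.symm, rfl⟩, ?_⟩
  rw [kk_mul, star_intCast, mul_assoc, (Int.cast_commute (p : ℤ) (kk c)).eq.symm, ← mul_assoc]
  push_cast
  rw [pow_two]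

theorem desc_one (hp : p % 4 = 1) {M : ℕ} {y : Hz} (hy : IsX (p * M) y)
    (hd : ((p : ℤ) : Hz) ∣ y) : ∃ k, IsX M k ∧ y = ((p : ℤ) : Hz) * k := by
  have pp : p.Prime := Fact.out
  obtain ⟨β, hb, rfl⟩ := hy
  obtain ⟨⟨h1, h2⟩, h3, h4⟩ := zmod_of_dvd_kk (by rintro rfl; omega) hb hd
  obtain ⟨a, b, hab⟩ := Nat.Prime.sq_add_sq (p := p) (by omega)
  have hz : (a : ZMod p) ^ 2 + (b : ZMod p) ^ 2 = 0 := by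
    have := congrArg (Nat.cast : ℕ → ZMod p) hab
    push_cast at this
    rwa [CharP.cast_eq_zero (ZMod p) p] at this
  have ha : (a : ZMod p) ≠ 0 := by
    intro ha
    rw [ZMod.natCast_eq_zero_iff] at ha
    have a0 : 0 < a := by
      rcases Nat.eq_zero_or_pos a with rfl | h
      · exact absurd ⟨b, by rw [← hab]; ring⟩ pp.prime.irreducible.not_isSquare
      · exact h
    have := Nat.le_of_dvd a0 ha
    have := pp.two_le
    nlinarith
  have p0 : (p : ℤ) ≠ 0 := by exact_mod_cast pp.ne_zero
  have main : ∀ e : ℤ, (e : ZMod p) ^ 2 = b ^ 2 → e ^ 2 = b ^ 2 →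
      (a * β.re + e * β.imI : ZMod p) = 0 → (a * β.imJ - e * β.imK : ZMod p) = 0 →
      ∃ k, IsX M k ∧ kk β = ((p : ℤ) : Hz) * k := by
    intro e he he' k1 k2
    have hg : Quaternion.normSq (Hz.mk a e 0 0) = p := by
      rw [Hz.normSq_eq]
      simp [he']
      exact_mod_cast hab
    have : ((p : ℤ) : Hz) ∣ β * star (Hz.mk a e 0 0) := by
      rw [Hz.dvd_iff]
      simp only [← ZMod.intCast_zmod_eq_zero_iff_dvd]
      simp only [Quaternion.re_mul, Quaternion.imI_mul, Quaternion.imJ_mul, Quaternion.imK_mul,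
        Quaternion.re_star, Quaternion.imI_star, Quaternion.imJ_star, Quaternion.imK_star, Hz.mk_re,
        Hz.mk_imI, Hz.mk_imJ, Hz.mk_imK]
      push_cast
      refine ⟨by linear_combination k1, ?_, by linear_combination k2, ?_⟩ <;>
        apply (mul_eq_zero.1 _).resolve_left ha
      · linear_combination β.imI * hz - e * k1 + β.imI * he
      · linear_combination β.imK * hz + e * k2 + β.imK * he
    obtain ⟨γ, hγ⟩ := this
    have hβ : β = γ * Hz.mk a e 0 0 := by
      apply Hz.mul_cancel p0
      rw [← mul_assoc, ← hγ, mul_assoc, Hz.star_mul_self', hg, (Int.cast_commute (p : ℤ) β).eq]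
    refine ⟨kk γ, ⟨γ, ?_, rfl⟩, ?_⟩
    · have := congrArg Quaternion.normSq hβ
      rw [hb, map_mul, hg] at this
      push_cast at this
      apply mul_left_cancel₀ p0
      rw [this]; ring
    · rw [hβ, kk_mul]
      have : kk (Hz.mk a e 0 0) = ((p : ℤ) : Hz) * qI := by
        rw [← hg, ← Hz.self_mul_star', kk, mul_assoc, mul_assoc]
        congr 1
        ext <;> simp [qI]
      rw [this, (Int.cast_commute (p : ℤ) γ).symm.left_comm, mul_assoc, kk, mul_assoc]
  have c1 : ((a * β.re + b * β.imI : ZMod p) = 0) ∨ ((a * β.re - b * β.imI : ZMod p) = 0) := by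
    rw [← mul_eq_zero]
    linear_combination (a : ZMod p) ^ 2 * h1 - (β.imI : ZMod p) ^ 2 * hz
  have c2 : ((a * β.imJ + b * β.imK : ZMod p) = 0) ∨ ((a * β.imJ - b * β.imK : ZMod p) = 0) := by
    rw [← mul_eq_zero]
    linear_combination (a : ZMod p) ^ 2 * h2 - (β.imK : ZMod p) ^ 2 * hz
  have c3 : ((a * β.re + b * β.imI : ZMod p) = 0) ∨ ((a * β.imJ + b * β.imK : ZMod p) = 0) := by
    rw [← mul_eq_zero]
    linear_combination (a : ZMod p) * b * h3 - (a : ZMod p) ^ 2 * h4 + β.imI * β.imK * hz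
  have c4 : ((a * β.re - b * β.imI : ZMod p) = 0) ∨ ((a * β.imJ - b * β.imK : ZMod p) = 0) := by
    rw [← mul_eq_zero]
    linear_combination - (a : ZMod p) * b * h3 - (a : ZMod p) ^ 2 * h4 + β.imI * β.imK * hz
  have : ((a * β.re + b * β.imI : ZMod p) = 0 ∧ (a * β.imJ - b * β.imK : ZMod p) = 0) ∨
    ((a * β.re - b * β.imI : ZMod p) = 0 ∧ (a * β.imJ + b * β.imK : ZMod p) = 0) := by
    tauto
  rcases this with ⟨k1, k2⟩ | ⟨k1, k2⟩
  · exact main b (by simp) rfl (by simpa using k1) (by simpa using k2)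
  · refine main (-b) (by simp) (by simp) ?_ ?_
    · push_cast; linear_combination k1
    · push_cast; linear_combination k2

end desc

section fib
variable {p : ℕ} [Fact p.Prime]

/-- The quadratic form whose zeros are the lines fixed by a pure quaternion modulo `p`. -/
def fixForm (x y : ZMod p) (k : Hz) (v : Option (ZMod p)) : ZMod p :=
  ptS v * row2 x y (ptS v) (ptT v) k - row1 x y (ptS v) (ptT v) k * ptT v

theorem fixForm_eq_zero (hp : p ≠ 2) {x y : ZMod p} (h : x ^ 2 + y ^ 2 = -1) {v : Option (ZMod p)}
    {R k k' : Hz} (hR : Quaternion.normSq R = p) (h1 : row1 x y (ptS v) (ptT v) R = 0)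
    (h2 : row2 x y (ptS v) (ptT v) R = 0) (hk : R * k * star R = ((p : ℤ) : Hz) * k') :
    fixForm x y k' v = 0 := by
  have pp : p.Prime := Fact.out
  have p0 : (p : ℤ) ≠ 0 := by exact_mod_cast pp.ne_zero
  have e : R * k = k' * R := by
    apply Hz.mul_cancel p0
    have := congrArg (· * R) hk
    simp only [mul_assoc, Hz.star_mul_self', hR] at this
    rw [← this, ← mul_assoc R k, (Int.cast_commute (p : ℤ) (R * k)).eq, mul_assoc]
  by_contra hne
  have e1 := row1_mul h (ptS v) (ptT v) R k
  have e2 := row2_mul h (ptS v) (ptT v) R k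
  rw [h1, h2, e, row1_mul h] at e1
  rw [h1, h2, e, row2_mul h] at e2
  have hd := dvd_of_rows hp h (s := ptS v) (t := ptT v) hne h1 h2 (e1.trans (by simp [row1]))
    (e2.trans (by simp [row2]))
  have hn := Hz.normSq_dvd hd
  rw [hR] at hn
  have := Int.le_of_dvd (by exact_mod_cast pp.pos) hn
  have h2' : (2 : ℤ) ≤ p := by exact_mod_cast pp.two_le
  nlinarith

theorem fixForm_none (x y : ZMod p) (k : Hz) : fixForm x y k none =
    -(-k.imI + y * k.imJ - x * k.imK) := by
  simp [fixForm, ptS, ptT, row1]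

theorem fixForm_some (x y : ZMod p) {k : Hz} (hk : k.re = 0) (t : ZMod p) : fixForm x y k (some t) =
    (k.imI + y * k.imJ - x * k.imK) - 2 * (x * k.imJ + y * k.imK) * t
      - (-k.imI + y * k.imJ - x * k.imK) * t ^ 2 := by
  simp [fixForm, ptS, ptT, row1, row2, hk]
  ring

theorem dvd_of_form (hp : p ≠ 2) {x y : ZMod p} (h : x ^ 2 + y ^ 2 = -1) {k : Hz} (hk : k.re = 0)
    (hA : (x * k.imJ + y * k.imK : ZMod p) = 0) (hB : (k.imI + y * k.imJ - x * k.imK : ZMod p) = 0)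
    (hC : (-k.imI + y * k.imJ - x * k.imK : ZMod p) = 0) : ((p : ℤ) : Hz) ∣ k := by
  have two := two_ne_zmod hp
  rw [Hz.dvd_iff]
  simp only [← ZMod.intCast_zmod_eq_zero_iff_dvd]
  refine ⟨by simp [hk], ?_, ?_, ?_⟩ <;> apply (mul_eq_zero.1 _).resolve_left two
  · linear_combination hB - hC
  · linear_combination 2 * k.imJ * h - 2 * x * hA - y * (hB + hC)
  · linear_combination 2 * k.imK * h - 2 * y * hA + x * (hB + hC)

theorem dvd_of_three_zeros (hp : p ≠ 2) {x y : ZMod p} (h : x ^ 2 + y ^ 2 = -1) {k : Hz}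
    (hk : k.re = 0) {u v w : Option (ZMod p)} (huv : u ≠ v) (huw : u ≠ w) (hvw : v ≠ w)
    (hu : fixForm x y k u = 0) (hv : fixForm x y k v = 0) (hw : fixForm x y k w = 0) :
    ((p : ℤ) : Hz) ∣ k := by
  have two := two_ne_zmod hp
  obtain ⟨A, hA⟩ : ∃ A, A = (x * k.imJ + y * k.imK : ZMod p) := ⟨_, rfl⟩
  obtain ⟨B, hB⟩ : ∃ A, A = (k.imI + y * k.imJ - x * k.imK : ZMod p) := ⟨_, rfl⟩
  obtain ⟨C, hC⟩ : ∃ A, A = (-k.imI + y * k.imJ - x * k.imK : ZMod p) := ⟨_, rfl⟩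
  suffices A = 0 ∧ B = 0 ∧ C = 0 from
    dvd_of_form hp h hk (hA ▸ this.1) (hB ▸ this.2.1) (hC ▸ this.2.2)
  have two_pts : ∀ s t : ZMod p, s ≠ t → C = 0 → B - 2 * A * s - C * s ^ 2 = 0 →
      B - 2 * A * t - C * t ^ 2 = 0 → A = 0 ∧ B = 0 ∧ C = 0 := by
    intro s t hst h0 h1 h2
    have hA0 : A = 0 := by
      apply (mul_eq_zero.1 _).resolve_left (mul_ne_zero two (sub_ne_zero.2 hst))
      linear_combination h2 - h1 - (s ^ 2 - t ^ 2) * h0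
    exact ⟨hA0, by linear_combination h1 + 2 * s * hA0 + s ^ 2 * h0, h0⟩
  cases u <;> cases v <;> cases w <;>
    simp only [fixForm_none, fixForm_some _ _ hk, ← hA, ← hB, ← hC, ne_eq, Option.some.injEq,
      reduceCtorEq, not_true_eq_false, not_false_eq_true, neg_eq_zero] at hu hv hw huv huw hvw
  · exact two_pts _ _ hvw hu hv hw
  · exact two_pts _ _ huw hv hu hw
  · exact two_pts _ _ huv hw hu hv
  · rename_i a b c
    have e1 : 2 * A + C * (a + b) = 0 := by
      apply (mul_eq_zero.1 _).resolve_left (sub_ne_zero.2 huv)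
      linear_combination hv - hu
    have e2 : 2 * A + C * (a + c) = 0 := by
      apply (mul_eq_zero.1 _).resolve_left (sub_ne_zero.2 huw)
      linear_combination hw - hu
    refine two_pts _ _ huv ?_ hu hv
    apply (mul_eq_zero.1 _).resolve_left (sub_ne_zero.2 hvw)
    linear_combination e1 - e2

theorem dvd_of_two_zeros (hp : p ≠ 2) {x y : ZMod p} (h : x ^ 2 + y ^ 2 = -1) {k : Hz}
    (hk : k.re = 0) (hn : (p : ℤ) ∣ Quaternion.normSq k) {u v : Option (ZMod p)} (huv : u ≠ v)
    (hu : fixForm x y k u = 0) (hv : fixForm x y k v = 0) :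
    ((p : ℤ) : Hz) ∣ k := by
  have two := two_ne_zmod hp
  obtain ⟨A, hA⟩ : ∃ A, A = (x * k.imJ + y * k.imK : ZMod p) := ⟨_, rfl⟩
  obtain ⟨B, hB⟩ : ∃ A, A = (k.imI + y * k.imJ - x * k.imK : ZMod p) := ⟨_, rfl⟩
  obtain ⟨C, hC⟩ : ∃ A, A = (-k.imI + y * k.imJ - x * k.imK : ZMod p) := ⟨_, rfl⟩
  suffices A = 0 ∧ B = 0 ∧ C = 0 from
    dvd_of_form hp h hk (hA ▸ this.1) (hB ▸ this.2.1) (hC ▸ this.2.2)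
  have hdisc : A ^ 2 + B * C = 0 := by
    rw [Hz.normSq_eq, ← ZMod.intCast_zmod_eq_zero_iff_dvd, hk] at hn
    push_cast at hn
    rw [hA, hB, hC]
    linear_combination (k.imJ ^ 2 + k.imK ^ 2 : ZMod p) * h - hn
  have one_pt : ∀ s : ZMod p, C = 0 → B - 2 * A * s - C * s ^ 2 = 0 → A = 0 ∧ B = 0 ∧ C = 0 := by
    intro s h0 h1
    have hA0 : A = 0 := by
      apply pow_eq_zero_iff two_ne_zero |>.1
      linear_combination hdisc - B * h0
    exact ⟨hA0, by linear_combination h1 + 2 * s * hA0 + s ^ 2 * h0, h0⟩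
  cases u <;> cases v <;>
    simp only [fixForm_none, fixForm_some _ _ hk, ← hA, ← hB, ← hC, ne_eq, Option.some.injEq,
      reduceCtorEq, not_true_eq_false, not_false_eq_true, neg_eq_zero] at hu hv huv
  · exact one_pt _ hu hv
  · exact one_pt _ hv hu
  · rename_i a b
    have e1 : 2 * A + C * (a + b) = 0 := by
      apply (mul_eq_zero.1 _).resolve_left (sub_ne_zero.2 huv)
      linear_combination hv - hu
    have e2 : (C * (a - b)) ^ 2 = 0 := by
      linear_combination (C * (a + b) - 2 * A) * e1 + 4 * hdisc - 4 * C * hv - 4 * b * C * e1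
    refine one_pt _ ?_ hu
    exact (mul_eq_zero.1 (pow_eq_zero_iff two_ne_zero |>.1 e2)).resolve_right (sub_ne_zero.2 huv)

end fib

theorem isX_mul {p M : ℕ} {k R : Hz} (hR : Quaternion.normSq R = p) (hk : IsX M k) :
    IsX (p * M) (R * k * Star.star R) := by
  obtain ⟨α, hα, rfl⟩ := hk
  exact ⟨R * α, by rw [map_mul, hR, hα]; push_cast; rfl, kk_mul R α⟩

theorem card_sum_aux {ι : Type*} [DecidableEq ι] (Y B : Finset ι) (f : ι → ℕ) (c n x : ℕ)
    (h1 : ∀ y ∈ Y, y ∉ B → f y ≤ 1) (h2 : ∀ y ∈ Y, f y ≤ c + 1) (hB : c * B.card ≤ x)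
    (hn : n + x ≤ ∑ y ∈ Y, f y) : n ≤ Y.card := by
  have : ∑ y ∈ Y, f y ≤ ∑ y ∈ Y, (1 + if y ∈ B then c else 0) := by
    apply Finset.sum_le_sum
    intro y hy
    split_ifs with h
    · linarith [h2 y hy]
    · exact h1 y hy h
  rw [Finset.sum_add_distrib, Finset.sum_ite_mem, Finset.sum_const, Finset.sum_const] at this
  have h3 : (Y ∩ B).card ≤ B.card := Finset.card_le_card Finset.inter_subset_right
  simp only [smul_eq_mul, mul_one] at this
  nlinarith

section fib
variable {p : ℕ} [Fact p.Prime]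

theorem card_XN_mul_le (hp : p ≠ 2) (M : ℕ) (hM : 0 < M) : p * (XN M).card ≤ (XN (p * M)).card := by
  classical
  induction M using Nat.strong_induction_on with
  | _ M ih =>
  have pp : p.Prime := Fact.out
  have p0 : (p : ℤ) ≠ 0 := by exact_mod_cast pp.ne_zero
  obtain ⟨x, y, h⟩ := ZMod.sq_add_sq p (-1)
  choose R hR hr1 hr2 using fun v => exists_norm_p hp h v
  set S : Finset (Option (ZMod p) × Hz) := Finset.univ ×ˢ XN M with hS
  set Φ : Option (ZMod p) × Hz → Hz := fun q => R q.1 * q.2 * star (R q.1) with hΦ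
  have hmaps : ∀ q ∈ S, Φ q ∈ XN (p * M) := by
    intro q hq
    rw [hS, Finset.mem_product] at hq
    exact mem_XN.2 (isX_mul (hR q.1) (mem_XN.1 hq.2))
  have hcard := Finset.card_eq_sum_card_fiberwise hmaps
  have hScard : S.card = (p + 1) * (XN M).card := by
    rw [hS, Finset.card_product, Finset.card_univ, Fintype.card_option, ZMod.card]
  have inj : ∀ q q' : Option (ZMod p) × Hz, Φ q = Φ q' → q.1 = q'.1 → q = q' := by
    rintro ⟨v, k⟩ ⟨v', k'⟩ he hv
    simp only at hv
    subst hv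
    simp only [hΦ] at he
    have e2 := congrArg (fun z => star (R v) * z * R v) he
    simp only [mul_assoc, Hz.star_mul_self', hR] at e2
    rw [← mul_assoc (star (R v)), ← mul_assoc (star (R v)), Hz.star_mul_self', hR] at e2
    have e3 := Hz.mul_cancel p0 e2
    rw [← (Int.cast_commute (p : ℤ) k).eq, ← (Int.cast_commute (p : ℤ) k').eq] at e3
    rw [Hz.mul_cancel p0 e3]
  have fibp : ∀ z, (S.filter (fun q => Φ q = z)).card ≤ p + 1 := by
    intro z
    rw [← Finset.card_image_of_injOn (f := Prod.fst) (s := S.filter (fun q => Φ q = z))]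
    · refine (Finset.card_le_univ _).trans ?_
      rw [Fintype.card_option, ZMod.card]
    · intro q hq q' hq' he
      simp only [Finset.coe_filter, mem_ofPred_eq] at hq hq'
      exact inj q q' (hq.2.trans hq'.2.symm) he
  have fib1 : ∀ z, ¬ ((p : ℤ) : Hz) ∣ z → (S.filter (fun q => Φ q = z)).card ≤ 1 := by
    intro z hz
    rw [Finset.card_le_one]
    intro q hq q' hq'
    rw [Finset.mem_filter] at hq hq'
    apply inj q q' (hq.2.trans hq'.2.symm)
    by_contra hne
    apply hz
    have hrow : ∀ q : Option (ZMod p) × Hz, Φ q = z →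
        row1 x y (ptS q.1) (ptT q.1) z = 0 ∧ row2 x y (ptS q.1) (ptT q.1) z = 0 := by
      rintro q rfl
      simp only [hΦ, mul_assoc]
      rw [row1_mul h, row2_mul h, hr1, hr2]
      simp [row1, row2]
    exact dvd_of_rows hp h (pt_det hne) (hrow q hq.2).1 (hrow q hq.2).2 (hrow q' hq'.2).1
      (hrow q' hq'.2).2
  have form : ∀ z, ∀ q ∈ S.filter (fun q => Φ q = ((p : ℤ) : Hz) * z), fixForm x y z q.1 = 0 := by
    intro z q hq
    rw [Finset.mem_filter] at hq
    exact fixForm_eq_zero hp h (hR _) (hr1 _) (hr2 _) hq.2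
  have fib2 : ∀ z : Hz, z.re = 0 → ¬ ((p : ℤ) : Hz) ∣ z →
      (S.filter (fun q => Φ q = ((p : ℤ) : Hz) * z)).card ≤ 2 := by
    intro z hz hd
    by_contra hcon
    push Not at hcon
    obtain ⟨a, ha, b, hb, c, hc, hab, hac, hbc⟩ := Finset.two_lt_card.1 hcon
    have ne : ∀ q q', q ∈ S.filter (fun q => Φ q = ((p : ℤ) : Hz) * z) →
      q' ∈ S.filter (fun q => Φ q = ((p : ℤ) : Hz) * z) → q ≠ q' → q.1 ≠ q'.1 := by
      intro q q' hq hq' hne he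
      rw [Finset.mem_filter] at hq hq'
      exact hne (inj q q' (hq.2.trans hq'.2.symm) he)
    exact hd (dvd_of_three_zeros hp h hz (ne a b ha hb hab) (ne a c ha hc hac) (ne b c hb hc hbc)
      (form z a ha) (form z b hb) (form z c hc))
  have fib3 : ∀ z : Hz, z.re = 0 → (p : ℤ) ∣ Quaternion.normSq z → ¬ ((p : ℤ) : Hz) ∣ z →
      (S.filter (fun q => Φ q = ((p : ℤ) : Hz) * z)).card ≤ 1 := by
    intro z hz hn hd
    rw [Finset.card_le_one]
    intro q hq q' hq'
    have hq2 := (Finset.mem_filter.1 hq).2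
    have hq2' := (Finset.mem_filter.1 hq').2
    apply inj q q' (hq2.trans hq2'.symm)
    by_contra hne
    exact hd (dvd_of_two_zeros hp h hz hn hne (form z q hq) (form z q' hq'))
  have hn : p * (XN M).card + (XN M).card ≤
      ∑ z ∈ XN (p * M), (S.filter (fun q => Φ q = z)).card := by
    rw [← hcard, hScard]; linarith
  have hmod : p % 4 = 1 ∨ p % 4 = 3 := by
    have := pp.eq_two_or_odd
    omega
  by_cases hpM : p ∣ M
  · obtain ⟨M', rfl⟩ := hpM
    have hM' : 0 < M' := Nat.pos_of_mul_pos_left hM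
    refine card_sum_aux _ ((XN M').image (fun k => ((p ^ 2 : ℤ) : Hz) * k)) _ p _ _ ?_
      (fun z _ => fibp z) ?_ hn
    · intro z hz hzB
      by_cases hd : ((p : ℤ) : Hz) ∣ z
      · rcases hmod with hm | hm
        · obtain ⟨k, hk, rfl⟩ := desc_one hm (mem_XN.1 hz) hd
          refine fib3 k hk.re ?_ ?_
          · rw [hk.normSq]
            push_cast
            exact Dvd.intro _ (by ring_nf : (p : ℤ) * (p * M' ^ 2) = _)
          · intro hd2
            obtain ⟨k', hk', rfl⟩ := desc_one hm hk hd2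
            apply hzB
            rw [Finset.mem_image]
            refine ⟨k', mem_XN.2 hk', ?_⟩
            rw [← mul_assoc, ← Int.cast_mul, pow_two]
        · obtain ⟨M'', k, hMM, hk, rfl⟩ := desc_three hm (mem_XN.1 hz) hd
          have := Nat.eq_of_mul_eq_mul_left pp.pos hMM
          subst this
          exact absurd (Finset.mem_image.2 ⟨k, mem_XN.2 hk, rfl⟩) hzB
      · exact fib1 z hd
    · refine le_trans (Nat.mul_le_mul_left p Finset.card_image_le) (ih M' ?_ hM')
      nlinarith [pp.two_le]
  · refine card_sum_aux _ ((XN M).image (fun k => ((p : ℤ) : Hz) * k)) _ 1 _ _ ?_ ?_ ?_ hn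
    · intro z hz hzB
      apply fib1
      intro hd
      rcases hmod with hm | hm
      · obtain ⟨k, hk, rfl⟩ := desc_one hm (mem_XN.1 hz) hd
        exact hzB (Finset.mem_image.2 ⟨k, mem_XN.2 hk, rfl⟩)
      · obtain ⟨M', -, hM', -⟩ := desc_three hm (mem_XN.1 hz) hd
        exact hpM ⟨M', hM'⟩
    · intro z hz
      by_cases hd : ((p : ℤ) : Hz) ∣ z
      · rcases hmod with hm | hm
        · obtain ⟨k, hk, rfl⟩ := desc_one hm (mem_XN.1 hz) hd
          refine fib2 k hk.re ?_
          intro hd2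
          have h3 := (Dvd.intro_left _ rfl : (p : ℤ) ∣ p * p).trans
            (by simpa [pow_two] using Hz.normSq_dvd hd2)
          rw [hk.normSq] at h3
          exact hpM (Int.natCast_dvd_natCast.1
            ((Nat.prime_iff_prime_int.1 pp).dvd_of_dvd_pow h3))
        · obtain ⟨M', -, hM', -⟩ := desc_three hm (mem_XN.1 hz) hd
          exact absurd ⟨M', hM'⟩ hpM
      · exact (fib1 z hd).trans (by norm_num)
    · rw [one_mul]; exact Finset.card_image_le

end fib

theorem le_card_XN (N : ℕ) (hN : Odd N) : N ≤ (XN N).card := by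
  induction N using Nat.strong_induction_on with
  | _ N ih =>
  by_cases h1 : N = 1
  · subst h1
    rw [Nat.one_le_iff_ne_zero, Finset.card_ne_zero]
    exact ⟨kk 1, mem_XN.2 ⟨1, by simp, rfl⟩⟩
  · obtain ⟨p, pp, M, rfl⟩ := Nat.exists_prime_and_dvd h1
    have : Fact p.Prime := ⟨pp⟩
    have ho := Nat.odd_mul.1 hN
    have hp2 : p ≠ 2 := by rintro rfl; exact absurd ho.1 (by decide)
    have hM : 0 < M := ho.2.pos
    refine le_trans (Nat.mul_le_mul_left p (ih M ?_ ho.2)) (card_XN_mul_le hp2 M hM)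
    nlinarith [pp.two_le]

open Classical in
/-- Gaussian integers of norm `n`. -/
def RN (n : ℕ) : Finset GaussianInt :=
  ((Finset.Icc (-n : ℤ) n ×ˢ Finset.Icc (-n : ℤ) n).image
    (fun v => (⟨v.1, v.2⟩ : GaussianInt))).filter (fun x => x.norm = (n : ℤ))

theorem gnorm_eq (x : GaussianInt) : x.norm = x.re ^ 2 + x.im ^ 2 := by
  rw [Zsqrtd.norm_def]; ring

theorem mem_RN {n : ℕ} {x : GaussianInt} : x ∈ RN n ↔ x.norm = (n : ℤ) := by
  classical
  rw [RN, Finset.mem_filter, and_iff_right_iff_imp]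
  intro h
  rw [Finset.mem_image]
  refine ⟨(x.re, x.im), ?_, rfl⟩
  rw [gnorm_eq] at h
  have key : ∀ a : ℤ, a ^ 2 ≤ n → -(n : ℤ) ≤ a ∧ a ≤ n := fun a ha =>
    ⟨by nlinarith [Int.le_self_sq (-a)], by nlinarith [Int.le_self_sq a]⟩
  have := sq_nonneg x.re
  have := sq_nonneg x.im
  rw [Finset.mem_product, Finset.mem_Icc, Finset.mem_Icc]
  exact ⟨key _ (by linarith), key _ (by linarith)⟩

theorem gaussian_prime_of_norm {p : ℕ} (pp : p.Prime) {ϖ : GaussianInt} (h : ϖ.norm = p) :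
    Prime ϖ := by
  apply Irreducible.prime
  constructor
  · intro hu
    rw [← Zsqrtd.norm_eq_one_iff' (by norm_num), h] at hu
    exact pp.one_lt.ne' (by exact_mod_cast hu)
  · intro a b hab
    have h2 := congrArg Zsqrtd.norm hab
    rw [Zsqrtd.norm_mul, h] at h2
    have h3 : p = a.norm.natAbs * b.norm.natAbs := by
      rw [← Int.natAbs_mul, ← h2, Int.natAbs_natCast]
    rw [← Zsqrtd.norm_eq_one_iff, ← Zsqrtd.norm_eq_one_iff]
    simpa only [Nat.isUnit_iff] using pp.prime.irreducible.isUnit_or_isUnit h3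

theorem exists_split_dvd {p : ℕ} (pp : p.Prime) {ϖ : GaussianInt} (h : ϖ.norm = p) (m : ℕ) (a : ℕ) :
    ∀ z : GaussianInt, z.norm = (p ^ a * m : ℕ) → ∃ j ≤ a, ∃ z', z = ϖ ^ j * star ϖ ^ (a - j) * z' ∧
      z'.norm = m := by
  have hs : (star ϖ).norm = p := by rw [Zsqrtd.norm_conj, h]
  have p0 : (p : ℤ) ≠ 0 := by exact_mod_cast pp.ne_zero
  induction a with
  | zero => exact fun z hz => ⟨0, le_rfl, z, by simp, by simpa using hz⟩
  | succ a ih =>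
    intro z hz
    have hd : ϖ ∣ z * star z := by
      rw [← Zsqrtd.norm_eq_mul_conj, hz]
      have : (p : GaussianInt) = ϖ * star ϖ := by
        rw [← Zsqrtd.norm_eq_mul_conj, h]; simp
      exact ⟨star ϖ * ((p ^ a * m : ℕ) : GaussianInt), by
        rw [← mul_assoc, ← this]; push_cast; ring⟩
    have hdd : ϖ ∣ z ∨ star ϖ ∣ z := by
      rcases (gaussian_prime_of_norm pp h).dvd_or_dvd hd with h1 | ⟨u, hu⟩
      · exact Or.inl h1
      · exact Or.inr ⟨star u, by rw [← star_mul', ← hu, star_star]⟩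
    rcases hdd with ⟨y, rfl⟩ | ⟨y, rfl⟩
    · rw [Zsqrtd.norm_mul, h] at hz
      obtain ⟨j, hj, z', rfl, hz'⟩ := ih y (by
        apply mul_left_cancel₀ p0; rw [hz]; push_cast; ring)
      refine ⟨j + 1, by omega, z', ?_, hz'⟩
      rw [show a + 1 - (j + 1) = a - j by omega]; ring
    · rw [Zsqrtd.norm_mul, hs] at hz
      obtain ⟨j, hj, z', rfl, hz'⟩ := ih y (by
        apply mul_left_cancel₀ p0; rw [hz]; push_cast; ring)
      refine ⟨j, by omega, z', ?_, hz'⟩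
      rw [show a + 1 - j = (a - j) + 1 by omega]; ring

theorem exists_inert_dvd {p : ℕ} (pp : p.Prime) (hp : p % 4 = 3) {m : ℕ} (hm : ¬ p ∣ m) (a : ℕ) :
    ∀ z : GaussianInt, z.norm = (p ^ a * m : ℕ) → ∃ z', z = (p : GaussianInt) ^ (a / 2) * z' ∧
      z'.norm = m := by
  have : Fact p.Prime := ⟨pp⟩
  have p0 : (p : ℤ) ^ 2 ≠ 0 := pow_ne_zero 2 (by exact_mod_cast pp.ne_zero)
  induction a using Nat.strong_induction_on with
  | _ a ih =>
  intro z hz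
  rcases Nat.eq_zero_or_pos a with rfl | ha
  · exact ⟨z, by simp, by simpa using hz⟩
  have key : ∀ u v : ℤ, (u : ZMod p) ^ 2 + (v : ZMod p) ^ 2 = 0 → (p : ℤ) ∣ u := by
    intro u v h
    rw [← ZMod.intCast_zmod_eq_zero_iff_dvd]
    by_contra hu
    have hv : (v : ZMod p) ≠ 0 := by
      intro hv
      rw [hv] at h
      exact hu (by simpa using h)
    exact ZMod.mod_four_ne_three_of_sq_eq_neg_sq' hv (x := (u : ZMod p)) (by linear_combination h) hp
  have h0 : (z.re : ZMod p) ^ 2 + (z.im : ZMod p) ^ 2 = 0 := by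
    have := congrArg (Int.cast : ℤ → ZMod p) hz
    rw [gnorm_eq] at this
    push_cast at this
    rw [this, CharP.cast_eq_zero (ZMod p) p, zero_pow ha.ne', zero_mul]
  obtain ⟨u, hu⟩ := key _ _ h0
  obtain ⟨v, hv⟩ := key z.im z.re (by linear_combination h0)
  obtain ⟨y, rfl⟩ : ∃ y, z = (p : GaussianInt) * y := ⟨⟨u, v⟩, by
    apply Zsqrtd.ext <;> simp [hu, hv]⟩
  rw [Zsqrtd.norm_mul, Zsqrtd.norm_natCast, ← pow_two] at hz
  obtain ⟨b, rfl | rfl⟩ : ∃ b, a = b + 2 ∨ a = 1 := by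
    rcases a with _ | _ | a
    · omega
    · exact ⟨0, Or.inr rfl⟩
    · exact ⟨a, Or.inl rfl⟩
  · obtain ⟨z', rfl, hz'⟩ := ih b (by omega) y (by
      apply mul_left_cancel₀ p0; rw [hz]; push_cast; ring)
    refine ⟨z', ?_, hz'⟩
    rw [show (b + 2) / 2 = b / 2 + 1 by omega]; ring
  · exfalso
    apply hm
    have : (p : ℤ) * y.norm = m := by
      apply mul_left_cancel₀ (show (p : ℤ) ≠ 0 by exact_mod_cast pp.ne_zero)
      push_cast at hz
      linear_combination hz
    exact Int.natCast_dvd_natCast.1 ⟨_, this.symm⟩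

theorem card_RN_mul {p : ℕ} (pp : p.Prime) {m : ℕ} (hm : ¬ p ∣ m) (a : ℕ) :
    (RN (p ^ a * m)).card ≤ (a + 1) * (RN m).card := by
  classical
  by_cases hs : ∃ ϖ : GaussianInt, ϖ.norm = p
  · obtain ⟨ϖ, hϖ⟩ := hs
    have : RN (p ^ a * m) ⊆ (Finset.range (a + 1)).biUnion
        (fun j => (RN m).image (fun z => ϖ ^ j * star ϖ ^ (a - j) * z)) := by
      intro z hz
      obtain ⟨j, hj, z', rfl, hz'⟩ := exists_split_dvd pp hϖ m a z (mem_RN.1 hz)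
      rw [Finset.mem_biUnion]
      exact ⟨j, Finset.mem_range.2 (by omega), Finset.mem_image.2 ⟨z', mem_RN.2 hz', rfl⟩⟩
    refine (Finset.card_le_card this).trans ((Finset.card_biUnion_le).trans ?_)
    refine (Finset.sum_le_sum fun j _ => Finset.card_image_le).trans ?_
    simp
  · have hp : p % 4 = 3 := by
      have : Fact p.Prime := ⟨pp⟩
      by_contra h3
      obtain ⟨a, b, hab⟩ := Nat.Prime.sq_add_sq h3
      exact hs ⟨⟨a, b⟩, by rw [gnorm_eq]; dsimp only; exact_mod_cast hab⟩
    have : RN (p ^ a * m) ⊆ (RN m).image (fun z => (p : GaussianInt) ^ (a / 2) * z) := by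
      intro z hz
      obtain ⟨z', rfl, hz'⟩ := exists_inert_dvd pp hp hm a z (mem_RN.1 hz)
      exact Finset.mem_image.2 ⟨z', mem_RN.2 hz', rfl⟩
    refine (Finset.card_le_card this).trans (Finset.card_image_le.trans ?_)
    nlinarith

theorem card_RN_le (n : ℕ) (hn : 0 < n) : (RN n).card ≤ 4 * n.divisors.card := by
  induction n using Nat.strong_induction_on with
  | _ n ih =>
  by_cases h1 : n = 1
  · subst h1
    simp only [Nat.divisors_one, Finset.card_singleton]
    decide +kernel
  · obtain ⟨p, pp, hpn⟩ := Nat.exists_prime_and_dvd h1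
    obtain ⟨a, m, hm, rfl⟩ := Nat.exists_eq_pow_mul_and_not_dvd hn.ne' p pp.ne_one
    have ha : a ≠ 0 := by rintro rfl; exact hm (by simpa using hpn)
    have hm0 : 0 < m := Nat.pos_of_mul_pos_left hn
    rw [Nat.Coprime.card_divisors_mul (Nat.Coprime.pow_left a ((Nat.Prime.coprime_iff_not_dvd pp).2 hm)),
      Nat.divisors_prime_pow pp, Finset.card_map, Finset.card_range]
    have := ih m (by nlinarith [Nat.one_lt_pow ha pp.one_lt]) hm0
    have := card_RN_mul pp hm a
    nlinarith

theorem exists_le_mul_pow {b : ℝ} (hb : 1 < b) : ∃ c : ℝ, 1 ≤ c ∧ ∀ a : ℕ, (a + 1 : ℝ) ≤ c * b ^ a := by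
  refine ⟨max 1 (1 / (b - 1)), le_max_left _ _, fun a => ?_⟩
  have h := one_add_mul_le_pow (a := b - 1) (by linarith) a
  have hb' : 0 < b - 1 := by linarith
  rw [add_sub_cancel] at h
  have h1 : (1 : ℝ) ≤ max 1 (1 / (b - 1)) := le_max_left _ _
  have h2 : 1 ≤ max 1 (1 / (b - 1)) * (b - 1) := by
    rw [← div_le_iff₀ hb']; exact le_max_right _ _
  calc (a + 1 : ℝ) ≤ max 1 (1 / (b - 1)) * (1 + a * (b - 1)) := by
        have : (0 : ℝ) ≤ a := Nat.cast_nonneg a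
        nlinarith
    _ ≤ _ := by gcongr

theorem card_divisors_le_rpow {ε : ℝ} (hε : 0 < ε) :
    ∃ C : ℝ, 1 ≤ C ∧ ∀ n : ℕ, 0 < n → (n.divisors.card : ℝ) ≤ C * (n : ℝ) ^ ε := by
  have h2 : 1 < (2 : ℝ) ^ ε := Real.one_lt_rpow (by norm_num) hε
  obtain ⟨c, hc1, hc⟩ := exists_le_mul_pow h2
  obtain ⟨K, hK⟩ := exists_nat_ge ((2 : ℝ) ^ (1 / ε))
  refine ⟨c ^ K, one_le_pow₀ hc1, ?_⟩
  suffices H : ∀ n : ℕ, 0 < n → (n.divisors.card : ℝ) ≤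
      c ^ (n.primeFactors.filter (· < K)).card * (n : ℝ) ^ ε by
    intro n hn
    refine (H n hn).trans ?_
    gcongr
    calc _ ≤ (Finset.range K).card := Finset.card_le_card (by
            intro q hq
            rw [Finset.mem_filter] at hq
            exact Finset.mem_range.2 hq.2)
      _ = K := Finset.card_range K
  intro n hn
  induction n using Nat.strong_induction_on with
  | _ n ih =>
  by_cases h1 : n = 1
  · subst h1; simp
  · obtain ⟨p, pp, hpn⟩ := Nat.exists_prime_and_dvd h1
    obtain ⟨a, m, hm, rfl⟩ := Nat.exists_eq_pow_mul_and_not_dvd hn.ne' p pp.ne_one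
    have ha : a ≠ 0 := by rintro rfl; exact hm (by simpa using hpn)
    have hm0 : 0 < m := Nat.pos_of_mul_pos_left hn
    have hcop : (p ^ a).Coprime m := Nat.Coprime.pow_left a ((Nat.Prime.coprime_iff_not_dvd pp).2 hm)
    rw [hcop.card_divisors_mul, Nat.divisors_prime_pow pp, Finset.card_map, Finset.card_range]
    have IH := ih m (by nlinarith [Nat.one_lt_pow ha pp.one_lt]) hm0
    rw [hcop.primeFactors_mul, Nat.primeFactors_prime_pow ha pp, Finset.filter_union]
    have hdis : Disjoint (({p} : Finset ℕ).filter (· < K)) (m.primeFactors.filter (· < K)) := by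
      rw [Finset.disjoint_left]
      intro q hq hq'
      rw [Finset.mem_filter, Finset.mem_singleton] at hq
      rw [hq.1, Finset.mem_filter, Nat.mem_primeFactors] at hq'
      exact hm hq'.1.2.1
    rw [Finset.card_union_of_disjoint hdis, pow_add]
    push_cast
    rw [Real.mul_rpow (by positivity) (by positivity), ← Real.rpow_natCast (p : ℝ) a,
      ← Real.rpow_mul (by positivity), mul_comm (a : ℝ) ε, Real.rpow_mul (by positivity),
      Real.rpow_natCast]
    have hp : (a + 1 : ℝ) ≤ c ^ (({p} : Finset ℕ).filter (· < K)).card * ((p : ℝ) ^ ε) ^ a := by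
      by_cases hpK : p < K
      · have : ({p} : Finset ℕ).filter (· < K) = {p} := by
          rw [Finset.filter_eq_self]; simpa using hpK
        rw [this, Finset.card_singleton, pow_one]
        refine (hc a).trans ?_
        have : (2 : ℝ) ≤ p := by exact_mod_cast pp.two_le
        gcongr
      · have : ({p} : Finset ℕ).filter (· < K) = ∅ := by
          rw [Finset.filter_eq_empty_iff]; simpa using hpK
        rw [this, Finset.card_empty, pow_zero, one_mul]
        have h3 : (2 : ℝ) ≤ (p : ℝ) ^ ε := by
          have : (2 : ℝ) = ((2 : ℝ) ^ (1 / ε)) ^ ε := by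
            rw [← Real.rpow_mul (by norm_num), one_div_mul_cancel hε.ne', Real.rpow_one]
          rw [this]
          apply Real.rpow_le_rpow (by positivity) _ hε.le
          exact hK.trans (by exact_mod_cast not_lt.1 hpK)
        calc (a + 1 : ℝ) ≤ 2 ^ a := by exact_mod_cast Nat.lt_two_pow_self (n := a)
          _ ≤ _ := by gcongr
    calc ((a + 1 : ℝ)) * (m.divisors.card : ℝ)
        ≤ (c ^ (({p} : Finset ℕ).filter (· < K)).card * ((p : ℝ) ^ ε) ^ a) *
          (c ^ (m.primeFactors.filter (· < K)).card * (m : ℝ) ^ ε) := by gcongr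
      _ = _ := by ring

theorem card_RN_le_rpow {ε : ℝ} (hε : 0 < ε) :
    ∃ C : ℝ, 1 ≤ C ∧ ∀ N n : ℕ, 0 < N → n ≤ N ^ 2 → ((RN n).card : ℝ) ≤ C * (N : ℝ) ^ ε := by
  obtain ⟨C, hC, h⟩ := card_divisors_le_rpow (half_pos hε)
  refine ⟨4 * C, by linarith, fun N n hN hn => ?_⟩
  have hN1 : (1 : ℝ) ≤ N := by exact_mod_cast hN
  have h1 : (1 : ℝ) ≤ (N : ℝ) ^ ε := Real.one_le_rpow hN1 hε.le
  rcases Nat.eq_zero_or_pos n with rfl | h0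
  · have : (RN 0).card = 1 := by decide +kernel
    rw [this]
    push_cast
    nlinarith
  · calc ((RN n).card : ℝ) ≤ 4 * n.divisors.card := by exact_mod_cast card_RN_le n h0
      _ ≤ 4 * (C * (n : ℝ) ^ (ε / 2)) := by gcongr; exact h n h0
      _ ≤ 4 * (C * ((N : ℝ) ^ 2) ^ (ε / 2)) := by
        gcongr
        exact_mod_cast hn
      _ = _ := by
        rw [← Real.rpow_natCast, ← Real.rpow_mul (by positivity)]
        push_cast
        rw [mul_div_cancel₀ _ (by norm_num : (2:ℝ) ≠ 0)]
        ring

/-- The Gaussian coordinates of an integral quaternion. -/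
def gz (q : Hz) : GaussianInt := ⟨q.re, q.imI⟩
def gw (q : Hz) : GaussianInt := ⟨q.imJ, q.imK⟩

theorem gz_gw_inj {q r : Hz} (h1 : gz q = gz r) (h2 : gw q = gw r) : q = r := by
  simp only [gz, gw, Zsqrtd.mk.injEq] at h1 h2
  ext
  exacts [h1.1, h1.2, h2.1, h2.2]

theorem normSq_gz_gw (q : Hz) : Quaternion.normSq q = (gz q).norm + (gw q).norm := by
  rw [Hz.normSq_eq, gnorm_eq, gnorm_eq]
  simp only [gz, gw]
  ring

theorem pack {N g : ℕ} (hN : 0 < N) (hg : 0 < g) (S : Finset Hz)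
    (h1 : ∀ a ∈ S, Quaternion.normSq a = N)
    (h2 : ∀ a ∈ S, ∀ b ∈ S, (N : ℤ) ∣ Quaternion.normSq (a - b) * g) :
    (S.card : ℝ) ≤ 1296 * (g : ℝ) ^ 2 := by
  classical
  have hNr : (0 : ℝ) < N := by exact_mod_cast hN
  have hgr : (1 : ℝ) ≤ g := by exact_mod_cast hg
  set h : ℝ := √(N / g) / 2 with hh
  have hsq : h ^ 2 = N / g / 4 := by
    rw [hh, div_pow, Real.sq_sqrt (by positivity)]; norm_num
  have hpos : 0 < h := by positivity
  set I : Finset ℤ := Finset.Icc ⌊-√N / h⌋ ⌊√N / h⌋ with hI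
  set φ : Hz → (Fin 4 → ℤ) := fun a => ![⌊a.re / h⌋, ⌊a.imI / h⌋, ⌊a.imJ / h⌋, ⌊a.imK / h⌋] with hφ
  have hr : √(N : ℝ) / h = 2 * √g := by
    rw [hh, Real.sqrt_div' _ (by positivity)]
    field_simp
  have sg1 : 1 ≤ √(g : ℝ) := Real.one_le_sqrt.2 hgr
  have hIc : (I.card : ℝ) ≤ 6 * √g := by
    rw [hI, Int.card_Icc]
    have e1 := Int.floor_le (√(N : ℝ) / h)
    have e2 := Int.lt_floor_add_one (-√(N : ℝ) / h)
    rw [neg_div, hr] at e2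
    rw [hr] at e1
    have e4 : ((⌊-√(N : ℝ) / h⌋ : ℤ) : ℝ) > -(2 * √g) - 1 := by rw [neg_div, hr]; linarith
    have e3 : 0 ≤ ⌊√(N : ℝ) / h⌋ + 1 - ⌊-√(N : ℝ) / h⌋ := by
      have : ⌊-√(N : ℝ) / h⌋ ≤ ⌊√(N : ℝ) / h⌋ := by
        apply Int.floor_le_floor
        gcongr
        linarith [Real.sqrt_nonneg (N : ℝ)]
      omega
    have : (((⌊√(N : ℝ) / h⌋ + 1 - ⌊-√(N : ℝ) / h⌋).toNat : ℤ) : ℝ) ≤ 6 * √g := by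
      rw [Int.toNat_of_nonneg e3]
      push_cast
      rw [hr]
      linarith
    exact_mod_cast this
  have hmaps : ∀ a ∈ S, φ a ∈ Fintype.piFinset (fun _ : Fin 4 => I) := by
    intro a ha
    have hn := h1 a ha
    rw [Hz.normSq_eq] at hn
    have hn' : (a.re : ℝ) ^ 2 + (a.imI : ℝ) ^ 2 + (a.imJ : ℝ) ^ 2 + (a.imK : ℝ) ^ 2 = N := by
      exact_mod_cast hn
    have key : ∀ u : ℝ, u ^ 2 ≤ N → ⌊u / h⌋ ∈ I := by
      intro u hu
      have := abs_le.1 (Real.abs_le_sqrt hu)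
      rw [hI, Finset.mem_Icc]
      exact ⟨Int.floor_le_floor (by gcongr; exact this.1), Int.floor_le_floor (by gcongr; exact this.2)⟩
    rw [Fintype.mem_piFinset]
    have := sq_nonneg (a.re : ℝ)
    have := sq_nonneg (a.imI : ℝ)
    have := sq_nonneg (a.imJ : ℝ)
    have := sq_nonneg (a.imK : ℝ)
    intro i
    fin_cases i <;> simp only [hφ] <;> exact key _ (by linarith)
  have hinj : Set.InjOn φ S := by
    intro a ha b hb hab
    have hdiv := h2 a ha b hb
    have key : ∀ u v : ℤ, ⌊u / h⌋ = ⌊v / h⌋ → ((u : ℝ) - v) ^ 2 < h ^ 2 := by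
      intro u v huv
      have := Int.abs_sub_lt_one_of_floor_eq_floor huv
      rw [← sub_div, abs_div, abs_of_pos hpos, div_lt_one hpos] at this
      rw [← sq_abs]
      gcongr
    have e := fun i => congrFun hab i
    have k0 := key _ _ (e 0)
    have k1 := key _ _ (e 1)
    have k2 := key _ _ (e 2)
    have k3 := key _ _ (e 3)
    by_contra hne
    have hpos' : 0 < Quaternion.normSq (a - b) := by
      have h0 : 0 ≤ Quaternion.normSq (a - b) := by rw [Hz.normSq_eq]; positivity
      refine lt_of_le_of_ne h0 (Ne.symm ?_)
      intro hz
      apply hne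
      rw [Hz.normSq_eq] at hz
      have := sq_nonneg (a - b).re
      have := sq_nonneg (a - b).imI
      have := sq_nonneg (a - b).imJ
      have := sq_nonneg (a - b).imK
      have z0 : (a - b).re = 0 := by apply pow_eq_zero_iff two_ne_zero |>.1; linarith
      have z1 : (a - b).imI = 0 := by apply pow_eq_zero_iff two_ne_zero |>.1; linarith
      have z2 : (a - b).imJ = 0 := by apply pow_eq_zero_iff two_ne_zero |>.1; linarith
      have z3 : (a - b).imK = 0 := by apply pow_eq_zero_iff two_ne_zero |>.1; linarith
      rw [Quaternion.re_sub] at z0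
      rw [Quaternion.imI_sub] at z1
      rw [Quaternion.imJ_sub] at z2
      rw [Quaternion.imK_sub] at z3
      ext <;> omega
    have hle := Int.le_of_dvd (by positivity) hdiv
    have hle' : (N : ℝ) ≤ ((a.re - b.re : ℝ) ^ 2 + (a.imI - b.imI : ℝ) ^ 2 + (a.imJ - b.imJ : ℝ) ^ 2 +
        (a.imK - b.imK : ℝ) ^ 2) * g := by
      rw [Hz.normSq_eq] at hle
      exact_mod_cast hle
    have : (N : ℝ) < (4 * h ^ 2) * g := by
      refine lt_of_le_of_lt hle' ?_
      gcongr
      linarith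
    rw [hsq] at this
    have h3 : 4 * ((N : ℝ) / g / 4) * g = N := by field_simp
    linarith
  calc (S.card : ℝ) ≤ ((Fintype.piFinset (fun _ : Fin 4 => I)).card : ℝ) := by
        exact_mod_cast Finset.card_le_card_of_injOn φ hmaps hinj
    _ = (I.card : ℝ) ^ 4 := by simp [Fintype.card_piFinset]
    _ ≤ (6 * √g) ^ 4 := by gcongr
    _ = 1296 * ((√(g : ℝ)) ^ 2) ^ 2 := by ring
    _ = _ := by rw [Real.sq_sqrt (by positivity)]

theorem gw_conj (x : Hz) : gw (tau * x * tauBar) = (⟨2, 1⟩ : GaussianInt) ^ 2 * gw x := by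
  rw [pow_two]
  ext <;> simp [gw, tau, tauBar, Gen.q] <;> ring

theorem gw_conj_pow (L : ℕ) (x : Hz) :
    gw (tau ^ L * x * tauBar ^ L) = (⟨2, 1⟩ : GaussianInt) ^ (2 * L) * gw x := by
  induction L with
  | zero => simp
  | succ L ih =>
    have e : tau ^ (L + 1) * x * tauBar ^ (L + 1) = tau * (tau ^ L * x * tauBar ^ L) * tauBar := by
      rw [pow_succ' tau, pow_succ tauBar]; simp only [mul_assoc]
    rw [e, gw_conj, ih]; ring

theorem gaussian_coprime : IsCoprime (⟨2, -1⟩ : GaussianInt) ⟨2, 1⟩ :=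
  ⟨⟨1, 1⟩, -1, by ext <;> simp⟩

theorem gaussian_five : (5 : GaussianInt) = ⟨2, -1⟩ * ⟨2, 1⟩ := by
  ext <;> simp

theorem pow_dvd_norm_gw {L : ℕ} {x : Hz}
    (h : ((5 ^ L : ℤ) : Hz) ∣ tau ^ L * x * tauBar ^ L) : (5 ^ L : ℤ) ∣ (gw x).norm := by
  have h1 : (5 : GaussianInt) ^ L ∣ (⟨2, 1⟩ : GaussianInt) ^ (2 * L) * gw x := by
    rw [← gw_conj_pow]
    have := (Hz.dvd_iff _ _).1 h
    have e : (5 : GaussianInt) ^ L = ((5 ^ L : ℤ) : GaussianInt) := by push_cast; rfl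
    rw [e, Zsqrtd.intCast_dvd]
    exact ⟨this.2.2.1, this.2.2.2⟩
  rw [gaussian_five, mul_pow] at h1
  have h2 : (⟨2, -1⟩ : GaussianInt) ^ L ∣ (⟨2, 1⟩ : GaussianInt) ^ (2 * L) * gw x :=
    (Dvd.intro _ rfl).trans h1
  have h3 := (gaussian_coprime.pow (m := L) (n := 2 * L)).dvd_of_dvd_mul_left h2
  obtain ⟨y, hy⟩ := h3
  rw [hy, Zsqrtd.norm_mul]
  have : ((⟨2, -1⟩ : GaussianInt) ^ L).norm = 5 ^ L := by
    have := map_pow (Zsqrtd.normMonoidHom (d := -1)) (⟨2, -1⟩ : GaussianInt) L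
    simp only [Zsqrtd.normMonoidHom, MonoidHom.coe_mk, OneHom.coe_mk] at this
    rw [this]
    simp [Zsqrtd.norm]
  rw [this]
  exact dvd_mul_right _ _

theorem kk_eq_of_gw_eq_zero {N : ℕ} (hN : 0 < N) {α β : Hz} (hα : Quaternion.normSq α = N)
    (hβ : Quaternion.normSq β = N) (h : gw (star α * β) = 0) : kk α = kk β := by
  set γ := star α * β with hγ
  have h1 : α * γ = ((N : ℤ) : Hz) * β := by
    rw [hγ, ← mul_assoc, Hz.self_mul_star', hα]
  have h2 : γ.imJ = 0 ∧ γ.imK = 0 := by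
    have h3 := congrArg Zsqrtd.re h
    have h4 := congrArg Zsqrtd.im h
    exact ⟨h3, h4⟩
  have hc : γ * qI = qI * γ := by
    ext <;> simp [qI, h2.1, h2.2]
  have hn : Quaternion.normSq γ = (N : ℤ) ^ 2 := by
    rw [hγ, map_mul, Quaternion.normSq_star, hα, hβ]; ring
  have h5 : kk (α * γ) = (((N : ℤ) ^ 2 : ℤ) : Hz) * kk α := by
    calc kk (α * γ) = α * (γ * qI) * star γ * star α := by
          rw [kk, star_mul]; simp only [mul_assoc]
      _ = α * qI * (γ * star γ) * star α := by rw [hc]; simp only [mul_assoc]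
      _ = _ := by
          rw [Hz.self_mul_star', hn, ← (Int.cast_commute _ (α * qI)).eq, kk, mul_assoc]
  have h6 : kk (((N : ℤ) : Hz) * β) = (((N : ℤ) ^ 2 : ℤ) : Hz) * kk β := by
    rw [kk, star_mul, kk, star_intCast, pow_two, Int.cast_mul,
      ← (Int.cast_commute (N : ℤ) (star β)).eq]
    simp only [mul_assoc]
    rw [← (Int.cast_commute (N : ℤ) qI).left_comm, ← (Int.cast_commute (N : ℤ) β).left_comm]
  rw [h1, h6] at h5
  exact (Hz.mul_cancel (by positivity) h5).symm

open Classical in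
/-- The quaternions of norm `M ^ 2` whose second Gaussian coordinate is divisible by `d`. -/
def GM (M d : ℕ) : Finset Hz :=
  (QN (M ^ 2)).filter (fun x => gw x ≠ 0 ∧ (d : ℤ) ∣ (gw x).norm)

theorem card_GM_le {M d : ℕ} (hd : 0 < d) {R : ℝ} (hR : ∀ n ≤ M ^ 2, ((RN n).card : ℝ) ≤ R) :
    ((GM M d).card : ℝ) ≤ (M : ℝ) ^ 2 / d * R ^ 2 := by
  classical
  have hR0 : 0 ≤ R := (Nat.cast_nonneg _).trans (hR 0 (Nat.zero_le _))
  have hsub : (GM M d).image (fun q => (gz q, gw q)) ⊆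
      (Finset.Icc 1 (M ^ 2 / d)).biUnion
        (fun m => RN (M ^ 2 - d * m) ×ˢ RN (d * m)) := by
    intro p hp
    obtain ⟨q, hq, rfl⟩ := Finset.mem_image.1 hp
    rw [GM, Finset.mem_filter] at hq
    obtain ⟨h1, h2, h3⟩ := hq
    rw [mem_QN, normSq_gz_gw] at h1
    obtain ⟨m, hm⟩ := h3
    have hwpos : 0 < (gw q).norm := GaussianInt.norm_pos.2 h2
    have hz0 : 0 ≤ (gz q).norm := GaussianInt.norm_nonneg _
    have h5 : (0 : ℤ) < d := by exact_mod_cast hd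
    have hmpos : 0 < m := by
      rw [hm] at hwpos
      exact (mul_pos_iff_of_pos_left h5).1 hwpos
    lift m to ℕ using hmpos.le
    have hle : d * m ≤ M ^ 2 := by
      have : (d * m : ℤ) ≤ (M ^ 2 : ℕ) := by rw [← h1, hm]; linarith
      exact_mod_cast this
    rw [Finset.mem_biUnion]
    refine ⟨m, Finset.mem_Icc.2 ⟨by exact_mod_cast hmpos, ?_⟩, ?_⟩
    · rw [Nat.le_div_iff_mul_le hd, mul_comm]; exact hle
    · rw [Finset.mem_product, mem_RN, mem_RN]
      constructor
      · simp only
        rw [Nat.cast_sub hle, ← h1, hm]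
        push_cast; ring
      · simp only
        rw [hm]; push_cast; ring
  have hc : (GM M d).card = ((GM M d).image (fun q => (gz q, gw q))).card := by
    rw [Finset.card_image_of_injective]
    intro q r h
    exact gz_gw_inj (Prod.ext_iff.1 h).1 (Prod.ext_iff.1 h).2
  have h1 : (GM M d).card ≤ ∑ m ∈ Finset.Icc 1 (M ^ 2 / d),
      (RN (M ^ 2 - d * m) ×ˢ RN (d * m)).card := by
    rw [hc]
    exact (Finset.card_le_card hsub).trans Finset.card_biUnion_le
  have h2 : ∀ m ∈ Finset.Icc 1 (M ^ 2 / d),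
      ((RN (M ^ 2 - d * m) ×ˢ RN (d * m)).card : ℝ) ≤ R ^ 2 := by
    intro m hm
    rw [Finset.card_product, Nat.cast_mul, sq R]
    have := (Finset.mem_Icc.1 hm).2
    rw [Nat.le_div_iff_mul_le hd, mul_comm] at this
    have h1 := hR (M ^ 2 - d * m) (Nat.sub_le (M ^ 2) (d * m))
    have h2 := hR (d * m) this
    exact mul_le_mul h1 h2 (Nat.cast_nonneg _) hR0
  have h3 : ((M ^ 2 / d : ℕ) : ℝ) ≤ (M : ℝ) ^ 2 / d :=
    Nat.cast_div_le.trans (by rw [Nat.cast_pow])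
  have h4 := Finset.sum_le_sum h2
  rw [Finset.sum_const, Nat.card_Icc, Nat.add_sub_cancel, nsmul_eq_mul] at h4
  have h5 : ((GM M d).card : ℝ) ≤ ∑ m ∈ Finset.Icc 1 (M ^ 2 / d),
      ((RN (M ^ 2 - d * m) ×ˢ RN (d * m)).card : ℝ) := by
    rw [← Nat.cast_sum]
    exact Nat.cast_le.2 h1
  exact h5.trans (h4.trans (mul_le_mul_of_nonneg_right h3 (sq_nonneg R)))

/-- The content of a quaternion, relative to `N`. -/
def cnt (N : ℕ) (x : Hz) : ℕ :=
  Nat.gcd N (Nat.gcd (Nat.gcd x.re.natAbs x.imI.natAbs) (Nat.gcd x.imJ.natAbs x.imK.natAbs))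

theorem cnt_dvd (N : ℕ) (x : Hz) : ((cnt N x : ℤ) : Hz) ∣ x := by
  have h : cnt N x ∣ Nat.gcd (Nat.gcd x.re.natAbs x.imI.natAbs) (Nat.gcd x.imJ.natAbs x.imK.natAbs) :=
    Nat.gcd_dvd_right _ _
  rw [Nat.dvd_gcd_iff, Nat.dvd_gcd_iff, Nat.dvd_gcd_iff] at h
  rw [Hz.dvd_iff]
  simp only [Int.natCast_dvd]
  exact ⟨h.1.1, h.1.2, h.2.1, h.2.2⟩

theorem dvd_mul_cnt {N : ℕ} {m : ℤ} {x : Hz} (h : ((N : ℤ) : Hz) ∣ (m : Hz) * x) :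
    (N : ℤ) ∣ m * (cnt N x : ℤ) := by
  rw [Hz.dvd_iff] at h
  have e : ∀ a : ℤ, (N : ℤ) ∣ m * a ↔ N ∣ m.natAbs * a.natAbs := by
    intro a; rw [Int.natCast_dvd, Int.natAbs_mul]
  simp only [Quaternion.re_mul, Quaternion.imI_mul, Quaternion.imJ_mul, Quaternion.imK_mul,
    Quaternion.re_intCast, Quaternion.imI_intCast, Quaternion.imJ_intCast,
    Quaternion.imK_intCast, zero_mul, sub_zero, add_zero, Int.cast_id] at h
  simp only [e] at h
  rw [e, Int.natAbs_natCast, cnt]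
  rw [← Nat.gcd_mul_left, ← Nat.gcd_mul_left, ← Nat.gcd_mul_left, ← Nat.gcd_mul_left]
  obtain ⟨h1, h2, h3, h4⟩ := h
  exact Nat.dvd_gcd (dvd_mul_left _ _) (Nat.dvd_gcd (Nat.dvd_gcd h1 h2) (Nat.dvd_gcd h3 h4))

open Classical in
theorem card_fiber_le {N : ℕ} (hN : 0 < N) (γ : Hz) :
    (((QN N).filter (fun α => ((N : ℤ) : Hz) ∣ α * γ)).card : ℝ) ≤ 1296 * (cnt N γ : ℝ) ^ 2 := by
  apply pack hN (Nat.gcd_pos_of_pos_left _ hN)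
  · intro a ha
    exact mem_QN.1 (Finset.mem_filter.1 ha).1
  · intro a ha b hb
    have h1 := (Finset.mem_filter.1 ha).2
    have h2 := (Finset.mem_filter.1 hb).2
    have h3 := Hz.dvd_mul_left' (dvd_sub h1 h2) (star (a - b))
    rw [← sub_mul, ← mul_assoc, Hz.star_mul_self'] at h3
    exact dvd_mul_cnt h3

open Classical in
theorem card_GM_dvd_le {N g d : ℕ} (hN : 0 < N) (hg : g ∣ N) (hd : 0 < d) (hc : Nat.Coprime d N)
    {R : ℝ} (hR : ∀ n ≤ N ^ 2, ((RN n).card : ℝ) ≤ R) :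
    (((GM N d).filter (fun γ => ((g : ℤ) : Hz) ∣ γ)).card : ℝ) ≤
      ((N : ℝ) / g) ^ 2 / d * R ^ 2 := by
  obtain ⟨M, rfl⟩ := hg
  have hg0 : 0 < g := Nat.pos_of_mul_pos_right hN
  have hM0 : 0 < M := Nat.pos_of_mul_pos_left hN
  have hgi : (g : ℤ) ≠ 0 := by exact_mod_cast hg0.ne'
  have hsub : ((GM (g * M) d).filter (fun γ => ((g : ℤ) : Hz) ∣ γ)) ⊆
      (GM M d).image (fun x => ((g : ℤ) : Hz) * x) := by
    intro γ hγ
    obtain ⟨h1, x, rfl⟩ := Finset.mem_filter.1 hγ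
    rw [GM, Finset.mem_filter, mem_QN, map_mul, Hz.normSq_intCast] at h1
    obtain ⟨h1, h2, h3⟩ := h1
    have e : gw (((g : ℤ) : Hz) * x) = (g : ℤ) * gw x := by
      ext <;> simp [gw]
    have e2 : (((g : ℤ) : GaussianInt)).norm = (g : ℤ) ^ 2 := by
      rw [Zsqrtd.norm_intCast]; ring
    rw [e] at h2 h3
    rw [Zsqrtd.norm_mul, e2] at h3
    refine Finset.mem_image.2 ⟨x, ?_, rfl⟩
    rw [GM, Finset.mem_filter, mem_QN]
    refine ⟨?_, right_ne_zero_of_mul h2, ?_⟩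
    · have : (g : ℤ) ^ 2 * Quaternion.normSq x = (g : ℤ) ^ 2 * ((M ^ 2 : ℕ) : ℤ) := by
        rw [h1]; push_cast; ring
      exact mul_left_cancel₀ (by positivity) this
    · have : IsCoprime (d : ℤ) ((g : ℤ) ^ 2) :=
        IsCoprime.pow_right (Nat.isCoprime_iff_coprime.2 (Nat.Coprime.coprime_mul_right_right hc))
      exact this.dvd_of_dvd_mul_left h3
  have h1 : ((g * M : ℕ) : ℝ) / g = M := by
    have : (g : ℝ) ≠ 0 := by exact_mod_cast hg0.ne'
    push_cast; field_simp
  rw [h1]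
  refine le_trans ?_ (card_GM_le hd fun n hn => hR n (hn.trans ?_))
  · exact_mod_cast (Finset.card_le_card hsub).trans Finset.card_image_le
  · gcongr
    exact Nat.le_mul_of_pos_left M hg0

open Classical in
/-- The pairs of lattice points sharing the first `L` letters. -/
def prs (N L : ℕ) : Finset (Hz × Hz) :=
  ((XN N) ×ˢ (XN N)).filter (fun p => wd N L p.1 = wd N L p.2)

open Classical in
theorem card_prs_le_aux {N : ℕ} (hN : 0 < N) (h5 : ¬ 5 ∣ N) (L : ℕ)
    {R : ℝ} (hR : ∀ n ≤ N ^ 2, ((RN n).card : ℝ) ≤ R) :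
    ((prs N L).card : ℝ) ≤ (XN N).card +
      1296 * N.divisors.card * ((N : ℝ) ^ 2 / ((5 ^ L : ℕ) : ℝ) * R ^ 2) := by
  have hd : 0 < 5 ^ L := by positivity
  have hcop : Nat.Coprime (5 ^ L) N :=
    Nat.Coprime.pow_left _ ((Nat.Prime.coprime_iff_not_dvd (by norm_num)).2 h5)
  generalize hD : 5 ^ L = d at hd hcop
  have hsec : ∀ k : Hz, ∃ α : Hz, k ∈ XN N → Quaternion.normSq α = N ∧ kk α = k := by
    intro k
    by_cases hk : k ∈ XN N
    · obtain ⟨α, h⟩ := mem_XN.1 hk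
      exact ⟨α, fun _ => h⟩
    · exact ⟨0, fun h => absurd h hk⟩
  choose σ hσ using hsec
  set T : Finset (Σ _ : Hz, Hz) := (GM N d).sigma
    (fun γ => (QN N).filter (fun α => ((N : ℤ) : Hz) ∣ α * γ)) with hT
  have hoff : ((prs N L).filter (fun p => p.1 ≠ p.2)).card ≤ T.card := by
    apply Finset.card_le_card_of_injOn (fun p => ⟨star (σ p.1) * σ p.2, σ p.1⟩)
    · rintro ⟨k, l⟩ hp
      have hp := Finset.mem_filter.1 hp
      rw [prs, Finset.mem_filter, Finset.mem_product] at hp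
      obtain ⟨⟨⟨hk, hl⟩, hw⟩, hne⟩ := hp
      obtain ⟨a1, a2⟩ := hσ k hk
      obtain ⟨b1, b2⟩ := hσ l hl
      simp only at hw hne a1 a2 b1 b2
      rw [hT, Finset.mem_coe, Finset.mem_sigma, Finset.mem_filter, GM, Finset.mem_filter, mem_QN,
        mem_QN]
      simp only
      refine ⟨⟨?_, ?_, ?_⟩, a1, ?_⟩
      · rw [map_mul, Quaternion.normSq_star, a1, b1]; push_cast; ring
      · intro h0
        exact hne (by rw [← a2, ← b2]; exact kk_eq_of_gw_eq_zero hN a1 b1 h0)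
      · rw [← hD]
        push_cast
        apply pow_dvd_norm_gw
        apply wd_eq_dvd h5 L a1 b1
        rw [a2, b2, hw]
      · rw [← mul_assoc, Hz.self_mul_star', a1]
        exact Dvd.intro _ rfl
    · rintro ⟨k, l⟩ hp ⟨k', l'⟩ hp' he
      have hp := Finset.mem_filter.1 hp
      have hp' := Finset.mem_filter.1 hp'
      rw [prs, Finset.mem_filter, Finset.mem_product] at hp hp'
      obtain ⟨a1, a2⟩ := hσ k hp.1.1.1
      obtain ⟨b1, b2⟩ := hσ l hp.1.1.2
      obtain ⟨a1', a2'⟩ := hσ k' hp'.1.1.1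
      obtain ⟨b1', b2'⟩ := hσ l' hp'.1.1.2
      simp only [Sigma.mk.injEq, heq_eq_eq] at he
      obtain ⟨e1, e2⟩ := he
      have e3 := congrArg (fun x => σ k * x) e1
      rw [← mul_assoc, Hz.self_mul_star', a1] at e3
      rw [e2, ← mul_assoc, Hz.self_mul_star', a1'] at e3
      have e4 := Hz.mul_cancel (by exact_mod_cast hN.ne') e3
      rw [← a2, ← b2, ← a2', ← b2', e2, e4]
  have hdiag : ((prs N L).filter (fun p => ¬ p.1 ≠ p.2)).card ≤ (XN N).card := by
    apply Finset.card_le_card_of_injOn Prod.fst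
    · intro p hp
      have hp := Finset.mem_filter.1 hp
      rw [prs, Finset.mem_filter, Finset.mem_product] at hp
      exact hp.1.1.1
    · rintro ⟨k, l⟩ hp ⟨k', l'⟩ hp' he
      have hp := not_not.1 (Finset.mem_filter.1 hp).2
      have hp' := not_not.1 (Finset.mem_filter.1 hp').2
      change k = l at hp
      change k' = l' at hp'
      change k = k' at he
      rw [← hp, ← hp', he]
  have hTc : (T.card : ℝ) ≤ ∑ g ∈ N.divisors, 1296 * ((N : ℝ) ^ 2 / d * R ^ 2) := by
    calc (T.card : ℝ) = ∑ γ ∈ GM N d,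
          (((QN N).filter (fun α => ((N : ℤ) : Hz) ∣ α * γ)).card : ℝ) := by
          rw [hT, Finset.card_sigma, Nat.cast_sum]
      _ ≤ ∑ γ ∈ GM N d, ∑ g ∈ N.divisors,
            if ((g : ℤ) : Hz) ∣ γ then 1296 * (g : ℝ) ^ 2 else 0 := by
          apply Finset.sum_le_sum
          intro γ _
          refine (card_fiber_le hN γ).trans ?_
          have hm : cnt N γ ∈ N.divisors :=
            Nat.mem_divisors.2 ⟨Nat.gcd_dvd_left _ _, hN.ne'⟩
          have := Finset.single_le_sum (s := N.divisors)
            (f := fun g : ℕ => if ((g : ℤ) : Hz) ∣ γ then 1296 * (g : ℝ) ^ 2 else 0)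
            (fun g _ => by split_ifs <;> positivity) hm
          rwa [if_pos (cnt_dvd N γ)] at this
      _ = ∑ g ∈ N.divisors, ∑ γ ∈ GM N d,
            if ((g : ℤ) : Hz) ∣ γ then 1296 * (g : ℝ) ^ 2 else 0 := Finset.sum_comm
      _ ≤ _ := by
          apply Finset.sum_le_sum
          intro g hg
          have hgN := Nat.dvd_of_mem_divisors hg
          have hg0 : (g : ℝ) ≠ 0 := by exact_mod_cast (Nat.pos_of_mem_divisors hg).ne'
          rw [← Finset.sum_filter, Finset.sum_const, nsmul_eq_mul]
          have := card_GM_dvd_le hN hgN hd hcop hR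
          calc _ ≤ ((N : ℝ) / g) ^ 2 / d * R ^ 2 * (1296 * (g : ℝ) ^ 2) := by gcongr
            _ = _ := by field_simp
  rw [Finset.sum_const, nsmul_eq_mul] at hTc
  have hsplit := Finset.card_filter_add_card_filter_not (s := prs N L) (fun p => p.1 ≠ p.2)
  have : ((prs N L).card : ℝ) ≤ T.card + (XN N).card := by
    rw [← hsplit]
    exact_mod_cast Nat.add_le_add hoff hdiag
  linarith

theorem card_prs_le {ε : ℝ} (hε : 0 < ε) : ∃ C : ℝ, 1 ≤ C ∧ ∀ N : ℕ, 0 < N → ¬ 5 ∣ N → ∀ L,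
    ((prs N L).card : ℝ) ≤ (XN N).card + C * (N : ℝ) ^ (2 + ε) / 5 ^ L := by
  have hε3 : 0 < ε / 3 := by positivity
  obtain ⟨C, hC, h⟩ := card_RN_le_rpow hε3
  obtain ⟨D, hD, h'⟩ := card_divisors_le_rpow hε3
  refine ⟨1296 * D * C ^ 2, by nlinarith [one_le_pow₀ hC (n := 2)], fun N hN h5 L => ?_⟩
  refine (card_prs_le_aux hN h5 L (fun n hn => h N n hN hn)).trans ?_
  have hNr : (0 : ℝ) < N := by exact_mod_cast hN
  have e : (N : ℝ) ^ (2 + ε) = (N : ℝ) ^ (ε / 3) * ((N : ℝ) ^ 2 * ((N : ℝ) ^ (ε / 3)) ^ 2) := by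
    rw [← Real.rpow_natCast (_ ^ _) 2, ← Real.rpow_mul hNr.le, ← Real.rpow_natCast _ 2,
      ← Real.rpow_add hNr, ← Real.rpow_add hNr]
    congr 1; push_cast; ring
  rw [e]
  push_cast
  have := h' N hN
  calc _ ≤ ((XN N).card : ℝ) + 1296 * (D * (N : ℝ) ^ (ε / 3)) *
        ((N : ℝ) ^ 2 / 5 ^ L * (C * (N : ℝ) ^ (ε / 3)) ^ 2) := by gcongr
    _ = _ := by ring

abbrev V3 := EuclideanSpace ℝ (Fin 3)

theorem sum_cyc (i : Fin 3) (f : Fin 3 → ℝ) : ∑ j, f j = f i + f (i + 1) + f (i + 2) := by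
  rw [Fin.sum_univ_three]
  fin_cases i
  · rfl
  · change f 0 + f 1 + f 2 = f 1 + f 2 + f 0
    ring
  · change f 0 + f 1 + f 2 = f 2 + f 0 + f 1
    ring

theorem cyc_ne : ∀ i : Fin 3, i + 1 ≠ i ∧ i + 2 ≠ i ∧ i + 2 ≠ i + 1 := by decide

def rotv (i : Fin 3) (θ : ℝ) (x : V3) : V3 :=
  WithLp.toLp 2 (fun j => if j = i then x i else if j = i + 1 then
    cos θ * x (i + 1) - sin θ * x (i + 2) else sin θ * x (i + 1) + cos θ * x (i + 2))

theorem rotv_apply (i : Fin 3) (θ : ℝ) (x : V3) (j : Fin 3) : rotv i θ x j =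
    if j = i then x i else if j = i + 1 then
    cos θ * x (i + 1) - sin θ * x (i + 2) else sin θ * x (i + 1) + cos θ * x (i + 2) := rfl

/-- The rotation about the `i`-th axis. -/
def rotL (i : Fin 3) (θ : ℝ) : V3 →ₗᵢ[ℝ] V3 where
  toFun x := rotv i θ x
  map_add' x y := by
    ext j
    simp only [PiLp.add_apply, rotv_apply]
    split_ifs <;> ring
  map_smul' c x := by
    ext j
    simp only [PiLp.smul_apply, smul_eq_mul, RingHom.id_apply, rotv_apply]
    split_ifs <;> ring
  norm_map' x := by
    change ‖rotv i θ x‖ = ‖x‖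
    have h := sin_sq_add_cos_sq θ
    rw [EuclideanSpace.norm_eq, EuclideanSpace.norm_eq]
    obtain ⟨h1, h2, h3⟩ := cyc_ne i
    simp only [Real.norm_eq_abs, sq_abs, sum_cyc i, rotv_apply, if_pos, if_neg h1, if_neg h2,
      if_neg h3]
    congr 1
    linear_combination (x (i + 1) ^ 2 + x (i + 2) ^ 2) * h

theorem rotL_apply (i : Fin 3) (θ : ℝ) (x : V3) (j : Fin 3) : rotL i θ x j =
    if j = i then x i else if j = i + 1 then
    cos θ * x (i + 1) - sin θ * x (i + 2) else sin θ * x (i + 1) + cos θ * x (i + 2) := rfl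

theorem rotL_zero (i : Fin 3) (x : V3) : rotL i 0 x = x := by
  ext j
  rw [rotL_apply]
  fin_cases i <;> fin_cases j <;> simp

theorem rotL_add (i : Fin 3) (θ φ : ℝ) (x : V3) : rotL i (θ + φ) x = rotL i θ (rotL i φ x) := by
  ext j
  simp only [rotL_apply, cos_add, sin_add]
  fin_cases i <;> fin_cases j <;> simp [Fin.ext_iff] <;> ring

theorem rotL_congr {θ φ : ℝ} (h : ∃ k : ℤ, θ = φ + k * (2 * π)) (i : Fin 3) (x : V3) :
    rotL i θ x = rotL i φ x := by
  obtain ⟨k, rfl⟩ := h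
  ext j
  simp only [rotL_apply, cos_add_int_mul_two_pi, sin_add_int_mul_two_pi]

theorem norm_rotL_sub_le (i : Fin 3) (θ φ : ℝ) (x : V3) :
    ‖rotL i θ x - rotL i φ x‖ ≤ |θ - φ| * ‖x‖ := by
  have h1 := one_sub_sq_div_two_le_cos (x := θ - φ)
  rw [cos_sub] at h1
  have h2 := sin_sq_add_cos_sq θ
  have h3 := sin_sq_add_cos_sq φ
  apply le_of_sq_le_sq _ (by positivity)
  rw [mul_pow, sq_abs, EuclideanSpace.norm_sq_eq, EuclideanSpace.norm_sq_eq]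
  have key : ∀ a b c : ℝ, (cos θ * a - sin θ * b - (cos φ * a - sin φ * b)) ^ 2 +
      (sin θ * a + cos θ * b - (sin φ * a + cos φ * b)) ^ 2 ≤
      (θ - φ) ^ 2 * (a ^ 2 + b ^ 2 + c ^ 2) := by
    intro a b c
    have e : (cos θ * a - sin θ * b - (cos φ * a - sin φ * b)) ^ 2 +
      (sin θ * a + cos θ * b - (sin φ * a + cos φ * b)) ^ 2 =
      (2 - 2 * (cos θ * cos φ + sin θ * sin φ)) * (a ^ 2 + b ^ 2) := by
      linear_combination (a ^ 2 + b ^ 2) * (h2 + h3)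
    rw [e]
    have := mul_nonneg (sq_nonneg (θ - φ)) (sq_nonneg c)
    have : (2 - 2 * (cos θ * cos φ + sin θ * sin φ)) * (a ^ 2 + b ^ 2) ≤
      (θ - φ) ^ 2 * (a ^ 2 + b ^ 2) := by gcongr; linarith
    linarith
  obtain ⟨n1, n2, n3⟩ := cyc_ne i
  simp only [Real.norm_eq_abs, sq_abs, sum_cyc i, PiLp.sub_apply, rotL_apply, if_pos, if_neg n1,
    if_neg n2, if_neg n3]
  have := key (x (i + 1)) (x (i + 2)) (x i)
  linarith

/-- The basic angle. -/
def th : ℝ := arccos (3 / 5)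

theorem cos_th : cos th = 3 / 5 := by
  rw [th, cos_arccos] <;> norm_num

theorem sin_th : sin th = 4 / 5 := by
  rw [th, sin_arccos, show (1 : ℝ) - (3 / 5) ^ 2 = (4 / 5) ^ 2 by norm_num,
    Real.sqrt_sq (by norm_num)]

theorem cos_mul_th (m : ℕ) : ∃ a b : ℤ, (5 : ℝ) ^ (m + 1) * cos ((m + 1 : ℕ) * th) = 5 * a + 3 ∧
    (5 : ℝ) ^ m * cos (m * th) = b ∧ (m = 0 ∨ b % 5 = 3) := by
  induction m with
  | zero => exact ⟨0, 1, by simp [cos_th]; norm_num, by simp, Or.inl rfl⟩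
  | succ m ih =>
    obtain ⟨a, b, h1, h2, h3⟩ := ih
    refine ⟨6 * a + 3 - 5 * b, 5 * a + 3, ?_, by rw [h1]; push_cast; ring, Or.inr (by omega)⟩
    have e : cos ((m + 1 + 1 : ℕ) * th) = 2 * cos th * cos ((m + 1 : ℕ) * th) - cos (m * th) := by
      have e1 : ((m + 1 + 1 : ℕ) : ℝ) * th = (m + 1 : ℕ) * th + th := by push_cast; ring
      have e2 : (m : ℝ) * th = (m + 1 : ℕ) * th - th := by push_cast; ring
      rw [e1, e2, cos_add, cos_sub]; ring
    rw [e, cos_th]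
    have : (5 : ℝ) ^ (m + 1 + 1) * (2 * (3 / 5) * cos ((m + 1 : ℕ) * th) - cos (m * th)) =
      6 * (5 ^ (m + 1) * cos ((m + 1 : ℕ) * th)) - 25 * (5 ^ m * cos (m * th)) := by ring
    rw [this, h1, h2]; push_cast; ring

theorem cos_mul_th_ne {m : ℕ} (hm : m ≠ 0) : cos (m * th) ≠ 1 := by
  obtain ⟨k, rfl⟩ := Nat.exists_eq_succ_of_ne_zero hm
  obtain ⟨a, b, h1, -, -⟩ := cos_mul_th k
  intro h
  rw [Nat.succ_eq_add_one] at h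
  rw [h] at h1
  have h2 : (5 : ℤ) ^ (k + 1) * 1 = 5 * a + 3 := by exact_mod_cast h1
  rw [pow_succ] at h2
  omega

theorem irrational_th : Irrational (th / (2 * π)) := by
  rintro ⟨q, hq⟩
  apply cos_mul_th_ne q.den_ne_zero
  have h1 : (q.den : ℝ) * th = q.num * (2 * π) := by
    rw [eq_div_iff (by positivity)] at hq
    rw [← hq, ← mul_assoc]
    congr 1
    exact_mod_cast Rat.den_mul_eq_num q
  rw [h1, cos_int_mul_two_pi]

theorem exists_mul_th_near {η : ℝ} (hη : 0 < η) : ∃ K : ℕ, 1 ≤ K ∧ ∀ φ : ℝ, ∃ m : ℕ, 1 ≤ m ∧ m ≤ K ∧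
    ∃ k : ℤ, |m * th - (φ + k * (2 * π))| < η := by
  have : Fact (0 < 2 * π) := ⟨by positivity⟩
  have hd := (AddCircle.denseRange_zsmul_coe_iff (a := th) (p := 2 * π)).2 irrational_th
  have hcov : (Set.univ : Set (AddCircle (2 * π))) ⊆
      ⋃ n : ℤ, Metric.ball (n • (th : AddCircle (2 * π))) η := by
    intro x _
    obtain ⟨n, hn⟩ := hd.exists_dist_lt x hη
    exact Set.mem_iUnion.2 ⟨n, hn⟩
  obtain ⟨t, ht⟩ := isCompact_univ.elim_finite_subcover _ (fun _ => Metric.isOpen_ball) hcov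
  set B := t.sup Int.natAbs with hB
  refine ⟨2 * B + 1, by omega, fun φ => ?_⟩
  have hx := ht (Set.mem_univ ((φ - (B + 1 : ℕ) * th : ℝ) : AddCircle (2 * π)))
  obtain ⟨n, hn, hb⟩ := Set.mem_iUnion₂.1 hx
  have hnB : n.natAbs ≤ B := Finset.le_sup (f := Int.natAbs) hn
  refine ⟨(n + B + 1).toNat, by omega, by omega, ?_⟩
  rw [Metric.mem_ball, dist_comm, dist_eq_norm, ← AddCircle.coe_zsmul, ← AddCircle.coe_sub,
    AddCircle.norm_eq] at hb
  refine ⟨round ((2 * π)⁻¹ * (n • th - (φ - ↑(B + 1) * th))), ?_⟩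
  have e : (((n + B + 1).toNat : ℕ) : ℝ) = n + B + 1 := by
    have : (((n + B + 1).toNat : ℤ)) = n + B + 1 := Int.toNat_of_nonneg (by omega)
    exact_mod_cast this
  generalize round ((2 * π)⁻¹ * (n • th - (φ - ↑(B + 1) * th))) = k at hb ⊢
  rw [e]
  rw [zsmul_eq_mul] at hb
  convert hb using 2
  push_cast
  ring

def e0 : V3 := EuclideanSpace.single 0 1

theorem rotL_e0 (θ : ℝ) : rotL 0 θ e0 = e0 := by
  ext j
  rw [rotL_apply]
  fin_cases j <;> simp [e0]

theorem exists_rot_e0 {x : V3} (hx : ‖x‖ = 1) : ∃ φ ψ : ℝ, rotL 1 ψ (rotL 0 φ x) = e0 := by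
  rw [EuclideanSpace.norm_eq, Real.sqrt_eq_one] at hx
  simp only [Real.norm_eq_abs, sq_abs, Fin.sum_univ_three] at hx
  obtain ⟨φ, h1⟩ : ∃ φ : ℝ, cos φ * x 1 - sin φ * x 2 = 0 := by
    set z : ℂ := ⟨x 1, x 2⟩
    have hc := Complex.norm_mul_cos_arg z
    have hs := Complex.norm_mul_sin_arg z
    refine ⟨π / 2 - Complex.arg z, ?_⟩
    change ‖z‖ * cos (Complex.arg z) = x 1 at hc
    change ‖z‖ * sin (Complex.arg z) = x 2 at hs
    rw [← hc, ← hs, cos_pi_div_two_sub, sin_pi_div_two_sub]; ring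
  set u := sin φ * x 1 + cos φ * x 2 with hu
  have hn : x 0 ^ 2 + u ^ 2 = 1 := by
    rw [hu]
    linear_combination hx + (x 1 ^ 2 + x 2 ^ 2) * sin_sq_add_cos_sq φ -
      (cos φ * x 1 - sin φ * x 2) * h1
  set z : ℂ := ⟨x 0, u⟩ with hz
  have hz1 : ‖z‖ = 1 := by
    rw [← sq_eq_sq₀ (norm_nonneg _) zero_le_one, ← Complex.normSq_eq_norm_sq, Complex.normSq_apply]
    simp only [hz]; linarith
  have hc := Complex.norm_mul_cos_arg z
  have hs := Complex.norm_mul_sin_arg z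
  rw [hz1, one_mul] at hc hs
  change _ = x 0 at hc
  change _ = u at hs
  refine ⟨φ, Complex.arg z, ?_⟩
  ext j
  simp only [rotL_apply]
  fin_cases j
  · simp [e0, ← hu, hc, hs]
    linarith
  · simp [e0, h1]
  · simp [e0, ← hu, hc, hs]
    linarith

theorem norm_rotL_sub (i : Fin 3) (θ : ℝ) (x y : V3) : ‖rotL i θ x - rotL i θ y‖ = ‖x - y‖ := by
  rw [← map_sub, LinearIsometry.norm_map]

theorem reach_core {δ : ℝ} (hδ : 0 < δ) : ∃ T : ℕ, ∀ x y : V3, ‖x‖ = 1 → ‖y‖ = 1 →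
    ∃ m0 m1 m2 m3 m4 : ℕ, 1 ≤ m0 ∧ 1 ≤ m1 ∧ 1 ≤ m2 ∧ 1 ≤ m3 ∧ 1 ≤ m4 ∧
      m0 + m1 + m2 + m3 + m4 = T ∧
      ‖rotL 0 (m4 * th) (rotL 1 (m3 * th) (rotL 0 (m2 * th) (rotL 1 (m1 * th)
        (rotL 0 (m0 * th) x)))) - y‖ ≤ δ := by
  obtain ⟨K, hK1, hK⟩ := exists_mul_th_near (show 0 < δ / 4 by positivity)
  have near : ∀ φ : ℝ, ∃ m : ℕ, 1 ≤ m ∧ m ≤ K ∧ ∀ i (z w : V3), ‖w‖ = 1 →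
      ‖rotL i (m * th) z - rotL i φ w‖ ≤ ‖z - w‖ + δ / 4 := by
    intro φ
    obtain ⟨m, h1, h2, k, hk⟩ := hK φ
    refine ⟨m, h1, h2, fun i z w hw => ?_⟩
    have h3 := norm_rotL_sub_le i (m * th) (φ + k * (2 * π)) w
    rw [rotL_congr ⟨k, rfl⟩, hw, mul_one] at h3
    calc ‖rotL i (m * th) z - rotL i φ w‖
        = ‖(rotL i (m * th) z - rotL i (m * th) w) + (rotL i (m * th) w - rotL i φ w)‖ := by
          congr 1; abel
      _ ≤ _ := norm_add_le _ _
      _ ≤ ‖z - w‖ + δ / 4 := by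
          rw [norm_rotL_sub]
          gcongr
          exact h3.trans hk.le
  have he0 : ‖e0‖ = 1 := by simp [e0]
  refine ⟨5 * K, fun x y hx hy => ?_⟩
  obtain ⟨φ, ψ, h⟩ := exists_rot_e0 hx
  obtain ⟨φ', ψ', h'⟩ := exists_rot_e0 hy
  have hy' : rotL 0 (-φ') (rotL 1 (-ψ') e0) = y := by
    rw [← h', ← rotL_add, neg_add_cancel, rotL_zero, ← rotL_add, neg_add_cancel, rotL_zero]
  obtain ⟨m0, a0, b0, c0⟩ := near φ
  obtain ⟨m1, a1, b1, c1⟩ := near ψ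
  obtain ⟨m3, a3, b3, c3⟩ := near (-ψ')
  obtain ⟨m4, a4, b4, c4⟩ := near (-φ')
  refine ⟨m0, m1, 5 * K - (m0 + m1 + m3 + m4), m3, m4, a0, a1, by omega, a3, a4, by omega, ?_⟩
  have d0 := c0 0 x x hx
  rw [sub_self, norm_zero] at d0
  have d1 := c1 1 _ (rotL 0 φ x) (by rw [LinearIsometry.norm_map, hx]) |>.trans
    (add_le_add_left d0 _)
  rw [h] at d1
  set p := rotL 1 (m1 * th) (rotL 0 (m0 * th) x)
  generalize (5 * K - (m0 + m1 + m3 + m4)) = m2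
  have d2 : ‖rotL 0 (m2 * th) p - e0‖ ≤ 0 + δ / 4 + δ / 4 := by
    rw [← rotL_e0 (m2 * th), norm_rotL_sub]
    exact d1
  have d3 := c3 1 (rotL 0 (m2 * th) p) e0 he0
  have d4 := c4 0 (rotL 1 (m3 * th) (rotL 0 (m2 * th) p)) (rotL 1 (-ψ') e0)
    (by rw [LinearIsometry.norm_map, he0])
  rw [hy'] at d4
  linarith

/-- The rotation attached to a letter. -/
def rho (s : Gen) : V3 →ₗᵢ[ℝ] V3 := rotL s.1 (if s.2 then th else -th)

/-- Reachability in a given number of steps. -/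
def Rch : ℕ → Gen × V3 → Gen × V3 → Prop
  | 0, p, q => p = q
  | n + 1, p, q => ∃ t : Gen, t ≠ p.1.inv ∧ Rch n (t, rho t p.2) q

theorem Rch.trans {m n : ℕ} {p q r : Gen × V3} (h : Rch m p q) (h' : Rch n q r) :
    Rch (m + n) p r := by
  induction m generalizing p with
  | zero =>
    have h : p = q := h
    rw [h, Nat.zero_add]; exact h'
  | succ m ih =>
    obtain ⟨t, h1, h2⟩ := h
    rw [Nat.add_right_comm]
    exact ⟨t, h1, ih h2⟩

theorem Rch.one {s t : Gen} (h : t ≠ s.inv) (x : V3) : Rch 1 (s, x) (t, rho t x) :=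
  ⟨t, h, rfl⟩

theorem ne_inv_of_fst_ne {s t : Gen} (h : t.1 ≠ s.1) : t ≠ s.inv := by
  rintro rfl
  exact h rfl

theorem Rch.pow {s : Gen} {i : Fin 3} (h : i ≠ s.1) {m : ℕ} (hm : 1 ≤ m) (x : V3) :
    Rch m (s, x) ((i, true), rotL i (m * th) x) := by
  induction m, hm using Nat.le_induction with
  | base =>
    rw [Nat.cast_one, one_mul]
    exact Rch.one (s := s) (t := (i, true)) (ne_inv_of_fst_ne h) x
  | succ m hm ih =>
    have h2 := ih.trans (Rch.one (t := (i, true)) (Gen.inv_ne _).symm _)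
    have e : rho (i, true) (rotL i (m * th) x) = rotL i ((m + 1 : ℕ) * th) x := by
      have e2 : ((m + 1 : ℕ) : ℝ) * th = th + m * th := by push_cast; ring
      rw [rho, if_pos rfl, e2, rotL_add]
    rwa [e] at h2

theorem exists_rho_eq (s : Gen) (y : V3) : ∃ x, rho s x = y ∧ ‖x‖ = ‖y‖ := by
  refine ⟨rotL s.1 (-(if s.2 then th else -th)) y, ?_, LinearIsometry.norm_map _ _⟩
  rw [rho, ← rotL_add, add_neg_cancel, rotL_zero]

theorem exists_reach {δ : ℝ} (hδ : 0 < δ) : ∃ T : ℕ, ∀ (s t : Gen) (x y : V3), ‖x‖ = 1 → ‖y‖ = 1 →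
    ∃ z : V3, ‖z - y‖ ≤ δ ∧ Rch T (s, x) (t, z) := by
  obtain ⟨T, hT⟩ := reach_core hδ
  refine ⟨1 + T + 1 + 1, fun s t x y hx hy => ?_⟩
  obtain ⟨p, hp0, hps⟩ : ∃ p : Fin 3, p ≠ 0 ∧ p ≠ s.1 := by
    generalize s.1 = i
    revert i; decide
  obtain ⟨q, hq0, hqt⟩ : ∃ q : Fin 3, q ≠ 0 ∧ q ≠ t.1 := by
    generalize t.1 = i
    revert i; decide
  obtain ⟨y1, hy1, hn1⟩ := exists_rho_eq t y
  obtain ⟨y2, hy2, hn2⟩ := exists_rho_eq (q, true) y1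
  obtain ⟨m0, m1, m2, m3, m4, a0, a1, a2, a3, a4, rfl, h⟩ :=
    hT (rho (p, true) x) y2 (by rw [LinearIsometry.norm_map, hx]) (by rw [hn2, hn1, hy])
  refine ⟨rho t (rho (q, true) (rotL 0 (m4 * th) (rotL 1 (m3 * th) (rotL 0 (m2 * th)
    (rotL 1 (m1 * th) (rotL 0 (m0 * th) (rho (p, true) x))))))), ?_, ?_⟩
  · rw [← hy1, ← map_sub, LinearIsometry.norm_map, ← hy2, ← map_sub, LinearIsometry.norm_map]
    exact h
  · have r0 := Rch.one (s := s) (t := (p, true)) (ne_inv_of_fst_ne hps) x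
    have r1 := Rch.pow (s := (p, true)) (i := 0) hp0.symm a0 (rho (p, true) x)
    have r2 := r1.trans (Rch.pow (s := (0, true)) (i := 1) (by simp) a1 _)
    have r3 := r2.trans (Rch.pow (s := (1, true)) (i := 0) (by simp) a2 _)
    have r4 := r3.trans (Rch.pow (s := (0, true)) (i := 1) (by simp) a3 _)
    have r5 := r4.trans (Rch.pow (s := (1, true)) (i := 0) (by simp) a4 _)
    exact ((r0.trans r5).trans (Rch.one (t := (q, true)) (ne_inv_of_fst_ne hq0) _)).trans
      (Rch.one (ne_inv_of_fst_ne (Ne.symm hqt)) _)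

/-- The letters allowed after `s`. -/
def nx (s : Gen) : Finset Gen := Finset.univ.filter (fun t => t ≠ s.inv)

theorem mem_nx {s t : Gen} : t ∈ nx s ↔ t ≠ s.inv := by simp [nx]

theorem card_nx (s : Gen) : (nx s).card = 5 := by revert s; decide

/-- The transition operator of the nonbacktracking walk. -/
def UU (F : Gen → V3 → ℝ) : Gen → V3 → ℝ := fun s x => (1 / 5) * ∑ t ∈ nx s, F t (rho t x)

theorem continuous_UU {F : Gen → V3 → ℝ} (hF : ∀ s, Continuous (F s)) (s : Gen) :
    Continuous (UU F s) := by
  unfold UU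
  have := fun t => (hF t).comp (rho t).continuous
  simp only [Function.comp_def] at this
  fun_prop

theorem continuous_UU_iter {F : Gen → V3 → ℝ} (hF : ∀ s, Continuous (F s)) (n : ℕ) (s : Gen) :
    Continuous (UU^[n] F s) := by
  induction n generalizing s with
  | zero => exact hF s
  | succ n ih => rw [Function.iterate_succ_apply']; exact continuous_UU ih s

theorem UU_le {F : Gen → V3 → ℝ} {b : ℝ} (hF : ∀ s x, ‖x‖ = 1 → F s x ≤ b) :
    ∀ s x, ‖x‖ = 1 → UU F s x ≤ b := by
  intro s x hx
  have h : ∑ t ∈ nx s, F t (rho t x) ≤ ∑ t ∈ nx s, b := by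
    gcongr with t
    exact hF t _ (by rw [LinearIsometry.norm_map, hx])
  rw [Finset.sum_const, card_nx, nsmul_eq_mul] at h
  rw [UU]; push_cast at h; linarith

theorem UU_neg (F : Gen → V3 → ℝ) : UU (fun s x => - F s x) = fun s x => - UU F s x := by
  funext s x
  simp [UU]

theorem UU_iter_neg (F : Gen → V3 → ℝ) (n : ℕ) :
    UU^[n] (fun s x => - F s x) = fun s x => - UU^[n] F s x := by
  induction n with
  | zero => rfl
  | succ n ih => rw [Function.iterate_succ_apply', ih, UU_neg, Function.iterate_succ_apply']

theorem UU_iter_le {F : Gen → V3 → ℝ} {b : ℝ} (hF : ∀ s x, ‖x‖ = 1 → F s x ≤ b) (n : ℕ) :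
    ∀ s x, ‖x‖ = 1 → UU^[n] F s x ≤ b := by
  induction n with
  | zero => exact hF
  | succ n ih => rw [Function.iterate_succ_apply']; exact UU_le ih

theorem le_UU_iter {F : Gen → V3 → ℝ} {b : ℝ} (hF : ∀ s x, ‖x‖ = 1 → b ≤ F s x) (n : ℕ) :
    ∀ s x, ‖x‖ = 1 → b ≤ UU^[n] F s x := by
  intro s x hx
  have := UU_iter_le (F := fun s x => - F s x) (fun s x hx => neg_le_neg (hF s x hx)) n s x hx
  rw [UU_iter_neg] at this
  exact neg_le_neg_iff.1 this

theorem UU_iter_le_of_rch {F : Gen → V3 → ℝ} {b : ℝ} (hF : ∀ s x, ‖x‖ = 1 → F s x ≤ b) (n : ℕ)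
    {s t : Gen} {x y : V3} (hx : ‖x‖ = 1) (h : Rch n (s, x) (t, y)) :
    UU^[n] F s x ≤ b - (1 / 5) ^ n * (b - F t y) := by
  induction n generalizing s x with
  | zero =>
    have h : (s, x) = (t, y) := h
    simp only [Prod.mk.injEq] at h
    obtain ⟨rfl, rfl⟩ := h
    simp
  | succ n ih =>
    obtain ⟨u, hu, h⟩ := h
    simp only at hu h
    have h1 := ih (x := rho u x) (by rw [LinearIsometry.norm_map, hx]) h
    have hmem : u ∈ nx s := mem_nx.2 hu
    rw [Function.iterate_succ_apply', UU, ← Finset.add_sum_erase _ _ hmem]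
    have h2 : ∑ v ∈ (nx s).erase u, UU^[n] F v (rho v x) ≤ ∑ v ∈ (nx s).erase u, b := by
      gcongr with v
      exact UU_iter_le hF n v _ (by rw [LinearIsometry.norm_map, hx])
    rw [Finset.sum_const, Finset.card_erase_of_mem hmem, card_nx, nsmul_eq_mul] at h2
    push_cast at h2
    rw [pow_succ]
    linarith

theorem le_UU_iter_of_rch {F : Gen → V3 → ℝ} {b : ℝ} (hF : ∀ s x, ‖x‖ = 1 → b ≤ F s x) (n : ℕ)
    {s t : Gen} {x y : V3} (hx : ‖x‖ = 1) (h : Rch n (s, x) (t, y)) :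
    b + (1 / 5) ^ n * (F t y - b) ≤ UU^[n] F s x := by
  have := UU_iter_le_of_rch (F := fun s x => - F s x) (fun s x hx => neg_le_neg (hF s x hx)) n hx h
  rw [UU_iter_neg] at this
  linarith

theorem Rch.norm_eq {n : ℕ} {p q : Gen × V3} (h : Rch n p q) : ‖q.2‖ = ‖p.2‖ := by
  induction n generalizing p with
  | zero =>
    have h : p = q := h
    rw [h]
  | succ n ih =>
    obtain ⟨u, hu, h⟩ := h
    rw [ih h, LinearIsometry.norm_map]

/-- `F` varies by at most `η` at scale `δ`. -/
def Md (F : Gen → V3 → ℝ) (δ η : ℝ) : Prop :=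
  ∀ s x y, ‖x‖ = 1 → ‖y‖ = 1 → ‖x - y‖ ≤ δ → |F s x - F s y| ≤ η

theorem Md.UU {F : Gen → V3 → ℝ} {δ η : ℝ} (h : Md F δ η) : Md (UU F) δ η := by
  intro s x y hx hy hxy
  have h1 : |∑ t ∈ nx s, (F t (rho t x) - F t (rho t y))| ≤ ∑ t ∈ nx s, η := by
    refine (Finset.abs_sum_le_sum_abs _ _).trans ?_
    gcongr with t
    refine h t _ _ (by rw [LinearIsometry.norm_map, hx]) (by rw [LinearIsometry.norm_map, hy]) ?_
    rwa [← map_sub, LinearIsometry.norm_map]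
  rw [Finset.sum_const, card_nx, nsmul_eq_mul] at h1
  push_cast at h1
  rw [HighFreq.UU, HighFreq.UU, ← mul_sub, ← Finset.sum_sub_distrib, abs_mul,
    abs_of_nonneg (by norm_num)]
  linarith

theorem Md.iter {F : Gen → V3 → ℝ} {δ η : ℝ} (h : Md F δ η) (n : ℕ) : Md (HighFreq.UU^[n] F) δ η := by
  induction n with
  | zero => exact h
  | succ n ih => rw [Function.iterate_succ_apply']; exact ih.UU

/-- The oscillation of `F` is at most `d`. -/
def Osc (F : Gen → V3 → ℝ) (d : ℝ) : Prop :=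
  ∀ s t x y, ‖x‖ = 1 → ‖y‖ = 1 → F s x - F t y ≤ d

theorem norm_e0 : ‖e0‖ = 1 := by simp [e0]

theorem Osc.exists_bounds {F : Gen → V3 → ℝ} {d : ℝ} (h : Osc F d) :
    ∃ a, ∀ s x, ‖x‖ = 1 → a ≤ F s x ∧ F s x ≤ a + d := by
  set A : Set ℝ := {r | ∃ s x, ‖x‖ = 1 ∧ F s x = r}
  have hne : A.Nonempty := ⟨_, (0, true), e0, norm_e0, rfl⟩
  have hb : BddBelow A := by
    refine ⟨F (0, true) e0 - d, ?_⟩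
    rintro r ⟨s, x, hx, rfl⟩
    linarith [h (0, true) s e0 x norm_e0 hx]
  refine ⟨sInf A, fun s x hx => ⟨csInf_le hb ⟨s, x, hx, rfl⟩, ?_⟩⟩
  have : F s x - d ≤ sInf A := by
    apply le_csInf hne
    rintro r ⟨t, y, hy, rfl⟩
    linarith [h s t x y hx hy]
  linarith

theorem Osc.UU {F : Gen → V3 → ℝ} {d : ℝ} (h : Osc F d) : Osc (UU F) d := by
  obtain ⟨a, ha⟩ := h.exists_bounds
  intro s t x y hx hy
  have h1 := UU_le (fun s x hx => (ha s x hx).2) s x hx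
  have h2 := le_UU_iter (fun s x hx => (ha s x hx).1) 1 t y hy
  simp only [Function.iterate_one] at h2
  linarith

theorem Osc.mono_iter {F : Gen → V3 → ℝ} {d : ℝ} {m n : ℕ} (hmn : m ≤ n)
    (h : Osc (HighFreq.UU^[m] F) d) : Osc (HighFreq.UU^[n] F) d := by
  induction n, hmn using Nat.le_induction with
  | base => exact h
  | succ n _ ih => rw [Function.iterate_succ_apply']; exact ih.UU

theorem osc_step {δ : ℝ} (hδ : 0 < δ) : ∃ T : ℕ, ∀ (F : Gen → V3 → ℝ) (η d : ℝ), Md F δ η → Osc F d →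
    Osc (UU^[T] F) ((1 - (1 / 5) ^ T) * d + (1 / 5) ^ T * η) := by
  obtain ⟨T, hT⟩ := exists_reach (half_pos hδ)
  refine ⟨T, fun F η d hM hO s t x y hx hy => ?_⟩
  obtain ⟨a, ha⟩ := hO.exists_bounds
  obtain ⟨z, hz, r⟩ := hT s (0, true) x e0 hx norm_e0
  obtain ⟨z', hz', r'⟩ := hT t (0, true) y e0 hy norm_e0
  have h1 := UU_iter_le_of_rch (fun s x hx => (ha s x hx).2) T hx r
  have h2 := le_UU_iter_of_rch (fun s x hx => (ha s x hx).1) T hy r'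
  have h3 : |F (0, true) z - F (0, true) z'| ≤ η := by
    apply hM
    · rw [← hx]; exact r.norm_eq
    · rw [← hy]; exact r'.norm_eq
    · calc ‖z - z'‖ = ‖(z - e0) - (z' - e0)‖ := by congr 1; abel
        _ ≤ ‖z - e0‖ + ‖z' - e0‖ := norm_sub_le _ _
        _ ≤ δ := by linarith
  have h4 := (abs_le.1 h3).2
  have h5 : (0 : ℝ) ≤ (1 / 5) ^ T := by positivity
  nlinarith

theorem exists_md {F : Gen → V3 → ℝ} (hF : ∀ s, Continuous (F s)) {η : ℝ} (hη : 0 < η) :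
    ∃ δ, 0 < δ ∧ Md F δ η := by
  have h : ∀ s : Gen, ∃ δ, 0 < δ ∧ ∀ x y : V3, ‖x‖ = 1 → ‖y‖ = 1 → ‖x - y‖ ≤ δ →
      |F s x - F s y| ≤ η := by
    intro s
    have hc := (isCompact_sphere (0 : V3) 1).uniformContinuousOn_of_continuous (hF s).continuousOn
    rw [Metric.uniformContinuousOn_iff] at hc
    obtain ⟨δ, hδ, h⟩ := hc η hη
    refine ⟨δ / 2, by positivity, fun x y hx hy hxy => ?_⟩
    have := h x (by simpa using hx) y (by simpa using hy) (by rw [dist_eq_norm]; linarith)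
    rw [Real.dist_eq] at this
    exact this.le
  choose δ hδ h using h
  refine ⟨Finset.univ.inf' Finset.univ_nonempty δ, ?_, ?_⟩
  · rw [Finset.lt_inf'_iff]; exact fun s _ => hδ s
  · intro s x y hx hy hxy
    exact h s x y hx hy (hxy.trans (Finset.inf'_le _ (Finset.mem_univ s)))

theorem exists_osc {F : Gen → V3 → ℝ} (hF : ∀ s, Continuous (F s)) : ∃ d, 0 ≤ d ∧ Osc F d := by
  have h : ∀ s : Gen, ∃ b, ∀ x : V3, ‖x‖ = 1 → |F s x| ≤ b := by
    intro s
    obtain ⟨b, hb⟩ := (isCompact_sphere (0 : V3) 1).exists_bound_of_continuousOn (hF s).continuousOn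
    exact ⟨b, fun x hx => hb x (by simpa using hx)⟩
  choose b hb using h
  have hb0 : ∀ s, 0 ≤ b s := fun s => (abs_nonneg _).trans (hb s e0 norm_e0)
  have hle : ∀ s, b s ≤ ∑ t, b t := fun s =>
    Finset.single_le_sum (fun t _ => hb0 t) (Finset.mem_univ s)
  refine ⟨2 * ∑ t, b t, by have := Finset.sum_nonneg (fun t (_ : t ∈ Finset.univ) => hb0 t); linarith, ?_⟩
  intro s t x y hx hy
  have h1 := (abs_le.1 (hb s x hx)).2
  have h2 := (abs_le.1 (hb t y hy)).1
  linarith [hle s, hle t]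

theorem exists_osc_iter {F : Gen → V3 → ℝ} (hF : ∀ s, Continuous (F s)) {η : ℝ} (hη : 0 < η) :
    ∃ n0, ∀ n ≥ n0, Osc (UU^[n] F) η := by
  obtain ⟨δ, hδ, hM⟩ := exists_md hF (half_pos hη)
  obtain ⟨T, hT⟩ := osc_step hδ
  obtain ⟨d, hd, hO⟩ := exists_osc hF
  set q : ℝ := (1 / 5) ^ T with hq
  have hq0 : 0 < q := by positivity
  have hq1 : q ≤ 1 := pow_le_one₀ (by norm_num) (by norm_num)
  have key : ∀ k : ℕ, Osc (UU^[k * T] F) ((1 - q) ^ k * d + η / 2) := by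
    intro k
    induction k with
    | zero =>
      simp only [zero_mul, Function.iterate_zero, id, pow_zero, one_mul]
      exact fun s t x y hx hy => (hO s t x y hx hy).trans (by linarith)
    | succ k ih =>
      have := hT _ _ _ (hM.iter (k * T)) ih
      rw [← Function.iterate_add_apply] at this
      rw [add_mul, one_mul, add_comm (k * T)]
      convert this using 1
      rw [pow_succ]; ring
  obtain ⟨k, hk⟩ : ∃ k : ℕ, (1 - q) ^ k * d < η / 2 := by
    have h1 := (tendsto_pow_atTop_nhds_zero_of_lt_one (r := 1 - q) (by linarith) (by linarith)).mul_const d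
    rw [zero_mul] at h1
    exact (h1.eventually (gt_mem_nhds (half_pos hη))).exists
  refine ⟨k * T, fun n hn => Osc.mono_iter hn ?_⟩
  exact fun s t x y hx hy => (key k s t x y hx hy).trans (by linarith)

/-- The spherical mean of `f`. -/
def Lam (f : V3 → ℝ) : ℝ :=
  (∫ x in Metric.ball (0 : V3) 1, f (‖x‖⁻¹ • x)) / volume.real (Metric.ball (0 : V3) 1)

theorem vol_ball_pos : 0 < volume.real (Metric.ball (0 : V3) 1) :=
  ENNReal.toReal_pos (Metric.measure_ball_pos _ _ one_pos).ne' measure_ball_lt_top.ne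

theorem measurable_dir : Measurable (fun x : V3 => ‖x‖⁻¹ • x) :=
  (measurable_norm.inv).smul measurable_id

theorem integrableOn_dir {f : V3 → ℝ} (hf : Continuous f) :
    IntegrableOn (fun x => f (‖x‖⁻¹ • x)) (Metric.ball (0 : V3) 1) := by
  obtain ⟨C, hC⟩ := (isCompact_closedBall (0 : V3) 1).exists_bound_of_continuousOn hf.continuousOn
  refine Measure.integrableOn_of_bounded measure_ball_lt_top.ne
    (hf.measurable.comp measurable_dir).aestronglyMeasurable (M := C) ?_
  refine Filter.Eventually.of_forall fun x => hC _ ?_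
  rw [mem_closedBall_zero_iff, norm_smul, norm_inv, norm_norm]
  exact inv_mul_le_one

theorem Lam_const (c : ℝ) : Lam (fun _ => c) = c := by
  rw [Lam, setIntegral_const, smul_eq_mul, mul_div_right_comm, div_self vol_ball_pos.ne', one_mul]

theorem Lam_add {f g : V3 → ℝ} (hf : Continuous f) (hg : Continuous g) :
    Lam (fun x => f x + g x) = Lam f + Lam g := by
  rw [Lam, integral_add (integrableOn_dir hf) (integrableOn_dir hg), add_div, ← Lam, ← Lam]

theorem Lam_const_mul (c : ℝ) (f : V3 → ℝ) : Lam (fun x => c * f x) = c * Lam f := by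
  rw [Lam, integral_const_mul, mul_div_assoc, ← Lam]

theorem Lam_sum {ι : Type*} (S : Finset ι) {f : ι → V3 → ℝ} (hf : ∀ i, Continuous (f i)) :
    Lam (fun x => ∑ i ∈ S, f i x) = ∑ i ∈ S, Lam (f i) := by
  rw [Lam, integral_finsetSum _ (fun i _ => integrableOn_dir (hf i)), Finset.sum_div]
  rfl

theorem ae_ne_zero : ∀ᵐ x ∂(volume.restrict (Metric.ball (0 : V3) 1)), x ≠ 0 :=
  ae_restrict_of_ae (Measure.ae_ne volume 0)

theorem Lam_mono {f g : V3 → ℝ} (hf : Continuous f) (hg : Continuous g)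
    (h : ∀ x, ‖x‖ = 1 → f x ≤ g x) : Lam f ≤ Lam g := by
  refine div_le_div_of_nonneg_right ?_ vol_ball_pos.le
  refine integral_mono_ae (integrableOn_dir hf) (integrableOn_dir hg) ?_
  filter_upwards [ae_ne_zero] with x hx
  refine h _ ?_
  rw [norm_smul, norm_inv, norm_norm, inv_mul_cancel₀ (norm_ne_zero_iff.2 hx)]

theorem Lam_comp (e : V3 →ₗᵢ[ℝ] V3) (f : V3 → ℝ) : Lam (fun x => f (e x)) = Lam f := by
  have hm := (e.toLinearIsometryEquiv rfl).measurePreserving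
  have hE := (e.toLinearIsometryEquiv rfl).toHomeomorph.measurableEmbedding
  have := hm.setIntegral_preimage_emb hE (fun x => f (‖x‖⁻¹ • x)) (Metric.ball 0 1)
  rw [LinearIsometryEquiv.preimage_ball] at this
  rw [Lam, Lam, ← this]
  simp

/-- The stationary mean of a state function. -/
def mm (F : Gen → V3 → ℝ) : ℝ := (1 / 6) * ∑ s, Lam (F s)

theorem mm_UU {F : Gen → V3 → ℝ} (hF : ∀ s, Continuous (F s)) : mm (UU F) = mm F := by
  have h1 : ∀ s, Lam (UU F s) = (1 / 5) * ∑ t ∈ nx s, Lam (F t) := by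
    intro s
    have : UU F s = fun x => (1 / 5) * ∑ t ∈ nx s, F t (rho t x) := rfl
    rw [this, Lam_const_mul, Lam_sum _ (f := fun t x => F t (rho t x))
      (fun t => (hF t).comp (rho t).continuous)]
    simp only [Lam_comp]
  have h2 : ∀ t : Gen, (Finset.univ.filter (fun s : Gen => t ≠ s.inv)).card = 5 := by decide
  have h3 : ∑ s, ∑ t ∈ nx s, Lam (F t) = 5 * ∑ t, Lam (F t) := by
    simp only [nx, Finset.sum_filter]
    rw [Finset.sum_comm, Finset.mul_sum]
    refine Finset.sum_congr rfl fun t _ => ?_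
    rw [← Finset.sum_filter, Finset.sum_const, h2, nsmul_eq_mul]
    norm_num
  rw [mm, mm]
  simp only [h1]
  rw [← Finset.mul_sum, h3]
  ring

theorem mm_UU_iter {F : Gen → V3 → ℝ} (hF : ∀ s, Continuous (F s)) (n : ℕ) :
    mm (UU^[n] F) = mm F := by
  induction n with
  | zero => rfl
  | succ n ih => rw [Function.iterate_succ_apply', mm_UU (fun s => continuous_UU_iter hF n s), ih]

theorem mm_mono {F G : Gen → V3 → ℝ} (hF : ∀ s, Continuous (F s)) (hG : ∀ s, Continuous (G s))
    (h : ∀ s x, ‖x‖ = 1 → F s x ≤ G s x) : mm F ≤ mm G := by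
  unfold mm
  gcongr with s
  exact Lam_mono (hF s) (hG s) (h s)

theorem mm_const (c : ℝ) : mm (fun _ _ => c) = c := by
  have : (Finset.univ : Finset Gen).card = 6 := by decide
  simp [mm, Lam_const, this]

theorem mm_neg (F : Gen → V3 → ℝ) : mm (fun s x => - F s x) = - mm F := by
  have : ∀ s, Lam (fun x => - F s x) = - Lam (F s) := fun s => by
    simpa using Lam_const_mul (-1) (F s)
  simp [mm, this]

theorem mm_state (f : V3 → ℝ) : mm (fun _ => f) = Lam f := by
  have : (Finset.univ : Finset Gen).card = 6 := by decide
  simp [mm, this]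

theorem exists_mixing {F : Gen → V3 → ℝ} (hF : ∀ s, Continuous (F s)) {η : ℝ} (hη : 0 < η) :
    ∃ n0, ∀ n ≥ n0, ∀ s x, ‖x‖ = 1 → |UU^[n] F s x - mm F| ≤ η := by
  obtain ⟨n0, h⟩ := exists_osc_iter hF hη
  refine ⟨n0, fun n hn s x hx => ?_⟩
  have hO := h n hn
  have hc := fun s => continuous_UU_iter hF n s
  have h1 := mm_mono (F := fun _ _ => UU^[n] F s x - η) (fun _ => continuous_const) hc
    (fun t y hy => by linarith [hO s t x y hx hy])
  have h2 := mm_mono (G := fun _ _ => UU^[n] F s x + η) hc (fun _ => continuous_const)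
    (fun t y hy => by linarith [hO t s y x hy hx])
  rw [mm_const, mm_UU_iter hF] at h1 h2
  exact abs_le.2 ⟨by linarith, by linarith⟩

/-- Nonbacktracking words of length `n` that may follow the letter `s`. -/
def Wd : ℕ → Gen → Finset (List Gen)
  | 0, _ => {[]}
  | n + 1, s => (nx s).biUnion fun t => (Wd n t).image (List.cons t)

theorem sum_Wd_succ (n : ℕ) (s : Gen) (F : List Gen → ℝ) :
    ∑ w ∈ Wd (n + 1) s, F w = ∑ t ∈ nx s, ∑ w ∈ Wd n t, F (t :: w) := by
  rw [Wd, Finset.sum_biUnion]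
  · exact Finset.sum_congr rfl fun t _ => Finset.sum_image fun a _ b _ h => by simpa using h
  · intro a _ b _ hab
    simp only [Function.onFun, Finset.disjoint_left, Finset.mem_image]
    rintro _ ⟨v, _, rfl⟩ ⟨w, _, h⟩
    exact hab (by simpa using (List.cons.inj h).1.symm)

theorem cons_mem_Wd {n : ℕ} {s t : Gen} {w : List Gen} (ht : t ≠ s.inv) (hw : w ∈ Wd n t) :
    t :: w ∈ Wd (n + 1) s :=
  Finset.mem_biUnion.2 ⟨t, mem_nx.2 ht, Finset.mem_image_of_mem _ hw⟩

/-- The sum of `h` along the trajectory of `x` spelled by a word. -/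
def hs (h : Gen → V3 → ℝ) : List Gen → V3 → ℝ
  | [], _ => 0
  | t :: w, x => h t (rho t x) + hs h w (rho t x)

theorem abs_hs_sub_le {h : Gen → V3 → ℝ} {δ η : ℝ} (hM : Md h δ η) (w : List Gen) {x y : V3}
    (hx : ‖x‖ = 1) (hy : ‖y‖ = 1) (hxy : ‖x - y‖ ≤ δ) : |hs h w x - hs h w y| ≤ w.length * η := by
  induction w generalizing x y with
  | nil => simp [hs]
  | cons t w ih =>
    have e1 : ‖rho t x‖ = 1 := by rw [LinearIsometry.norm_map, hx]
    have e2 : ‖rho t y‖ = 1 := by rw [LinearIsometry.norm_map, hy]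
    have e3 : ‖rho t x - rho t y‖ ≤ δ := by rwa [← map_sub, LinearIsometry.norm_map]
    have h1 := hM t _ _ e1 e2 e3
    have h2 := ih e1 e2 e3
    rw [hs, hs, List.length_cons]
    push_cast
    calc _ = |(h t (rho t x) - h t (rho t y)) + (hs h w (rho t x) - hs h w (rho t y))| := by
          congr 1; ring_nf
      _ ≤ _ := (abs_add_le _ _).trans (by linarith)

theorem sum_exp_le {S : Finset Gen} (hS : S.card = 5) {a : Gen → ℝ} {τ C : ℝ}
    (ha : ∀ t, |τ * (a t - (1 / 5) * ∑ u ∈ S, a u)| ≤ C) (hC : C ≤ 1) :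
    ∑ t ∈ S, exp (τ * a t) ≤ 5 * exp (C ^ 2) * exp (τ * ((1 / 5) * ∑ u ∈ S, a u)) := by
  set A := (1 / 5) * ∑ u ∈ S, a u with hA
  have h1 : ∀ t ∈ S, exp (τ * (a t - A)) ≤ 1 + τ * (a t - A) + C ^ 2 := by
    intro t _
    have h2 := (abs_le.1 (Real.abs_exp_sub_one_sub_id_le ((ha t).trans hC))).2
    have h3 : (τ * (a t - A)) ^ 2 ≤ C ^ 2 := sq_le_sq' (abs_le.1 (ha t)).1 (abs_le.1 (ha t)).2
    linarith
  have h2 := Finset.sum_le_sum h1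
  rw [Finset.sum_add_distrib, Finset.sum_add_distrib, ← Finset.mul_sum, Finset.sum_sub_distrib,
    Finset.sum_const, Finset.sum_const, Finset.sum_const, hS] at h2
  have h3 : ∑ t ∈ S, a t = 5 * A := by rw [hA]; ring_nf
  rw [h3] at h2
  have h4 : 1 + C ^ 2 ≤ exp (C ^ 2) := by linarith [add_one_le_exp (C ^ 2)]
  calc _ = (∑ t ∈ S, exp (τ * (a t - A))) * exp (τ * A) := by
        rw [Finset.sum_mul]
        exact Finset.sum_congr rfl fun t _ => by rw [← exp_add]; ring_nf
    _ ≤ _ := by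
        gcongr
        simp only [nsmul_eq_mul] at h2
        push_cast at h2
        linarith

theorem sum_exp_hs_le {h H : Gen → V3 → ℝ} {B η τ : ℝ}
    (hH : ∀ s x, ‖x‖ = 1 → |H s x| ≤ B)
    (hh : ∀ s x, ‖x‖ = 1 → h s x + UU H s x ≤ H s x + η) (hτ : 0 ≤ τ) (hτB : 2 * τ * B ≤ 1)
    (n : ℕ) (s : Gen) (x : V3) (hx : ‖x‖ = 1) :
    ∑ w ∈ Wd n s, exp (τ * hs h w x) ≤
      (5 * exp ((2 * τ * B) ^ 2 + τ * η)) ^ n * exp (τ * (UU H s x + B)) := by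
  have hU1 : ∀ s x, ‖x‖ = 1 → UU H s x ≤ B := UU_le fun s x hx => (abs_le.1 (hH s x hx)).2
  have hU2 : ∀ s x, ‖x‖ = 1 → -B ≤ UU H s x :=
    le_UU_iter (n := 1) fun s x hx => (abs_le.1 (hH s x hx)).1
  induction n generalizing s x with
  | zero =>
    simp only [Wd, Finset.sum_singleton, hs, mul_zero, exp_zero, pow_zero, one_mul]
    refine one_le_exp (mul_nonneg hτ ?_)
    linarith [hU2 s x hx]
  | succ n ih =>
    set K := (5 * exp ((2 * τ * B) ^ 2 + τ * η)) with hK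
    have e1 : ∀ t, ‖rho t x‖ = 1 := fun t => by rw [LinearIsometry.norm_map, hx]
    have hA : UU H s x = (1 / 5) * ∑ t ∈ nx s, H t (rho t x) := rfl
    have h0 := sum_exp_le (card_nx s) (a := fun t => H t (rho t x)) (τ := τ) (C := 2 * τ * B) (by
      intro t
      rw [← hA, abs_mul, abs_of_nonneg hτ]
      have h1 := abs_le.1 (hH t _ (e1 t))
      have : |H t (rho t x) - UU H s x| ≤ 2 * B :=
        abs_le.2 ⟨by linarith [hU1 s x hx], by linarith [hU2 s x hx]⟩
      nlinarith) hτB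
    rw [← hA] at h0
    rw [sum_Wd_succ]
    calc _ = ∑ t ∈ nx s, exp (τ * h t (rho t x)) * ∑ w ∈ Wd n t, exp (τ * hs h w (rho t x)) := by
          refine Finset.sum_congr rfl fun t _ => ?_
          rw [Finset.mul_sum]
          exact Finset.sum_congr rfl fun w _ => by rw [hs, ← exp_add]; ring_nf
      _ ≤ ∑ t ∈ nx s, K ^ n * exp (τ * (η + B)) * exp (τ * H t (rho t x)) := by
          refine Finset.sum_le_sum fun t _ => ?_
          calc _ ≤ exp (τ * h t (rho t x)) * (K ^ n * exp (τ * (UU H t (rho t x) + B))) := by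
                gcongr
                exact ih t _ (e1 t)
            _ = K ^ n * exp (τ * (h t (rho t x) + UU H t (rho t x) + B)) := by
                rw [mul_left_comm, ← exp_add]; ring_nf
            _ ≤ K ^ n * exp (τ * (H t (rho t x) + η + B)) := by
                exact mul_le_mul_of_nonneg_left (exp_le_exp.2
                  (mul_le_mul_of_nonneg_left (by linarith [hh t _ (e1 t)]) hτ)) (by positivity)
            _ = _ := by rw [mul_assoc, ← exp_add]; ring_nf
      _ ≤ K ^ n * exp (τ * (η + B)) * (5 * exp ((2 * τ * B) ^ 2) * exp (τ * UU H s x)) := by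
          rw [← Finset.mul_sum]
          gcongr
      _ = _ := by
          rw [pow_succ, hK, exp_add _ (τ * η), mul_add τ (UU H s x), exp_add, mul_add, exp_add]
          ring_nf

theorem UU_sum (F : ℕ → Gen → V3 → ℝ) (m : ℕ) :
    UU (fun s x => ∑ i ∈ Finset.range m, F i s x) =
      fun s x => ∑ i ∈ Finset.range m, UU (F i) s x := by
  funext s x
  simp only [UU]
  rw [Finset.sum_comm, Finset.mul_sum]

theorem exists_bound_state {F : Gen → V3 → ℝ} (hF : ∀ s, Continuous (F s)) :
    ∃ B, 0 < B ∧ ∀ s x, ‖x‖ = 1 → |F s x| ≤ B := by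
  have h : ∀ s, ∃ b, ∀ x, ‖x‖ = 1 → |F s x| ≤ b := fun s => by
    obtain ⟨b, hb⟩ := (isCompact_sphere (0 : V3) 1).exists_bound_of_continuousOn (hF s).continuousOn
    exact ⟨b, fun x hx => hb x (by simpa using hx)⟩
  choose b hb using h
  have hb0 : ∀ s, 0 ≤ b s := fun s => (abs_nonneg _).trans (hb s e0 norm_e0)
  refine ⟨1 + ∑ t, b t, by have := Finset.sum_nonneg (fun t (_ : t ∈ Finset.univ) => hb0 t); linarith, ?_⟩
  intro s x hx
  have := Finset.single_le_sum (f := b) (fun t _ => hb0 t) (Finset.mem_univ s)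
  linarith [hb s x hx]

open Classical in
/-- Large deviations for trajectory sums of a centred state function. -/
theorem exists_large_dev {h : Gen → V3 → ℝ} (hc : ∀ s, Continuous (h s)) (h0 : mm h = 0) {η : ℝ}
    (hη : 0 < η) : ∃ c > 0, ∃ C > 0, ∀ n s x, ‖x‖ = 1 →
      (((Wd n s).filter (fun w => 3 * η * n < hs h w x)).card : ℝ) ≤ C * (5 ^ n * exp (-c * n)) := by
  obtain ⟨m, hm⟩ := exists_mixing hc hη
  have hm := hm m le_rfl
  set H : Gen → V3 → ℝ := fun s x => ∑ i ∈ Finset.range m, UU^[i] h s x with hH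
  have hHc : ∀ s, Continuous (H s) := fun s =>
    continuous_finsetSum _ fun i _ => continuous_UU_iter hc i s
  obtain ⟨B, hB, hHB⟩ := exists_bound_state hHc
  have hid : ∀ s x, h s x + UU H s x = H s x + UU^[m] h s x := by
    intro s x
    have h1 : UU H s x = ∑ i ∈ Finset.range m, UU^[i + 1] h s x := by
      rw [hH, UU_sum]
      simp only [Function.iterate_succ_apply']
    rw [h1, ← Finset.sum_range_succ (fun i => UU^[i] h s x), Finset.sum_range_succ', add_comm]
    rfl
  have hh : ∀ s x, ‖x‖ = 1 → h s x + UU H s x ≤ H s x + η := fun s x hx => by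
    have := (abs_le.1 (hm s x hx)).2
    rw [h0, sub_zero] at this
    rw [hid]; linarith
  set τ : ℝ := min (1 / (2 * B)) (η / (4 * B ^ 2)) with hτ
  have hτ0 : 0 < τ := by positivity
  have hτ1 : 2 * τ * B ≤ 1 := by
    have : τ ≤ 1 / (2 * B) := min_le_left _ _
    rw [le_div_iff₀ (by positivity)] at this
    linarith
  have hτ2 : (2 * τ * B) ^ 2 ≤ τ * η := by
    have : τ ≤ η / (4 * B ^ 2) := min_le_right _ _
    rw [le_div_iff₀ (by positivity)] at this
    nlinarith
  refine ⟨τ * η, by positivity, exp (2 * τ * B), exp_pos _, fun n s x hx => ?_⟩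
  have key := sum_exp_hs_le hHB hh hτ0.le hτ1 n s x hx
  have h1 : (((Wd n s).filter (fun w => 3 * η * n < hs h w x)).card : ℝ) * exp (τ * (3 * η * n)) ≤
      ∑ w ∈ Wd n s, exp (τ * hs h w x) := by
    rw [← nsmul_eq_mul, ← Finset.sum_const]
    refine (Finset.sum_le_sum fun w hw => ?_).trans
      (Finset.sum_le_sum_of_subset_of_nonneg (Finset.filter_subset _ _) fun _ _ _ => (exp_pos _).le)
    exact exp_le_exp.2 (mul_le_mul_of_nonneg_left (Finset.mem_filter.1 hw).2.le hτ0.le)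
  have h2 : UU H s x ≤ B := UU_le (fun s x hx => (abs_le.1 (hHB s x hx)).2) s x hx
  have h3 : (5 * exp ((2 * τ * B) ^ 2 + τ * η)) ^ n * exp (τ * (UU H s x + B)) ≤
      (5 * exp (2 * (τ * η))) ^ n * exp (2 * τ * B) := by
    refine mul_le_mul ?_ (exp_le_exp.2 (by nlinarith)) (exp_pos _).le (by positivity)
    gcongr
    linarith
  have h4 := h1.trans (key.trans h3)
  rw [← le_div_iff₀ (exp_pos _)] at h4
  refine h4.trans_eq ?_
  rw [mul_pow, ← exp_nat_mul, div_eq_mul_inv, ← exp_neg]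
  have : exp (-(τ * η) * n) = exp (n * (2 * (τ * η))) * exp (-(τ * (3 * η * n))) := by
    rw [← exp_add]; ring_nf
  rw [this]; ring_nf

/-- The direction of a lattice point of length `N`. -/
def pt (N : ℕ) (k : Hz) : V3 := !₂[(k.imI / N : ℝ), (k.imJ / N : ℝ), (k.imK / N : ℝ)]

theorem norm_pt {N : ℕ} (hN : 0 < N) {k : Hz} (h0 : k.re = 0)
    (h : Quaternion.normSq k = (N : ℤ) ^ 2) : ‖pt N k‖ = 1 := by
  have hN' : (N : ℝ) ≠ 0 := by exact_mod_cast hN.ne'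
  have h1 : (k.imI : ℝ) ^ 2 + k.imJ ^ 2 + k.imK ^ 2 = N ^ 2 := by
    rw [Hz.normSq_eq, h0] at h
    have h : k.imI ^ 2 + k.imJ ^ 2 + k.imK ^ 2 = (N : ℤ) ^ 2 := by linarith
    exact_mod_cast h
  rw [EuclideanSpace.norm_eq, Real.sqrt_eq_one, Fin.sum_univ_three]
  simp only [pt, Real.norm_eq_abs, sq_abs]
  simp
  field_simp
  linarith

theorem pt_act (N : ℕ) (s : Gen) (k : Hz) : pt (5 * N) (act s k) = rho s (pt N k) := by
  obtain ⟨i, b⟩ := s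
  fin_cases i <;> cases b <;> ext j <;> fin_cases j <;>
    simp [act, Gen.q, Gen.inv, pt, rho, rotL_apply, cos_th, sin_th] <;>
    ring

theorem pt_mul (m N : ℕ) (hm : m ≠ 0) (k : Hz) : pt (m * N) (((m : ℤ) : Hz) * k) = pt N k := by
  have : (m : ℝ) ≠ 0 := by exact_mod_cast hm
  ext j
  fin_cases j <;> simp [pt, mul_div_mul_left _ _ this]

theorem pt_flow {N : ℕ} (h5 : ¬ 5 ∣ N) {k : Hz} (h : IsX N k) :
    pt N (flow N k) = rho (nxt N k) (pt N k) := by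
  rw [← pt_act, act_nxt h5 h]
  exact (pt_mul 5 N (by norm_num) _).symm

theorem IsX.norm_pt {N : ℕ} (hN : 0 < N) {k : Hz} (h : IsX N k) : ‖pt N k‖ = 1 :=
  HighFreq.norm_pt hN h.re h.normSq

theorem sum_lift_state {N : ℕ} (h5 : ¬ 5 ∣ N) (a : ℕ) (F : Gen → V3 → ℝ) :
    ∑ p ∈ lift N a, F p.2 (pt (5 ^ a * N) p.1) =
      5 ^ a * ∑ k ∈ XN N, UU^[a] F (arr N k) (pt N k) := by
  induction a generalizing F with
  | zero => simp [sum_lift_zero]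
  | succ a ih =>
    rw [sum_lift_succ h5 a (fun p => F p.2 (pt (5 ^ (a + 1) * N) p.1)), Function.iterate_succ_apply,
      pow_succ' (5 : ℝ), mul_assoc, ← ih, Finset.mul_sum]
    refine Finset.sum_congr rfl fun p _ => ?_
    simp only [pow_succ', mul_assoc, pt_act]
    rw [UU, ← mul_assoc]
    norm_num [nx]

theorem card_lift {N : ℕ} (h5 : ¬ 5 ∣ N) (a : ℕ) : (lift N a).card = 5 ^ a * (XN N).card := by
  have := sum_lift_state h5 a (fun _ _ => 1)
  have h1 : ∀ a, UU^[a] (fun _ _ => 1) = fun _ _ => 1 := by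
    intro a
    induction a with
    | zero => rfl
    | succ a ih =>
      rw [Function.iterate_succ_apply', ih]
      funext s x
      simp [UU, card_nx]
  rw [h1] at this
  simp only [Finset.sum_const, nsmul_eq_mul, mul_one] at this
  exact_mod_cast this

theorem sum_hs_wd {N : ℕ} (h5 : ¬ 5 ∣ N) (h : Gen → V3 → ℝ) (L : ℕ) :
    ∑ k ∈ XN N, hs h (wd N L k) (pt N k) = L * ∑ k ∈ XN N, h (arr N k) (pt N k) := by
  induction L with
  | zero => simp [wd, hs]
  | succ L ih =>
    have h1 : ∀ k ∈ XN N, hs h (wd N (L + 1) k) (pt N k) =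
        h (arr N (flow N k)) (pt N (flow N k)) + hs h (wd N L (flow N k)) (pt N (flow N k)) := by
      intro k hk
      rw [wd, hs, arr_flow h5 (mem_XN.1 hk), pt_flow h5 (mem_XN.1 hk)]
    rw [Finset.sum_congr rfl h1, Finset.sum_add_distrib,
      sum_flow h5 (fun k => h (arr N k) (pt N k)),
      sum_flow h5 (fun k => hs h (wd N L k) (pt N k)), ih]
    push_cast; ring

theorem wd_mem_Wd {N : ℕ} (h5 : ¬ 5 ∣ N) (L : ℕ) {k : Hz} (hk : IsX N k) :
    wd N L k ∈ Wd L (arr N k) := by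
  induction L generalizing k with
  | zero => simp [wd, Wd]
  | succ L ih =>
    refine cons_mem_Wd (nxt_ne h5 hk) ?_
    rw [← arr_flow h5 hk]
    exact ih (hk.flow h5)

theorem card_sq_le_prs {N L : ℕ} {S : Finset Hz} (hS : S ⊆ XN N) {B : Finset (List Gen)}
    (hB : ∀ k ∈ S, wd N L k ∈ B) : (S.card : ℝ) ^ 2 ≤ B.card * (prs N L).card := by
  classical
  have h1 : S.card = ∑ v ∈ B, (S.filter (fun k => wd N L k = v)).card :=
    Finset.card_eq_sum_card_fiberwise hB
  have h2 : ∑ v ∈ B, (S.filter (fun k => wd N L k = v)).card ^ 2 ≤ (prs N L).card := by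
    have : ∀ v, (S.filter (fun k => wd N L k = v)).card ^ 2 ≤
        ((prs N L).filter (fun p => wd N L p.1 = v)).card := by
      intro v
      rw [sq, ← Finset.card_product]
      refine Finset.card_le_card fun p hp => ?_
      simp only [Finset.mem_product, Finset.mem_filter] at hp
      simp only [prs, Finset.mem_filter, Finset.mem_product]
      exact ⟨⟨⟨hS hp.1.1, hS hp.2.1⟩, hp.1.2.trans hp.2.2.symm⟩, hp.1.2⟩
    refine (Finset.sum_le_sum fun v _ => this v).trans ?_
    rw [Finset.sum_card_fiberwise_eq_card_filter]
    exact Finset.card_le_card (Finset.filter_subset _ _)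
  have h3 := sq_sum_le_card_mul_sum_sq (s := B)
    (f := fun v => (S.filter (fun k => wd N L k = v)).card)
  rw [← h1] at h3
  exact_mod_cast h3.trans (Nat.mul_le_mul_left _ h2)

theorem exists_net {δ : ℝ} (hδ : 0 < δ) :
    ∃ Y : Finset V3, (∀ y ∈ Y, ‖y‖ = 1) ∧ ∀ x : V3, ‖x‖ = 1 → ∃ y ∈ Y, ‖x - y‖ ≤ δ := by
  obtain ⟨t, ht, hf, hc⟩ := (isCompact_sphere (0 : V3) 1).finite_cover_balls hδ
  refine ⟨hf.toFinset, fun y hy => by simpa using ht (hf.mem_toFinset.1 hy), fun x hx => ?_⟩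
  have := hc (by simpa using hx : x ∈ Metric.sphere (0 : V3) 1)
  simp only [Set.mem_iUnion, Metric.mem_ball, dist_eq_norm] at this
  obtain ⟨y, hy, h⟩ := this
  exact ⟨y, hf.mem_toFinset.2 hy, h.le⟩

open Classical in
theorem exists_card_bad_le {h : Gen → V3 → ℝ} (hc : ∀ s, Continuous (h s)) (h0 : mm h = 0) {η : ℝ}
    (hη : 0 < η) : ∃ c > 0, ∃ C > 0, ∀ N : ℕ, 0 < N → ¬ 5 ∣ N → ∀ L,
      (((XN N).filter (fun k => 4 * η * L < hs h (wd N L k) (pt N k))).card : ℝ) ^ 2 ≤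
        C * (5 ^ L * exp (-c * L)) * (prs N L).card := by
  obtain ⟨c, hc0, C, hC0, hD⟩ := exists_large_dev hc h0 hη
  obtain ⟨δ, hδ, hM⟩ := exists_md hc hη
  obtain ⟨Y, hY1, hY2⟩ := exists_net hδ
  have hYc : 0 < Y.card := by
    obtain ⟨y, hy, -⟩ := hY2 e0 norm_e0
    exact Finset.card_pos.2 ⟨y, hy⟩
  refine ⟨c, hc0, 6 * Y.card * C, by positivity, fun N hN h5 L => ?_⟩
  set B : Finset (List Gen) := (Finset.univ ×ˢ Y).biUnion fun p =>
    (Wd L p.1).filter (fun w => 3 * η * L < hs h w p.2) with hB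
  have hBc : (B.card : ℝ) ≤ 6 * Y.card * C * (5 ^ L * exp (-c * L)) := by
    have h1 : (B.card : ℝ) ≤ ∑ p ∈ (Finset.univ : Finset Gen) ×ˢ Y,
        (((Wd L p.1).filter (fun w => 3 * η * L < hs h w p.2)).card : ℝ) := by
      exact_mod_cast Finset.card_biUnion_le
    refine h1.trans ((Finset.sum_le_sum (g := fun _ => C * (5 ^ L * exp (-c * L))) fun p hp =>
      hD L p.1 p.2 (hY1 _ (Finset.mem_product.1 hp).2)).trans_eq ?_)
    have : (Finset.univ : Finset Gen).card = 6 := by decide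
    rw [Finset.sum_const, Finset.card_product, this, nsmul_eq_mul]
    push_cast; ring
  refine (card_sq_le_prs (B := B) (Finset.filter_subset _ _) ?_).trans (by gcongr)
  intro k hk
  obtain ⟨hk, hk2⟩ := Finset.mem_filter.1 hk
  have hk := mem_XN.1 hk
  obtain ⟨y, hy, hxy⟩ := hY2 (pt N k) (hk.norm_pt hN)
  refine Finset.mem_biUnion.2 ⟨(arr N k, y), Finset.mem_product.2 ⟨Finset.mem_univ _, hy⟩,
    Finset.mem_filter.2 ⟨wd_mem_Wd h5 L hk, ?_⟩⟩
  have := (abs_le.1 (abs_hs_sub_le hM (wd N L k) (hk.norm_pt hN) (hY1 y hy) hxy)).2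
  rw [length_wd] at this
  change 3 * η * L < hs h (wd N L k) y
  linarith

theorem hs_le {h : Gen → V3 → ℝ} {B : ℝ} (hB : ∀ s x, ‖x‖ = 1 → |h s x| ≤ B) (w : List Gen) {x : V3}
    (hx : ‖x‖ = 1) : hs h w x ≤ w.length * B := by
  induction w generalizing x with
  | nil => simp [hs]
  | cons t w ih =>
    have e1 : ‖rho t x‖ = 1 := by rw [LinearIsometry.norm_map, hx]
    rw [hs, List.length_cons]
    push_cast
    linarith [ih e1, (abs_le.1 (hB t _ e1)).2]

theorem exp_neg_log_le {c ε : ℝ} (hc : 0 < c) (hε : ε = c / (2 * Real.log 5)) {N : ℕ} (hN : 0 < N) :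
    exp (-c * (Nat.log 5 N : ℕ)) * (N : ℝ) ^ ε ≤ exp c * (N : ℝ) ^ (-ε) := by
  have hNr : (0 : ℝ) < N := by exact_mod_cast hN
  have h5 : 0 < Real.log 5 := Real.log_pos (by norm_num)
  have h1 : (N : ℝ) < 5 ^ (Nat.log 5 N + 1) := by
    exact_mod_cast Nat.lt_pow_succ_log_self (by norm_num) N
  have h2 := Real.log_lt_log hNr h1
  rw [Real.log_pow] at h2
  push_cast at h2
  rw [Real.rpow_def_of_pos hNr, Real.rpow_def_of_pos hNr, ← exp_add, ← exp_add]
  apply exp_le_exp.2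
  have h3 : c = 2 * ε * Real.log 5 := by rw [hε]; field_simp
  have hε0 : 0 < ε := by rw [hε]; positivity
  nlinarith

theorem exists_sum_le {h : Gen → V3 → ℝ} (hc : ∀ s, Continuous (h s)) (h0 : mm h = 0) {η : ℝ}
    (hη : 0 < η) : ∃ N0 : ℕ, ∀ N ≥ N0, Odd N → ¬ 5 ∣ N →
      ∑ k ∈ XN N, h (arr N k) (pt N k) ≤ η * (XN N).card := by
  classical
  have hη' : 0 < η / 8 := by positivity
  obtain ⟨B, hB, hhB⟩ := exists_bound_state hc
  obtain ⟨c, hc0, C, hC, hbad⟩ := exists_card_bad_le hc h0 hη'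
  set ε : ℝ := c / (2 * Real.log 5) with hε
  have hε0 : 0 < ε := by
    have := Real.log_pos (show (1 : ℝ) < 5 by norm_num)
    positivity
  obtain ⟨D, hD, hprs⟩ := card_prs_le hε0
  have hlim := ((tendsto_rpow_neg_atTop hε0).comp tendsto_natCast_atTop_atTop).const_mul
    (2 * C * D * exp c)
  rw [mul_zero] at hlim
  obtain ⟨N1, hN1⟩ := Filter.eventually_atTop.1
    (hlim.eventually (gt_mem_nhds (show 0 < (η / (2 * B)) ^ 2 by positivity)))
  refine ⟨max N1 5, fun N hN hodd h5 => ?_⟩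
  have hN5 : 5 ≤ N := (le_max_right _ _).trans hN
  have hN0 : 0 < N := by omega
  have hlt := hN1 N ((le_max_left _ _).trans hN)
  simp only [Function.comp] at hlt
  set L := Nat.log 5 N with hL
  have hL1 : 0 < L := Nat.log_pos (by norm_num) hN5
  have hL1r : (0 : ℝ) < L := by exact_mod_cast hL1
  set X : ℝ := ((XN N).card : ℝ) with hX
  have hNr : (1 : ℝ) ≤ N := by exact_mod_cast hN0
  have hNX : (N : ℝ) ≤ X := Nat.cast_le.2 (le_card_XN N hodd)
  have h5L : (5 : ℝ) ^ L ≤ N := by exact_mod_cast Nat.pow_log_le_self 5 hN0.ne'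
  set S := (XN N).filter (fun k => 4 * (η / 8) * L < hs h (wd N L k) (pt N k)) with hS
  have hb := hbad N hN0 h5 L
  have hNε : (1 : ℝ) ≤ (N : ℝ) ^ ε := Real.one_le_rpow hNr hε0.le
  have hp : (5 : ℝ) ^ L * (prs N L).card ≤ 2 * D * (N : ℝ) ^ ε * X ^ 2 := by
    calc (5 : ℝ) ^ L * (prs N L).card ≤ 5 ^ L * (X + D * (N : ℝ) ^ (2 + ε) / 5 ^ L) := by
          gcongr
          exact hprs N hN0 h5 L
      _ = 5 ^ L * X + D * (N ^ 2 * (N : ℝ) ^ ε) := by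
          rw [Real.rpow_add (by linarith), Real.rpow_two]; field_simp
      _ ≤ X * X + D * (X ^ 2 * (N : ℝ) ^ ε) := by
          gcongr
          linarith
      _ ≤ _ := by
          have : 1 ≤ D * (N : ℝ) ^ ε := one_le_mul_of_one_le_of_one_le hD hNε
          nlinarith [sq_nonneg X]
  have hS2 : (S.card : ℝ) ^ 2 ≤ (η / (2 * B) * X) ^ 2 := by
    calc (S.card : ℝ) ^ 2 ≤ C * (5 ^ L * exp (-c * L)) * (prs N L).card := hb
      _ = C * exp (-c * L) * (5 ^ L * (prs N L).card) := by ring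
      _ ≤ C * exp (-c * L) * (2 * D * (N : ℝ) ^ ε * X ^ 2) := by gcongr
      _ = 2 * C * D * (exp (-c * L) * (N : ℝ) ^ ε) * X ^ 2 := by ring
      _ ≤ 2 * C * D * (exp c * (N : ℝ) ^ (-ε)) * X ^ 2 := by
          have := exp_neg_log_le hc0 hε hN0
          rw [← hL] at this
          exact mul_le_mul_of_nonneg_right (mul_le_mul_of_nonneg_left this (by positivity))
            (sq_nonneg X)
      _ ≤ (η / (2 * B)) ^ 2 * X ^ 2 := by
          gcongr
          linarith
      _ = _ := by ring
  have hS1 : (S.card : ℝ) ≤ η / (2 * B) * X := abs_le_of_sq_le_sq' hS2 (by positivity) |>.2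
  have hsum : ∑ k ∈ XN N, hs h (wd N L k) (pt N k) ≤ L * (η / 2 * X + S.card * B) := by
    rw [← Finset.sum_filter_add_sum_filter_not (XN N)
      (fun k => 4 * (η / 8) * L < hs h (wd N L k) (pt N k)), ← hS]
    have h1 : ∑ k ∈ S, hs h (wd N L k) (pt N k) ≤ ∑ k ∈ S, (L : ℝ) * B := by
      refine Finset.sum_le_sum fun k hk => ?_
      have := hs_le hhB (wd N L k) ((mem_XN.1 (Finset.mem_filter.1 hk).1).norm_pt hN0)
      rwa [length_wd] at this
    have h2 : ∑ k ∈ (XN N).filter (fun k => ¬ 4 * (η / 8) * L < hs h (wd N L k) (pt N k)),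
        hs h (wd N L k) (pt N k) ≤ ((XN N).filter
          (fun k => ¬ 4 * (η / 8) * L < hs h (wd N L k) (pt N k))).card • (4 * (η / 8) * L) :=
      Finset.sum_le_card_nsmul _ _ _ fun k hk => not_lt.1 (Finset.mem_filter.1 hk).2
    have h3 : (((XN N).filter
        (fun k => ¬ 4 * (η / 8) * L < hs h (wd N L k) (pt N k))).card : ℝ) ≤ X :=
      Nat.cast_le.2 (Finset.card_le_card (Finset.filter_subset _ _))
    rw [Finset.sum_const, nsmul_eq_mul] at h1
    rw [nsmul_eq_mul] at h2
    have h4 := mul_le_mul_of_nonneg_right h3 (show 0 ≤ 4 * (η / 8) * L by positivity)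
    linarith
  rw [sum_hs_wd h5] at hsum
  have h1 := le_of_mul_le_mul_left hsum hL1r
  have h2 : (S.card : ℝ) * B ≤ η / 2 * X := by
    calc _ ≤ η / (2 * B) * X * B := by gcongr
      _ = _ := by field_simp
  linarith

/-- Equidistribution of the states of lattice points of norm prime to five. -/
theorem exists_equi {h : Gen → V3 → ℝ} (hc : ∀ s, Continuous (h s)) {η : ℝ}
    (hη : 0 < η) : ∃ N0 : ℕ, ∀ N ≥ N0, Odd N → ¬ 5 ∣ N →
      |∑ k ∈ XN N, h (arr N k) (pt N k) - mm h * (XN N).card| ≤ η * (XN N).card := by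
  have hm : ∀ f : Gen → V3 → ℝ, (∀ s, Continuous (f s)) → mm (fun s x => f s x - mm f) = 0 := by
    intro f hf
    have h1 : ∀ s, Lam (fun x => f s x + -mm f) = Lam (f s) + -mm f := fun s => by
      rw [Lam_add (hf s) continuous_const, Lam_const]
    have : (Finset.univ : Finset Gen).card = 6 := by decide
    have h2 : mm (fun s x => f s x - mm f) = (1 / 6) * (∑ s, Lam (f s)) - mm f := by
      simp only [sub_eq_add_neg]
      rw [mm]
      simp only [h1, Finset.sum_add_distrib, Finset.sum_const, Finset.card_univ] 
      rw [← Finset.card_univ, this]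
      simp; ring
    rw [h2, ← mm, sub_self]
  obtain ⟨N1, h1⟩ := exists_sum_le (h := fun s x => h s x - mm h)
    (fun s => (hc s).sub continuous_const) (hm h hc) hη
  obtain ⟨N2, h2⟩ := exists_sum_le (h := fun s x => - h s x - mm (fun s x => - h s x))
    (fun s => (hc s).neg.sub continuous_const) (hm _ fun s => (hc s).neg) hη
  refine ⟨max N1 N2, fun N hN ho h5 => ?_⟩
  have a1 := h1 N ((le_max_left _ _).trans hN) ho h5
  have a2 := h2 N ((le_max_right _ _).trans hN) ho h5
  simp only [mm_neg, Finset.sum_sub_distrib, Finset.sum_neg_distrib, Finset.sum_const,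
    nsmul_eq_mul] at a1 a2
  exact abs_le.2 ⟨by linarith, by linarith⟩

/-- The imaginary part of a quaternion as a lattice vector. -/
def vec (k : Hz) : Fin 3 → ℤ := ![k.imI, k.imJ, k.imK]

/-- The lattice vector `κ` scaled by `1 / N`. -/
def dr (N : ℕ) (κ : Fin 3 → ℤ) : V3 := WithLp.toLp 2 fun i => (κ i : ℝ) / N

theorem dr_vec (N : ℕ) (k : Hz) : dr N (vec k) = pt N k := by
  ext j
  fin_cases j <;> simp [dr, vec, pt]

/-- The part of `N` prime to five. -/
def cof (N : ℕ) : ℕ := N / 5 ^ N.factorization 5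

open Classical in
/-- The equidistributing family of lattice points of length `N`. -/
def PN (N : ℕ) : Finset (Fin 3 → ℤ) := ((lift (cof N) (N.factorization 5)).image Prod.fst).image vec

theorem cof_mul (N : ℕ) : 5 ^ N.factorization 5 * cof N = N := Nat.ordProj_mul_ordCompl_eq_self N 5

theorem not_dvd_cof {N : ℕ} (hN : Odd N) : ¬ 5 ∣ cof N :=
  Nat.not_dvd_ordCompl (by norm_num) (by rintro rfl; simp at hN)

theorem odd_cof {N : ℕ} (hN : Odd N) : Odd (cof N) :=
  hN.of_dvd_nat (Nat.ordCompl_dvd N 5)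

theorem re_of_mem_lift {N a : ℕ} {p : Hz × Gen} (h : p ∈ lift N a) : p.1.re = 0 := by
  have := congrArg (·.re) (lift_star h)
  simp at this
  omega

theorem sum_PN {N : ℕ} (hN : Odd N) (F : (Fin 3 → ℤ) → ℝ) :
    ∑ κ ∈ PN N, F κ = ∑ p ∈ lift (cof N) (N.factorization 5), F (vec p.1) := by
  classical
  rw [PN, Finset.sum_image, ← sum_image_lift (not_dvd_cof hN) _ (fun k => F (vec k))]
  · intro x hx y hy h
    simp only [Finset.coe_image, Set.mem_image, Finset.mem_coe] at hx hy
    obtain ⟨p, hp, rfl⟩ := hx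
    obtain ⟨q, hq, rfl⟩ := hy
    have h0 := congrFun h 0
    have h1 := congrFun h 1
    have h2 := congrFun h 2
    simp [vec] at h0 h1 h2
    ext
    · rw [re_of_mem_lift hp, re_of_mem_lift hq]
    · exact h0
    · exact h1
    · exact h2

theorem card_PN {N : ℕ} (hN : Odd N) :
    ((PN N).card : ℝ) = 5 ^ N.factorization 5 * (XN (cof N)).card := by
  have := sum_PN hN (fun _ => 1)
  simp only [Finset.sum_const, nsmul_eq_mul, mul_one] at this
  rw [this, card_lift (not_dvd_cof hN)]
  push_cast; ring

theorem le_card_PN {N : ℕ} (hN : Odd N) : N ≤ (PN N).card := by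
  have h1 : (PN N).card = 5 ^ N.factorization 5 * (XN (cof N)).card := by
    exact_mod_cast card_PN hN
  rw [h1]
  conv_lhs => rw [← cof_mul N]
  exact Nat.mul_le_mul_left _ (le_card_XN _ (odd_cof hN))

theorem sq_of_mem_PN {N : ℕ} {κ : Fin 3 → ℤ} (h : κ ∈ PN N) : ∑ i, κ i ^ 2 = (N : ℤ) ^ 2 := by
  classical
  obtain ⟨y, hy, rfl⟩ := Finset.mem_image.1 h
  obtain ⟨p, hp, rfl⟩ := Finset.mem_image.1 hy
  have h1 := lift_normSq hp
  have h2 := re_of_mem_lift hp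
  rw [Hz.normSq_eq, h2] at h1
  have h3 : ((N : ℕ) : ℤ) = 5 ^ N.factorization 5 * cof N := by exact_mod_cast (cof_mul N).symm
  rw [Fin.sum_univ_three, h3]
  simp [vec] at h1 ⊢
  linarith

theorem sum_PN_dir {N : ℕ} (hN : Odd N) (f : V3 → ℝ) :
    ∑ κ ∈ PN N, f (dr N κ) = 5 ^ N.factorization 5 *
      ∑ k ∈ XN (cof N), UU^[N.factorization 5] (fun _ => f) (arr (cof N) k) (pt (cof N) k) := by
  rw [← sum_lift_state (not_dvd_cof hN), sum_PN hN (fun κ => f (dr N κ)), cof_mul]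
  simp only [dr_vec]

/-- Equidistribution of the lattice points on the sphere. -/
theorem exists_equi_PN {f : V3 → ℝ} (hf : Continuous f) {η : ℝ} (hη : 0 < η) :
    ∃ N0 : ℕ, ∀ N ≥ N0, Odd N →
      |∑ κ ∈ PN N, f (dr N κ) - Lam f * (PN N).card| ≤ η * (PN N).card := by
  have hF : ∀ s : Gen, Continuous ((fun _ => f : Gen → V3 → ℝ) s) := fun _ => hf
  obtain ⟨a0, ha0⟩ := exists_mixing hF hη
  have hE := fun a => exists_equi (continuous_UU_iter hF a) hη
  choose M hM using hE
  refine ⟨5 ^ a0 * ∑ a ∈ Finset.range a0, M a, fun N hN ho => ?_⟩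
  have hN' := cof_mul N
  set a := N.factorization 5 with ha
  have hpos : 0 < cof N := (odd_cof ho).pos
  have key : |∑ k ∈ XN (cof N), UU^[a] (fun _ => f) (arr (cof N) k) (pt (cof N) k) -
      Lam f * (XN (cof N)).card| ≤ η * (XN (cof N)).card := by
    by_cases h : a0 ≤ a
    · have h1 := ha0 a h
      rw [mm_state] at h1
      have : ∑ k ∈ XN (cof N), UU^[a] (fun _ => f) (arr (cof N) k) (pt (cof N) k) -
          Lam f * (XN (cof N)).card =
          ∑ k ∈ XN (cof N), (UU^[a] (fun _ => f) (arr (cof N) k) (pt (cof N) k) - Lam f) := by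
        rw [Finset.sum_sub_distrib, Finset.sum_const, nsmul_eq_mul, mul_comm (Lam f)]
      rw [this]
      refine (Finset.abs_sum_le_sum_abs _ _).trans ((Finset.sum_le_card_nsmul _ _ η fun k hk => ?_).trans ?_)
      · exact h1 _ _ ((mem_XN.1 hk).norm_pt hpos)
      · rw [nsmul_eq_mul, mul_comm]
    · rw [not_le] at h
      have h2 : M a ≤ cof N := by
        have h3 : M a ≤ ∑ b ∈ Finset.range a0, M b :=
          Finset.single_le_sum (fun _ _ => Nat.zero_le _) (Finset.mem_range.2 h)
        have h4 : 5 ^ a ≤ 5 ^ a0 := Nat.pow_le_pow_right (by norm_num) h.le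
        have h5 : 5 ^ a0 * M a ≤ 5 ^ a0 * cof N :=
          calc _ ≤ 5 ^ a0 * ∑ b ∈ Finset.range a0, M b := Nat.mul_le_mul_left _ h3
            _ ≤ N := hN
            _ = 5 ^ a * cof N := hN'.symm
            _ ≤ _ := Nat.mul_le_mul_right _ h4
        exact Nat.le_of_mul_le_mul_left h5 (by positivity)
      have h6 := hM a (cof N) h2 (odd_cof ho) (not_dvd_cof ho)
      rwa [mm_UU_iter hF, mm_state] at h6
  rw [sum_PN_dir ho, card_PN ho, ← ha]
  have e : ∀ S X : ℝ, |5 ^ a * S - Lam f * (5 ^ a * X)| = 5 ^ a * |S - Lam f * X| := by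
    intro S X
    rw [show 5 ^ a * S - Lam f * (5 ^ a * X) = 5 ^ a * (S - Lam f * X) by ring, abs_mul,
      abs_of_pos (show (0 : ℝ) < 5 ^ a by positivity)]
  rw [e, mul_left_comm]
  exact mul_le_mul_of_nonneg_left key (by positivity)

/-- The standard basis of space. -/
def ev (i : Fin 3) : V3 := EuclideanSpace.single i 1

/-- Partial derivatives on Euclidean space. -/
def dd (i : Fin 3) (g : V3 → ℝ) : V3 → ℝ := fun y => fderiv ℝ g y (ev i)

/-- The truncated kernels. -/
def ph (T : ℝ) (n : ℕ) (y : V3) : ℝ := (max (1 - ‖y‖ ^ 2 / T) 0) ^ n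

theorem hasDerivAt_max_pow (n : ℕ) (t : ℝ) :
    HasDerivAt (fun t : ℝ => (max t 0) ^ (n + 2)) ((n + 2) * (max t 0) ^ (n + 1)) t := by
  rcases lt_trichotomy t 0 with h | h | h
  · have : (fun t : ℝ => (max t 0) ^ (n + 2)) =ᶠ[nhds t] fun _ => 0 := by
      filter_upwards [gt_mem_nhds h] with s hs
      rw [max_eq_right hs.le, zero_pow (by omega)]
    rw [max_eq_right h.le, zero_pow (by omega), mul_zero]
    exact (hasDerivAt_const t (0 : ℝ)).congr_of_eventuallyEq this
  · subst h
    rw [max_self, zero_pow (by omega), mul_zero, hasDerivAt_iff_isLittleO]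
    simp only [max_self, sub_zero, smul_zero]
    rw [zero_pow (by omega)]
    simp only [sub_zero]
    have h1 : (fun t : ℝ => t ^ (n + 2)) =o[nhds 0] fun t => t :=
      Asymptotics.isLittleO_pow_id (by omega)
    refine Asymptotics.IsBigO.trans_isLittleO ?_ h1
    refine Asymptotics.IsBigO.of_bound 1 (Filter.Eventually.of_forall fun s => ?_)
    rw [one_mul, norm_pow, norm_pow]
    gcongr
    rw [Real.norm_eq_abs, Real.norm_eq_abs]
    exact abs_max_le_max_abs_abs.trans (by simp)
  · have : (fun t : ℝ => (max t 0) ^ (n + 2)) =ᶠ[nhds t] fun s => s ^ (n + 2) := by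
      filter_upwards [lt_mem_nhds h] with s hs
      rw [max_eq_left hs.le]
    rw [max_eq_left h.le]
    have h2 := (hasDerivAt_pow (n + 2) t).congr_of_eventuallyEq this
    push_cast at h2
    exact h2

theorem inner_ev (y : V3) (i : Fin 3) : inner ℝ y (ev i) = y i := by
  simp [ev, EuclideanSpace.inner_single_right]

theorem hasFDerivAt_ph (T : ℝ) (n : ℕ) (y : V3) :
    HasFDerivAt (ph T (n + 2)) (((n + 2) * ph T (n + 1) y * (-(2 / T))) • innerSL ℝ y) y := by
  have h1 : HasFDerivAt (fun y : V3 => 1 - ‖y‖ ^ 2 / T) ((-(2 / T)) • innerSL ℝ y) y := by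
    have h := ((hasStrictFDerivAt_norm_sq y).hasFDerivAt.const_mul (T⁻¹)).const_sub 1
    have e : (fun y : V3 => 1 - T⁻¹ * ‖y‖ ^ 2) = fun y : V3 => 1 - ‖y‖ ^ 2 / T := by
      funext z; ring
    rw [e] at h
    refine h.congr_fderiv ?_
    ext z; simp; ring
  have h2 := (hasDerivAt_max_pow n (1 - ‖y‖ ^ 2 / T)).comp_hasFDerivAt y h1
  rw [smul_smul] at h2
  exact h2

theorem continuous_ph (T : ℝ) (n : ℕ) : Continuous (ph T n) := by
  unfold ph; fun_prop

theorem differentiable_ph (T : ℝ) (n : ℕ) : Differentiable ℝ (ph T (n + 2)) :=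
  fun y => (hasFDerivAt_ph T n y).differentiableAt

theorem dd_ph (T : ℝ) (n : ℕ) (i : Fin 3) :
    dd i (ph T (n + 2)) = fun y => (-(2 * (n + 2) / T)) * (y i * ph T (n + 1) y) := by
  funext y
  rw [dd, (hasFDerivAt_ph T n y).fderiv]
  simp only [smul_apply, innerSL_apply_apply, inner_ev, smul_eq_mul]
  ring

theorem hasFDerivAt_coord (i : Fin 3) (y : V3) :
    HasFDerivAt (fun y : V3 => y i) (EuclideanSpace.proj i : V3 →L[ℝ] ℝ) y :=
  (EuclideanSpace.proj i : V3 →L[ℝ] ℝ).hasFDerivAt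

theorem dd_dd_ph (T : ℝ) (n : ℕ) (i : Fin 3) :
    dd i (dd i (ph T (n + 3))) = fun y => (-(2 * (n + 3) / T)) * (ph T (n + 2) y +
      y i * ((-(2 * (n + 2) / T)) * (y i * ph T (n + 1) y))) := by
  have e : n + 3 = (n + 1) + 2 := rfl
  rw [e, dd_ph T (n + 1) i]
  funext y
  have h := ((hasFDerivAt_coord i y).mul (hasFDerivAt_ph T n y)).const_mul
    (-(2 * ((n + 1 : ℕ) + 2) / T))
  have h' : HasFDerivAt (fun y : V3 => -(2 * ((n + 1 : ℕ) + 2) / T) * (y i * ph T (n + 1 + 1) y)) _ y := h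
  rw [dd, h'.fderiv]
  simp [inner_ev]
  simp [ev]
  ring

theorem ph_succ (T : ℝ) (n : ℕ) (y : V3) : (1 - ‖y‖ ^ 2 / T) * ph T (n + 1) y = ph T (n + 2) y := by
  unfold ph
  rcases le_total 0 (1 - ‖y‖ ^ 2 / T) with h | h
  · rw [max_eq_left h]; ring
  · rw [max_eq_right h, zero_pow (by omega), zero_pow (by omega), mul_zero]

theorem lap_ph {T : ℝ} (hT : 0 < T) (n : ℕ) (y : V3) :
    ∑ i, dd i (dd i (ph T (n + 3))) y = (4 * (n + 3) * (n + 2) / T) * (ph T (n + 1) y - ph T (n + 2) y)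
      - (6 * (n + 3) / T) * ph T (n + 2) y := by
  have h1 : ‖y‖ ^ 2 = y 0 ^ 2 + y 1 ^ 2 + y 2 ^ 2 := by
    rw [EuclideanSpace.norm_sq_eq, Fin.sum_univ_three]; simp
  have h2 := ph_succ T n y
  simp only [dd_dd_ph, Fin.sum_univ_three]
  rw [← h2, h1]
  field_simp
  ring

theorem ph_eq_zero {T : ℝ} (hT : 0 < T) (n : ℕ) {y : V3} (h : T ≤ ‖y‖ ^ 2) : ph T (n + 1) y = 0 := by
  rw [ph, max_eq_right, zero_pow (by omega)]
  rw [sub_nonpos, le_div_iff₀ hT, one_mul]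
  exact h

theorem hasCompactSupport_ph {T : ℝ} (hT : 0 < T) (n : ℕ) : HasCompactSupport (ph T (n + 1)) := by
  refine HasCompactSupport.intro (isCompact_closedBall (0 : V3) (√T)) fun y hy => ?_
  refine ph_eq_zero hT n ?_
  rw [mem_closedBall_zero_iff, not_le] at hy
  exact (Real.lt_sq_of_sqrt_lt hy).le

theorem integrable_mul_ph {T : ℝ} (hT : 0 < T) (n : ℕ) {g : V3 → ℝ} (hg : Continuous g) :
    Integrable (fun y => g y * ph T (n + 1) y) :=
  (hg.mul (continuous_ph T _)).integrable_of_hasCompactSupport (hasCompactSupport_ph hT n).mul_left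

theorem contDiff_dd {g : V3 → ℝ} (hg : ContDiff ℝ (⊤ : ℕ∞) g) (i : Fin 3) :
    ContDiff ℝ (⊤ : ℕ∞) (dd i g) :=
  (hg.fderiv_right (by simp)).clm_apply contDiff_const

theorem integral_mul_dd_ph {T : ℝ} (hT : 0 < T) (n : ℕ) {g : V3 → ℝ} (hg : ContDiff ℝ (⊤ : ℕ∞) g)
    (i : Fin 3) : ∫ y, g y * dd i (ph T (n + 2)) y = - ∫ y, dd i g y * ph T (n + 2) y := by
  have h1 := (contDiff_dd hg i).continuous
  have h2 : Integrable fun y => g y * dd i (ph T (n + 2)) y := by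
    rw [dd_ph]
    have : Continuous fun y : V3 => g y * (-(2 * (n + 2) / T) * y i) := by
      have := hg.continuous
      fun_prop
    refine (integrable_mul_ph hT n this).congr (Filter.Eventually.of_forall fun y => ?_)
    simp only; ring
  exact integral_mul_fderiv_eq_neg_fderiv_mul_of_integrable (integrable_mul_ph hT (n + 1) h1) h2
    (integrable_mul_ph hT (n + 1) hg.continuous) (fun x _ => hg.differentiable (by simp) x)
    (fun x _ => differentiable_ph T n x)

theorem integral_mul_dd_dd_ph {T : ℝ} (hT : 0 < T) (n : ℕ) {g : V3 → ℝ}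
    (hg : ContDiff ℝ (⊤ : ℕ∞) g) (i : Fin 3) :
    ∫ y, g y * dd i (dd i (ph T (n + 3))) y = ∫ y, dd i (dd i g) y * ph T (n + 3) y := by
  have h0 := integral_mul_dd_ph hT (n + 1) (contDiff_dd hg i) i
  rw [← neg_eq_iff_eq_neg] at h0
  rw [show n + 3 = n + 1 + 2 from rfl, ← h0]
  have hc := hg.continuous
  have h1 := (contDiff_dd hg i).continuous
  have e : dd i (ph T (n + 1 + 2)) =
      fun y => (-(2 * ((n + 1 : ℕ) + 2) / T)) * (y i * ph T (n + 2) y) := dd_ph T (n + 1) i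
  refine integral_mul_fderiv_eq_neg_fderiv_mul_of_integrable ?_ ?_ ?_
    (fun x _ => hg.differentiable (by simp) x) ?_
  · rw [e]
    have : Continuous fun y : V3 => dd i g y * (-(2 * ((n + 1 : ℕ) + 2) / T) * y i) := by fun_prop
    refine (integrable_mul_ph hT (n + 1) this).congr (Filter.Eventually.of_forall fun y => ?_)
    simp only [dd]; ring
  · change Integrable fun y => g y * dd i (dd i (ph T (n + 3))) y
    rw [dd_dd_ph]
    have a1 : Continuous fun y : V3 => g y * (-(2 * (n + 3) / T)) := by fun_prop
    have a2 : Continuous fun y : V3 =>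
        g y * ((-(2 * (n + 3) / T)) * (y i * ((-(2 * (n + 2) / T)) * y i))) := by fun_prop
    refine ((integrable_mul_ph hT (n + 1) a1).add (integrable_mul_ph hT n a2)).congr
      (Filter.Eventually.of_forall fun y => ?_)
    simp only [Pi.add_apply]; ring
  · rw [e]
    have : Continuous fun y : V3 => g y * (-(2 * ((n + 1 : ℕ) + 2) / T) * y i) := by fun_prop
    refine (integrable_mul_ph hT (n + 1) this).congr (Filter.Eventually.of_forall fun y => ?_)
    simp only; ring
  · rw [e]
    intro x _
    exact ((hasFDerivAt_coord i x).differentiableAt.mul (differentiable_ph T n x)).const_mul _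

/-- Smooth solutions of the Helmholtz equation. -/
structure Sol (lam : ℝ) (g : V3 → ℝ) : Prop where
  smooth : ContDiff ℝ (⊤ : ℕ∞) g
  eq : ∀ y, ∑ i, dd i (dd i g) y = - lam ^ 2 * g y

theorem Sol.recursion {lam : ℝ} {g : V3 → ℝ} (hg : Sol lam g) {T : ℝ} (hT : 0 < T) (n : ℕ) :
    (4 * (n + 3) * (n + 2) / T) * ((∫ y, g y * ph T (n + 1) y) - ∫ y, g y * ph T (n + 2) y)
      - (6 * (n + 3) / T) * (∫ y, g y * ph T (n + 2) y) + lam ^ 2 * ∫ y, g y * ph T (n + 3) y = 0 := by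
  have hc := hg.smooth.continuous
  have i1 := integrable_mul_ph hT n hc
  have i2 := integrable_mul_ph hT (n + 1) hc
  have i3 := integrable_mul_ph hT (n + 2) hc
  have h1 : ∑ i, ∫ y, g y * dd i (dd i (ph T (n + 3))) y = - lam ^ 2 * ∫ y, g y * ph T (n + 3) y := by
    simp only [integral_mul_dd_dd_ph hT n hg.smooth]
    rw [← integral_finsetSum, ← integral_const_mul]
    · congr 1
      funext y
      rw [← Finset.sum_mul, hg.eq, mul_assoc]
    · exact fun i _ => integrable_mul_ph hT (n + 2) (contDiff_dd (contDiff_dd hg.smooth i) i).continuous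
  have h2 : ∑ i, ∫ y, g y * dd i (dd i (ph T (n + 3))) y = (4 * (n + 3) * (n + 2) / T) *
      ((∫ y, g y * ph T (n + 1) y) - ∫ y, g y * ph T (n + 2) y)
      - (6 * (n + 3) / T) * (∫ y, g y * ph T (n + 2) y) := by
    rw [← integral_finsetSum]
    · rw [← integral_sub i1 i2, ← integral_const_mul, ← integral_const_mul, ← integral_sub]
      · congr 1
        funext y
        rw [← Finset.mul_sum, lap_ph hT]
        ring
      · exact (i1.sub i2).const_mul _
      · exact i2.const_mul _
    · intro i _
      rw [dd_dd_ph]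
      have a1 : Continuous fun y : V3 => g y * (-(2 * (n + 3) / T)) := by fun_prop
      have a2 : Continuous fun y : V3 =>
          g y * ((-(2 * (n + 3) / T)) * (y i * ((-(2 * (n + 2) / T)) * y i))) := by fun_prop
      refine ((integrable_mul_ph hT (n + 1) a1).add (integrable_mul_ph hT n a2)).congr
        (Filter.Eventually.of_forall fun y => ?_)
      simp only [Pi.add_apply]; ring
  linarith

/-- The volume of the unit ball. -/
def vB : ℝ := volume.real (Metric.ball (0 : V3) 1)

theorem integral_radial (f : ℝ → ℝ) {R : ℝ} (hR : 0 ≤ R) (hf : ∀ r, R < r → f r = 0) :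
    ∫ y : V3, f ‖y‖ = 3 * vB * ∫ r in (0 : ℝ)..R, r ^ 2 * f r := by
  rw [integral_fun_norm_addHaar volume f, intervalIntegral.integral_of_le hR]
  have e : Module.finrank ℝ V3 = 3 := by simp
  rw [e, nsmul_eq_mul, smul_eq_mul, vB, mul_assoc]
  congr 2
  rw [← integral_indicator measurableSet_Ioi, ← integral_indicator measurableSet_Ioc]
  congr 1
  funext r
  by_cases h : r ∈ Ioc 0 R
  · rw [indicator_of_mem h, indicator_of_mem (show r ∈ Ioi (0 : ℝ) from h.1)]; rfl
  · rw [indicator_of_notMem h]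
    by_cases h' : r ∈ Ioi (0 : ℝ)
    · rw [indicator_of_mem h', hf r (not_le.1 fun h2 => h ⟨h', h2⟩), smul_zero]
    · rw [indicator_of_notMem h']

theorem integral_radial_ph (k : ℝ → ℝ) {T : ℝ} (hT : 0 < T) (n : ℕ) :
    ∫ y : V3, k ‖y‖ * ph T (n + 1) y =
      3 * vB * ∫ r in (0 : ℝ)..√T, r ^ 2 * (k r * (1 - r ^ 2 / T) ^ (n + 1)) := by
  have h := integral_radial (fun r => k r * (max (1 - r ^ 2 / T) 0) ^ (n + 1)) (sqrt_nonneg T)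
    (fun r hr => by
      have : T < r ^ 2 := Real.lt_sq_of_sqrt_lt hr
      rw [max_eq_right, zero_pow (by omega), mul_zero]
      rw [sub_nonpos, le_div_iff₀ hT, one_mul]; exact this.le)
  rw [show (∫ y : V3, k ‖y‖ * ph T (n + 1) y) =
    ∫ y : V3, (fun r => k r * (max (1 - r ^ 2 / T) 0) ^ (n + 1)) ‖y‖ from rfl, h]
  congr 1
  refine intervalIntegral.integral_congr fun r hr => ?_
  rw [uIcc_of_le (sqrt_nonneg T)] at hr
  have : r ^ 2 ≤ T := by
    have := pow_le_pow_left₀ hr.1 hr.2 2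
    rwa [sq_sqrt hT.le] at this
  have h2 : 0 ≤ 1 - r ^ 2 / T := by
    rw [sub_nonneg, div_le_one hT]; exact this
  rw [max_eq_left h2]

/-- Functions whose moments against the truncated kernels satisfy the Helmholtz recursion. -/
structure Rec (lam : ℝ) (g : V3 → ℝ) : Prop where
  cont : Continuous g
  rec' : ∀ T : ℝ, 0 < T → ∀ n : ℕ, (4 * (n + 3) * (n + 2) / T) *
      ((∫ y, g y * ph T (n + 1) y) - ∫ y, g y * ph T (n + 2) y)
      - (6 * (n + 3) / T) * (∫ y, g y * ph T (n + 2) y) + lam ^ 2 * ∫ y, g y * ph T (n + 3) y = 0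

theorem Sol.toRec {lam : ℝ} {g : V3 → ℝ} (hg : Sol lam g) : Rec lam g :=
  ⟨hg.smooth.continuous, fun _ hT n => hg.recursion hT n⟩

/-- The radial Helmholtz solution. -/
def jj (lam : ℝ) (y : V3) : ℝ := Real.sinc (lam * ‖y‖)

theorem continuous_jj (lam : ℝ) : Continuous (jj lam) :=
  Real.continuous_sinc.comp (by fun_prop)

theorem jj_zero (lam : ℝ) : jj lam 0 = 1 := by simp [jj]

theorem integral_jj_ph {lam : ℝ} (hl : 0 < lam) {T : ℝ} (hT : 0 < T) (n : ℕ) :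
    ∫ y, jj lam y * ph T (n + 1) y =
      3 * vB / lam * ∫ r in (0 : ℝ)..√T, r * (Real.sin (lam * r) * (1 - r ^ 2 / T) ^ (n + 1)) := by
  unfold jj
  rw [integral_radial_ph (fun r => Real.sinc (lam * r)) hT n, div_mul_eq_mul_div,
    mul_div_assoc, ← intervalIntegral.integral_div]
  congr 1
  refine intervalIntegral.integral_congr fun r _ => ?_
  rcases eq_or_ne r 0 with h | h
  · simp [h]
  · rw [Real.sinc_of_ne_zero (mul_ne_zero hl.ne' h)]
    field_simp

theorem radial_recursion (lam : ℝ) {T : ℝ} (hT : 0 < T) (n : ℕ) :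
    (4 * (n + 3) * (n + 2) / T) *
      ((∫ r in (0 : ℝ)..√T, r * (Real.sin (lam * r) * (1 - r ^ 2 / T) ^ (n + 1))) -
        ∫ r in (0 : ℝ)..√T, r * (Real.sin (lam * r) * (1 - r ^ 2 / T) ^ (n + 2)))
      - (6 * (n + 3) / T) * (∫ r in (0 : ℝ)..√T, r * (Real.sin (lam * r) * (1 - r ^ 2 / T) ^ (n + 2)))
      + lam ^ 2 * ∫ r in (0 : ℝ)..√T, r * (Real.sin (lam * r) * (1 - r ^ 2 / T) ^ (n + 3)) = 0 := by
  have ii : ∀ m : ℕ, IntervalIntegrable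
      (fun r => r * (Real.sin (lam * r) * (1 - r ^ 2 / T) ^ m)) volume 0 (√T) :=
    fun m => Continuous.intervalIntegrable (by fun_prop) _ _
  have key : ∀ r : ℝ, HasDerivAt (fun r => Real.sin (lam * r) *
      ((1 - r ^ 2 / T) ^ (n + 3) - (2 * (n + 3) / T) * (r ^ 2 * (1 - r ^ 2 / T) ^ (n + 2))) -
      lam * (Real.cos (lam * r) * (r * (1 - r ^ 2 / T) ^ (n + 3))))
      ((4 * (n + 3) * (n + 2) / T) * (r * (Real.sin (lam * r) * (1 - r ^ 2 / T) ^ (n + 1)) -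
        r * (Real.sin (lam * r) * (1 - r ^ 2 / T) ^ (n + 2)))
      - (6 * (n + 3) / T) * (r * (Real.sin (lam * r) * (1 - r ^ 2 / T) ^ (n + 2)))
      + lam ^ 2 * (r * (Real.sin (lam * r) * (1 - r ^ 2 / T) ^ (n + 3)))) r := by
    intro r
    have hl : HasDerivAt (fun r : ℝ => lam * r) lam r := by
      simpa using (hasDerivAt_id r).const_mul lam
    have hs := hl.sin
    have hc := hl.cos
    have hr2 : HasDerivAt (fun r : ℝ => r ^ 2) (2 * r) r := by
      simpa using hasDerivAt_pow 2 r
    have hu : HasDerivAt (fun r : ℝ => 1 - r ^ 2 / T) (-(2 * r / T)) r :=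
      (hr2.div_const T).const_sub 1
    have hu3 := hu.pow (n + 3)
    have hu2 := hu.pow (n + 2)
    have h := (hs.mul (hu3.sub ((hr2.mul hu2).const_mul (2 * (n + 3) / T)))).sub
      ((hc.mul ((hasDerivAt_id r).mul hu3)).const_mul lam)
    refine h.congr_deriv ?_
    simp only [Pi.pow_apply, Pi.mul_apply, Pi.sub_apply, id]
    rw [show n + 3 - 1 = n + 2 from rfl, show n + 2 - 1 = n + 1 from rfl]
    push_cast
    obtain ⟨U, hU⟩ : ∃ U, U = 1 - r ^ 2 / T := ⟨_, rfl⟩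
    have hU' : r ^ 2 * T⁻¹ = 1 - U := by rw [hU]; ring
    rw [← hU]
    simp only [div_eq_mul_inv]
    linear_combination Real.sin (lam * r) * 4 * (n + 3) * (n + 2) * T⁻¹ * r * U ^ (n + 1) * hU'
  have h := intervalIntegral.integral_eq_sub_of_hasDerivAt (a := 0) (b := √T)
    (fun r _ => key r) (Continuous.intervalIntegrable (by fun_prop) _ _)
  rw [← intervalIntegral.integral_sub (ii _) (ii _)]
  rw [← intervalIntegral.integral_const_mul, ← intervalIntegral.integral_const_mul,
    ← intervalIntegral.integral_const_mul, ← intervalIntegral.integral_sub, ← intervalIntegral.integral_add]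
  · rw [h, sq_sqrt hT.le, div_self hT.ne']
    simp
  · exact (((ii _).sub (ii _)).const_mul _).sub ((ii _).const_mul _)
  · exact (ii _).const_mul _
  · exact ((ii _).sub (ii _)).const_mul _
  · exact (ii _).const_mul _

theorem rec_jj {lam : ℝ} (hl : 0 < lam) : Rec lam (jj lam) := by
  refine ⟨continuous_jj lam, fun T hT n => ?_⟩
  rw [show n + 2 = (n + 1) + 1 from rfl, show n + 3 = (n + 2) + 1 from rfl,
    integral_jj_ph hl hT, integral_jj_ph hl hT, integral_jj_ph hl hT]
  have h := radial_recursion lam hT n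
  rw [show n + 2 = (n + 1) + 1 from rfl, show n + 3 = (n + 2) + 1 from rfl] at h
  linear_combination (3 * vB / lam) * h

theorem Rec.sub_smul {lam : ℝ} {f g : V3 → ℝ} (hf : Rec lam f) (hg : Rec lam g) (c : ℝ) :
    Rec lam (fun y => f y - c * g y) := by
  have e : ∀ T : ℝ, 0 < T → ∀ n : ℕ, ∫ y, (f y - c * g y) * ph T (n + 1) y =
      (∫ y, f y * ph T (n + 1) y) - c * ∫ y, g y * ph T (n + 1) y := by
    intro T hT n
    rw [← integral_const_mul, ← integral_sub (integrable_mul_ph hT n hf.cont)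
      ((integrable_mul_ph hT n hg.cont).const_mul c)]
    congr 1; funext y; ring
  refine ⟨hf.cont.sub (continuous_const.mul hg.cont), fun T hT n => ?_⟩
  rw [show n + 2 = (n + 1) + 1 from rfl, show n + 3 = (n + 2) + 1 from rfl,
    e T hT, e T hT, e T hT]
  have h1 := hf.rec' T hT n
  have h2 := hg.rec' T hT n
  rw [show n + 2 = (n + 1) + 1 from rfl, show n + 3 = (n + 2) + 1 from rfl] at h1 h2
  linear_combination h1 - c * h2

theorem rec_one : Rec 0 (fun _ => (1 : ℝ)) := by
  refine Sol.toRec ⟨contDiff_const, fun y => ?_⟩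
  have : ∀ i, dd i (fun _ => (1 : ℝ)) = fun _ => 0 := fun i => by
    funext y; simp [dd]
  simp [this, dd]

theorem integral_ph_pos {T : ℝ} (hT : 0 < T) (n : ℕ) : 0 < ∫ y, ph T (n + 1) y := by
  refine (continuous_ph T (n + 1)).integral_pos_of_hasCompactSupport_nonneg_nonzero
    (hasCompactSupport_ph hT n) (fun y => pow_nonneg (le_max_right _ _) _) (x := 0) ?_
  simp [ph]

theorem ph_nonneg (T : ℝ) (n : ℕ) (y : V3) : 0 ≤ ph T n y := pow_nonneg (le_max_right _ _) _

theorem ph_le_one {T : ℝ} (hT : 0 < T) (n : ℕ) (y : V3) : ph T n y ≤ 1 := by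
  refine pow_le_one₀ (le_max_right _ _) (max_le ?_ zero_le_one)
  have : 0 ≤ ‖y‖ ^ 2 / T := by positivity
  linarith

theorem ph_succ_le {T : ℝ} (hT : 0 < T) (n : ℕ) (y : V3) : ph T (n + 1) y ≤ ph T n y := by
  have h := ph_le_one hT 1 y
  have h2 : ph T (n + 1) y = ph T n y * ph T 1 y := by simp only [ph]; ring
  rw [h2]
  exact mul_le_of_le_one_right (ph_nonneg T n y) h

theorem integral_ph_closedBall {T : ℝ} (hT : 0 < T) (n : ℕ) (f : V3 → ℝ) :
    ∫ y in Metric.closedBall (0 : V3) (√T), f y * ph T (n + 1) y = ∫ y, f y * ph T (n + 1) y := by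
  refine setIntegral_eq_integral_of_forall_compl_eq_zero fun y hy => ?_
  rw [mem_closedBall_zero_iff, not_le] at hy
  rw [ph_eq_zero hT n (Real.lt_sq_of_sqrt_lt hy).le, mul_zero]

theorem tendsto_mean_ph {T : ℝ} (hT : 0 < T) {f : V3 → ℝ} (hf : Continuous f) :
    Filter.Tendsto (fun n => (∫ y, f y * ph T (n + 1) y) / ∫ y, ph T (n + 1) y) Filter.atTop
      (nhds (f 0)) := by
  have h0 : (0 : V3) ∈ Metric.closedBall (0 : V3) (√T) := by simp
  have h := tendsto_setIntegral_pow_smul_of_unique_maximum_of_isCompact_of_continuousOn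
    (μ := (volume : Measure V3)) (s := Metric.closedBall (0 : V3) (√T)) (c := fun y => ph T 1 y)
    (g := f) (x₀ := 0) (isCompact_closedBall _ _) (continuous_ph T 1).continuousOn
    (fun y _ hy => by
      have : 0 < ‖y‖ ^ 2 / T := by have := norm_pos_iff.2 hy; positivity
      simp only [ph, norm_zero, pow_one]
      refine max_lt_iff.2 ⟨lt_max_of_lt_left (by simpa using this), lt_max_of_lt_left (by simp)⟩)
    (fun y _ => ph_nonneg T 1 y) (by simp [ph]) (by
      rw [interior_closedBall _ (Real.sqrt_pos.2 hT).ne', closure_ball _ (Real.sqrt_pos.2 hT).ne']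
      exact h0) hf.continuousOn
  refine (h.comp (Filter.tendsto_add_atTop_nat 1)).congr fun n => ?_
  have e : ∀ y, ph T 1 y ^ (n + 1) = ph T (n + 1) y := fun y => by simp only [ph, pow_one]
  simp only [Function.comp, e, smul_eq_mul]
  have h1 := integral_ph_closedBall hT n (fun _ => 1)
  simp only [one_mul] at h1
  rw [h1, ← integral_ph_closedBall hT n f, div_eq_inv_mul]
  simp only [mul_comm (f _)]

theorem eq_zero_of_le_succ {d : ℕ → ℝ} {K : ℝ} (hK : 0 ≤ K)
    (h : ∀ n : ℕ, |d n| ≤ |d (n + 1)| + K / ((n + 2) * (n + 3)) * |d (n + 2)|)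
    (h0 : Filter.Tendsto d Filter.atTop (nhds 0)) (n : ℕ) : d n = 0 := by
  set M : ℕ → ℝ := fun n => max |d n| |d (n + 1)|
  have hM0 : ∀ n, 0 ≤ M n := fun n => (abs_nonneg _).trans (le_max_left _ _)
  have hM : ∀ n : ℕ, M n ≤ Real.exp (K / (n + 2) - K / (n + 3)) * M (n + 1) := by
    intro n
    have e : K / (n + 2) - K / (n + 3) = K / (((n : ℝ) + 2) * (n + 3)) := by field_simp; ring
    have e0 : 0 ≤ K / (((n : ℝ) + 2) * (n + 3)) := by positivity
    have h1 := Real.add_one_le_exp (K / (((n : ℝ) + 2) * (n + 3)))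
    rw [e]
    refine le_trans ?_ (mul_le_mul_of_nonneg_right h1 (hM0 _))
    have a1 : |d (n + 1)| ≤ M (n + 1) := le_max_left _ _
    have a2 : |d (n + 2)| ≤ M (n + 1) := le_max_right _ _
    have a3 := mul_le_mul_of_nonneg_left a2 e0
    have a4 := mul_nonneg e0 (hM0 (n + 1))
    refine max_le ?_ ?_
    · linarith [h n]
    · linarith
  set E : ℕ → ℝ := fun n => M n * Real.exp (-(K / (n + 2)))
  have hE : Monotone E := by
    refine monotone_nat_of_le_succ fun n => ?_
    have := mul_le_mul_of_nonneg_right (hM n) (Real.exp_nonneg (-(K / (n + 2))))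
    refine this.trans (le_of_eq ?_)
    simp only [E]
    rw [mul_comm (Real.exp _), mul_assoc, ← Real.exp_add]
    congr 2
    push_cast; ring
  have hd : Filter.Tendsto M Filter.atTop (nhds 0) := by
    have a1 := h0.abs
    have a2 := a1.comp (Filter.tendsto_add_atTop_nat 1)
    simpa using a1.max a2
  have hE0 : Filter.Tendsto E Filter.atTop (nhds 0) := by
    refine squeeze_zero (fun n => mul_nonneg (hM0 n) (Real.exp_nonneg _)) (fun n => ?_) hd
    refine mul_le_of_le_one_right (hM0 n) (Real.exp_le_one_iff.2 ?_)
    rw [neg_nonpos]; positivity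
  have h1 : E n ≤ 0 := hE.ge_of_tendsto hE0 n
  have h2 : M n ≤ 0 := by
    by_contra hc
    exact absurd h1 (not_le.2 (mul_pos (not_le.1 hc) (Real.exp_pos _)))
  exact abs_eq_zero.1 (le_antisymm ((le_max_left _ _).trans h2) (abs_nonneg _))

theorem Rec.integral_eq_zero {lam : ℝ} {f : V3 → ℝ} (hf : Rec lam f) (h0 : f 0 = 0) {T : ℝ}
    (hT : 0 < T) (n : ℕ) : ∫ y, f y * ph T (n + 1) y = 0 := by
  set I : ℕ → ℝ := fun n => ∫ y, ph T (n + 1) y with hI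
  set q : ℕ → ℝ := fun n => ∫ y, f y * ph T (n + 1) y with hq
  have hIp : ∀ n, 0 < I n := fun n => integral_ph_pos hT n
  have hle : ∀ n, I (n + 1) ≤ I n := by
    intro n
    have i : ∀ n, Integrable (ph T (n + 1)) := fun n =>
      (continuous_ph T _).integrable_of_hasCompactSupport (hasCompactSupport_ph hT n)
    exact integral_mono (i _) (i _) fun y => ph_succ_le hT (n + 1) y
  have h := eq_zero_of_le_succ (d := fun n => q n / I n) (K := lam ^ 2 * T / 4) (by positivity) ?_ ?_ n
  · have := (div_eq_zero_iff.1 h).resolve_right (hIp n).ne'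
    exact this
  · intro n
    have r1 := hf.rec' T hT n
    have r2 := rec_one.rec' T hT n
    simp only [one_mul, ne_eq, OfNat.ofNat_ne_zero, not_false_eq_true, zero_pow, zero_mul,
      add_zero] at r2
    change (4 * (n + 3) * (n + 2) / T) * (q n - q (n + 1)) - (6 * (n + 3) / T) * q (n + 1) +
      lam ^ 2 * q (n + 2) = 0 at r1
    change (4 * (n + 3) * (n + 2) / T) * (I n - I (n + 1)) - (6 * (n + 3) / T) * I (n + 1) = 0 at r2
    have hA : 0 < 4 * ((n : ℝ) + 3) * (n + 2) / T := by positivity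
    set A := 4 * ((n : ℝ) + 3) * (n + 2) / T with hAdef
    set B := 6 * ((n : ℝ) + 3) / T
    have p0 := hIp n
    have p1 := hIp (n + 1)
    have p2 := hIp (n + 2)
    have e : q n / I n = q (n + 1) / I (n + 1) - lam ^ 2 * I (n + 2) / (A * I n) * (q (n + 2) / I (n + 2)) := by
      field_simp
      linear_combination I (n + 1) * r1 - q (n + 1) * r2
    have hc : lam ^ 2 * I (n + 2) / (A * I n) ≤ lam ^ 2 * T / 4 / ((n + 2) * (n + 3)) := by
      have : lam ^ 2 * T / 4 / ((n + 2) * (n + 3)) = lam ^ 2 * I n / (A * I n) := by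
        rw [hAdef]; field_simp
      rw [this]
      have := (hle (n + 1)).trans (hle n)
      gcongr
    have hc0 : 0 ≤ lam ^ 2 * I (n + 2) / (A * I n) := by positivity
    rw [e]
    refine (abs_sub _ _).trans ?_
    rw [abs_mul, abs_of_nonneg hc0]
    gcongr
  · have := tendsto_mean_ph hT hf.cont
    rwa [h0] at this

theorem Sol.integral_ph {lam : ℝ} (hl : 0 < lam) {g : V3 → ℝ} (hg : Sol lam g) {T : ℝ}
    (hT : 0 < T) (n : ℕ) :
    ∫ y, g y * ph T (n + 1) y = g 0 * ∫ y, jj lam y * ph T (n + 1) y := by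
  have h := (hg.toRec.sub_smul (rec_jj hl) (g 0)).integral_eq_zero (by simp [jj_zero]) hT n
  have i1 := integrable_mul_ph hT n hg.smooth.continuous
  have i2 := integrable_mul_ph hT n (continuous_jj lam)
  have e : (fun y => (g y - g 0 * jj lam y) * ph T (n + 1) y) =
      fun y => g y * ph T (n + 1) y - g 0 * (jj lam y * ph T (n + 1) y) := by
    funext y; ring
  rw [e, integral_sub i1 (i2.const_mul _), integral_const_mul] at h
  linarith

theorem dd_translate (g : V3 → ℝ) (x : V3) (i : Fin 3) :
    dd i (fun y => g (x + y)) = fun y => dd i g (x + y) := by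
  funext y
  simp only [dd]
  rw [fderiv_comp_add_left]

theorem Sol.translate {lam : ℝ} {g : V3 → ℝ} (hg : Sol lam g) (x : V3) :
    Sol lam (fun y => g (x + y)) := by
  refine ⟨hg.smooth.comp (contDiff_const.add contDiff_id), fun y => ?_⟩
  simp only [dd_translate, hg.eq]

theorem Sol.integral_polynomial {lam : ℝ} (hl : 0 < lam) {g : V3 → ℝ} (hg : Sol lam g) {T : ℝ}
    (hT : 0 < T) (p : Polynomial ℝ) :
    ∫ y, g y * (ph T 1 y * p.eval (ph T 1 y)) =
      g 0 * ∫ y, jj lam y * (ph T 1 y * p.eval (ph T 1 y)) := by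
  have key : ∀ f : V3 → ℝ, Continuous f → ∫ y, f y * (ph T 1 y * p.eval (ph T 1 y)) =
      ∑ k ∈ Finset.range (p.natDegree + 1), p.coeff k * ∫ y, f y * ph T (k + 1) y := by
    intro f hf
    simp only [← integral_const_mul]
    rw [← integral_finsetSum _ fun k _ => (integrable_mul_ph hT k hf).const_mul _]
    congr 1; funext y
    rw [Polynomial.eval_eq_sum_range, Finset.mul_sum, Finset.mul_sum]
    refine Finset.sum_congr rfl fun k _ => ?_
    simp only [ph]; ring
  rw [key _ hg.smooth.continuous, key _ (continuous_jj lam), Finset.mul_sum]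
  refine Finset.sum_congr rfl fun k _ => ?_
  rw [hg.integral_ph hl hT]; ring

theorem ph_one_mem {T : ℝ} (hT : 0 < T) (y : V3) : ph T 1 y ∈ Icc (0 : ℝ) 1 :=
  ⟨ph_nonneg T 1 y, ph_le_one hT 1 y⟩

theorem Sol.integral_continuous {lam : ℝ} (hl : 0 < lam) {g : V3 → ℝ} (hg : Sol lam g) {T : ℝ}
    (hT : 0 < T) {q : ℝ → ℝ} (hq : Continuous q) :
    ∫ y, g y * (ph T 1 y * q (ph T 1 y)) = g 0 * ∫ y, jj lam y * (ph T 1 y * q (ph T 1 y)) := by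
  have est : ∀ f : V3 → ℝ, Continuous f → ∀ (ε : ℝ) (p : Polynomial ℝ),
      (∀ x ∈ Icc (0 : ℝ) 1, |p.eval x - q x| < ε) →
      |(∫ y, f y * (ph T 1 y * p.eval (ph T 1 y))) - ∫ y, f y * (ph T 1 y * q (ph T 1 y))| ≤
        (∫ y, |f y| * ph T 1 y) * ε := by
    intro f hf ε p hp
    have c1 := continuous_ph T 1
    have i1 : Integrable fun y => f y * (ph T 1 y * p.eval (ph T 1 y)) := by
      have : Continuous fun y : V3 => f y * p.eval (ph T 1 y) :=
        hf.mul (p.continuous.comp c1)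
      refine (integrable_mul_ph hT 0 this).congr (Filter.Eventually.of_forall fun y => ?_)
      simp only; ring
    have i2 : Integrable fun y => f y * (ph T 1 y * q (ph T 1 y)) := by
      have : Continuous fun y : V3 => f y * q (ph T 1 y) := hf.mul (hq.comp c1)
      refine (integrable_mul_ph hT 0 this).congr (Filter.Eventually.of_forall fun y => ?_)
      simp only; ring
    rw [← integral_sub i1 i2, ← integral_mul_const]
    refine (abs_integral_le_integral_abs).trans
      (integral_mono (i1.sub i2).abs ((integrable_mul_ph hT 0 hf.abs).mul_const ε) fun y => ?_)
    have h1 := (hp _ (ph_one_mem hT y)).le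
    have : f y * (ph T 1 y * p.eval (ph T 1 y)) - f y * (ph T 1 y * q (ph T 1 y)) =
      f y * ph T 1 y * (p.eval (ph T 1 y) - q (ph T 1 y)) := by ring
    dsimp only [Pi.sub_apply]
    rw [this, abs_mul, abs_mul, abs_of_nonneg (ph_nonneg T 1 y)]
    exact mul_le_mul_of_nonneg_left h1 (mul_nonneg (abs_nonneg _) (ph_nonneg T 1 y))
  have hA : 0 ≤ ∫ y, |g y| * ph T 1 y := integral_nonneg fun y => mul_nonneg (abs_nonneg _) (ph_nonneg T 1 y)
  have hB : 0 ≤ ∫ y, |jj lam y| * ph T 1 y := integral_nonneg fun y => mul_nonneg (abs_nonneg _) (ph_nonneg T 1 y)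
  set A := ∫ y, |g y| * ph T 1 y
  set B := ∫ y, |jj lam y| * ph T 1 y
  rw [← sub_eq_zero, ← abs_nonpos_iff]
  refine le_of_forall_pos_le_add fun ε hε => ?_
  have hD : 0 < A + |g 0| * B + 1 := by positivity
  obtain ⟨p, hp⟩ := exists_polynomial_near_of_continuousOn 0 1 q hq.continuousOn
    (ε / (A + |g 0| * B + 1)) (by positivity)
  have e1 := est g hg.smooth.continuous _ p hp
  have e2 := est _ (continuous_jj lam) _ p hp
  rw [hg.integral_polynomial hl hT p] at e1
  set X := ∫ y, g y * (ph T 1 y * q (ph T 1 y))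
  set Y := ∫ y, jj lam y * (ph T 1 y * q (ph T 1 y))
  set Z := ∫ y, jj lam y * (ph T 1 y * p.eval (ph T 1 y))
  have : X - g 0 * Y = -(g 0 * Z - X) + g 0 * (Z - Y) := by ring
  rw [this, zero_add]
  refine (abs_add_le _ _).trans ?_
  rw [abs_neg, abs_mul]
  have e3 := mul_le_mul_of_nonneg_left e2 (abs_nonneg (g 0))
  have e4 : (A + |g 0| * B + 1) * (ε / (A + |g 0| * B + 1)) = ε := by field_simp
  have e5 : 0 ≤ ε / (A + |g 0| * B + 1) := by positivity
  nlinarith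

theorem Sol.mean {lam : ℝ} (hl : 0 < lam) {g : V3 → ℝ} (hg : Sol lam g) {T : ℝ}
    (hT : 0 < T) {k : ℝ → ℝ} (hk : Continuous k) (x : V3) :
    ∫ y, g (x + y) * (ph T 1 y * k ‖y‖) = g x * ∫ y, jj lam y * (ph T 1 y * k ‖y‖) := by
  have hq : Continuous fun u : ℝ => k (√(T * (1 - u))) := by fun_prop
  have h := (hg.translate x).integral_continuous hl hT hq
  have e : ∀ y, ph T 1 y * k (√(T * (1 - ph T 1 y))) = ph T 1 y * k ‖y‖ := by
    intro y
    rcases le_total T (‖y‖ ^ 2) with h | h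
    · rw [ph_eq_zero hT 0 h, zero_mul, zero_mul]
    · have : ph T 1 y = 1 - ‖y‖ ^ 2 / T := by
        rw [ph, pow_one, max_eq_left]
        rw [sub_nonneg, div_le_one hT]; exact h
      rw [this]
      congr 2
      rw [sub_sub_cancel, mul_div_cancel₀ _ hT.ne', sqrt_sq (norm_nonneg _)]
  simp only [e, add_zero] at h
  exact h

theorem dd_dd_eq {g : V3 → ℝ} (hg : ContDiff ℝ (⊤ : ℕ∞) g) (i j : Fin 3) (y : V3) :
    dd i (dd j g) y = fderiv ℝ (fderiv ℝ g) y (ev i) (ev j) := by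
  have h : DifferentiableAt ℝ (fderiv ℝ g) y :=
    (hg.fderiv_right (m := 1) (by norm_cast)).differentiable (by simp) y
  have h2 := (h.hasFDerivAt.clm_apply (hasFDerivAt_const (ev j) y)).fderiv
  unfold dd
  rw [h2]
  simp

theorem dd_comm {g : V3 → ℝ} (hg : ContDiff ℝ (⊤ : ℕ∞) g) (i j : Fin 3) :
    dd i (dd j g) = dd j (dd i g) := by
  funext y
  rw [dd_dd_eq hg, dd_dd_eq hg]
  exact (hg.contDiffAt.isSymmSndFDerivAt (by simp; norm_cast)) _ _

theorem dd_const_mul {g : V3 → ℝ} (hg : Differentiable ℝ g) (c : ℝ) (i : Fin 3) :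
    dd i (fun y => c * g y) = fun y => c * dd i g y := by
  funext y
  unfold dd
  rw [fderiv_const_mul (hg y)]
  simp

theorem dd_sum {ι : Type*} (s : Finset ι) {g : ι → V3 → ℝ} (hg : ∀ k ∈ s, Differentiable ℝ (g k)) (i : Fin 3) :
    dd i (fun y => ∑ k ∈ s, g k y) = fun y => ∑ k ∈ s, dd i (g k) y := by
  funext y
  unfold dd
  rw [fderiv_fun_sum fun k hk => hg k hk y]
  simp

theorem Sol.dd {lam : ℝ} {g : V3 → ℝ} (hg : Sol lam g) (i : Fin 3) : Sol lam (dd i g) := by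
  refine ⟨contDiff_dd hg.smooth i, fun y => ?_⟩
  have h1 : ∀ j, HighFreq.dd j (HighFreq.dd j (HighFreq.dd i g)) =
      HighFreq.dd i (HighFreq.dd j (HighFreq.dd j g)) := fun j => by
    rw [dd_comm hg.smooth j i, dd_comm (contDiff_dd hg.smooth j) j i]
  have hd : ∀ j, Differentiable ℝ (HighFreq.dd j (HighFreq.dd j g)) := fun j =>
    (contDiff_dd (contDiff_dd hg.smooth j) j).differentiable (by simp)
  have h2 : (fun y => ∑ j, HighFreq.dd j (HighFreq.dd j g) y) = fun y => - lam ^ 2 * g y := by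
    funext y; exact hg.eq y
  have h3 := dd_sum Finset.univ (fun j _ => hd j) i
  rw [h2, dd_const_mul (hg.smooth.differentiable (by simp))] at h3
  simp only [h1]
  exact (congrFun h3 y).symm

theorem integral_jj_ph_pos (lam : ℝ) {T : ℝ} (hT : 0 < T) (h : lam ^ 2 * T ≤ 1) (n : ℕ) :
    0 < ∫ y, jj lam y * ph T (n + 1) y := by
  refine Continuous.integral_pos_of_hasCompactSupport_nonneg_nonzero
    ((continuous_jj lam).mul (continuous_ph T (n + 1)))
    (hasCompactSupport_ph hT n).mul_left (fun y => ?_) (x := 0) ?_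
  · rcases le_total T (‖y‖ ^ 2) with h1 | h1
    · simp [ph_eq_zero hT n h1]
    · refine mul_nonneg ?_ (ph_nonneg _ _ _)
      have h2 : |lam * ‖y‖| ≤ 1 := by
        rw [← sq_le_one_iff_abs_le_one, mul_pow]
        exact (mul_le_mul_of_nonneg_left h1 (sq_nonneg _)).trans h
      rw [jj]
      rcases eq_or_ne (lam * ‖y‖) 0 with h3 | h3
      · rw [h3, sinc_zero]; exact zero_le_one
      · rw [sinc_of_ne_zero h3]
        rcases le_total 0 (lam * ‖y‖) with h4 | h4
        · refine div_nonneg (sin_nonneg_of_nonneg_of_le_pi h4 ?_) h4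
          linarith [le_abs_self (lam * ‖y‖), pi_gt_three]
        · refine div_nonneg_of_nonpos (sin_nonpos_of_nonpos_of_neg_pi_le h4 ?_) h4
          linarith [neg_abs_le (lam * ‖y‖), pi_gt_three]
  · simp [jj, ph]

theorem exists_elliptic {lam : ℝ} (hl : 0 < lam) : ∃ C : ℝ, 0 < C ∧ ∀ g : V3 → ℝ, Sol lam g →
    ∀ (i : Fin 3) (x : V3) (S : ℝ), (∀ z, ‖z - x‖ ≤ 1 → |g z| ≤ S) → |dd i g x| ≤ C * S := by
  set T : ℝ := 1 / (1 + lam ^ 2) with hTdef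
  have hT : 0 < T := by positivity
  have hT1 : T ≤ 1 := by
    rw [hTdef, div_le_one (by positivity)]; nlinarith [sq_nonneg lam]
  have hT2 : lam ^ 2 * T ≤ 1 := by
    rw [hTdef, mul_one_div, div_le_one (by positivity)]; linarith
  have hm := integral_jj_ph_pos lam hT hT2 2
  set m := ∫ y, jj lam y * ph T (2 + 1) y with hmdef
  set B := ∫ y : V3, ‖y‖ * ph T 2 y with hB
  have hB0 : 0 ≤ B := integral_nonneg fun y => mul_nonneg (norm_nonneg _) (ph_nonneg _ _ _)
  refine ⟨6 / T * B / m + 1, by positivity, fun g hg i x S hS => ?_⟩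
  have hS0 : 0 ≤ S := (abs_nonneg _).trans (hS x (by simp))
  have h1 := ((hg.dd i).translate x).integral_ph hl hT 2
  rw [add_zero, ← hmdef] at h1
  have h2 := integral_mul_dd_ph hT 1 (hg.translate x).smooth i
  rw [dd_translate] at h2
  change _ = - ∫ y, dd i g (x + y) * ph T (2 + 1) y at h2
  rw [h1, dd_ph] at h2
  have h3 : |dd i g x * m| ≤ 6 / T * (S * B) := by
    rw [← abs_neg, ← h2]
    rw [hB, ← integral_const_mul, ← integral_const_mul]
    refine (abs_integral_le_integral_abs).trans (integral_mono_of_nonneg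
      (Filter.Eventually.of_forall fun y => abs_nonneg _) ?_ (Filter.Eventually.of_forall fun y => ?_))
    · exact ((integrable_mul_ph hT 1 continuous_norm).const_mul _).const_mul _
    · simp only
      have e : (2 * ((1 : ℕ) + 2 : ℝ) / T) = 6 / T := by norm_num
      rw [e, abs_mul, abs_mul, abs_neg, abs_of_pos (by positivity : 0 < 6 / T), abs_mul,
        abs_of_nonneg (ph_nonneg T (1 + 1) y), show 1 + 1 = 2 from rfl]
      rcases le_total T (‖y‖ ^ 2) with h | h
      · rw [ph_eq_zero hT 1 h]; simp
      · have hy : ‖y‖ ≤ 1 := by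
          have : ‖y‖ ^ 2 ≤ 1 := h.trans hT1
          exact (sq_le_one_iff₀ (norm_nonneg _)).1 this
        have a1 := hS (x + y) (by simpa using hy)
        have a2 : |y i| ≤ ‖y‖ := EuclideanSpace.norm_eq y ▸ by
          rw [← sqrt_sq_eq_abs]
          refine sqrt_le_sqrt ?_
          have := Finset.single_le_sum (f := fun j => ‖y j‖ ^ 2) (fun j _ => sq_nonneg _) (Finset.mem_univ i)
          simpa using this
        have a3 := ph_nonneg T 2 y
        calc |g (x + y)| * (6 / T * (|y i| * ph T 2 y)) = 6 / T * (|g (x + y)| * (|y i| * ph T 2 y)) := by ring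
          _ ≤ 6 / T * (S * (‖y‖ * ph T 2 y)) := by gcongr
  rw [abs_mul, abs_of_pos hm, ← le_div_iff₀ hm] at h3
  refine h3.trans ?_
  have : 6 / T * (S * B) / m = 6 / T * B / m * S := by ring
  rw [this]
  nlinarith

theorem integral_volumeIoiPow (n : ℕ) (f : ℝ → ℝ) :
    ∫ r : Ioi (0 : ℝ), f r ∂(Measure.volumeIoiPow n) = ∫ r in Ioi (0 : ℝ), r ^ n * f r := by
  simp only [Measure.volumeIoiPow, ENNReal.ofReal]
  rw [integral_withDensity_eq_integral_smul ((measurable_subtype_coe.pow_const _).real_toNNReal),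
    integral_subtype_comap measurableSet_Ioi fun a ↦ Real.toNNReal (a ^ n) • f a,
    setIntegral_congr_fun measurableSet_Ioi fun x hx ↦ ?_]
  simp only [NNReal.smul_def, smul_eq_mul]
  rw [Real.coe_toNNReal _ (pow_nonneg (le_of_lt hx) _)]

theorem integral_polar {H : V3 → ℝ} (hH : Integrable H) {R : ℝ} (hR : 0 ≤ R)
    (h0 : ∀ z, R < ‖z‖ → H z = 0) :
    ∫ z, H z = ∫ ω : Metric.sphere (0 : V3) 1, (∫ r in (0 : ℝ)..R, r ^ 2 * H (r • (ω : V3)))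
      ∂(volume : Measure V3).toSphere := by
  have e : Module.finrank ℝ V3 = 3 := by simp
  have mp := (volume : Measure V3).measurePreserving_homeomorphUnitSphereProd
  have me := (homeomorphUnitSphereProd V3).measurableEmbedding
  rw [e] at mp
  set G : Metric.sphere (0 : V3) 1 × Ioi (0 : ℝ) → ℝ := fun p => H (p.2.1 • (p.1 : V3)) with hG
  have hcomp : (fun z : ({0}ᶜ : Set V3) => H z) = G ∘ homeomorphUnitSphereProd V3 := by
    funext z
    simp only [hG, Function.comp, homeomorphUnitSphereProd_apply_snd_coe,
      homeomorphUnitSphereProd_apply_fst_coe]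
    rw [smul_smul, mul_inv_cancel₀ (norm_ne_zero_iff.2 z.2), one_smul]
  have ms : MeasurableSet ({0}ᶜ : Set V3) := (measurableSet_singleton _).compl
  have hi : Integrable G ((volume : Measure V3).toSphere.prod (Measure.volumeIoiPow 2)) := by
    rw [← mp.integrable_comp_emb me, ← hcomp]
    have := (integrableOn_iff_comap_subtypeVal (f := H) (μ := volume) ms).1 hH.integrableOn
    exact this
  calc ∫ z, H z = ∫ z : ({0}ᶜ : Set V3), H z ∂(Measure.comap Subtype.val volume) := by
        rw [integral_subtype_comap ms H, restrict_compl_singleton]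
    _ = ∫ p, G p ∂((volume : Measure V3).toSphere.prod (Measure.volumeIoiPow 2)) := by
        rw [← mp.integral_comp me]
        rw [hcomp]; rfl
    _ = ∫ ω, (∫ r, G (ω, r) ∂(Measure.volumeIoiPow 2)) ∂(volume : Measure V3).toSphere :=
        integral_prod _ hi
    _ = _ := by
      congr 1
      funext ω
      simp only [hG]
      rw [integral_volumeIoiPow 2 (fun r => H (r • (ω : V3))), intervalIntegral.integral_of_le hR]
      rw [← integral_indicator measurableSet_Ioi, ← integral_indicator measurableSet_Ioc]
      congr 1
      funext r
      by_cases h : r ∈ Ioc 0 R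
      · rw [indicator_of_mem h, indicator_of_mem (show r ∈ Ioi (0 : ℝ) from h.1)]
      · rw [indicator_of_notMem h]
        by_cases h' : r ∈ Ioi (0 : ℝ)
        · have h2 : R < r := not_le.1 fun h2 => h ⟨h', h2⟩
          rw [indicator_of_mem h', h0, mul_zero]
          rw [norm_smul, norm_eq_of_mem_sphere, mul_one, Real.norm_eq_abs]
          exact h2.trans_le (le_abs_self r)
        · rw [indicator_of_notMem h']

theorem vB_pos : 0 < vB := vol_ball_pos

theorem Lam_eq_integral_sphere {f : V3 → ℝ} (hf : Continuous f) :
    3 * vB * Lam f = ∫ ω : Metric.sphere (0 : V3) 1, f ω ∂(volume : Measure V3).toSphere := by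
  have e1 : vB * Lam f = ∫ x in Metric.ball (0 : V3) 1, f (‖x‖⁻¹ • x) := by
    rw [Lam, ← vB, mul_div_cancel₀ _ vB_pos.ne']
  rw [mul_assoc, e1, ← integral_indicator measurableSet_ball]
  rw [integral_polar (R := 1) ((integrable_indicator_iff measurableSet_ball).2 (integrableOn_dir hf))
    zero_le_one (fun z hz => indicator_of_notMem (by simpa using hz.le) _), ← integral_const_mul]
  congr 1
  funext ω
  have : ∫ r in (0 : ℝ)..1, r ^ 2 * (Metric.ball (0 : V3) 1).indicator (fun x => f (‖x‖⁻¹ • x))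
      (r • (ω : V3)) = ∫ r in (0 : ℝ)..1, r ^ 2 * f ω := by
    refine intervalIntegral.integral_congr_ae ?_
    have : ∀ᵐ r : ℝ, r ≠ 1 := by simp [ae_iff]
    filter_upwards [this] with r hr hr'
    rw [uIoc_of_le zero_le_one] at hr'
    have hn : ‖r • (ω : V3)‖ = r := by
      rw [norm_smul, norm_eq_of_mem_sphere, mul_one, Real.norm_eq_abs, abs_of_pos hr'.1]
    rw [indicator_of_mem, hn, smul_smul, inv_mul_cancel₀ hr'.1.ne', one_smul]
    rw [mem_ball_zero_iff, hn]
    exact lt_of_le_of_ne hr'.2 hr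
  rw [this]
  simp [integral_pow]
  ring

theorem integral_eq_Lam {H F : V3 → ℝ} (hH : Integrable H) {R : ℝ} (hR : 0 ≤ R)
    (h0 : ∀ z, R < ‖z‖ → H z = 0) (hF : Continuous F)
    (hFH : ∀ ω : V3, ‖ω‖ = 1 → F ω = ∫ r in (0 : ℝ)..R, r ^ 2 * H (r • ω)) :
    ∫ z, H z = 3 * vB * Lam F := by
  rw [integral_polar hH hR h0, Lam_eq_integral_sphere hF]
  congr 1
  funext ω
  exact (hFH ω (norm_eq_of_mem_sphere ω)).symm

/-- A compactly supported radial reproducing kernel at scale `R`. -/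
def KR (lam R : ℝ) (y : V3) : ℝ := ph (R ^ 2) 3 y * (lam / R * Real.sinc (lam * ‖y‖))

/-- The far-field form of the reproducing kernel. -/
def KP (lam R : ℝ) (x z : V3) : ℝ :=
  ph (R ^ 2) 3 z * (1 / R * (Real.sin (lam * (‖z‖ - inner ℝ x z / ‖z‖)) / ‖z‖))

theorem abs_pow_three_sub_le {a b : ℝ} (ha : a ∈ Icc (0 : ℝ) 1) (hb : b ∈ Icc (0 : ℝ) 1) :
    |a ^ 3 - b ^ 3| ≤ 3 * |a - b| := by
  have : a ^ 3 - b ^ 3 = (a ^ 2 + a * b + b ^ 2) * (a - b) := by ring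
  rw [this, abs_mul]
  refine mul_le_mul_of_nonneg_right ?_ (abs_nonneg _)
  obtain ⟨a0, a1⟩ := ha
  obtain ⟨b0, b1⟩ := hb
  rw [abs_of_nonneg (by positivity)]
  nlinarith

theorem abs_ph_sub_le {R : ℝ} (hR : 0 < R) (y z : V3) :
    |ph (R ^ 2) 3 y - ph (R ^ 2) 3 z| ≤ 3 * (|‖y‖ ^ 2 - ‖z‖ ^ 2| / R ^ 2) := by
  have hT : 0 < R ^ 2 := by positivity
  have h := abs_pow_three_sub_le (ph_one_mem hT y) (ph_one_mem hT z)
  have e : ∀ y, ph (R ^ 2) 1 y ^ 3 = ph (R ^ 2) 3 y := fun y => by simp only [ph, pow_one]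
  rw [e, e] at h
  refine h.trans (mul_le_mul_of_nonneg_left ?_ (by norm_num))
  simp only [ph, pow_one]
  refine (abs_max_sub_max_le_abs _ _ _).trans (le_of_eq ?_)
  rw [← abs_of_pos hT, ← abs_div, abs_of_pos hT, ← abs_neg]
  congr 1; ring

theorem KR_eq_zero (lam : ℝ) {R : ℝ} (hR : 0 < R) {y : V3} (h : R ≤ ‖y‖) : KR lam R y = 0 := by
  rw [KR, ph_eq_zero (by positivity) 2 (by gcongr), zero_mul]

theorem KP_eq_zero (lam : ℝ) {R : ℝ} (hR : 0 < R) (x : V3) {z : V3} (h : R ≤ ‖z‖) :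
    KP lam R x z = 0 := by
  rw [KP, ph_eq_zero (by positivity) 2 (by gcongr), zero_mul]

theorem abs_sub_le_of_sq {ρ τ s A : ℝ} (hs : 0 < s) (h1 : s / 2 ≤ ρ) (h2 : s / 2 ≤ τ)
    (h : |ρ ^ 2 - τ ^ 2| ≤ A) : |ρ - τ| ≤ A / s := by
  rw [le_div_iff₀ hs]
  have e : ρ ^ 2 - τ ^ 2 = (ρ - τ) * (ρ + τ) := by ring
  rw [e, abs_mul] at h
  refine le_trans (mul_le_mul_of_nonneg_left ?_ (abs_nonneg _)) h
  refine le_trans ?_ (le_abs_self _)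
  linarith

theorem ker_far {lam A R : ℝ} (hl : 0 < lam) (hA : 0 ≤ A) (hR : 1 ≤ R) {x z : V3}
    (hx : ‖x‖ ≤ A) (hz : 2 * A + 1 ≤ ‖z‖) :
    |KR lam R (z - x) - KP lam R x z| ≤ 1 / R * ((74 * A + lam * A ^ 2) / ‖z‖ ^ 2) := by
  have hR0 : 0 < R := by linarith
  set s := ‖z‖ with hs
  set ρ := ‖z - x‖ with hρ
  have hs1 : 1 ≤ s := by linarith
  have hs0 : 0 < s := by linarith
  have hρs : |ρ - s| ≤ A := by
    refine (abs_norm_sub_norm_le _ _).trans ?_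
    simpa using hx
  have hρ2 : s / 2 ≤ ρ := by linarith [neg_abs_le (ρ - s)]
  have hρ0 : 0 < ρ := by linarith
  have hin : |inner ℝ x z / s| ≤ A := by
    rw [abs_div, abs_of_pos hs0, div_le_iff₀ hs0]
    exact (abs_real_inner_le_norm x z).trans (mul_le_mul_of_nonneg_right hx hs0.le)
  set τ := s - inner ℝ x z / s with hτ
  have hτ2 : s / 2 ≤ τ := by linarith [le_abs_self (inner ℝ x z / s)]
  have hd : |ρ - τ| ≤ A ^ 2 / s := by
    refine abs_sub_le_of_sq hs0 hρ2 hτ2 ?_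
    have e1 : ρ ^ 2 = s ^ 2 - 2 * inner ℝ x z + ‖x‖ ^ 2 := by
      rw [hρ, norm_sub_sq_real, real_inner_comm]
    have e2 : τ ^ 2 = s ^ 2 - 2 * inner ℝ x z + (inner ℝ x z / s) ^ 2 := by
      rw [hτ]; field_simp; ring
    rw [e1, e2]
    have b1 : (inner ℝ x z / s) ^ 2 ≤ A ^ 2 := sq_le_sq' (by linarith [neg_abs_le (inner ℝ x z / s)])
      (by linarith [le_abs_self (inner ℝ x z / s)])
    have b2 : ‖x‖ ^ 2 ≤ A ^ 2 := by gcongr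
    rw [abs_le]
    constructor <;> nlinarith [sq_nonneg (inner ℝ x z / s), sq_nonneg ‖x‖]
  have hsin : |Real.sin (lam * ρ) - Real.sin (lam * τ)| ≤ lam * (A ^ 2 / s) := by
    refine (Real.abs_sin_sub_sin_le _ _).trans ?_
    rw [← mul_sub, abs_mul, abs_of_pos hl]
    exact mul_le_mul_of_nonneg_left hd hl.le
  set p := ph (R ^ 2) 3 (z - x) with hp
  set p' := ph (R ^ 2) 3 z with hp'
  have hpp : |p - p'| ≤ 36 * A / s := by
    rcases le_or_gt s (2 * R) with h | h
    · refine (abs_ph_sub_le hR0 _ _).trans ?_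
      rw [← hs, ← hρ]
      have b1 : |ρ ^ 2 - s ^ 2| ≤ A * (3 * s) := by
        rw [show ρ ^ 2 - s ^ 2 = (ρ - s) * (ρ + s) by ring, abs_mul, abs_of_pos (by linarith : 0 < ρ + s)]
        refine mul_le_mul hρs ?_ (by linarith) hA
        linarith [le_abs_self (ρ - s)]
      rw [le_div_iff₀ hs0, ← mul_div_assoc, div_mul_eq_mul_div, div_le_iff₀ (by positivity)]
      have b2 : s ^ 2 ≤ 4 * R ^ 2 := by nlinarith
      have b3 := mul_le_mul_of_nonneg_right b1 hs0.le
      nlinarith [mul_le_mul_of_nonneg_left b2 hA]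
    · have z1 : p = 0 := ph_eq_zero (by positivity) 2 (by
        have : R ≤ ‖z - x‖ := by rw [← hρ]; linarith [neg_abs_le (ρ - s)]
        gcongr)
      have z2 : p' = 0 := ph_eq_zero (by positivity) 2 (by
        have : R ≤ ‖z‖ := by rw [← hs]; linarith
        gcongr)
      rw [z1, z2, sub_zero, abs_zero]; positivity
  have e : KR lam R (z - x) - KP lam R x z = 1 / R * ((p - p') * (Real.sin (lam * ρ) / ρ) +
      p' * (Real.sin (lam * ρ) * ((s - ρ) / (ρ * s))) +
      p' * ((Real.sin (lam * ρ) - Real.sin (lam * τ)) / s)) := by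
    rw [KR, KP, ← hs, ← hρ, ← hτ, ← hp, ← hp', Real.sinc_of_ne_zero (by positivity)]
    field_simp
    ring
  rw [e, abs_mul, abs_of_pos (by positivity : 0 < 1 / R)]
  refine mul_le_mul_of_nonneg_left ?_ (by positivity)
  have hp1 : |p'| ≤ 1 := by
    rw [abs_of_nonneg (ph_nonneg _ _ _)]; exact ph_le_one (by positivity) _ _
  have hsn : |Real.sin (lam * ρ)| ≤ 1 := Real.abs_sin_le_one _
  have t1 : |(p - p') * (Real.sin (lam * ρ) / ρ)| ≤ 36 * A / s * (2 / s) := by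
    rw [abs_mul]
    refine mul_le_mul hpp ?_ (abs_nonneg _) (by positivity)
    rw [abs_div, abs_of_pos hρ0, div_le_div_iff₀ hρ0 hs0]
    nlinarith
  have t2 : |p' * (Real.sin (lam * ρ) * ((s - ρ) / (ρ * s)))| ≤ 2 * A / s ^ 2 := by
    rw [abs_mul, abs_mul]
    have : |(s - ρ) / (ρ * s)| ≤ 2 * A / s ^ 2 := by
      rw [abs_div, abs_of_pos (by positivity : 0 < ρ * s), abs_sub_comm,
        div_le_div_iff₀ (by positivity) (by positivity)]
      calc |ρ - s| * s ^ 2 ≤ A * s ^ 2 := by gcongr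
        _ = A * s * s := by ring
        _ ≤ A * s * (2 * ρ) := by gcongr; linarith
        _ = _ := by ring
    calc |p'| * (|Real.sin (lam * ρ)| * |(s - ρ) / (ρ * s)|) ≤ 1 * (1 * (2 * A / s ^ 2)) := by gcongr
      _ = _ := by ring
  have t3 : |p' * ((Real.sin (lam * ρ) - Real.sin (lam * τ)) / s)| ≤ lam * (A ^ 2 / s) / s := by
    rw [abs_mul, abs_div, abs_of_pos hs0]
    calc |p'| * (|Real.sin (lam * ρ) - Real.sin (lam * τ)| / s) ≤ 1 * (lam * (A ^ 2 / s) / s) := by gcongr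
      _ = _ := by ring
  refine (abs_add_le _ _).trans ((add_le_add (abs_add_le _ _) le_rfl).trans ?_)
  refine (add_le_add (add_le_add t1 t2) t3).trans (le_of_eq ?_)
  field_simp
  ring

theorem ker_near {lam B R : ℝ} (hl : 0 < lam) (hB : 1 ≤ B) (hR : 1 ≤ R) {x z : V3}
    (hz0 : z ≠ 0) (hz : ‖z‖ ≤ B) :
    |KR lam R (z - x) - KP lam R x z| ≤ 1 / R * ((lam * B ^ 2 + B) / (‖z‖ * √‖z‖)) := by
  have hR0 : 0 < R := by linarith
  have hs : 0 < ‖z‖ := norm_pos_iff.2 hz0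
  set s := ‖z‖
  have hq : √s ≤ B := by
    rw [Real.sqrt_le_left (by linarith)]; nlinarith
  have hq0 : 0 < √s := Real.sqrt_pos.2 hs
  have b1 : |KR lam R (z - x)| ≤ 1 / R * lam := by
    rw [KR, abs_mul, abs_of_nonneg (ph_nonneg _ _ _), abs_mul, abs_of_pos (by positivity)]
    calc ph (R ^ 2) 3 (z - x) * (lam / R * |Real.sinc (lam * ‖z - x‖)|) ≤ 1 * (lam / R * 1) := by
          have := ph_le_one (by positivity : 0 < R ^ 2) 3 (z - x)
          have := Real.abs_sinc_le_one (lam * ‖z - x‖)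
          gcongr
      _ = _ := by ring
  have b2 : |KP lam R x z| ≤ 1 / R * (1 / s) := by
    rw [KP, abs_mul, abs_of_nonneg (ph_nonneg _ _ _), abs_mul, abs_of_pos (by positivity : 0 < 1 / R),
      abs_div, abs_of_pos hs]
    calc _ ≤ 1 * (1 / R * (1 / s)) := by
          have := ph_le_one (by positivity : 0 < R ^ 2) 3 z
          have := Real.abs_sin_le_one (lam * (s - inner ℝ x z / s))
          gcongr
      _ = _ := by ring
  refine (abs_sub _ _).trans ((add_le_add b1 b2).trans ?_)
  rw [← mul_add]
  refine mul_le_mul_of_nonneg_left ?_ (by positivity)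
  rw [le_div_iff₀ (by positivity)]
  have : (lam + 1 / s) * (s * √s) = lam * (s * √s) + √s := by field_simp
  rw [this]
  have : s * √s ≤ B ^ 2 := by rw [sq]; gcongr
  have := mul_le_mul_of_nonneg_left this hl.le
  linarith

theorem exists_ker_bound {lam A : ℝ} (hl : 0 < lam) (hA : 0 ≤ A) : ∃ D : ℝ, 0 < D ∧
    ∀ R : ℝ, 1 ≤ R → ∀ x z : V3, ‖x‖ ≤ A → z ≠ 0 →
      |KR lam R (z - x) - KP lam R x z| ≤ 1 / R * (D / (‖z‖ * √‖z‖)) := by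
  refine ⟨lam * (2 * A + 1) ^ 2 + (2 * A + 1) + (74 * A + lam * A ^ 2), by positivity,
    fun R hR x z hx hz => ?_⟩
  have hs : 0 < ‖z‖ := norm_pos_iff.2 hz
  have hq0 : 0 < √‖z‖ := Real.sqrt_pos.2 hs
  rcases le_total ‖z‖ (2 * A + 1) with h | h
  · refine (ker_near hl (by linarith) hR hz h).trans ?_
    refine mul_le_mul_of_nonneg_left (div_le_div_of_nonneg_right ?_ (by positivity)) (by positivity)
    have : 0 ≤ 74 * A + lam * A ^ 2 := by positivity
    linarith
  · refine (ker_far hl hA hR hx h).trans ?_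
    have h1 : 1 ≤ ‖z‖ := by linarith
    have h2 : √‖z‖ ≤ ‖z‖ := by
      rw [Real.sqrt_le_left hs.le]; nlinarith
    gcongr ?_ * (?_ / ?_)
    · have : 0 ≤ lam * (2 * A + 1) ^ 2 + (2 * A + 1) := by positivity
      linarith
    · rw [sq]; gcongr

theorem continuous_KR (lam R : ℝ) : Continuous (KR lam R) := by
  have := continuous_ph (R ^ 2) 3
  have h2 : Continuous fun y : V3 => Real.sinc (lam * ‖y‖) := continuous_jj lam
  unfold KR
  fun_prop

/-- The normalization of the reproducing kernel. -/
def mR (lam R : ℝ) : ℝ := ∫ y, jj lam y * KR lam R y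

theorem integral_sin_sq_ge {lam a : ℝ} (hl : 0 < lam) :
    a / 2 - 1 / (4 * lam) ≤ ∫ r in (0 : ℝ)..a, Real.sin (lam * r) ^ 2 := by
  have key : ∀ r : ℝ, HasDerivAt (fun r => r / 2 - Real.sin (lam * r) * Real.cos (lam * r) / (2 * lam))
      (Real.sin (lam * r) ^ 2) r := by
    intro r
    have hl' : HasDerivAt (fun r : ℝ => lam * r) lam r := by
      simpa using (hasDerivAt_id r).const_mul lam
    have h := ((hasDerivAt_id r).div_const 2).sub ((hl'.sin.mul hl'.cos).div_const (2 * lam))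
    refine h.congr_deriv ?_
    have := Real.sin_sq_add_cos_sq (lam * r)
    field_simp
    linear_combination -this
  rw [intervalIntegral.integral_eq_sub_of_hasDerivAt (fun r _ => key r)
    (Continuous.intervalIntegrable (by fun_prop) _ _)]
  have h1 : Real.sin (lam * a) * Real.cos (lam * a) ≤ 1 / 2 := by
    nlinarith [sq_nonneg (Real.sin (lam * a) - Real.cos (lam * a)), Real.sin_sq_add_cos_sq (lam * a)]
  have h2 : Real.sin (lam * a) * Real.cos (lam * a) / (2 * lam) ≤ 1 / 2 / (2 * lam) := by gcongr
  have h3 : 1 / 2 / (2 * lam) = 1 / (4 * lam) := by field_simp; norm_num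
  simp only [mul_zero, sin_zero, zero_mul, zero_div, sub_zero]
  linarith

theorem mR_ge {lam R : ℝ} (hl : 0 < lam) (hR : 2 / lam ≤ R) : vB / (8 * lam) ≤ mR lam R := by
  have hR0 : 0 < R := lt_of_lt_of_le (by positivity) hR
  have hT : 0 < R ^ 2 := by positivity
  have e : mR lam R = ∫ y : V3, Real.sinc (lam * ‖y‖) * (lam / R * Real.sinc (lam * ‖y‖)) *
      ph (R ^ 2) (2 + 1) y := by
    rw [mR]; congr 1; funext y; rw [jj, KR]; ring
  have e2 := integral_radial_ph (fun r => Real.sinc (lam * r) * (lam / R * Real.sinc (lam * r))) hT 2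
  rw [sqrt_sq hR0.le] at e2
  rw [e.trans e2]
  have c1 : Continuous fun r : ℝ => r ^ 2 * (Real.sinc (lam * r) * (lam / R * Real.sinc (lam * r)) *
      (1 - r ^ 2 / R ^ 2) ^ (2 + 1)) := by
    have := Real.continuous_sinc
    fun_prop
  have hsq : ∀ r : ℝ, r ^ 2 * (Real.sinc (lam * r) * (lam / R * Real.sinc (lam * r)) *
      (1 - r ^ 2 / R ^ 2) ^ (2 + 1)) = 1 / (lam * R) * (Real.sin (lam * r) ^ 2 * (1 - r ^ 2 / R ^ 2) ^ 3) := by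
    intro r
    rcases eq_or_ne r 0 with h | h
    · simp [h]
    · rw [Real.sinc_of_ne_zero (by positivity)]
      generalize 1 - r ^ 2 / R ^ 2 = v
      field_simp
  have h1 : (1 / (lam * R) * (27 / 64)) * ∫ r in (0 : ℝ)..(R / 2), Real.sin (lam * r) ^ 2 ≤
      ∫ r in (0 : ℝ)..R, r ^ 2 * (Real.sinc (lam * r) * (lam / R * Real.sinc (lam * r)) *
      (1 - r ^ 2 / R ^ 2) ^ (2 + 1)) := by
    have u1 : ∀ r ∈ Icc (0 : ℝ) R, 0 ≤ 1 - r ^ 2 / R ^ 2 := by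
      intro r hr
      rw [sub_nonneg, div_le_one hT]
      exact pow_le_pow_left₀ hr.1 hr.2 2
    rw [← intervalIntegral.integral_const_mul]
    refine le_trans (intervalIntegral.integral_mono_on (by positivity)
      (Continuous.intervalIntegrable (by fun_prop) _ _) (c1.intervalIntegrable _ _) fun r hr => ?_)
      (intervalIntegral.integral_mono_interval le_rfl (by positivity) (by linarith) ?_
        (c1.intervalIntegrable _ _))
    · rw [hsq, mul_assoc]
      refine mul_le_mul_of_nonneg_left ?_ (by positivity)
      have h3 : 3 / 4 ≤ 1 - r ^ 2 / R ^ 2 := by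
        have : r ^ 2 / R ^ 2 ≤ 1 / 4 := by
          rw [div_le_div_iff₀ hT (by norm_num)]
          have := pow_le_pow_left₀ hr.1 hr.2 2
          nlinarith
        linarith
      have h4 : (27 : ℝ) / 64 ≤ (1 - r ^ 2 / R ^ 2) ^ 3 := by
        calc (27 : ℝ) / 64 = (3 / 4) ^ 3 := by norm_num
          _ ≤ _ := by gcongr
      rw [mul_comm]
      exact mul_le_mul_of_nonneg_left h4 (sq_nonneg _)
    · rw [Filter.EventuallyLE, ae_restrict_iff' measurableSet_Ioc]
      refine Filter.Eventually.of_forall fun r hr => ?_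
      rw [hsq]
      have := u1 r ⟨hr.1.le, hr.2⟩
      simp only [Pi.zero_apply]
      positivity
  have h2 := integral_sin_sq_ge hl (a := R / 2)
  have h3 : R / 8 ≤ R / 2 / 2 - 1 / (4 * lam) := by
    rw [div_le_iff₀ hl] at hR
    have : 1 / (4 * lam) ≤ R / 8 := by
      rw [div_le_div_iff₀ (by positivity) (by norm_num)]; linarith
    linarith
  have hv := vB_pos
  calc vB / (8 * lam) ≤ 3 * vB * ((1 / (lam * R) * (27 / 64)) * (R / 8)) := by
        have : 3 * vB * ((1 / (lam * R) * (27 / 64)) * (R / 8)) = 81 / 64 * (vB / (8 * lam)) := by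
          field_simp; norm_num
        rw [this]
        have : 0 < vB / (8 * lam) := by positivity
        linarith
    _ ≤ _ := by
        refine mul_le_mul_of_nonneg_left (le_trans ?_ h1) (by positivity)
        exact mul_le_mul_of_nonneg_left (h3.trans h2) (by positivity)

theorem Sol.reproducing {lam : ℝ} (hl : 0 < lam) {g : V3 → ℝ} (hg : Sol lam g) {R : ℝ} (hR : 0 < R)
    (x : V3) : ∫ z, g z * KR lam R (z - x) = g x * mR lam R := by
  have hk : Continuous fun r : ℝ => (max (1 - r ^ 2 / R ^ 2) 0) ^ 2 * (lam / R * Real.sinc (lam * r)) := by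
    have := Real.continuous_sinc
    fun_prop
  have h := hg.mean hl (by positivity : 0 < R ^ 2) hk x
  have e : ∀ y : V3, ph (R ^ 2) 1 y * ((max (1 - ‖y‖ ^ 2 / R ^ 2) 0) ^ 2 *
      (lam / R * Real.sinc (lam * ‖y‖))) = KR lam R y := by
    intro y; rw [KR]; simp only [ph]; ring
  simp only [e] at h
  rw [mR, ← h, ← integral_add_left_eq_self _ x]
  simp

theorem integrable_mul_KR (lam : ℝ) {g : V3 → ℝ} (hg : Continuous g) {R : ℝ} (hR : 0 < R) (x : V3) :
    Integrable fun z => g z * KR lam R (z - x) := by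
  have c1 : Continuous fun z => KR lam R (z - x) := (continuous_KR lam R).comp (by fun_prop)
  refine (hg.mul c1).integrable_of_hasCompactSupport (HasCompactSupport.mul_left ?_)
  refine HasCompactSupport.intro (isCompact_closedBall x R) fun z hz => ?_
  refine KR_eq_zero lam hR ?_
  rw [Metric.mem_closedBall, dist_eq_norm, not_le] at hz
  exact hz.le

/-- A radial integrable majorant. -/
def maj (R : ℝ) (r : ℝ) : ℝ := if r ≤ R then 1 / (r ^ 2 * √r) else 0

theorem sq_mul_maj (R : ℝ) {r : ℝ} (hr : r ∈ Ioc 0 R) : r ^ 2 * maj R r = r ^ (-(1 / 2) : ℝ) := by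
  have h0 := hr.1
  have : 0 < √r := Real.sqrt_pos.2 h0
  rw [maj, if_pos hr.2, rpow_neg h0.le, ← sqrt_eq_rpow]
  field_simp

theorem integrable_maj (R : ℝ) : Integrable fun z : V3 => maj R ‖z‖ := by
  rw [integrable_fun_norm_addHaar volume (f := maj R)]
  have e : Module.finrank ℝ V3 = 3 := by simp
  rw [e]
  have h1 : IntegrableOn (fun r : ℝ => r ^ (-(1 / 2) : ℝ)) (Ioc 0 R) := by
    rcases le_total 0 R with h | h
    · rw [← intervalIntegrable_iff_integrableOn_Ioc_of_le h]
      exact intervalIntegral.intervalIntegrable_rpow' (by norm_num)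
    · rw [Ioc_eq_empty (not_lt.2 h)]; exact integrableOn_empty
  have h2 : Integrable ((Ioc 0 R).indicator fun r : ℝ => r ^ (-(1 / 2) : ℝ)) :=
    (integrable_indicator_iff measurableSet_Ioc).2 h1
  refine (h2.integrableOn (s := Ioi 0)).congr_fun (fun r hr => ?_) measurableSet_Ioi
  simp only [smul_eq_mul]
  by_cases h : r ≤ R
  · rw [indicator_of_mem (show r ∈ Ioc 0 R from ⟨hr, h⟩), ← sq_mul_maj R ⟨hr, h⟩]
  · rw [indicator_of_notMem (fun h' => h h'.2), maj, if_neg h, mul_zero]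

theorem integral_maj {R : ℝ} (hR : 0 ≤ R) : ∫ z : V3, maj R ‖z‖ = 6 * vB * √R := by
  rw [integral_radial (maj R) hR fun r hr => if_neg (not_le.2 hr)]
  have : ∫ r in (0 : ℝ)..R, r ^ 2 * maj R r = ∫ r in (0 : ℝ)..R, r ^ (-(1 / 2) : ℝ) := by
    refine intervalIntegral.integral_congr_ae (Filter.Eventually.of_forall fun r hr => ?_)
    rw [uIoc_of_le hR] at hr
    exact sq_mul_maj R hr
  rw [this, integral_rpow (Or.inl (by norm_num)), zero_rpow (by norm_num), sqrt_eq_rpow]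
  norm_num
  ring

theorem measurable_KP (lam R : ℝ) (x : V3) : Measurable (KP lam R x) := by
  have h1 : Measurable (ph (R ^ 2) 3) := (continuous_ph _ _).measurable
  have h2 : Measurable fun z : V3 => (inner ℝ x z : ℝ) := (by fun_prop : Continuous fun z : V3 => (inner ℝ x z : ℝ)).measurable
  unfold KP
  fun_prop

/-- Comparison of the reproducing kernel with its far-field form. -/
theorem Sol.far {lam : ℝ} (hl : 0 < lam) {g : V3 → ℝ} (hg : Sol lam g) {C D A R : ℝ} (hD : 0 < D)
    (hC : ∀ z, z ≠ 0 → |g z| ≤ C / ‖z‖) (hR : 1 ≤ R) (hA : A ≤ R) {x : V3} (hx : ‖x‖ ≤ A)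
    (hK : ∀ z : V3, z ≠ 0 → |KR lam R (z - x) - KP lam R x z| ≤ 1 / R * (D / (‖z‖ * √‖z‖))) :
    Integrable (fun z => g z * KP lam R x z) ∧
      |g x * mR lam R - ∫ z, g z * KP lam R x z| ≤ C * D / R * (6 * vB * √(2 * R)) := by
  have hR0 : 0 < R := by linarith
  have cg : Continuous g := hg.smooth.continuous
  have ckr : Continuous fun z => KR lam R (z - x) := (continuous_KR lam R).comp (by fun_prop)
  have hbd : ∀ z : V3, z ≠ 0 → |g z * (KR lam R (z - x) - KP lam R x z)| ≤
      C * D / R * maj (2 * R) ‖z‖ := by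
    intro z hz
    have hs : 0 < ‖z‖ := norm_pos_iff.2 hz
    rw [maj]
    split_ifs with h
    · have hq0 : 0 < √‖z‖ := Real.sqrt_pos.2 hs
      have hC0 : 0 ≤ C / ‖z‖ := (abs_nonneg _).trans (hC z hz)
      rw [abs_mul]
      refine (mul_le_mul (hC z hz) (hK z hz) (abs_nonneg _) hC0).trans_eq ?_
      field_simp
    · have h1 : R ≤ ‖z - x‖ := by
        have := norm_sub_norm_le z x
        linarith
      rw [KR_eq_zero lam hR0 h1, KP_eq_zero lam hR0 x (by linarith)]
      simp
  have hae : ∀ᵐ z : V3, z ≠ 0 := by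
    have := measure_singleton (μ := (volume : Measure V3)) (0 : V3)
    exact compl_mem_ae_iff.2 this
  have hgi : Integrable fun z => g z * (KR lam R (z - x) - KP lam R x z) := by
    refine ((integrable_maj (2 * R)).const_mul (C * D / R)).mono'
      (cg.measurable.mul (ckr.measurable.sub (measurable_KP lam R x))).aestronglyMeasurable ?_
    filter_upwards [hae] with z hz
    exact hbd z hz
  have hgi2 := integrable_mul_KR lam cg hR0 x
  have hgi3 : Integrable (fun z => g z * KP lam R x z) := by
    refine (hgi2.sub hgi).congr (Filter.Eventually.of_forall fun z => ?_)
    simp only [Pi.sub_apply]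
    ring
  refine ⟨hgi3, ?_⟩
  rw [← hg.reproducing hl hR0 x, ← integral_sub hgi2 hgi3, ← integral_maj (by linarith),
    ← integral_const_mul]
  rw [← Real.norm_eq_abs]
  refine norm_integral_le_of_norm_le ((integrable_maj (2 * R)).const_mul _) ?_
  filter_upwards [hae] with z hz
  have := hbd z hz
  rwa [mul_sub] at this

/-- The far-field amplitudes. -/
def FA (R : ℝ) (g : V3 → ℝ) (s : ℝ → ℝ) (ω : V3) : ℝ :=
  ∫ r in (0 : ℝ)..R, g (r • ω) * ((max (1 - r ^ 2 / R ^ 2) 0) ^ 3 * (r / R * s r))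

theorem continuous_FA {R : ℝ} {g : V3 → ℝ} (hg : Continuous g) {s : ℝ → ℝ} (hs : Continuous s) :
    Continuous (FA R g s) := by
  unfold FA
  refine intervalIntegral.continuous_parametric_intervalIntegral_of_continuous' ?_ 0 R
  simp only [Function.uncurry_def]
  fun_prop

theorem abs_FA_le {R : ℝ} (hR : 0 < R) {g : V3 → ℝ} {s : ℝ → ℝ} (hs : ∀ r, |s r| ≤ 1) {C : ℝ}
    (hC : ∀ z, z ≠ 0 → |g z| ≤ C / ‖z‖) {ω : V3} (hω : ‖ω‖ = 1) : |FA R g s ω| ≤ C := by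
  have h : ∀ r ∈ uIoc (0 : ℝ) R, ‖g (r • ω) * ((max (1 - r ^ 2 / R ^ 2) 0) ^ 3 * (r / R * s r))‖ ≤ C / R := by
    intro r hr
    rw [uIoc_of_le hR.le] at hr
    have hr0 := hr.1
    have hn : ‖r • ω‖ = r := by rw [norm_smul, hω, mul_one, Real.norm_of_nonneg hr0.le]
    have h1 : |g (r • ω)| ≤ C / r := by
      have := hC (r • ω) (norm_pos_iff.1 (by rw [hn]; exact hr0))
      rwa [hn] at this
    have h2 : (max (1 - r ^ 2 / R ^ 2) 0) ^ 3 ≤ 1 := by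
      refine pow_le_one₀ (le_max_right _ _) (max_le ?_ zero_le_one)
      have : 0 ≤ r ^ 2 / R ^ 2 := by positivity
      linarith
    have h20 : 0 ≤ (max (1 - r ^ 2 / R ^ 2) 0) ^ 3 := pow_nonneg (le_max_right _ _) _
    rw [Real.norm_eq_abs, abs_mul, abs_mul, abs_mul, abs_of_nonneg h20, abs_of_pos (div_pos hr0 hR)]
    have h3 : (max (1 - r ^ 2 / R ^ 2) 0) ^ 3 * (r / R * |s r|) ≤ 1 * (r / R * 1) :=
      mul_le_mul h2 (mul_le_mul_of_nonneg_left (hs r) (by positivity)) (by positivity) zero_le_one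
    refine (mul_le_mul h1 h3 (by positivity) ((abs_nonneg _).trans h1)).trans_eq ?_
    field_simp
  have := intervalIntegral.norm_integral_le_of_norm_le_const h
  rw [sub_zero, abs_of_pos hR, div_mul_cancel₀ _ hR.ne'] at this
  exact this

theorem integral_mul_KP {lam R : ℝ} (hR : 0 < R) {g : V3 → ℝ} (hg : Continuous g) {x : V3}
    (hi : Integrable (fun z => g z * KP lam R x z)) :
    ∫ z, g z * KP lam R x z = 3 * vB * Lam fun ω =>
      FA R g (fun r => Real.sin (lam * r)) ω * Real.cos (lam * inner ℝ x ω) -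
      FA R g (fun r => Real.cos (lam * r)) ω * Real.sin (lam * inner ℝ x ω) := by
  have c1 := continuous_FA (R := R) hg (by fun_prop : Continuous fun r => Real.sin (lam * r))
  have c2 := continuous_FA (R := R) hg (by fun_prop : Continuous fun r => Real.cos (lam * r))
  refine integral_eq_Lam hi hR.le (fun z hz => by rw [KP_eq_zero lam hR x hz.le, mul_zero])
    (by fun_prop) fun ω hω => ?_
  rw [FA, FA, ← intervalIntegral.integral_mul_const, ← intervalIntegral.integral_mul_const,
    ← intervalIntegral.integral_sub (Continuous.intervalIntegrable (by fun_prop) _ _)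
      (Continuous.intervalIntegrable (by fun_prop) _ _)]
  refine intervalIntegral.integral_congr_ae (Filter.Eventually.of_forall fun r hr => ?_)
  rw [uIoc_of_le hR.le] at hr
  have hr0 := hr.1
  have hn : ‖r • ω‖ = r := by rw [norm_smul, hω, mul_one, Real.norm_of_nonneg hr0.le]
  have e1 : lam * (r - inner ℝ x (r • ω) / r) = lam * r - lam * inner ℝ x ω := by
    rw [inner_smul_right]; field_simp
  rw [KP, ph, hn, e1, Real.sin_sub]
  field_simp

/-- A decaying solution of the Helmholtz equation is, locally, a limit of Herglotz waves
with uniformly bounded densities. -/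
theorem Sol.exists_herglotz {lam : ℝ} (hl : 0 < lam) {g : V3 → ℝ} (hg : Sol lam g) {C : ℝ}
    (hC0 : 0 < C) (hC : ∀ z, z ≠ 0 → |g z| ≤ C / ‖z‖) {A η : ℝ} (hA : 0 ≤ A) (hη : 0 < η) :
    ∃ a b : V3 → ℝ, Continuous a ∧ Continuous b ∧
      (∀ ω, ‖ω‖ = 1 → |a ω| ≤ 24 * lam * C) ∧ (∀ ω, ‖ω‖ = 1 → |b ω| ≤ 24 * lam * C) ∧
      ∀ x, ‖x‖ ≤ A → |g x - Lam fun ω => a ω * Real.cos (lam * inner ℝ x ω) -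
        b ω * Real.sin (lam * inner ℝ x ω)| ≤ η := by
  obtain ⟨D, hD, hK⟩ := exists_ker_bound hl hA
  have hv := vB_pos
  set B := C * D * (6 * vB) * (8 * lam / vB) with hB
  have hB0 : 0 < B := by positivity
  obtain ⟨R, hR1, hRA, hRl, hRη⟩ : ∃ R : ℝ, 1 ≤ R ∧ A ≤ R ∧ 2 / lam ≤ R ∧ B * √(2 * R) / R ≤ η := by
    refine ⟨max (max 1 A) (max (2 / lam) (2 * B ^ 2 / η ^ 2)), le_max_of_le_left (le_max_left _ _),
      le_max_of_le_left (le_max_right _ _), le_max_of_le_right (le_max_left _ _), ?_⟩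
    set R := max (max 1 A) (max (2 / lam) (2 * B ^ 2 / η ^ 2))
    have h1 : 1 ≤ R := le_max_of_le_left (le_max_left _ _)
    have h2 : 2 * B ^ 2 / η ^ 2 ≤ R := le_max_of_le_right (le_max_right _ _)
    rw [div_le_iff₀ (by positivity)] at h2
    rw [div_le_iff₀ (by linarith)]
    refine le_of_sq_le_sq ?_ (by positivity)
    rw [mul_pow, mul_pow, sq_sqrt (by linarith)]
    nlinarith
  have hR0 : 0 < R := by linarith
  have cg := hg.smooth.continuous
  have hm := mR_ge hl hRl
  have hm0 : 0 < mR lam R := lt_of_lt_of_le (by positivity) hm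
  have c1 := continuous_FA (R := R) cg (by fun_prop : Continuous fun r => Real.sin (lam * r))
  have c2 := continuous_FA (R := R) cg (by fun_prop : Continuous fun r => Real.cos (lam * r))
  have hq : 3 * vB / mR lam R ≤ 24 * lam := by
    rw [div_le_iff₀ hm0]
    calc 3 * vB = 24 * lam * (vB / (8 * lam)) := by field_simp; norm_num
      _ ≤ _ := by gcongr
  have hbd : ∀ s : ℝ → ℝ, (∀ r, |s r| ≤ 1) → ∀ ω : V3, ‖ω‖ = 1 →
      |3 * vB / mR lam R * FA R g s ω| ≤ 24 * lam * C := by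
    intro s hs ω hω
    rw [abs_mul, abs_of_pos (by positivity)]
    exact mul_le_mul hq (abs_FA_le hR0 hs hC hω) (abs_nonneg _) (by positivity)
  refine ⟨fun ω => 3 * vB / mR lam R * FA R g (fun r => Real.sin (lam * r)) ω,
    fun ω => 3 * vB / mR lam R * FA R g (fun r => Real.cos (lam * r)) ω, by fun_prop, by fun_prop,
    hbd _ fun r => Real.abs_sin_le_one _, hbd _ fun r => Real.abs_cos_le_one _, fun x hx => ?_⟩
  obtain ⟨hi, hf⟩ := hg.far hl hD hC hR1 hRA hx (fun z hz => hK R hR1 x z hx hz)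
  rw [integral_mul_KP hR0 cg hi] at hf
  set L := Lam fun ω => FA R g (fun r => Real.sin (lam * r)) ω * Real.cos (lam * inner ℝ x ω) -
      FA R g (fun r => Real.cos (lam * r)) ω * Real.sin (lam * inner ℝ x ω) with hL
  have e : (Lam fun ω => 3 * vB / mR lam R * FA R g (fun r => Real.sin (lam * r)) ω *
      Real.cos (lam * inner ℝ x ω) - 3 * vB / mR lam R * FA R g (fun r => Real.cos (lam * r)) ω *
      Real.sin (lam * inner ℝ x ω)) = 3 * vB / mR lam R * L := by
    rw [hL, ← Lam_const_mul]; congr 1; funext ω; ring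
  rw [e]
  have e2 : g x - 3 * vB / mR lam R * L = (g x * mR lam R - 3 * vB * L) / mR lam R := by
    field_simp
  rw [e2, abs_div, abs_of_pos hm0, div_le_iff₀ hm0]
  refine hf.trans (le_trans ?_ (mul_le_mul_of_nonneg_left hm hη.le))
  calc C * D / R * (6 * vB * √(2 * R)) = B * √(2 * R) / R * (vB / (8 * lam)) := by
        rw [hB]; field_simp
    _ ≤ _ := mul_le_mul_of_nonneg_right hRη (by positivity)

/-- A function of the coordinates, seen on Euclidean space. -/
def up (f : E3 → ℝ) : V3 → ℝ := fun y => f y.ofLp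

theorem dd_up (i : Fin 3) (f : E3 → ℝ) : dd i (up f) = up (pd i f) := by
  funext y
  have h := (EuclideanSpace.equiv (Fin 3) ℝ).comp_right_fderiv (f := f) (x := y)
  unfold dd
  rw [show up f = f ∘ (EuclideanSpace.equiv (Fin 3) ℝ) from rfl, h]
  simp only [ContinuousLinearMap.comp_apply, up, pd]
  congr 1

theorem norm_toLp (x : E3) : ‖(WithLp.toLp 2 x : V3)‖ = enorm3 x := by
  rw [EuclideanSpace.norm_eq, enorm3]
  simp

theorem contDiff_up {f : E3 → ℝ} : ContDiff ℝ (⊤ : ℕ∞) (up f) ↔ ContDiff ℝ (⊤ : ℕ∞) f := by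
  constructor
  · intro h
    have : f = up f ∘ (EuclideanSpace.equiv (Fin 3) ℝ).symm := by
      funext x; rfl
    rw [this]
    exact h.comp (EuclideanSpace.equiv (Fin 3) ℝ).symm.contDiff
  · intro h
    exact h.comp (EuclideanSpace.equiv (Fin 3) ℝ).contDiff

theorem contDiff_pd {f : E3 → ℝ} (hf : ContDiff ℝ (⊤ : ℕ∞) f) (i : Fin 3) :
    ContDiff ℝ (⊤ : ℕ∞) (pd i f) := by
  rw [← contDiff_up, ← dd_up]
  exact contDiff_dd (contDiff_up.2 hf) i

theorem pd_comm {f : E3 → ℝ} (hf : ContDiff ℝ (⊤ : ℕ∞) f) (i j : Fin 3) (x : E3) :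
    pd i (pd j f) x = pd j (pd i f) x := by
  have := congrFun (dd_comm (contDiff_up.2 hf) i j) (WithLp.toLp 2 x)
  simp only [dd_up] at this
  exact this

theorem pd_lin {f g : E3 → ℝ} (hf : ContDiff ℝ (⊤ : ℕ∞) f) (hg : ContDiff ℝ (⊤ : ℕ∞) g) (c d : ℝ)
    (i : Fin 3) (x : E3) : pd i (fun y => c * f y + d * g y) x = c * pd i f x + d * pd i g x := by
  have h1 := (hf.differentiable (by simp) x).hasFDerivAt
  have h2 := (hg.differentiable (by simp) x).hasFDerivAt
  unfold pd
  rw [((h1.const_mul c).fun_add (h2.const_mul d)).fderiv]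
  simp

theorem pd_sub {f g : E3 → ℝ} (hf : ContDiff ℝ (⊤ : ℕ∞) f) (hg : ContDiff ℝ (⊤ : ℕ∞) g)
    (i : Fin 3) (x : E3) : pd i (fun y => f y - g y) x = pd i f x - pd i g x := by
  have := pd_lin hf hg 1 (-1) i x
  simpa [sub_eq_add_neg] using this

theorem pd_const_mul {f : E3 → ℝ} (hf : ContDiff ℝ (⊤ : ℕ∞) f) (c : ℝ)
    (i : Fin 3) (x : E3) : pd i (fun y => c * f y) x = c * pd i f x := by
  have := pd_lin hf hf c 0 i x
  simpa using this

theorem sol_up {lam : ℝ} {f : E3 → ℝ} (hf : ContDiff ℝ (⊤ : ℕ∞) f)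
    (h : ∀ x, ∑ i, pd i (pd i f) x = - lam ^ 2 * f x) : Sol lam (up f) := by
  refine ⟨contDiff_up.2 hf, fun y => ?_⟩
  simp only [dd_up]
  exact h _

theorem Sol.sum_pd {lam : ℝ} {f : E3 → ℝ} (h : Sol lam (up f)) (x : E3) :
    ∑ i, pd i (pd i f) x = - lam ^ 2 * f x := by
  have := h.eq (WithLp.toLp 2 x)
  simp only [dd_up] at this
  exact this

theorem Sol.pd {lam : ℝ} {f : E3 → ℝ} (h : Sol lam (up f)) (i : Fin 3) : Sol lam (up (pd i f)) := by
  rw [← dd_up]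
  exact h.dd i

theorem Sol.contDiff {lam : ℝ} {f : E3 → ℝ} (h : Sol lam (up f)) : ContDiff ℝ (⊤ : ℕ∞) f :=
  contDiff_up.1 h.smooth

theorem Sol.lin {lam : ℝ} {f g : E3 → ℝ} (hf : Sol lam (up f)) (hg : Sol lam (up g)) (c d : ℝ) :
    Sol lam (up fun x => c * f x + d * g x) := by
  have h1 := hf.contDiff
  have h2 := hg.contDiff
  refine sol_up ((contDiff_const.mul h1).add (contDiff_const.mul h2)) fun x => ?_
  have e : ∀ i, _root_.pd i (_root_.pd i fun x => c * f x + d * g x) x =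
      c * _root_.pd i (_root_.pd i f) x + d * _root_.pd i (_root_.pd i g) x := fun i => by
    rw [show _root_.pd i (fun x => c * f x + d * g x) =
      fun x => c * _root_.pd i f x + d * _root_.pd i g x from funext fun y => pd_lin h1 h2 c d i y]
    exact pd_lin (contDiff_pd h1 i) (contDiff_pd h2 i) c d i x
  have e1 := hf.sum_pd x
  have e2 := hg.sum_pd x
  simp only [e, Finset.sum_add_distrib, ← Finset.mul_sum, e1, e2]
  ring

theorem exists_elliptic_pd {lam : ℝ} (hl : 0 < lam) : ∃ C : ℝ, 1 ≤ C ∧ ∀ f : E3 → ℝ, Sol lam (up f) →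
    ∀ (i : Fin 3) (r S : ℝ), (∀ z, enorm3 z ≤ r + 1 → |f z| ≤ S) →
      ∀ x, enorm3 x ≤ r → |pd i f x| ≤ C * S := by
  obtain ⟨C, hC, h⟩ := exists_elliptic hl
  refine ⟨max C 1, le_max_right _ _, fun f hf i r S hS x hx => ?_⟩
  have h0 : 0 ≤ S := (abs_nonneg _).trans (hS x (by linarith))
  have h1 := h _ hf i (WithLp.toLp 2 x) S fun z hz => ?_
  · rw [dd_up] at h1
    exact h1.trans (mul_le_mul_of_nonneg_right (le_max_left _ _) h0)
  · refine hS z.ofLp ?_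
    rw [← norm_toLp] at hx ⊢
    have := norm_le_norm_add_norm_sub' z (WithLp.toLp 2 x)
    exact this.trans (add_le_add hx hz)

theorem contDiff_comp {u : E3 → E3} (hu : ContDiff ℝ (⊤ : ℕ∞) u) (i : Fin 3) :
    ContDiff ℝ (⊤ : ℕ∞) fun y => u y i := contDiff_pi.1 hu i

/-- The components of a Beltrami field solve the Helmholtz equation. -/
theorem sol_of_beltrami {lam : ℝ} (hl : 0 < lam) {w : E3 → E3} (hw : ContDiff ℝ (⊤ : ℕ∞) w)
    (hB : ∀ x, vcurl w x = lam • w x) (i : Fin 3) : Sol lam (up fun x => w x i) := by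
  have hc := contDiff_comp hw
  refine sol_up (hc i) fun x => ?_
  have e : ∀ i j k l m : Fin 3, (∀ x, pd j (fun y => w y k) x - pd l (fun y => w y m) x = lam * w x i) →
      ∀ (n : Fin 3) x, pd n (pd j fun y => w y k) x - pd n (pd l fun y => w y m) x =
        lam * pd n (fun y => w y i) x := fun i j k l m h n x => by
    rw [← pd_sub (contDiff_pd (hc k) j) (contDiff_pd (hc m) l), ← pd_const_mul (hc i)]
    congr 1
    exact funext h
  have h0 : ∀ x, pd 1 (fun y => w y 2) x - pd 2 (fun y => w y 1) x = lam * w x 0 := fun x =>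
    congrFun (hB x) 0
  have h1 : ∀ x, pd 2 (fun y => w y 0) x - pd 0 (fun y => w y 2) x = lam * w x 1 := fun x =>
    congrFun (hB x) 1
  have h2 : ∀ x, pd 0 (fun y => w y 1) x - pd 1 (fun y => w y 0) x = lam * w x 2 := fun x =>
    congrFun (hB x) 2
  have e0 := e _ _ _ _ _ h0
  have e1 := e _ _ _ _ _ h1
  have e2 := e _ _ _ _ _ h2
  have hdiv : ∀ x, 1 * pd 0 (fun y => w y 0) x + (1 : ℝ) * (1 * pd 1 (fun y => w y 1) x +
      1 * pd 2 (fun y => w y 2) x) = 0 := by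
    intro x
    have c01 := pd_comm (hc 2) 0 1 x
    have c02 := pd_comm (hc 1) 0 2 x
    have c12 := pd_comm (hc 0) 1 2 x
    have := e0 0 x
    have := e1 1 x
    have := e2 2 x
    have : lam * (pd 0 (fun y => w y 0) x + pd 1 (fun y => w y 1) x + pd 2 (fun y => w y 2) x) = 0 := by
      linarith
    have := (mul_eq_zero.1 this).resolve_left hl.ne'
    linarith
  have hdd : ∀ n, pd n (pd 0 fun y => w y 0) x + (pd n (pd 1 fun y => w y 1) x +
      pd n (pd 2 fun y => w y 2) x) = 0 := by
    intro n
    have p0 := contDiff_pd (hc 0) 0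
    have p1 := contDiff_pd (hc 1) 1
    have p2 := contDiff_pd (hc 2) 2
    have := pd_lin p0 ((contDiff_const (c := (1 : ℝ))).mul p1 |>.add ((contDiff_const (c := (1 : ℝ))).mul p2)) 1 1 n x
    rw [pd_lin p1 p2 1 1 n x, funext hdiv] at this
    have z : pd n (fun _ : E3 => (0 : ℝ)) x = 0 := by simp [pd]
    linarith
  have s0 := h0 x
  have s1 := h1 x
  have s2 := h2 x
  rw [Fin.sum_univ_three]
  fin_cases i <;> simp only [Fin.zero_eta, Fin.mk_one, Fin.reduceFinMk]
  · linear_combination hdd 0 - pd_comm (hc 1) 0 1 x - pd_comm (hc 2) 0 2 x - e2 1 x + e1 2 x - lam * s0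
  · linear_combination hdd 1 - pd_comm (hc 2) 1 2 x - pd_comm (hc 0) 1 0 x - e0 2 x + e2 0 x - lam * s1
  · linear_combination hdd 2 - pd_comm (hc 0) 2 0 x - pd_comm (hc 1) 2 1 x - e1 0 x + e0 1 x - lam * s2

section

variable {ι : Type*}

/-- Real trigonometric sums. -/
def tp (P : Finset ι) (k : ι → E3) (a b : ι → ℝ) (X : E3) : ℝ :=
  ∑ κ ∈ P, (a κ * Real.cos (∑ j, k κ j * X j) - b κ * Real.sin (∑ j, k κ j * X j))

theorem contDiff_tp (P : Finset ι) (k : ι → E3) (a b : ι → ℝ) : ContDiff ℝ (⊤ : ℕ∞) (tp P k a b) := by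
  unfold tp
  refine ContDiff.sum fun κ _ => ?_
  have : ContDiff ℝ (⊤ : ℕ∞) fun X : E3 => ∑ j, k κ j * X j :=
    ContDiff.sum fun j _ => contDiff_const.mul (contDiff_apply ℝ ℝ j)
  exact (contDiff_const.mul this.cos).sub (contDiff_const.mul this.sin)

theorem pd_tp (P : Finset ι) (k : ι → E3) (a b : ι → ℝ) (j : Fin 3) :
    pd j (tp P k a b) = tp P k (fun κ => -(k κ j * b κ)) (fun κ => k κ j * a κ) := by
  funext X
  have hL : ∀ κ, HasFDerivAt (fun X : E3 => ∑ j, k κ j * X j)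
      (∑ j, k κ j • (ContinuousLinearMap.proj j : E3 →L[ℝ] ℝ)) X := fun κ =>
    HasFDerivAt.fun_sum fun j _ => (ContinuousLinearMap.proj (R := ℝ) (φ := fun _ : Fin 3 => ℝ) j).hasFDerivAt.const_mul _
  have h := HasFDerivAt.fun_sum (u := P) fun κ _ =>
    ((hL κ).cos.const_mul (a κ)).fun_sub ((hL κ).sin.const_mul (b κ))
  unfold pd tp
  rw [h.fderiv]
  simp only [sum_apply, sub_apply, smul_apply, ContinuousLinearMap.proj_apply,
    Pi.single_apply, smul_eq_mul, mul_ite, mul_one, mul_zero, Finset.sum_ite_eq', Finset.mem_univ, if_true]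
  refine Finset.sum_congr rfl fun κ _ => ?_
  ring

theorem tp_lin (P : Finset ι) (k : ι → E3) (a b a' b' : ι → ℝ) (c d : ℝ) (X : E3) :
    c * tp P k a b X + d * tp P k a' b' X =
      tp P k (fun κ => c * a κ + d * a' κ) (fun κ => c * b κ + d * b' κ) X := by
  simp only [tp, Finset.mul_sum, ← Finset.sum_add_distrib]
  refine Finset.sum_congr rfl fun κ _ => ?_
  ring

theorem tp_congr {P : Finset ι} {k : ι → E3} {a b a' b' : ι → ℝ} (ha : ∀ κ ∈ P, a κ = a' κ)
    (hb : ∀ κ ∈ P, b κ = b' κ) (X : E3) : tp P k a b X = tp P k a' b' X := by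
  refine Finset.sum_congr rfl fun κ h => ?_
  rw [ha κ h, hb κ h]

theorem tp_smul (P : Finset ι) (k : ι → E3) (a b : ι → ℝ) (c d : ℝ) (X : E3) :
    tp P (fun κ => c • k κ) a b (d • X) = tp P (fun κ => (c * d) • k κ) a b X := by
  simp only [tp, Pi.smul_apply, smul_eq_mul]
  have : ∀ κ, ∑ j, c * k κ j * (d * X j) = ∑ j, c * d * k κ j * X j := fun κ =>
    Finset.sum_congr rfl fun j _ => by ring
  simp only [this]

theorem sol_tp {P : Finset ι} {k : ι → E3} {lam : ℝ} (hk : ∀ κ ∈ P, ∑ j, k κ j ^ 2 = lam ^ 2)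
    (a b : ι → ℝ) : Sol lam (up (tp P k a b)) := by
  refine sol_up (contDiff_tp P k a b) fun X => ?_
  simp only [pd_tp]
  simp only [tp]
  rw [Finset.sum_comm, Finset.mul_sum]
  refine Finset.sum_congr rfl fun κ h => ?_
  rw [← hk κ h]
  simp only [Fin.sum_univ_three]
  ring

/-- Vector trigonometric sums. -/
def tv (P : Finset ι) (k : ι → E3) (a b : ι → E3) (X : E3) : E3 :=
  fun i => tp P k (fun κ => a κ i) (fun κ => b κ i) X

theorem contDiff_tv (P : Finset ι) (k : ι → E3) (a b : ι → E3) : ContDiff ℝ (⊤ : ℕ∞) (tv P k a b) :=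
  contDiff_pi.2 fun _ => contDiff_tp _ _ _ _

theorem vcurl_tv (P : Finset ι) (k : ι → E3) (a b : ι → E3) :
    vcurl (tv P k a b) = tv P k (fun κ => -(crossProduct (k κ) (b κ))) (fun κ => crossProduct (k κ) (a κ)) := by
  have e : ∀ i, (fun y => tv P k a b y i) = tp P k (fun κ => a κ i) (fun κ => b κ i) := fun i => rfl
  funext X i
  unfold vcurl
  simp only [e, pd_tp]
  fin_cases i <;>
  · simp only [tv, cross_apply, tp, ← Finset.sum_sub_distrib]
    refine Finset.sum_congr rfl fun κ _ => ?_
    simp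
    ring

/-- The projection onto Beltrami fields inside the solutions of the Helmholtz equation. -/
def proj (lam : ℝ) (u : E3 → E3) : E3 → E3 := fun x i =>
  1 / 2 * (1 / lam ^ 2 * vcurl (vcurl u) x i + 1 / lam * vcurl u x i)

/-- Its action on coefficients. -/
def pA (w a b : E3) : E3 := fun i =>
  1 / 2 * (-(crossProduct w (crossProduct w a)) i - crossProduct w b i)

def pB (w a b : E3) : E3 := fun i =>
  1 / 2 * (-(crossProduct w (crossProduct w b)) i + crossProduct w a i)

theorem proj_tv {lam : ℝ} (hl : lam ≠ 0) (P : Finset ι) (w : ι → E3) (a b : ι → E3) :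
    proj lam (tv P (fun κ => lam • w κ) a b) =
      tv P (fun κ => lam • w κ) (fun κ => pA (w κ) (a κ) (b κ)) (fun κ => pB (w κ) (a κ) (b κ)) := by
  funext X i
  rw [proj, vcurl_tv, vcurl_tv]
  simp only [tv, tp_lin]
  rw [← add_zero (1 / 2 * _), ← zero_mul (tp P (fun κ => lam • w κ) 0 0 X), tp_lin]
  refine tp_congr (fun κ _ => ?_) (fun κ _ => ?_) X
  · simp only [pA, map_smul, LinearMap.smul_apply, Pi.smul_apply, Pi.neg_apply, smul_eq_mul, zero_mul]
    field_simp
    ring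
  · simp only [pB, map_smul, map_neg, LinearMap.smul_apply, Pi.smul_apply, Pi.neg_apply, smul_eq_mul, zero_mul]
    field_simp
    ring

theorem cross_cross_cross {w : E3} (hw : ∑ j, w j ^ 2 = 1) (a : E3) :
    crossProduct w (crossProduct w (crossProduct w a)) = -crossProduct w a := by
  rw [Fin.sum_univ_three] at hw
  funext i
  fin_cases i <;> simp [cross_apply]
  · linear_combination -(w 1 * a 2 - w 2 * a 1) * hw
  · linear_combination -(w 2 * a 0 - w 0 * a 2) * hw
  · linear_combination -(w 0 * a 1 - w 1 * a 0) * hw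

theorem vcurl_proj_tv {mu : ℝ} {P : Finset ι} {w : ι → E3} (hw : ∀ κ ∈ P, ∑ j, w κ j ^ 2 = 1)
    (a b : ι → E3) (X : E3) :
    vcurl (tv P (fun κ => mu • w κ) (fun κ => pA (w κ) (a κ) (b κ)) (fun κ => pB (w κ) (a κ) (b κ))) X =
      mu • tv P (fun κ => mu • w κ) (fun κ => pA (w κ) (a κ) (b κ)) (fun κ => pB (w κ) (a κ) (b κ)) X := by
  have eA : ∀ κ, pA (w κ) (a κ) (b κ) =
      (1 / 2 : ℝ) • (-(crossProduct (w κ) (crossProduct (w κ) (a κ))) - crossProduct (w κ) (b κ)) :=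
    fun κ => rfl
  have eB : ∀ κ, pB (w κ) (a κ) (b κ) =
      (1 / 2 : ℝ) • (-(crossProduct (w κ) (crossProduct (w κ) (b κ))) + crossProduct (w κ) (a κ)) :=
    fun κ => rfl
  rw [vcurl_tv]
  funext i
  simp only [tv, Pi.smul_apply, smul_eq_mul]
  rw [← add_zero (mu * _), ← zero_mul (tp P (fun κ => mu • w κ) 0 0 X), tp_lin]
  refine tp_congr (fun κ h => ?_) (fun κ h => ?_) X
  · simp only [eA, eB, map_smul, map_neg, map_add, LinearMap.smul_apply, cross_cross_cross (hw κ h)]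
    simp only [Pi.smul_apply, Pi.neg_apply, Pi.add_apply, Pi.sub_apply, smul_eq_mul]
    ring
  · simp only [eA, eB, map_smul, map_neg, map_sub, LinearMap.smul_apply, cross_cross_cross (hw κ h)]
    simp only [Pi.smul_apply, Pi.neg_apply, Pi.add_apply, Pi.sub_apply, smul_eq_mul]
    ring

theorem contDiff_vcurl {u : E3 → E3} (hu : ContDiff ℝ (⊤ : ℕ∞) u) : ContDiff ℝ (⊤ : ℕ∞) (vcurl u) := by
  have h := contDiff_comp hu
  refine contDiff_pi.2 fun i => ?_
  fin_cases i
  · exact (contDiff_pd (h 2) 1).sub (contDiff_pd (h 1) 2)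
  · exact (contDiff_pd (h 0) 2).sub (contDiff_pd (h 2) 0)
  · exact (contDiff_pd (h 1) 0).sub (contDiff_pd (h 0) 1)

theorem vcurl_sub {u v : E3 → E3} (hu : ContDiff ℝ (⊤ : ℕ∞) u) (hv : ContDiff ℝ (⊤ : ℕ∞) v) :
    vcurl (fun x => u x - v x) = fun x => vcurl u x - vcurl v x := by
  have h := contDiff_comp hu
  have h' := contDiff_comp hv
  have e : ∀ i j x, pd i (fun y => (u y - v y) j) x = pd i (fun y => u y j) x - pd i (fun y => v y j) x :=
    fun i j x => pd_sub (h j) (h' j) i x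
  funext x i
  unfold vcurl
  simp only [e]
  fin_cases i <;> simp <;> ring

theorem vcurl_smul {u : E3 → E3} (hu : ContDiff ℝ (⊤ : ℕ∞) u) (c : ℝ) :
    vcurl (fun x => c • u x) = fun x => c • vcurl u x := by
  have h := contDiff_comp hu
  have e : ∀ i j x, pd i (fun y => (c • u y) j) x = c * pd i (fun y => u y j) x :=
    fun i j x => pd_const_mul (h j) c i x
  funext x i
  unfold vcurl
  simp only [e]
  fin_cases i <;> simp <;> ring

theorem vcurl_add {u v : E3 → E3} (hu : ContDiff ℝ (⊤ : ℕ∞) u) (hv : ContDiff ℝ (⊤ : ℕ∞) v) :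
    vcurl (fun x => u x + v x) = fun x => vcurl u x + vcurl v x := by
  have h := vcurl_sub hu (v := fun x => (-1 : ℝ) • v x) (hv.const_smul (-1 : ℝ))
  rw [vcurl_smul hv] at h
  simpa using h

theorem proj_sub {u v : E3 → E3} (hu : ContDiff ℝ (⊤ : ℕ∞) u) (hv : ContDiff ℝ (⊤ : ℕ∞) v) (lam : ℝ) :
    proj lam (fun x => u x - v x) = fun x => proj lam u x - proj lam v x := by
  unfold proj
  rw [vcurl_sub hu hv, vcurl_sub (contDiff_vcurl hu) (contDiff_vcurl hv)]
  funext x i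
  simp only [Pi.sub_apply]
  ring

theorem proj_beltrami {lam : ℝ} (hl : lam ≠ 0) {w : E3 → E3} (hw : ContDiff ℝ (⊤ : ℕ∞) w)
    (hB : ∀ x, vcurl w x = lam • w x) : proj lam w = w := by
  have h : vcurl w = fun x => lam • w x := funext hB
  unfold proj
  rw [h, vcurl_smul hw, h]
  funext x i
  simp only [Pi.smul_apply, smul_eq_mul]
  field_simp
  ring

end

theorem integral_exp_int {n : ℤ} (hn : n ≠ 0) :
    ∫ x in Icc (0 : ℝ) (2 * π), Complex.exp (Complex.I * n * x) = 0 := by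
  rw [integral_Icc_eq_integral_Ioc, ← intervalIntegral.integral_of_le (by positivity)]
  have hc : Complex.I * (n : ℂ) ≠ 0 := mul_ne_zero Complex.I_ne_zero (by exact_mod_cast hn)
  rw [integral_exp_mul_complex hc]
  have : Complex.I * (n : ℂ) * ((2 * π : ℝ) : ℂ) = n * (2 * π * Complex.I) := by push_cast; ring
  rw [this, Complex.exp_int_mul_two_pi_mul_I]
  simp

theorem integral_exp_T3 {n : Fin 3 → ℤ} (hn : n ≠ 0) :
    ∫ X in T3, Complex.exp (Complex.I * ((∑ j, (n j : ℝ) * X j : ℝ) : ℂ)) = 0 := by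
  have e : T3 = Set.univ.pi fun _ : Fin 3 => Icc (0 : ℝ) (2 * π) := by
    rw [T3, ← Set.pi_univ_Icc]; rfl
  have e2 : ∀ X : E3, Complex.exp (Complex.I * ((∑ j, (n j : ℝ) * X j : ℝ) : ℂ)) =
      ∏ j, Complex.exp (Complex.I * n j * X j) := fun X => by
    rw [← Complex.exp_sum]
    congr 1
    push_cast
    rw [Finset.mul_sum]
    exact Finset.sum_congr rfl fun j _ => by ring
  simp only [e2]
  rw [e, volume_pi, Measure.restrict_pi_pi,
    integral_fintype_prod_eq_prod fun j (x : ℝ) => Complex.exp (Complex.I * n j * x)]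
  obtain ⟨j, hj⟩ := Function.ne_iff.1 hn
  exact Finset.prod_eq_zero (Finset.mem_univ j) (integral_exp_int hj)

theorem isCompact_T3 : IsCompact T3 := isCompact_Icc

theorem integrable_T3 {F : Type*} [NormedAddCommGroup F] {f : E3 → F} (hf : Continuous f) :
    IntegrableOn f T3 :=
  hf.continuousOn.integrableOn_compact isCompact_T3

theorem integral_cos_T3 {n : Fin 3 → ℤ} (hn : n ≠ 0) : ∫ X in T3, Real.cos (∑ j, (n j : ℝ) * X j) = 0 := by
  have hi : IntegrableOn (fun X : E3 => Complex.exp (Complex.I * ((∑ j, (n j : ℝ) * X j : ℝ) : ℂ))) T3 :=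
    integrable_T3 (by fun_prop)
  have h := Complex.reCLM.integral_comp_comm hi
  rw [integral_exp_T3 hn] at h
  simp only [map_zero] at h
  rw [← h]
  congr 1
  funext X
  rw [Complex.reCLM_apply, mul_comm, Complex.exp_ofReal_mul_I_re]

theorem integral_sin_T3 {n : Fin 3 → ℤ} (hn : n ≠ 0) : ∫ X in T3, Real.sin (∑ j, (n j : ℝ) * X j) = 0 := by
  have hi : IntegrableOn (fun X : E3 => Complex.exp (Complex.I * ((∑ j, (n j : ℝ) * X j : ℝ) : ℂ))) T3 :=
    integrable_T3 (by fun_prop)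
  have h := Complex.imCLM.integral_comp_comm hi
  rw [integral_exp_T3 hn] at h
  simp only [map_zero] at h
  rw [← h]
  congr 1
  funext X
  rw [Complex.imCLM_apply, mul_comm, Complex.exp_ofReal_mul_I_im]

theorem volume_T3 : volume.real T3 = (2 * π) ^ 3 := by
  rw [T3, measureReal_def, Real.volume_Icc_pi]
  simp [ENNReal.toReal_ofReal pi_pos.le]

/-- A single real wave. -/
def wv (n : Fin 3 → ℤ) (a b : ℝ) (X : E3) : ℝ :=
  a * Real.cos (∑ j, (n j : ℝ) * X j) - b * Real.sin (∑ j, (n j : ℝ) * X j)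

theorem continuous_wv (n : Fin 3 → ℤ) (a b : ℝ) : Continuous (wv n a b) := by
  unfold wv
  fun_prop

theorem integral_wv {n : Fin 3 → ℤ} (hn : n ≠ 0) (a b : ℝ) : ∫ X in T3, wv n a b X = 0 := by
  unfold wv
  rw [integral_sub (integrable_T3 (by fun_prop)) (integrable_T3 (by fun_prop)), integral_const_mul,
    integral_const_mul, integral_cos_T3 hn, integral_sin_T3 hn]
  simp

theorem wv_mul_wv (n m : Fin 3 → ℤ) (a b a' b' : ℝ) (X : E3) : wv n a b X * wv m a' b' X =
    wv (n - m) ((a * a' + b * b') / 2) ((b * a' - a * b') / 2) X +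
      wv (n + m) ((a * a' - b * b') / 2) ((b * a' + a * b') / 2) X := by
  unfold wv
  have e1 : ∑ j, ((n - m) j : ℝ) * X j = ∑ j, (n j : ℝ) * X j - ∑ j, (m j : ℝ) * X j := by
    rw [← Finset.sum_sub_distrib]
    exact Finset.sum_congr rfl fun j _ => by rw [Pi.sub_apply]; push_cast; ring
  have e2 : ∑ j, ((n + m) j : ℝ) * X j = ∑ j, (n j : ℝ) * X j + ∑ j, (m j : ℝ) * X j := by
    rw [← Finset.sum_add_distrib]
    exact Finset.sum_congr rfl fun j _ => by rw [Pi.add_apply]; push_cast; ring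
  rw [e1, e2, cos_sub, cos_add, sin_sub, sin_add]
  ring

theorem abs_wv_le {c : ℝ} (n : Fin 3 → ℤ) {a b : ℝ} (ha : |a| ≤ c) (hb : |b| ≤ c) (X : E3) :
    |wv n a b X| ≤ 2 * c := by
  unfold wv
  refine (abs_sub _ _).trans ?_
  rw [abs_mul, abs_mul]
  have h1 := mul_le_mul ha (Real.abs_cos_le_one (∑ j, (n j : ℝ) * X j)) (abs_nonneg _) ((abs_nonneg _).trans ha)
  have h2 := mul_le_mul hb (Real.abs_sin_le_one (∑ j, (n j : ℝ) * X j)) (abs_nonneg _) ((abs_nonneg _).trans hb)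
  linarith

/-- Almost orthogonality of waves on the torus. -/
theorem integral_wv_mul_le {c : ℝ} (n m : Fin 3 → ℤ) {a b a' b' : ℝ} (ha : |a| ≤ c) (hb : |b| ≤ c)
    (ha' : |a'| ≤ c) (hb' : |b'| ≤ c) : ∫ X in T3, wv n a b X * wv m a' b' X ≤
      if m = n ∨ m = -n then (2 * c) ^ 2 * (2 * π) ^ 3 else 0 := by
  split_ifs with h
  · have hc : 0 ≤ c := (abs_nonneg _).trans ha
    have := norm_setIntegral_le_of_norm_le_const (μ := volume) (s := T3) (C := (2 * c) ^ 2)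
      (f := fun X => wv n a b X * wv m a' b' X) isCompact_T3.measure_lt_top fun X _ => by
        rw [Real.norm_eq_abs, abs_mul, sq]
        exact mul_le_mul (abs_wv_le n ha hb X) (abs_wv_le m ha' hb' X) (abs_nonneg _) (by positivity)
    rw [volume_T3] at this
    exact (le_abs_self _).trans this
  · push Not at h
    simp only [wv_mul_wv]
    rw [integral_add (integrable_T3 (continuous_wv _ _ _)) (integrable_T3 (continuous_wv _ _ _)),
      integral_wv, integral_wv, add_zero]
    · intro e; exact h.2 (by rw [eq_neg_iff_add_eq_zero, add_comm]; exact e)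
    · intro e; exact h.1 (sub_eq_zero.1 e).symm

theorem integral_tp_sq_le {P : Finset (Fin 3 → ℤ)} {a b : (Fin 3 → ℤ) → ℝ} {c : ℝ}
    (ha : ∀ κ ∈ P, |a κ| ≤ c) (hb : ∀ κ ∈ P, |b κ| ≤ c) :
    ∫ X in T3, tp P (fun κ j => (κ j : ℝ)) a b X ^ 2 ≤ P.card * (8 * c ^ 2 * (2 * π) ^ 3) := by
  have e : ∀ X, tp P (fun κ j => (κ j : ℝ)) a b X ^ 2 =
      ∑ n ∈ P, ∑ m ∈ P, wv n (a n) (b n) X * wv m (a m) (b m) X := fun X => by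
    rw [sq, ← Finset.sum_mul_sum]; rfl
  simp only [e]
  have hc : ∀ n m, Continuous fun X => wv n (a n) (b n) X * wv m (a m) (b m) X := fun n m =>
    (continuous_wv _ _ _).mul (continuous_wv _ _ _)
  rw [integral_finsetSum _ fun n _ => integrable_T3 (continuous_finsetSum _ fun m _ => hc n m)]
  rw [← nsmul_eq_mul]
  refine Finset.sum_le_card_nsmul _ _ _ fun n hn => ?_
  rw [integral_finsetSum _ fun m _ => integrable_T3 (hc n m)]
  refine (Finset.sum_le_sum fun m hm => integral_wv_mul_le n m (ha n hn) (hb n hn) (ha m hm) (hb m hm)).trans ?_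
  rw [← Finset.sum_filter, Finset.sum_const, nsmul_eq_mul]
  have h2 : (P.filter fun m => m = n ∨ m = -n).card ≤ 2 := by
    refine (Finset.card_le_card (t := {n, -n}) fun m hm => ?_).trans Finset.card_le_two
    simpa using (Finset.mem_filter.1 hm).2
  have h3 : ((P.filter fun m => m = n ∨ m = -n).card : ℝ) ≤ 2 := by exact_mod_cast h2
  refine (mul_le_mul_of_nonneg_right h3 (by positivity)).trans_eq ?_
  ring

theorem L2norm_sq (u : E3 → E3) : L2norm u = √(∫ X in T3, ∑ i, u X i ^ 2) := by
  simp [L2norm, Hnorm, HnormSq, gradSq, midx, pdM, Finset.Nat.antidiagonalTuple_zero_right]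

theorem norm_dr {N : ℕ} (hN : Odd N) {κ : Fin 3 → ℤ} (h : κ ∈ PN N) : ‖dr N κ‖ = 1 := by
  have hN0 : (N : ℝ) ≠ 0 := by exact_mod_cast hN.pos.ne'
  have h2 : ∑ i, (κ i : ℝ) ^ 2 = (N : ℝ) ^ 2 := by exact_mod_cast sq_of_mem_PN h
  rw [EuclideanSpace.norm_eq, Real.sqrt_eq_one]
  simp only [dr, Real.norm_eq_abs, sq_abs, div_pow, ← Finset.sum_div]
  rw [h2, div_self (by positivity)]

/-- Plane waves with given amplitudes. -/
def pw (lam : ℝ) (a b : V3 → ℝ) (x ω : V3) : ℝ :=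
  a ω * Real.cos (lam * inner ℝ x ω) - b ω * Real.sin (lam * inner ℝ x ω)

theorem continuous_pw (lam : ℝ) {a b : V3 → ℝ} (ha : Continuous a) (hb : Continuous b) (x : V3) :
    Continuous (pw lam a b x) := by
  unfold pw
  fun_prop

theorem abs_pw_sub_le {lam M : ℝ} (hl : 0 < lam) {a b : V3 → ℝ} {ω : V3} (hω : ‖ω‖ = 1)
    (ha : |a ω| ≤ M) (hb : |b ω| ≤ M) (x y : V3) :
    |pw lam a b x ω - pw lam a b y ω| ≤ 2 * M * lam * ‖x - y‖ := by
  have hM : 0 ≤ M := (abs_nonneg _).trans ha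
  have h0 : |lam * inner ℝ x ω - lam * inner ℝ y ω| ≤ lam * ‖x - y‖ := by
    rw [← mul_sub, ← inner_sub_left, abs_mul, abs_of_pos hl]
    refine mul_le_mul_of_nonneg_left ((abs_real_inner_le_norm _ _).trans_eq ?_) hl.le
    rw [hω, mul_one]
  have h1 := (Real.abs_cos_sub_cos_le (lam * inner ℝ x ω) (lam * inner ℝ y ω)).trans h0
  have h2 := (Real.abs_sin_sub_sin_le (lam * inner ℝ x ω) (lam * inner ℝ y ω)).trans h0
  have e : pw lam a b x ω - pw lam a b y ω =
      a ω * (Real.cos (lam * inner ℝ x ω) - Real.cos (lam * inner ℝ y ω)) -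
      b ω * (Real.sin (lam * inner ℝ x ω) - Real.sin (lam * inner ℝ y ω)) := by
    unfold pw; ring
  rw [e]
  refine (abs_sub _ _).trans ?_
  rw [abs_mul, abs_mul]
  have := mul_le_mul ha h1 (abs_nonneg _) hM
  have := mul_le_mul hb h2 (abs_nonneg _) hM
  linarith

theorem Lam_sub_le {f g : V3 → ℝ} (hf : Continuous f) (hg : Continuous g) {c : ℝ}
    (h : ∀ x, ‖x‖ = 1 → |f x - g x| ≤ c) : |Lam f - Lam g| ≤ c := by
  have h1 := Lam_mono hf (g := fun x => g x + c) (by fun_prop) fun x hx => by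
    linarith [(abs_le.1 (h x hx)).2]
  have h2 := Lam_mono hg (g := fun x => f x + c) (by fun_prop) fun x hx => by
    linarith [(abs_le.1 (h x hx)).1]
  rw [Lam_add hg continuous_const, Lam_const] at h1
  rw [Lam_add hf continuous_const, Lam_const] at h2
  exact abs_le.2 ⟨by linarith, by linarith⟩

/-- Uniform discretization of Herglotz waves on balls. -/
theorem exists_discretization {lam M : ℝ} (hl : 0 < lam) (hM : 0 < M) {a b : V3 → ℝ} (ha : Continuous a)
    (hb : Continuous b) (hab : ∀ ω, ‖ω‖ = 1 → |a ω| ≤ M ∧ |b ω| ≤ M) (A : ℝ) {η : ℝ} (hη : 0 < η) :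
    ∃ N0 : ℕ, ∀ N ≥ N0, Odd N → ∀ x : V3, ‖x‖ ≤ A →
      |(∑ κ ∈ PN N, pw lam a b x (dr N κ)) / (PN N).card - Lam (pw lam a b x)| ≤ η := by
  set δ := η / (6 * M * lam) with hδ
  have hδ0 : 0 < δ := by positivity
  obtain ⟨t, -, hf, hc⟩ := (isCompact_closedBall (0 : V3) A).finite_cover_balls hδ0
  choose N0 hN0 using fun y => exists_equi_PN (continuous_pw lam ha hb y) (by positivity : 0 < η / 3)
  refine ⟨hf.toFinset.sup N0, fun N hN hodd x hx => ?_⟩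
  obtain ⟨y, hy, hxy⟩ := mem_iUnion₂.1 (hc (by simpa using hx))
  rw [Metric.mem_ball, dist_eq_norm] at hxy
  have hp : 0 < ((PN N).card : ℝ) := by
    exact_mod_cast lt_of_lt_of_le hodd.pos (le_card_PN hodd)
  have h1 := hN0 y N ((Finset.le_sup (hf.mem_toFinset.2 hy)).trans hN) hodd
  have hd : ∀ ω : V3, ‖ω‖ = 1 → |pw lam a b x ω - pw lam a b y ω| ≤ η / 3 := fun ω hω => by
    refine (abs_pw_sub_le hl hω (hab ω hω).1 (hab ω hω).2 x y).trans ?_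
    calc 2 * M * lam * ‖x - y‖ ≤ 2 * M * lam * δ := by gcongr
      _ = η / 3 := by rw [hδ]; field_simp; norm_num
  have h2 := Lam_sub_le (continuous_pw lam ha hb x) (continuous_pw lam ha hb y) hd
  have h3 : |∑ κ ∈ PN N, pw lam a b x (dr N κ) - ∑ κ ∈ PN N, pw lam a b y (dr N κ)| ≤
      η / 3 * (PN N).card := by
    rw [← Finset.sum_sub_distrib]
    refine (Finset.abs_sum_le_sum_abs _ _).trans ?_
    refine (Finset.sum_le_card_nsmul _ _ _ fun κ h => hd _ (norm_dr hodd h)).trans_eq ?_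
    rw [nsmul_eq_mul, mul_comm]
  rw [div_sub' hp.ne', abs_div, abs_of_pos hp, div_le_iff₀ hp]
  have h4 : |(Lam (pw lam a b x) - Lam (pw lam a b y)) * (PN N).card| ≤ η / 3 * (PN N).card := by
    rw [abs_mul, abs_of_pos hp]
    exact mul_le_mul_of_nonneg_right h2 hp.le
  rw [abs_le] at *
  constructor <;> nlinarith

/-- Approximation of decaying solutions by trigonometric sums with bounded coefficients. -/
theorem exists_tp_approx {lam : ℝ} (hl : 0 < lam) {f : E3 → ℝ} (hf : Sol lam (up f)) {C : ℝ} (hC0 : 0 < C)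
    (hC : ∀ z, z ≠ 0 → |f z| ≤ C / enorm3 z) {A η : ℝ} (hA : 0 ≤ A) (hη : 0 < η) :
    ∃ a b : V3 → ℝ, (∀ ω, ‖ω‖ = 1 → |a ω| ≤ 24 * lam * C ∧ |b ω| ≤ 24 * lam * C) ∧
      ∃ N0 : ℕ, ∀ N ≥ N0, Odd N → ∀ x, enorm3 x ≤ A →
        |tp (PN N) (fun κ => lam • (dr N κ).ofLp) (fun κ => a (dr N κ) / (PN N).card)
          (fun κ => b (dr N κ) / (PN N).card) x - f x| ≤ η := by
  obtain ⟨a, b, ca, cb, ha, hb, h⟩ := hf.exists_herglotz hl hC0 (fun z hz => by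
    have := hC z.ofLp (by simpa using hz)
    rwa [← norm_toLp] at this) hA (by positivity : 0 < η / 2)
  refine ⟨a, b, fun ω hω => ⟨ha ω hω, hb ω hω⟩, ?_⟩
  obtain ⟨N0, hN0⟩ := exists_discretization hl (by positivity) ca cb (fun ω hω => ⟨ha ω hω, hb ω hω⟩) A
    (by positivity : 0 < η / 2)
  refine ⟨N0, fun N hN hodd x hx => ?_⟩
  rw [← norm_toLp] at hx
  have h1 := hN0 N hN hodd _ hx
  have h2 := h _ hx
  have e : tp (PN N) (fun κ => lam • (dr N κ).ofLp) (fun κ => a (dr N κ) / (PN N).card)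
      (fun κ => b (dr N κ) / (PN N).card) x =
      (∑ κ ∈ PN N, pw lam a b (WithLp.toLp 2 x) (dr N κ)) / (PN N).card := by
    rw [tp, Finset.sum_div]
    refine Finset.sum_congr rfl fun κ _ => ?_
    have : ∑ j, (lam • (dr N κ).ofLp) j * x j = lam * inner ℝ (WithLp.toLp 2 x) (dr N κ) := by
      rw [PiLp.inner_apply, Finset.mul_sum]
      refine Finset.sum_congr rfl fun j _ => ?_
      simp
      ring
    rw [this, pw]
    ring
  rw [e]
  have e2 : up f (WithLp.toLp 2 x) = f x := rfl
  rw [e2] at h2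
  change |f x - Lam (pw lam a b (WithLp.toLp 2 x))| ≤ η / 2 at h2
  rw [abs_le] at *
  constructor <;> linarith

theorem convex_B1 : Convex ℝ B1 := by
  have : B1 = (EuclideanSpace.equiv (Fin 3) ℝ).symm ⁻¹' Metric.ball (0 : V3) 1 := by
    ext x
    rw [Set.mem_preimage, mem_ball_zero_iff]
    exact (congrArg (· < 1) (norm_toLp x)).to_iff.symm
  rw [this]
  exact (convex_ball _ _).linear_preimage (EuclideanSpace.equiv (Fin 3) ℝ).symm.toLinearMap

theorem norm_le_enorm3 (x : E3) : ‖x‖ ≤ enorm3 x := by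
  refine (pi_norm_le_iff_of_nonneg (Real.sqrt_nonneg _)).2 fun i => ?_
  rw [Real.norm_eq_abs, ← Real.sqrt_sq_eq_abs]
  exact Real.sqrt_le_sqrt (Finset.single_le_sum (f := fun i => x i ^ 2) (fun j _ => sq_nonneg _)
    (Finset.mem_univ i))

theorem norm_fderiv_le {g : E3 → ℝ} {x : E3} {L : ℝ} (hL : ∀ i, |pd i g x| ≤ L) :
    ‖fderiv ℝ g x‖ ≤ 3 * L := by
  have h0 : 0 ≤ L := (abs_nonneg _).trans (hL 0)
  refine ContinuousLinearMap.opNorm_le_bound _ (by positivity) fun v => ?_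
  have e : fderiv ℝ g x v = ∑ i, v i * pd i g x := by
    conv_lhs => rw [← Finset.univ_sum_single v]
    rw [map_sum]
    refine Finset.sum_congr rfl fun i _ => ?_
    have : (Pi.single i (v i) : E3) = v i • (Pi.single i 1 : E3) := by
      rw [← Pi.single_smul]; simp
    rw [this, map_smul, pd, smul_eq_mul]
  rw [e]
  refine (norm_sum_le _ _).trans ?_
  refine (Finset.sum_le_card_nsmul _ _ (L * ‖v‖) fun i _ => ?_).trans_eq (by simp; ring)
  rw [norm_mul, mul_comm]
  exact mul_le_mul (hL i) (norm_le_pi_norm v i) (norm_nonneg _) h0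

theorem le_two_mul_rpow {d α : ℝ} (h0 : 0 < d) (h2 : d ≤ 2) (hα : α ∈ Ioo (0 : ℝ) 1) : d ≤ 2 * d ^ α := by
  rcases le_total d 1 with h | h
  · have := Real.rpow_le_rpow_of_exponent_ge h0 h hα.2.le
    rw [Real.rpow_one] at this
    have := Real.rpow_nonneg h0.le α
    linarith
  · have := Real.one_le_rpow h hα.1.le
    linarith

theorem holderSemiOn_le {α : ℝ} (hα : α ∈ Ioo (0 : ℝ) 1) {g : E3 → ℝ} (hg : ContDiff ℝ (⊤ : ℕ∞) g)
    {L : ℝ} (hL0 : 0 ≤ L) (hL : ∀ x ∈ B1, ∀ i, |pd i g x| ≤ L) : holderSemiOn α B1 g ≤ 6 * L := by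
  refine Real.iSup_le (fun p => ?_) (by positivity)
  rcases eq_or_ne ‖(p.1 : E3) - (p.2 : E3)‖ 0 with h | h
  · rw [h, Real.zero_rpow hα.1.ne', div_zero]; positivity
  · have hd : 0 < ‖(p.1 : E3) - (p.2 : E3)‖ := lt_of_le_of_ne (norm_nonneg _) h.symm
    have h2 : ‖(p.1 : E3) - (p.2 : E3)‖ ≤ 2 := by
      have a1 := (norm_le_enorm3 p.1).trans (le_of_lt p.1.2)
      have a2 := (norm_le_enorm3 p.2).trans (le_of_lt p.2.2)
      have := norm_sub_le (p.1 : E3) (p.2 : E3)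
      linarith
    rw [div_le_iff₀ (Real.rpow_pos_of_pos hd α)]
    have h1 := convex_B1.norm_image_sub_le_of_norm_fderiv_le (𝕜 := ℝ)
      (fun x _ => hg.differentiable (by simp) x) (fun x hx => norm_fderiv_le (hL x hx)) p.2.2 p.1.2
    rw [Real.norm_eq_abs] at h1
    have := mul_le_mul_of_nonneg_left (le_two_mul_rpow hd h2 hα) (by positivity : 0 ≤ 3 * L)
    linarith

theorem sol_iter {lam : ℝ} {f : E3 → ℝ} (hf : Sol lam (up f)) (j : Fin 3) (n : ℕ) :
    Sol lam (up ((pd j)^[n] f)) := by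
  induction n with
  | zero => exact hf
  | succ n ih => rw [Function.iterate_succ_apply']; exact ih.pd j

theorem sol_pdM {lam : ℝ} {f : E3 → ℝ} (hf : Sol lam (up f)) (β : Fin 3 → ℕ) :
    Sol lam (up (pdM β f)) :=
  sol_iter (sol_iter (sol_iter hf 2 _) 1 _) 0 _

/-- The gradient estimate with constant `C`. -/
def Grad (lam C : ℝ) : Prop := ∀ f : E3 → ℝ, Sol lam (up f) →
    ∀ (i : Fin 3) (r S : ℝ), (∀ z, enorm3 z ≤ r + 1 → |f z| ≤ S) →
      ∀ x, enorm3 x ≤ r → |pd i f x| ≤ C * S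

theorem abs_iter_le {lam C : ℝ} (hC : Grad lam C) (j : Fin 3) (n : ℕ) {f : E3 → ℝ} (hf : Sol lam (up f))
    {r S : ℝ} (h : ∀ z, enorm3 z ≤ r + n → |f z| ≤ S) {x : E3} (hx : enorm3 x ≤ r) :
    |(pd j)^[n] f x| ≤ C ^ n * S := by
  induction n generalizing r x with
  | zero => simpa using h x (by simpa using hx)
  | succ n ih =>
    rw [Function.iterate_succ_apply', pow_succ', mul_assoc]
    refine hC _ (sol_iter hf j n) j r _ (fun z hz => ih (r := r + 1) (fun y hy => h y ?_) hz) x hx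
    push_cast
    linarith

theorem abs_pdM_le {lam C : ℝ} (hC : Grad lam C) (β : Fin 3 → ℕ) {f : E3 → ℝ} (hf : Sol lam (up f))
    {r S : ℝ} (h : ∀ z, enorm3 z ≤ r + (∑ i, β i : ℕ) → |f z| ≤ S) {x : E3} (hx : enorm3 x ≤ r) :
    |pdM β f x| ≤ C ^ (∑ i, β i) * S := by
  rw [Fin.sum_univ_three, pow_add, pow_add, mul_assoc, mul_assoc]
  refine abs_iter_le hC 0 _ (sol_iter (sol_iter hf 2 _) 1 _) (r := r) (fun y hy => ?_) hx
  refine abs_iter_le hC 1 _ (sol_iter hf 2 _) (r := r + β 0) (fun y hy => ?_) hy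
  refine abs_iter_le hC 2 _ hf (r := r + β 0 + β 1) (fun y hy => h y ?_) hy
  rw [Fin.sum_univ_three]
  push_cast
  linarith

theorem exists_CkaNormOn_le {lam C : ℝ} (hC1 : 1 ≤ C) (hC : Grad lam C) {α : ℝ} (hα : α ∈ Ioo (0 : ℝ) 1) :
    ∃ K : ℝ, 0 < K ∧ ∀ v : E3 → E3, (∀ i, Sol lam (up fun x => v x i)) → ∀ S : ℝ,
      (∀ z, enorm3 z ≤ 6 → ∀ i, |v z i| ≤ S) → CkaNormOn 4 α B1 v ≤ K * S := by
  refine ⟨(∑ m ∈ Finset.range (4 + 1), ∑ _i : Fin 3, ∑ _β ∈ midx m, C ^ 5)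
    + ∑ _i : Fin 3, ∑ _β ∈ midx 4, 6 * C ^ 5 + 1, by positivity, fun v hv S hS => ?_⟩
  have hS0 : 0 ≤ S := (abs_nonneg _).trans (hS 0 (by simp [enorm3]) 0)
  have hp : ∀ m : ℕ, m ≤ 5 → C ^ m * S ≤ C ^ 5 * S := fun m hm =>
    mul_le_mul_of_nonneg_right (pow_le_pow_right₀ hC1 hm) hS0
  have hb : ∀ m ≤ 4, ∀ β ∈ midx m, ∀ i x, enorm3 x ≤ 2 → |pdM β (fun y => v y i) x| ≤ C ^ 4 * S := by
    intro m hm β hβ i x hx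
    have hβ' : ∑ i, β i = m := Finset.Nat.mem_antidiagonalTuple.1 hβ
    refine (abs_pdM_le hC β (hv i) (r := 2) (S := S) (fun z hz => hS z (hz.trans ?_) i) hx).trans ?_
    · have : (m : ℝ) ≤ 4 := by exact_mod_cast hm
      rw [hβ']; linarith
    · rw [hβ']
      exact mul_le_mul_of_nonneg_right (pow_le_pow_right₀ hC1 hm) hS0
  have hg : ∀ β ∈ midx 4, ∀ i, ∀ x ∈ B1, ∀ j, |pd j (pdM β fun y => v y i) x| ≤ C ^ 5 * S := by
    intro β hβ i x hx j
    rw [pow_succ', mul_assoc]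
    refine hC _ (sol_pdM (hv i) β) j 1 _ (fun z hz => hb 4 le_rfl β hβ i z (by linarith)) x (le_of_lt hx)
  rw [CkaNormOn, add_mul, add_mul]
  refine le_add_of_le_of_nonneg (add_le_add ?_ ?_) (by positivity)
  · simp only [Finset.sum_mul]
    refine Finset.sum_le_sum fun m hm => Finset.sum_le_sum fun i _ => Finset.sum_le_sum fun β hβ => ?_
    refine Real.iSup_le (fun x => ?_) (by positivity)
    have hx : enorm3 (x : E3) < 1 := x.2
    exact (hb m (Nat.lt_succ_iff.1 (Finset.mem_range.1 hm)) β hβ i x (by linarith)).trans (hp 4 (by norm_num))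
  · simp only [Finset.sum_mul]
    refine Finset.sum_le_sum fun i _ => Finset.sum_le_sum fun β hβ => ?_
    rw [mul_assoc]
    exact holderSemiOn_le hα (sol_pdM (hv i) β).contDiff (by positivity) (hg β hβ i)

theorem vcurl_bound {lam C : ℝ} (hC : Grad lam C) {u : E3 → E3} (hu : ∀ i, Sol lam (up fun x => u x i)) :
    (∀ i, Sol lam (up fun x => vcurl u x i)) ∧ ∀ r S : ℝ, (∀ z, enorm3 z ≤ r + 1 → ∀ i, |u z i| ≤ S) →
      ∀ x, enorm3 x ≤ r → ∀ i, |vcurl u x i| ≤ 2 * C * S := by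
  have hs : ∀ i j k l, Sol lam (up fun x => pd i (fun y => u y j) x - pd k (fun y => u y l) x) := by
    intro i j k l
    simpa [sub_eq_add_neg] using ((hu j).pd i).lin ((hu l).pd k) 1 (-1)
  refine ⟨fun i => ?_, fun r S h x hx => ?_⟩
  · fin_cases i
    · exact hs 1 2 2 1
    · exact hs 2 0 0 2
    · exact hs 0 1 1 0
  · have hb : ∀ i j k l, |pd i (fun y => u y j) x - pd k (fun y => u y l) x| ≤ 2 * C * S := by
      intro i j k l
      have h1 := hC _ (hu j) i r S (fun z hz => h z hz j) x hx
      have h2 := hC _ (hu l) k r S (fun z hz => h z hz l) x hx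
      have := abs_sub (pd i (fun y => u y j) x) (pd k (fun y => u y l) x)
      linarith
    intro i
    fin_cases i
    · exact hb 1 2 2 1
    · exact hb 2 0 0 2
    · exact hb 0 1 1 0

theorem proj_bound {lam C : ℝ} (hl : 0 < lam) (hC : Grad lam C) {u : E3 → E3}
    (hu : ∀ i, Sol lam (up fun x => u x i)) :
    (∀ i, Sol lam (up fun x => proj lam u x i)) ∧ ∀ r S : ℝ, (∀ z, enorm3 z ≤ r + 2 → ∀ i, |u z i| ≤ S) →
      ∀ x, enorm3 x ≤ r → ∀ i, |proj lam u x i| ≤ (2 * C ^ 2 / lam ^ 2 + C / lam) * S := by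
  obtain ⟨s1, b1⟩ := vcurl_bound hC hu
  obtain ⟨s2, b2⟩ := vcurl_bound hC s1
  refine ⟨fun i => ?_, fun r S h x hx i => ?_⟩
  · have := (s2 i).lin (s1 i) (1 / 2 * (1 / lam ^ 2)) (1 / 2 * (1 / lam))
    simpa only [proj, mul_add, mul_assoc] using this
  · have h1 : ∀ z, enorm3 z ≤ r + 1 → ∀ i, |vcurl u z i| ≤ 2 * C * S :=
      b1 (r + 1) S fun z hz => h z (by linarith)
    have h2 := b2 r _ h1 x hx i
    have h3 := h1 x (by linarith) i
    rw [proj, abs_mul, abs_of_pos (by norm_num : (0 : ℝ) < 1 / 2)]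
    have h4 := abs_add_le (1 / lam ^ 2 * vcurl (vcurl u) x i) (1 / lam * vcurl u x i)
    rw [abs_mul, abs_mul, abs_of_pos (by positivity : 0 < 1 / lam ^ 2), abs_of_pos (by positivity : 0 < 1 / lam)] at h4
    have h5 := mul_le_mul_of_nonneg_left h2 (by positivity : 0 ≤ 1 / lam ^ 2)
    have h6 := mul_le_mul_of_nonneg_left h3 (by positivity : 0 ≤ 1 / lam)
    have e : (2 * C ^ 2 / lam ^ 2 + C / lam) * S =
        1 / 2 * (1 / lam ^ 2 * (2 * C * (2 * C * S)) + 1 / lam * (2 * C * S)) := by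
      field_simp
    rw [e]
    linarith

theorem periodic_tv {ι : Type*} {P : Finset ι} {k : ι → E3} (hk : ∀ κ ∈ P, ∀ j, ∃ n : ℤ, k κ j = n)
    (a b : ι → E3) : SpacePeriodic (tv P k a b) := by
  intro x j
  funext i
  refine Finset.sum_congr rfl fun κ h => ?_
  obtain ⟨n, hn⟩ := hk κ h j
  have e : ∑ l, k κ l * (x + (2 * π) • (Pi.single j 1 : E3)) l = ∑ l, k κ l * x l + n * (2 * π) := by
    simp only [Pi.add_apply, Pi.smul_apply, smul_eq_mul, mul_add, Finset.sum_add_distrib]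
    congr 1
    rw [Finset.sum_eq_single j (fun l _ hl => by simp [hl]) (by simp), hn]
    simp
  simp only [e, Real.cos_add_int_mul_two_pi, Real.sin_add_int_mul_two_pi]

/-- A plane Beltrami wave with frequency `μ` and amplitude `c`. -/
def VV (μ c : ℝ) : E3 → E3 :=
  tv (Finset.univ : Finset Unit) (fun _ => μ • ![0, 0, 1]) (fun _ => c • ![0, 1, 0]) (fun _ => c • ![-1, 0, 0])

theorem vcurl_VV (μ c : ℝ) (x : E3) : vcurl (VV μ c) x = μ • VV μ c x := by
  rw [VV, vcurl_tv]
  funext i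
  fin_cases i <;> simp [tv, tp, cross_apply, Fin.sum_univ_three] <;> ring

theorem VV_smul (μ c d : ℝ) (x : E3) : VV μ c (d • x) = VV (μ * d) c x := by
  funext i
  exact tp_smul (Finset.univ : Finset Unit) (fun _ => ![0, 0, 1])
    (fun _ => (c • ![0, 1, 0] : E3) i) (fun _ => (c • ![-1, 0, 0] : E3) i) μ d x

theorem sol_VV (μ c : ℝ) (i : Fin 3) : Sol μ (up fun x => VV μ c x i) :=
  sol_tp (P := (Finset.univ : Finset Unit)) (k := fun _ => μ • ![0, 0, 1]) (lam := μ)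
    (fun _ _ => by simp [Fin.sum_univ_three]) (fun _ => (c • ![0, 1, 0] : E3) i)
    (fun _ => (c • ![-1, 0, 0] : E3) i)

theorem sum_VV_sq (μ c : ℝ) (x : E3) : ∑ i, VV μ c x i ^ 2 = c ^ 2 := by
  simp only [Fin.sum_univ_three, VV, tv, tp, Finset.univ_unique, Finset.sum_singleton, Pi.smul_apply, smul_eq_mul]
  simp
  linear_combination c ^ 2 * Real.sin_sq_add_cos_sq (μ * x 2)

theorem abs_VV_le (μ : ℝ) {c : ℝ} (hc : 0 ≤ c) (x : E3) (i : Fin 3) : |VV μ c x i| ≤ c := by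
  refine abs_le_of_sq_le_sq ?_ hc
  rw [← sum_VV_sq μ c x]
  exact Finset.single_le_sum (f := fun i => VV μ c x i ^ 2) (fun j _ => sq_nonneg _) (Finset.mem_univ i)

theorem abs_cross_le {w a : E3} {p q : ℝ} (hw : ∀ j, |w j| ≤ p) (ha : ∀ j, |a j| ≤ q) (i : Fin 3) :
    |crossProduct w a i| ≤ 2 * (p * q) := by
  have hp : 0 ≤ p := (abs_nonneg _).trans (hw 0)
  have h : ∀ j k l m, |w j * a k - w l * a m| ≤ 2 * (p * q) := by
    intro j k l m
    refine (abs_sub _ _).trans ?_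
    rw [abs_mul, abs_mul, two_mul]
    exact add_le_add (mul_le_mul (hw j) (ha k) (abs_nonneg _) hp) (mul_le_mul (hw l) (ha m) (abs_nonneg _) hp)
  rw [cross_apply]
  fin_cases i
  · exact h 1 2 2 1
  · exact h 2 0 0 2
  · exact h 0 1 1 0

theorem abs_pA_pB_le {w a b : E3} {m : ℝ} (hw : ∀ j, |w j| ≤ 1) (ha : ∀ j, |a j| ≤ m) (hb : ∀ j, |b j| ≤ m)
    (i : Fin 3) : |pA w a b i| ≤ 3 * m ∧ |pB w a b i| ≤ 3 * m := by
  have a1 := abs_cross_le hw ha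
  have b1 := abs_cross_le hw hb
  have a2 := abs_le.1 (abs_cross_le hw a1 i)
  have b2 := abs_le.1 (abs_cross_le hw b1 i)
  have a1 := abs_le.1 (a1 i)
  have b1 := abs_le.1 (b1 i)
  constructor
  · rw [pA, abs_le]
    constructor <;> linarith [a2.1, a2.2, b1.1, b1.2]
  · rw [pB, abs_le]
    constructor <;> linarith [b2.1, b2.2, a1.1, a1.2]

/-- The squared `L²` mass. -/
def mass (u : E3 → E3) : ℝ := ∫ X in T3, ∑ i, u X i ^ 2

theorem mass_nonneg (u : E3 → E3) : 0 ≤ mass u :=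
  integral_nonneg fun _ => Finset.sum_nonneg fun _ _ => sq_nonneg _

theorem mass_VV (μ c : ℝ) : mass (VV μ c) = c ^ 2 * (2 * π) ^ 3 := by
  simp only [mass, sum_VV_sq, setIntegral_const, volume_T3, smul_eq_mul]
  ring

theorem continuous_sumSq {u : E3 → E3} (hu : Continuous u) : Continuous fun X => ∑ i, u X i ^ 2 :=
  continuous_finsetSum _ fun i _ => ((continuous_apply i).comp hu).pow 2

theorem mass_parallelogram {u v : E3 → E3} (hu : Continuous u) (hv : Continuous v) :
    mass (fun x => u x + (1 : ℝ) • v x) + mass (fun x => u x + (-1 : ℝ) • v x) = 2 * mass u + 2 * mass v := by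
  have h : ∀ s : ℝ, Continuous fun x => u x + s • v x := fun s => hu.add (hv.const_smul s)
  unfold mass
  rw [← integral_add (integrable_T3 (continuous_sumSq (h _))) (integrable_T3 (continuous_sumSq (h _))),
    ← integral_const_mul, ← integral_const_mul, ← integral_add
      ((integrable_T3 (continuous_sumSq hu)).const_mul _) ((integrable_T3 (continuous_sumSq hv)).const_mul _)]
  congr 1
  funext X
  rw [Finset.mul_sum, Finset.mul_sum, ← Finset.sum_add_distrib, ← Finset.sum_add_distrib]
  refine Finset.sum_congr rfl fun i _ => ?_
  simp only [Pi.add_apply, Pi.smul_apply, smul_eq_mul]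
  ring

theorem exists_sign_mass {u v : E3 → E3} (hu : Continuous u) (hv : Continuous v) :
    ∃ s : ℝ, |s| = 1 ∧ mass v ≤ mass (fun x => u x + s • v x) ∧
      mass (fun x => u x + s • v x) ≤ 2 * mass u + 2 * mass v := by
  have h := mass_parallelogram hu hv
  have h1 := mass_nonneg fun x => u x + (1 : ℝ) • v x
  have h2 := mass_nonneg fun x => u x + (-1 : ℝ) • v x
  have h3 := mass_nonneg u
  rcases le_total (mass fun x => u x + (-1 : ℝ) • v x) (mass fun x => u x + (1 : ℝ) • v x) with h4 | h4
  · exact ⟨1, abs_one, by linarith, by linarith⟩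
  · exact ⟨-1, by simp, by linarith, by linarith⟩

theorem mass_tv_le {P : Finset (Fin 3 → ℤ)} {a b : (Fin 3 → ℤ) → E3} {c : ℝ}
    (h : ∀ κ ∈ P, ∀ i, |a κ i| ≤ c ∧ |b κ i| ≤ c) :
    mass (tv P (fun κ j => (κ j : ℝ)) a b) ≤ 3 * (P.card * (8 * c ^ 2 * (2 * π) ^ 3)) := by
  unfold mass
  rw [integral_finsetSum (μ := volume.restrict T3) Finset.univ
    (f := fun i X => tv P (fun κ j => (κ j : ℝ)) a b X i ^ 2)
    fun i _ => integrable_T3 (((contDiff_tp _ _ _ _).continuous).pow 2)]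
  refine (Finset.sum_le_card_nsmul _ _ _ fun i _ => integral_tp_sq_le (fun κ hκ => (h κ hκ i).1)
    (fun κ hκ => (h κ hκ i).2)).trans_eq ?_
  simp

theorem abs_le_enorm3 (x : E3) (i : Fin 3) : |x i| ≤ enorm3 x :=
  (norm_le_pi_norm x i).trans (norm_le_enorm3 x)

theorem exists_beltrami_approx {lam : ℝ} (hl : 0 < lam) {C : ℝ} (hC : 0 < C) {w : E3 → E3}
    (hw : ContDiff ℝ (⊤ : ℕ∞) w) (hB : ∀ x, vcurl w x = lam • w x)
    (hd : ∀ x : E3, x ≠ 0 → enorm3 (w x) ≤ C / enorm3 x) {η : ℝ} (hη : 0 < η) :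
    ∃ N0 : ℕ, ∀ N : ℕ, N0 ≤ N → Odd N → ∃ U : E3 → E3, ContDiff ℝ (⊤ : ℕ∞) U ∧ SpacePeriodic U ∧
      (∀ x, vcurl U x = (N : ℝ) • U x) ∧ mass U ≤ 216 * (24 * lam * C) ^ 2 * (2 * π) ^ 3 / N ∧
      (∀ i, Sol lam (up fun x => U ((lam / N) • x) i - w x i)) ∧
      ∀ z, enorm3 z ≤ 6 → ∀ i, |U ((lam / N) • z) i - w z i| ≤ η := by
  obtain ⟨D, hD1, hD⟩ := exists_elliptic_pd hl
  have hs : ∀ i, Sol lam (up fun x => w x i) := sol_of_beltrami hl hw hB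
  set K := 2 * D ^ 2 / lam ^ 2 + D / lam with hK
  have hK0 : 0 < K := by positivity
  have key := fun i => exists_tp_approx hl (hs i) hC
    (fun z hz => (abs_le_enorm3 (w z) i).trans (hd z hz)) (A := 8) (by norm_num) (div_pos hη hK0)
  choose a b hab N1 hN1 using key
  refine ⟨Finset.univ.sup N1, fun N hN hodd => ?_⟩
  have hN0 : (0 : ℝ) < N := by exact_mod_cast hodd.pos
  have hP : (N : ℝ) ≤ (PN N).card := by exact_mod_cast le_card_PN hodd
  have hP0 : (0 : ℝ) < (PN N).card := hN0.trans_le hP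
  set A : (Fin 3 → ℤ) → E3 := fun κ i => a i (dr N κ) / (PN N).card with hA
  set B : (Fin 3 → ℤ) → E3 := fun κ i => b i (dr N κ) / (PN N).card with hBd
  set d : (Fin 3 → ℤ) → E3 := fun κ => (dr N κ).ofLp with hdd
  have hd1 : ∀ κ ∈ PN N, ∑ j, d κ j ^ 2 = 1 := fun κ hκ => by
    have := norm_dr hodd hκ
    rw [EuclideanSpace.norm_eq, Real.sqrt_eq_one] at this
    simpa only [Real.norm_eq_abs, sq_abs] using this
  have hdj : ∀ κ ∈ PN N, ∀ j, |d κ j| ≤ 1 := fun κ hκ j => by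
    refine abs_le_of_sq_le_sq ?_ zero_le_one
    rw [one_pow, ← hd1 κ hκ]
    exact Finset.single_le_sum (f := fun j => d κ j ^ 2) (fun j _ => sq_nonneg _) (Finset.mem_univ j)
  have hNd : (fun κ => (N : ℝ) • d κ) = fun κ j => (κ j : ℝ) := by
    funext κ j
    simp only [hdd, dr, Pi.smul_apply, smul_eq_mul]
    field_simp
  set T := tv (PN N) (fun κ => lam • d κ) A B with hT
  set U := tv (PN N) (fun κ => (N : ℝ) • d κ) (fun κ => pA (d κ) (A κ) (B κ)) (fun κ => pB (d κ) (A κ) (B κ))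
    with hU
  have hUT : ∀ x, U ((lam / N) • x) = proj lam T x := fun x => by
    rw [hT, proj_tv hl.ne']
    funext i
    rw [hU, tv, tp_smul, mul_div_cancel₀ _ hN0.ne']
    rfl
  have hTs : ∀ i, Sol lam (up fun x => T x i) := fun i =>
    sol_tp (P := PN N) (k := fun κ => lam • d κ) (fun κ hκ => by
      simp only [Pi.smul_apply, smul_eq_mul, mul_pow, ← Finset.mul_sum]
      rw [hd1 κ hκ, mul_one]) (fun κ => A κ i) (fun κ => B κ i)
  have hsub : ∀ x i, U ((lam / N) • x) i - w x i = proj lam (fun y => T y - w y) x i := fun x i => by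
    rw [hUT, proj_sub (contDiff_tv _ _ _ _) hw, proj_beltrami hl.ne' hw hB]
    rfl
  obtain ⟨p1, p2⟩ := proj_bound hl hD (u := fun y => T y - w y) fun i => by
    simpa [sub_eq_add_neg] using (hTs i).lin (hs i) 1 (-1)
  refine ⟨U, contDiff_tv _ _ _ _, periodic_tv (fun κ _ j => ⟨κ j, congrFun (congrFun hNd κ) j⟩) _ _,
    vcurl_proj_tv hd1 A B, ?_, ?_, fun z hz i => ?_⟩
  · set m := 24 * lam * C / (PN N).card with hm
    have hA1 : ∀ κ ∈ PN N, ∀ i, |A κ i| ≤ m ∧ |B κ i| ≤ m := fun κ hκ i => by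
      have := hab i (dr N κ) (norm_dr hodd hκ)
      rw [hA, hBd, abs_div, abs_div, abs_of_pos hP0]
      exact ⟨div_le_div_of_nonneg_right this.1 hP0.le, div_le_div_of_nonneg_right this.2 hP0.le⟩
    have h := mass_tv_le (P := PN N) (a := fun κ => pA (d κ) (A κ) (B κ)) (b := fun κ => pB (d κ) (A κ) (B κ))
      (c := 3 * m) fun κ hκ i =>
        abs_pA_pB_le (hdj κ hκ) (fun j => (hA1 κ hκ j).1) (fun j => (hA1 κ hκ j).2) i
    rw [← hNd] at h
    refine h.trans ?_
    have e : 3 * ((PN N).card * (8 * (3 * m) ^ 2 * (2 * π) ^ 3)) =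
        216 * (24 * lam * C) ^ 2 * (2 * π) ^ 3 / (PN N).card := by
      rw [hm]
      field_simp
      ring
    rw [e]
    exact div_le_div_of_nonneg_left (by positivity) hN0 hP
  · simpa only [hsub] using p1
  · rw [hsub]
    refine (p2 6 (η / K) (fun y hy j => ?_) z hz i).trans_eq (mul_div_cancel₀ _ hK0.ne')
    exact hN1 j N ((Finset.le_sup (Finset.mem_univ j)).trans hN) hodd y (by linarith)

end HighFreq

/-- (high-frequency Beltrami fields on `𝕋³` approximating, after
rescaling, a given decaying Beltrami field of `ℝ³`; the constants `c₁ < c₂` depend on `w`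
but not on `N`, and `‖W‖_{L²}` is pinched between `c₁/N` and `c₂/√N`). -/
theorem high_frequency_beltrami_approximation
    (lam : ℝ) (hlam : 0 < lam) (C₀ : ℝ) (w : E3 → E3)
    (hw : ContDiff ℝ (⊤ : ℕ∞) w)
    (hBel : ∀ x, vcurl w x = lam • w x)
    (hdecay : ∀ x : E3, x ≠ 0 → enorm3 (w x) ≤ C₀ / enorm3 x)
    (α : ℝ) (hα : α ∈ Set.Ioo (0:ℝ) 1) :
    ∃ c₁ c₂ : ℝ, 0 < c₁ ∧ c₁ < c₂ ∧
      ∀ ε : ℝ, 0 < ε →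
        ∃ N₀ : ℕ, ∀ N : ℕ, N₀ ≤ N → Odd N →
          ∃ W : E3 → E3,
            ContDiff ℝ (⊤ : ℕ∞) W ∧
            SpacePeriodic W ∧
            (∀ x, vcurl W x = (N : ℝ) • W x) ∧
            CkaNormOn 4 α B1 (fun x => W ((lam / N) • x) - w x) < ε ∧
            c₁ / N ≤ L2norm W ∧ L2norm W ≤ c₂ / Real.sqrt N := by
  have hC : 0 < max C₀ 1 := lt_max_of_lt_right one_pos
  have hd : ∀ x : E3, x ≠ 0 → enorm3 (w x) ≤ max C₀ 1 / enorm3 x := fun x hx =>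
    (hdecay x hx).trans (div_le_div_of_nonneg_right (le_max_left _ _) (Real.sqrt_nonneg _))
  set G := 216 * (24 * lam * max C₀ 1) ^ 2 * (2 * π) ^ 3 with hG
  have hG0 : 0 < G := by positivity
  obtain ⟨D, hD1, hD⟩ := HighFreq.exists_elliptic_pd hlam
  obtain ⟨K, hK0, hK⟩ := HighFreq.exists_CkaNormOn_le hD1 hD hα
  refine ⟨√((2 * π) ^ 3), √(2 * G + 2 * (2 * π) ^ 3), by positivity,
    Real.sqrt_lt_sqrt (by positivity) (by nlinarith [pow_pos two_pi_pos 3]), fun ε hε => ?_⟩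
  obtain ⟨N1, hN1⟩ := HighFreq.exists_beltrami_approx hlam hC hw hBel hd (η := ε / (4 * K)) (by positivity)
  refine ⟨max N1 ⌈4 * K / ε⌉₊, fun N hN hodd => ?_⟩
  have hN0 : (0 : ℝ) < N := by exact_mod_cast hodd.pos
  have hN1' : (1 : ℝ) ≤ N := by exact_mod_cast hodd.pos
  obtain ⟨U, hUc, hUp, hUB, hUm, hUs, hUa⟩ := hN1 N ((le_max_left _ _).trans hN) hodd
  have hVc : ContDiff ℝ (⊤ : ℕ∞) (HighFreq.VV N (1 / N)) := HighFreq.contDiff_tv _ _ _ _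
  have hVp : SpacePeriodic (HighFreq.VV N (1 / N)) := HighFreq.periodic_tv (fun _ _ j => by
    fin_cases j
    · exact ⟨0, by simp⟩
    · exact ⟨0, by simp⟩
    · exact ⟨N, by simp⟩) _ _
  obtain ⟨s, hs, hs1, hs2⟩ := HighFreq.exists_sign_mass hUc.continuous hVc.continuous
  rw [HighFreq.mass_VV] at hs1 hs2
  have hVl : ∀ x, HighFreq.VV N (1 / N) ((lam / N) • x) = HighFreq.VV lam (1 / N) x := fun x => by
    rw [HighFreq.VV_smul, mul_div_cancel₀ _ hN0.ne']
  refine ⟨fun x => U x + s • HighFreq.VV N (1 / N) x, hUc.add (hVc.const_smul s), fun x j => ?_, fun x => ?_,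
    ?_, ?_, ?_⟩
  · simp only [hUp x j, hVp x j]
  · rw [HighFreq.vcurl_add hUc (hVc.const_smul s), HighFreq.vcurl_smul hVc]
    simp only [hUB, HighFreq.vcurl_VV]
    module
  · have e : ∀ x i, (U ((lam / N) • x) + s • HighFreq.VV N (1 / N) ((lam / N) • x) - w x) i =
        1 * (U ((lam / N) • x) i - w x i) + s * HighFreq.VV lam (1 / N) x i := fun x i => by
      rw [hVl]
      simp only [Pi.add_apply, Pi.sub_apply, Pi.smul_apply, smul_eq_mul]
      ring
    refine (hK _ (fun i => ?_) (ε / (4 * K) + 1 / N) fun z hz i => ?_).trans_lt ?_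
    · simp only [e]
      exact (hUs i).lin (HighFreq.sol_VV _ _ i) 1 s
    · rw [e, one_mul]
      refine (abs_add_le _ _).trans (add_le_add (hUa z hz i) ?_)
      rw [abs_mul, hs, one_mul]
      exact HighFreq.abs_VV_le _ (by positivity) _ _
    · have h1 : 4 * K / ε ≤ N := (Nat.le_ceil _).trans (by exact_mod_cast (le_max_right _ _).trans hN)
      have h2 : K * (1 / N) ≤ ε / 4 := by
        rw [div_le_iff₀ hε] at h1
        rw [mul_one_div, div_le_iff₀ hN0]
        linarith
      have h3 : K * (ε / (4 * K)) = ε / 4 := by field_simp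
      rw [mul_add, h3]
      linarith
  · rw [HighFreq.L2norm_sq]
    refine Real.le_sqrt_of_sq_le (le_trans (le_of_eq ?_) hs1)
    rw [div_pow, Real.sq_sqrt (by positivity)]
    ring
  · rw [HighFreq.L2norm_sq, ← Real.sqrt_div' _ hN0.le]
    refine Real.sqrt_le_sqrt (hs2.trans ?_)
    rw [le_div_iff₀ hN0]
    rw [le_div_iff₀ hN0] at hUm
    have h1 : (1 / (N : ℝ)) ^ 2 * (2 * π) ^ 3 * N ≤ (2 * π) ^ 3 := by
      have : (1 / (N : ℝ)) ^ 2 * (2 * π) ^ 3 * N = (2 * π) ^ 3 / N := by field_simp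
      rw [this]
      exact div_le_self (by positivity) hN1'
    linarith
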